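/- Let {ε_q} be signs ±1 indexed by primes, a ∈ {1,3}, x large, and 3 ≤ y ≤ c₀ log x for a suitably small constant c₀. Then the number of primes p ≤ x with p ≡ a (mod 4) and (q/p) = ε_q for all primes q ≤ y is ≫ π(x) exp(−3y + O(y/log y)). -/

import Mathlib

set_option linter.all false

section
open scoped Classical
open Finset Real
namespace LN
notation "§" => (by positivity)
notation "¢" => (by linarith)
notation "£" => (by omega)
notation "¤" => (by norm_num)
notation "¶" => (by simp)
notation:max "¥" x:max => (x : ℝ)
notation:max "¡" x:max => Real.exp (4 * x)
notation:max "¿" x:max => Finset.range (x + 1)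
notation:max "°" x:max => Finset.Ioc 0 x
notation:max "ϕ" x:max => Fintype.card x
alias mL := mul_le_mul_of_nonneg_left
alias mR := mul_le_mul_of_nonneg_right
alias nn0 := Nat.cast_nonneg
alias Lnn := ArithmeticFunction.vonMangoldt_nonneg
alias sub_sum := Finset.sum_le_sum_of_subset_of_nonneg
alias odl := one_div_le_one_div_of_le
alias dR := div_le_div_of_nonneg_right
alias insI := Finset.insert_Ioc_right_eq_Ioc_add_one
alias abs_sum := Finset.abs_sum_le_sum_abs
alias mem_ins := Finset.mem_insert_of_mem
alias dmd := div_mul_eq_mul_div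
alias ldi := Nat.le_div_iff_mul_le
alias mdA := Nat.mem_divisorsAntidiagonal
alias ltl := lt_of_lt_of_le
alias sum_add := Finset.sum_add_distrib
alias sum_sub := Finset.sum_sub_distrib
lemma nn (n : ℕ) : (0:ℝ) ≤ n := Nat.cast_nonneg n
end LN
end

section
open scoped Classical
open Finset Real
namespace LN
noncomputable def Pr (u w : ℝ) : Finset ℕ := (Finset.Ioc ⌊u⌋₊ ⌊w⌋₊).filter Nat.Prime
lemma mem_Pr {u w : ℝ} (hu : 0 ≤ u) {p : ℕ} : p ∈ Pr u w ↔ p.Prime ∧ u < p ∧ ¥p ≤ w := by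
  unfold Pr
  simp only [mem_filter, mem_Ioc, Nat.floor_lt hu]
  constructor
  · rintro ⟨⟨h1, h2⟩, h3⟩
    exact ⟨h3, h1, (Nat.le_floor_iff' h3.ne_zero).1 h2⟩
  · rintro ⟨h1, h2, h3⟩
    exact ⟨⟨h2, (Nat.le_floor_iff' h1.ne_zero).2 h3⟩, h1⟩
lemma sum_log_Ioc (N : ℕ) : ∑ n ∈ ° N, Real.log n = Real.log (N.factorial) := by
  induction N with
  | zero => simp
  | succ n ih =>
    rw [← insI £, sum_insert ¶, ih, Nat.factorial_succ,
      Nat.cast_mul, Real.log_mul § §]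
lemma log_fact_ge {N : ℕ} (hN : 0 < N) : N * Real.log N - N ≤ Real.log (N.factorial) := by
  have h := Real.pow_div_factorial_le_exp ¥N § N
  have h2 := Real.log_le_log § h
  rw [Real.log_exp, Real.log_div § §, Real.log_pow] at h2
  linarith
lemma log_fact_le (N : ℕ) : Real.log (N.factorial) ≤ N * Real.log N := by
  rw [← Real.log_pow]
  apply Real.log_le_log §
  exact_mod_cast Nat.factorial_le_pow N
local notation "Λ" => ArithmeticFunction.vonMangoldt
lemma mertens_nat {N : ℕ} (hN : 0 < N) :
    |∑ n ∈ ° N, Λ n / n - Real.log N| ≤ 6 := by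
  have hN' : ¥0 < N := by exact_mod_cast hN
  have key : ∑ n ∈ ° N, Real.log n = ∑ n ∈ ° N, Λ n * ((N / n : ℕ) : ℝ)
  · rw [← ArithmeticFunction.sum_Ioc_mul_zeta_eq_sum, ArithmeticFunction.vonMangoldt_mul_zeta]
    rfl
  rw [sum_log_Ioc] at key
  have h1 := log_fact_ge hN
  have h2 := log_fact_le N
  have hpsi := Chebyshev.psi_le_const_mul_self (x := N) hN'.le
  unfold Chebyshev.psi at hpsi
  rw [Nat.floor_natCast] at hpsi
  have hl4 : Real.log 4 ≤ 2
  · have : ¥4 = 2 ^ 2 := ¤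
    rw [this, Real.log_pow]; have := Real.log_two_lt_d9; push_cast; linarith
  have up : ∑ n ∈ ° N, Λ n * ((N / n : ℕ) : ℝ) ≤ N * ∑ n ∈ ° N, Λ n / n
  · rw [mul_sum]
    apply sum_le_sum
    intro n hn
    have : ((N / n : ℕ) : ℝ) ≤ N / n := Nat.cast_div_le
    calc Λ n * ((N / n : ℕ) : ℝ) ≤ Λ n * (N / n) := by
          gcongr
      _ = _ := by ring
  have lo : N * ∑ n ∈ ° N, Λ n / n - ∑ n ∈ ° N, Λ n ≤ ∑ n ∈ ° N, Λ n * ((N / n : ℕ) : ℝ)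
  · rw [mul_sum, ← sum_sub]
    apply sum_le_sum
    intro n hn
    have h5 : ¥N / n - 1 ≤ ((N / n : ℕ) : ℝ)
    · have := Nat.lt_floor_add_one (¥N / n)
      rw [Nat.floor_div_eq_div] at this
      linarith
    calc _ = Λ n * (N / n - 1) := by ring
      _ ≤ _ := by gcongr
  set S := ∑ n ∈ ° N, Λ n / n
  rw [abs_le]
  constructor
  · have : N * (Real.log N - 1) ≤ N * S := ¢
    have := le_of_mul_le_mul_left this hN'
    linarith
  · have : N * S ≤ N * (Real.log N + (2 + 4)) := by nlinarith
    have := le_of_mul_le_mul_left this hN'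
    linarith
lemma log_floor {x : ℝ} (hx : 1 ≤ x) : Real.log x - 1 ≤ Real.log ⌊x⌋₊ ∧ Real.log ⌊x⌋₊ ≤ Real.log x := by
  have h1 : 1 ≤ ⌊x⌋₊ := Nat.le_floor (by simpa using hx)
  have h1' : ¥1 ≤ ⌊x⌋₊ := by exact_mod_cast h1
  refine ⟨?_, Real.log_le_log ¢ (Nat.floor_le ¢)⟩
  have h2 : x ≤ 2 * ⌊x⌋₊ := by have := Nat.lt_floor_add_one x; linarith
  have h3 := Real.log_le_log ¢ h2
  rw [Real.log_mul ¤ ¢] at h3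
  have := Real.log_two_lt_d9
  linarith
lemma mertens {x : ℝ} (hx : 1 ≤ x) : |∑ n ∈ ° ⌊x⌋₊, Λ n / n - Real.log x| ≤ 7 := by
  have h1 : 0 < ⌊x⌋₊ := Nat.floor_pos.2 hx
  have := mertens_nat h1
  have := log_floor hx
  rw [abs_le] at *
  constructor <;> linarith
lemma sum_inv_Pr {u w : ℝ} (hu : 2 ≤ u) (huw : u ≤ w) :
    ∑ p ∈ Pr u w, ¥1 / p ≤ (Real.log w - Real.log u + 14) / Real.log u := by
  have hlu : 0 < Real.log u := Real.log_pos ¢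
  rw [le_div_iff₀ hlu, sum_mul]
  have h1 := abs_le.1 (mertens (x := w) ¢)
  have h2 := abs_le.1 (mertens (x := u) ¢)
  have hfl : ⌊u⌋₊ ≤ ⌊w⌋₊ := Nat.floor_mono huw
  have h3 : ∑ n ∈ ° ⌊w⌋₊, Λ n / n = ∑ n ∈ ° ⌊u⌋₊, Λ n / n + ∑ n ∈ Ioc ⌊u⌋₊ ⌊w⌋₊, Λ n / n :=
    (Finset.sum_Ioc_consecutive _ (Nat.zero_le _) hfl).symm
  have h4 : ∑ p ∈ Pr u w, ¥1 / p * Real.log u ≤ ∑ n ∈ Ioc ⌊u⌋₊ ⌊w⌋₊, Λ n / n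
  · calc _ ≤ ∑ p ∈ Pr u w, Λ p / p := by
          apply sum_le_sum
          intro p hp
          rw [mem_Pr ¢] at hp
          rw [ArithmeticFunction.vonMangoldt_apply_prime hp.1, one_div_mul_eq_div]
          gcongr
          exact hp.2.1.le
      _ ≤ _ := by
          apply sub_sum (filter_subset _ _)
          intro n _ _
          exact div_nonneg Lnn §
  linarith
lemma prod_primes_le {z : ℝ} (hz : 1 < z) : ∏ p ∈ Pr 1 z, (1 - ¥1 / p) ≤ 1 / Real.log z := by
  have key : ∀ N : ℕ, ∃ T : ℝ, HasSum (fun m : (N.smoothNumbers) ↦ ((m : ℕ) : ℝ)⁻¹) T ∧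
      T = ∏ p ∈ N.primesBelow, (1 - ¥p⁻¹)⁻¹ := by
    intro N
    refine ⟨_, ?_, rfl⟩
    rw [Nat.smoothNumbers_eq_factoredNumbers, Nat.primesBelow]
    let f : ℕ →* ℝ := ⟨⟨fun n => ¥n⁻¹, ¶⟩, by intro a b; simp [mul_comm]⟩
    have := (EulerProduct.summable_and_hasSum_factoredNumbers_prod_filter_prime_geometric (f := f) ?_ (range N)).2
    · exact this
    · intro p hp
      simp only [f, MonoidHom.coe_mk, OneHom.coe_mk, norm_inv, norm_natCast]
      exact inv_lt_one_of_one_lt₀ (by exact_mod_cast hp.one_lt)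
  set N := ⌊z⌋₊ + 1 with hN
  obtain ⟨T, hT, hTe⟩ := key N
  have hlz : 0 < Real.log z := Real.log_pos hz
  have hsub : ∀ n ∈ ° ⌊z⌋₊, n ∈ N.smoothNumbers
  · intro n hn
    rw [mem_Ioc] at hn
    rw [Nat.mem_smoothNumbers]
    refine ⟨£, fun p hp => ?_⟩
    have := Nat.le_of_mem_primeFactorsList hp
    omega
  have h1 : ∑ n ∈ ° ⌊z⌋₊, ((n : ℕ) : ℝ)⁻¹ ≤ T
  · have := sum_le_hasSum ((° ⌊z⌋₊).subtype (· ∈ N.smoothNumbers)) (fun i _ => by positivity) hT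
    rw [Finset.sum_subtype_eq_sum_filter (f := fun n : ℕ => ((n : ℕ) : ℝ)⁻¹), filter_true_of_mem hsub] at this
    exact this
  have h2 : Real.log z ≤ ∑ n ∈ ° ⌊z⌋₊, ((n : ℕ) : ℝ)⁻¹
  · have := log_le_harmonic_floor z ¢
    rw [harmonic_eq_sum_Icc] at this
    push_cast at this
    exact this
  have h3 : N.primesBelow = Pr 1 z
  · ext p
    rw [mem_Pr ¤, Nat.mem_primesBelow, hN, Nat.lt_succ_iff]
    constructor
    · rintro ⟨h1, h2⟩
      exact ⟨h2, by exact_mod_cast h2.one_lt, (Nat.le_floor_iff' h2.ne_zero).1 h1⟩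
    · rintro ⟨h1, h2, h3⟩
      exact ⟨(Nat.le_floor_iff' h1.ne_zero).2 h3, h1⟩
  rw [h3, prod_inv_distrib] at hTe
  have h4 : ∏ p ∈ Pr 1 z, (1 - ¥1 / p) = ∏ p ∈ Pr 1 z, (1 - ¥p⁻¹) := ¶
  rw [h4, le_div_iff₀ hlz]
  have hpos : 0 < ∏ p ∈ Pr 1 z, (1 - ¥p⁻¹)
  · apply prod_pos
    intro p hp
    rw [mem_Pr ¤] at hp
    have := inv_lt_one_of_one_lt₀ hp.2.1
    linarith
  calc _ ≤ (∏ p ∈ Pr 1 z, (1 - ¥p⁻¹)) * T := by gcongr; linarith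
    _ = 1 := by rw [hTe, mul_inv_cancel₀ hpos.ne']
end LN
end

section
open scoped Classical
open Finset Real
namespace LN
section bonf
variable {ι : Type*}
noncomputable def es (P : Finset ι) (s : ι → ℝ) (m : ℕ) : ℝ := ∑ D ∈ P.powersetCard m, ∏ p ∈ D, s p
lemma es_insert {P : Finset ι} {s : ι → ℝ} {p : ι} (hp : p ∉ P) (m : ℕ) :
    es (insert p P) s (m + 1) = es P s (m + 1) + s p * es P s m := by
  unfold es
  rw [powersetCard_succ_insert hp, sum_union, mul_sum, sum_image]
  · congr 1
    apply sum_congr rfl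
    intro D hD
    rw [prod_insert]
    intro h; exact hp ((mem_powersetCard.1 hD).1 h)
  · intro D hD D' hD' h
    have h1 : p ∉ D := fun h => hp ((mem_powersetCard.1 hD).1 h)
    have h2 : p ∉ D' := fun h => hp ((mem_powersetCard.1 hD').1 h)
    rw [← erase_insert h1, ← erase_insert h2]; rw [h]
  · rw [disjoint_left]
    intro D hD hD'
    rw [mem_image] at hD'
    obtain ⟨D', _, rfl⟩ := hD'
    exact hp ((mem_powersetCard.1 hD).1 (mem_insert_self _ _))
lemma es_zero (P : Finset ι) (s : ι → ℝ) : es P s 0 = 1 := by simp [es]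
lemma es_empty (s : ι → ℝ) (m : ℕ) : es (∅ : Finset ι) s (m + 1) = 0 := by
  rw [es, powersetCard_eq_empty.2 ¶]; simp
noncomputable def us (P : Finset ι) (s : ι → ℝ) (m : ℕ) : ℝ := ∑ i ∈ range m, (-1 : ℝ) ^ i * es P s i
lemma us_insert {P : Finset ι} {s : ι → ℝ} {p : ι} (hp : p ∉ P) (m : ℕ) :
    us (insert p P) s (m + 1) = us P s (m + 1) - s p * us P s m := by
  induction m with
  | zero => simp [us, es_zero]
  | succ m ih =>
    have h1 : us (insert p P) s (m + 1 + 1) = us (insert p P) s (m + 1) + (-1 : ℝ) ^ (m + 1) * es (insert p P) s (m + 1)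
    · unfold us; rw [sum_range_succ]
    have h2 : us P s (m + 1 + 1) = us P s (m + 1) + (-1 : ℝ) ^ (m + 1) * es P s (m + 1)
    · unfold us; rw [sum_range_succ]
    have h3 : us P s (m + 1) = us P s m + (-1 : ℝ) ^ m * es P s m
    · unfold us; rw [sum_range_succ]
    rw [h1, h2, ih, es_insert hp, h3]; ring
lemma bonferroni (P : Finset ι) (s : ι → ℝ) (hs : ∀ p ∈ P, 0 ≤ s p ∧ s p ≤ 1) (m : ℕ) :
    0 ≤ (-1 : ℝ) ^ m * (∏ p ∈ P, (1 - s p) - us P s m) ∧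
    (-1 : ℝ) ^ m * (∏ p ∈ P, (1 - s p) - us P s m) ≤ es P s m := by
  induction P using Finset.induction_on generalizing m with
  | empty =>
    cases m with
    | zero => simp [us, es_zero]
    | succ m =>
      have : us (∅ : Finset ι) s (m + 1) = 1
      · unfold us
        rw [sum_range_succ']
        simp [es_empty, es_zero]
      rw [this, es_empty]; simp
  | insert p P hp ih =>
    have ih' := ih (fun q hq => hs q (mem_ins hq))
    have hsp := hs p (mem_insert_self _ _)
    rw [prod_insert hp]
    cases m with
    | zero =>
      have h0 := ih' 0
      simp only [us, range_zero, sum_empty, es_zero, pow_zero, one_mul, sub_zero] at h0 ⊢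
      constructor
      · exact mul_nonneg ¢ h0.1
      · nlinarith
    | succ m =>
      have h1 := ih' (m + 1)
      have h0 := ih' m
      rw [us_insert hp, es_insert hp]
      have : (-1 : ℝ) ^ (m + 1) * ((1 - s p) * ∏ p ∈ P, (1 - s p) - (us P s (m + 1) - s p * us P s m))
        = (-1 : ℝ) ^ (m + 1) * (∏ p ∈ P, (1 - s p) - us P s (m + 1)) + s p * ((-1 : ℝ) ^ m * (∏ p ∈ P, (1 - s p) - us P s m)) := by
        ring
      rw [this]
      constructor
      · have := mul_nonneg hsp.1 h0.1
        linarith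
      · have := mL h0.2 hsp.1
        linarith
lemma es_nonneg {P : Finset ι} {s : ι → ℝ} (hs : ∀ p ∈ P, 0 ≤ s p) (m : ℕ) : 0 ≤ es P s m :=
  sum_nonneg fun D hD => prod_nonneg fun p hp => hs p ((mem_powersetCard.1 hD).1 hp)
lemma pow_add_ge {G t : ℝ} (hG : 0 ≤ G) (ht : 0 ≤ t) (m : ℕ) :
    G ^ (m + 1) + (m + 1) * t * G ^ m ≤ (G + t) ^ (m + 1) := by
  induction m with
  | zero => simp
  | succ m ih =>
    have := mR ih (add_nonneg hG ht)
    have h2 : 0 ≤ (m + 1) * t * G ^ m * t := §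
    push_cast
    calc _ ≤ (G ^ (m + 1) + (m + 1) * t * G ^ m) * (G + t) := by
          rw [show G ^ (m+1+1) = G ^ m * G * G by ring, show G ^ (m+1) = G^m * G by ring]
          nlinarith
      _ ≤ _ := by rw [pow_succ (G + t) (m + 1)]; exact this
lemma es_le {P : Finset ι} {s : ι → ℝ} (hs : ∀ p ∈ P, 0 ≤ s p) (m : ℕ) :
    es P s m ≤ (∑ p ∈ P, s p) ^ m / m.factorial := by
  induction P using Finset.induction_on generalizing m with
  | empty =>
    cases m with
    | zero => simp [es_zero]
    | succ m => rw [es_empty]; simp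
  | insert p P hp ih =>
    have ih' := ih (fun q hq => hs q (mem_ins hq))
    have hsp := hs p (mem_insert_self _ _)
    have hG : 0 ≤ ∑ p ∈ P, s p := sum_nonneg (fun q hq => hs q (mem_ins hq))
    rw [sum_insert hp]
    cases m with
    | zero => simp [es_zero]
    | succ m =>
      rw [es_insert hp]
      set G := ∑ p ∈ P, s p
      have h1 := ih' (m + 1)
      have h2 := mL (ih' m) hsp
      have h3 := pow_add_ge hG hsp m
      calc _ ≤ G ^ (m + 1) / (m + 1).factorial + s p * (G ^ m / m.factorial) := ¢
        _ = (G ^ (m + 1) + (m + 1) * s p * G ^ m) / (m + 1).factorial := by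
            rw [Nat.factorial_succ]; push_cast; field_simp
        _ ≤ _ := by
            rw [add_comm (s p)]
            gcongr
lemma sum_powerset_le {P : Finset ι} {h : ι → ℝ} (hh : ∀ p ∈ P, 0 ≤ h p) (m : ℕ) :
    ∑ D ∈ P.powerset with D.card ≤ m, ∏ p ∈ D, h p ≤ (1 + ∑ p ∈ P, h p) ^ m := by
  have h1 : ∑ D ∈ P.powerset with D.card ≤ m, ∏ p ∈ D, h p = ∑ i ∈ ¿m, es P h i
  · unfold es
    rw [← sum_fiberwise_of_maps_to (g := Finset.card) (t := ¿m)]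
    · apply sum_congr rfl
      intro i hi
      apply sum_congr _ (fun _ _ => rfl)
      ext D
      simp only [mem_filter, mem_powerset, mem_powersetCard]
      rw [mem_range] at hi
      constructor
      · rintro ⟨⟨a, b⟩, c⟩; exact ⟨a, c⟩
      · rintro ⟨a, b⟩; exact ⟨⟨a, £⟩, b⟩
    · intro D hD
      simp only [mem_filter] at hD
      simp; omega
  rw [h1, add_comm ¥1, add_pow]
  have hG : 0 ≤ ∑ p ∈ P, h p := sum_nonneg hh
  apply sum_le_sum
  intro i hi
  rw [mem_range] at hi
  refine (es_le hh i).trans ?_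
  rw [one_pow, mul_one]
  have h2 : ¥1 ≤ (m.choose i : ℝ)
  · exact_mod_cast Nat.choose_pos £
  have h3 : ¥1 ≤ (i.factorial : ℝ) := by exact_mod_cast Nat.factorial_pos i
  calc _ ≤ (∑ p ∈ P, h p) ^ i := div_le_self § h3
    _ ≤ _ := le_mul_of_one_le_right § h2
lemma us_eq (P : Finset ι) (s : ι → ℝ) (m : ℕ) :
    us P s (m + 1) = ∑ D ∈ P.powerset with D.card ≤ m, (-1 : ℝ) ^ D.card * ∏ p ∈ D, s p := by
  unfold us es
  symm
  rw [← sum_fiberwise_of_maps_to (g := Finset.card) (t := ¿m)]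
  · apply sum_congr rfl
    intro i hi
    rw [mul_sum, filter_filter]
    apply sum_congr
    · ext D
      simp only [mem_filter, mem_powerset, mem_powersetCard]
      rw [mem_range] at hi
      constructor
      · rintro ⟨a, b, c⟩; exact ⟨a, c⟩
      · rintro ⟨a, b⟩; exact ⟨a, £, b⟩
    · intro D hD
      rw [(mem_powersetCard.1 hD).2]
  · intro D hD
    simp only [mem_filter] at hD
    simp; omega
lemma prod_diff {J : Finset ℕ} {u v e : ℕ → ℝ} (hv : ∀ j ∈ J, 0 ≤ v j) (hu : ∀ j ∈ J, v j ≤ u j)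
    (he : ∀ j ∈ J, u j - v j ≤ e j) :
    ∏ j ∈ J, u j - ∏ j ∈ J, v j ≤ ∑ j ∈ J, ∏ i ∈ J, if i = j then e i else u i := by
  induction J using Finset.induction_on with
  | empty => simp
  | insert a J ha ih =>
    have ih' := ih (fun j hj => hv j (mem_ins hj)) (fun j hj => hu j (mem_ins hj))
      (fun j hj => he j (mem_ins hj))
    have hva := hv a (mem_insert_self _ _)
    have hua := hu a (mem_insert_self _ _)
    have hea := he a (mem_insert_self _ _)
    rw [prod_insert ha, prod_insert ha, sum_insert ha, prod_insert ha, if_pos rfl]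
    have h1 : ∏ i ∈ J, (if i = a then e i else u i) = ∏ i ∈ J, u i :=
      prod_congr rfl fun i hi => if_neg (by rintro rfl; exact ha hi)
    have h2 : ∑ j ∈ J, ∏ i ∈ insert a J, (if i = j then e i else u i) =
        u a * ∑ j ∈ J, ∏ i ∈ J, (if i = j then e i else u i) := by
      rw [mul_sum]
      apply sum_congr rfl
      intro j hj
      rw [prod_insert ha, if_neg (by rintro rfl; exact ha hj)]
    rw [h1, h2]
    have hPu : ∏ j ∈ J, v j ≤ ∏ j ∈ J, u j := prod_le_prod (fun j hj => hv j (mem_ins hj)) (fun j hj => hu j (mem_ins hj))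
    have hPv : 0 ≤ ∏ j ∈ J, v j := prod_nonneg (fun j hj => hv j (mem_ins hj))
    have h3 := mL ih' (hva.trans hua)
    have h4 := mR hea (hPv.trans hPu)
    nlinarith
end bonf
end LN
end

section
open scoped Classical
open Finset Real
namespace LN
lemma expand (A : Finset ℕ) (a g : ℕ → ℝ) (X E : ℝ) (P : ℕ → Finset ℕ) (T : Finset ℕ)
    (hH : ∀ D ⊆ T, |∑ n ∈ A with ∀ p ∈ D, p ∣ n, a n - X * ∏ p ∈ D, g p| ≤ E * (∏ p ∈ D, ¥p) ^ 2)
    (t : ℕ → Finset (Finset ℕ)) (ζ : ℕ → Finset ℕ → ℝ) (hζ : ∀ j D, |ζ j D| ≤ 1) (J : Finset ℕ) :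
    (∀ j ∈ J, P j ⊆ T) → (∀ i ∈ J, ∀ j ∈ J, i ≠ j → Disjoint (P i) (P j)) → (∀ j ∈ J, ∀ D ∈ t j, D ⊆ P j) →
    ∀ D0 ⊆ T, (∀ j ∈ J, Disjoint D0 (P j)) →
    |∑ n ∈ A with ∀ p ∈ D0, p ∣ n, a n * ∏ j ∈ J, ∑ D ∈ t j, ζ j D * ∏ p ∈ D, (if p ∣ n then 1 else 0)
      - X * (∏ p ∈ D0, g p) * ∏ j ∈ J, ∑ D ∈ t j, ζ j D * ∏ p ∈ D, g p| ≤
      E * (∏ p ∈ D0, ¥p) ^ 2 * ∏ j ∈ J, ∑ D ∈ t j, (∏ p ∈ D, ¥p) ^ 2 := by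
  induction J using Finset.induction_on with
  | empty => intro _ _ _ D0 hD0 _; simpa using hH D0 hD0
  | insert j J hj ih =>
    intro hP hdis ht D0 hD0 hD0J
    have ih' := ih (fun i hi => hP i (mem_ins hi))
      (fun i hi k hk => hdis i (mem_ins hi) k (mem_ins hk))
      (fun i hi => ht i (mem_ins hi))
    have hDsub : ∀ D ∈ t j, D ⊆ P j := ht j (mem_insert_self _ _)
    have hDis : ∀ D ∈ t j, Disjoint D0 D := fun D hD =>
      Disjoint.mono_right (hDsub D hD) (hD0J j (mem_insert_self _ _))
    have h1 : ∀ D ∈ t j, _ := fun D hD => ih' (D0 ∪ D) (union_subset hD0 ((hDsub D hD).trans (hP j (mem_insert_self _ _))))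
      (fun i hi => by
        rw [disjoint_union_left]
        refine ⟨hD0J i (mem_ins hi), Disjoint.mono_left (hDsub D hD) (hdis j (mem_insert_self _ _) i (mem_ins hi) ?_)⟩
        rintro rfl; exact hj hi)
    have e1 : ∑ n ∈ A with ∀ p ∈ D0, p ∣ n, a n * ∏ i ∈ insert j J, ∑ D ∈ t i, ζ i D * ∏ p ∈ D, (if p ∣ n then ¥1 else 0)
       = ∑ D ∈ t j, ζ j D * ∑ n ∈ A with ∀ p ∈ D0 ∪ D, p ∣ n, a n * ∏ i ∈ J, ∑ D ∈ t i, ζ i D * ∏ p ∈ D, (if p ∣ n then ¥1 else 0) := by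
      have r : ∀ D ∈ t j, ζ j D * ∑ n ∈ A with ∀ p ∈ D0 ∪ D, p ∣ n, a n * ∏ i ∈ J, ∑ D ∈ t i, ζ i D * ∏ p ∈ D, (if p ∣ n then ¥1 else 0)
          = ∑ n ∈ A, if ∀ p ∈ D0 ∪ D, p ∣ n then ζ j D * (a n * ∏ i ∈ J, ∑ D ∈ t i, ζ i D * ∏ p ∈ D, (if p ∣ n then ¥1 else 0)) else 0 := by
        intro D _
        rw [← sum_filter, mul_sum]
      rw [sum_congr rfl r, sum_comm, sum_filter]
      apply sum_congr rfl
      intro n hn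
      split_ifs with h
      · rw [prod_insert hj, sum_mul, mul_sum]
        apply sum_congr rfl
        intro D hD
        rw [prod_ite_zero]
        by_cases h3 : ∀ p ∈ D, p ∣ n
        · rw [if_pos h3, if_pos]
          · simp; ring
          · intro p hp
            rcases mem_union.1 hp with h4 | h4
            · exact h p h4
            · exact h3 p h4
        · rw [if_neg h3, if_neg]
          · simp
          · intro h4
            exact h3 fun p hp => h4 p (mem_union_right _ hp)
      · symm
        apply sum_eq_zero
        intro D hD
        rw [if_neg]
        intro h4
        exact h fun p hp => h4 p (mem_union_left _ hp)
    have e2 : X * (∏ p ∈ D0, g p) * ∏ i ∈ insert j J, ∑ D ∈ t i, ζ i D * ∏ p ∈ D, g p =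
        ∑ D ∈ t j, ζ j D * (X * (∏ p ∈ D0 ∪ D, g p) * ∏ i ∈ J, ∑ D ∈ t i, ζ i D * ∏ p ∈ D, g p) := by
      rw [prod_insert hj, sum_mul, mul_sum]
      apply sum_congr rfl
      intro D hD
      rw [prod_union (hDis D hD)]; ring
    have e3 : E * (∏ p ∈ D0, ¥p) ^ 2 * ∏ i ∈ insert j J, ∑ D ∈ t i, (∏ p ∈ D, ¥p) ^ 2 =
        ∑ D ∈ t j, E * (∏ p ∈ D0 ∪ D, ¥p) ^ 2 * ∏ i ∈ J, ∑ D ∈ t i, (∏ p ∈ D, ¥p) ^ 2 := by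
      rw [prod_insert hj, sum_mul, mul_sum]
      apply sum_congr rfl
      intro D hD
      rw [prod_union (hDis D hD)]; ring
    rw [e1, e2, e3, ← sum_sub]
    refine (abs_sum _ _).trans (sum_le_sum fun D hD => ?_)
    rw [← mul_sub, abs_mul]
    exact (mul_le_of_le_one_left (abs_nonneg _) (hζ j D)).trans (h1 D hD)
lemma fact_bound {m : ℕ} (hm : 41 ≤ m) : ¥4 ^ m / m.factorial ≤ Real.exp (-8) * (1/2) ^ m := by
  have key : ¥8 ^ m * 4096 ≤ m.factorial
  · induction m, hm using Nat.le_induction with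
    | base => norm_num [Nat.factorial]
    | succ n hn ih =>
      rw [Nat.factorial_succ]
      push_cast
      have : ¥41 ≤ n := by exact_mod_cast hn
      calc ¥8 ^ (n + 1) * 4096 = 8 * (8 ^ n * 4096) := by ring
        _ ≤ (n + 1) * n.factorial := by gcongr; linarith
  have he : Real.exp 8 ≤ 4096 * 4
  · have h := Real.exp_one_lt_d9
    have : Real.exp 8 = Real.exp 1 ^ 8 := by rw [← Real.exp_nat_mul]; norm_num
    rw [this]
    calc Real.exp 1 ^ 8 ≤ (2.72 : ℝ) ^ 8 := by gcongr; linarith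
      _ ≤ _ := ¤
  have he' : Real.exp 8 ≤ 4096
  · have h := Real.exp_one_lt_d9
    have : Real.exp 8 = Real.exp 1 ^ 8 := by rw [← Real.exp_nat_mul]; norm_num
    rw [this]
    calc Real.exp 1 ^ 8 ≤ (2.72 : ℝ) ^ 8 := by gcongr; linarith
      _ ≤ _ := ¤
  rw [div_le_iff₀ §, Real.exp_neg]
  have h8 : ¥8 ^ m = 4 ^ m * 2 ^ m := by rw [← mul_pow]; norm_num
  have : ¥4 ^ m * (Real.exp 8 * 2 ^ m) ≤ m.factorial
  · calc _ = ¥8 ^ m * Real.exp 8 := by rw [h8]; ring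
      _ ≤ ¥8 ^ m * 4096 := by gcongr
      _ ≤ _ := key
  calc ¥4 ^ m = (Real.exp 8)⁻¹ * (1/2) ^ m * (4 ^ m * (Real.exp 8 * 2 ^ m)) := by
        have := Real.exp_pos 8
        rw [one_div, inv_pow]; field_simp
    _ ≤ _ := by gcongr
noncomputable def wj (w : ℝ) (j : ℕ) : ℝ := w ^ ((1/2 : ℝ) ^ j)
noncomputable def Bl (y w : ℝ) (j : ℕ) : Finset ℕ := Pr (max y (wj w (j+1))) (wj w j)
lemma wj_ge {w : ℝ} (hw : 1 ≤ w) (j : ℕ) : 1 ≤ wj w j := Real.one_le_rpow hw §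
lemma wj_sq {w : ℝ} (hw : 1 ≤ w) (j : ℕ) : wj w (j+1) ^ 2 = wj w j := by
  unfold wj
  rw [← Real.rpow_natCast, ← Real.rpow_mul ¢]
  congr 1
  rw [pow_succ]; push_cast; ring
lemma wj_le {w : ℝ} (hw : 1 ≤ w) (j : ℕ) : wj w j ≤ w := by
  unfold wj
  calc w ^ ((1/2 : ℝ) ^ j) ≤ w ^ ¥1 := by
        apply Real.rpow_le_rpow_of_exponent_le hw
        exact pow_le_one₀ ¤ ¤
    _ = w := ¶
lemma Bl_step {y w : ℝ} (hy : 0 ≤ y) (hw : 1 ≤ w) (J : ℕ) :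
    Pr (max y (wj w (J+1))) w = Bl y w J ∪ Pr (max y (wj w J)) w ∧
    Disjoint (Bl y w J) (Pr (max y (wj w J)) w) := by
  have h1 := wj_ge hw J
  have h2 := wj_ge hw (J+1)
  have h3 := wj_sq hw J
  have h4 := wj_le hw J
  have h5 : wj w (J+1) ≤ wj w J := by nlinarith
  constructor
  · ext p
    rw [mem_union, Bl, mem_Pr (le_max_of_le_left hy), mem_Pr (le_max_of_le_left hy), mem_Pr (le_max_of_le_left hy)]
    simp only [max_lt_iff]
    constructor
    · rintro ⟨a, ⟨b, c⟩, d⟩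
      by_cases h : ¥p ≤ wj w J
      · left; exact ⟨a, ⟨b, c⟩, h⟩
      · right; exact ⟨a, ⟨b, ¢⟩, d⟩
    · rintro (⟨a, ⟨b, c⟩, d⟩ | ⟨a, ⟨b, c⟩, d⟩)
      · exact ⟨a, ⟨b, c⟩, ¢⟩
      · exact ⟨a, ⟨b, ¢⟩, d⟩
  · rw [disjoint_left]
    intro p hp hp'
    rw [Bl, mem_Pr (le_max_of_le_left hy)] at hp
    rw [mem_Pr (le_max_of_le_left hy)] at hp'
    simp only [max_lt_iff] at hp hp'
    linarith [hp.2.2, hp'.2.1.2]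
lemma Bl_prod {y w : ℝ} (hy : 0 ≤ y) (hw : 1 ≤ w) (J : ℕ) (f : ℕ → ℝ) :
    ∏ p ∈ Pr (max y (wj w J)) w, f p = ∏ j ∈ range J, ∏ p ∈ Bl y w j, f p := by
  induction J with
  | zero =>
    rw [range_zero, prod_empty]
    apply prod_eq_one
    intro p hp
    rw [mem_Pr (le_max_of_le_left hy)] at hp
    simp only [max_lt_iff] at hp
    have : wj w 0 = w := by simp [wj]
    linarith [hp.2.1.2, hp.2.2]
  | succ J ih =>
    rw [(Bl_step hy hw J).1, prod_union (Bl_step hy hw J).2, ih, prod_range_succ, mul_comm]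
lemma Bl_disj {y w : ℝ} (hy : 0 ≤ y) (hw : 1 ≤ w) {i j : ℕ} (h : i ≠ j) : Disjoint (Bl y w i) (Bl y w j) := by
  wlog hij : i < j generalizing i j
  · exact (this h.symm £).symm
  have mono : wj w j ≤ wj w (i+1)
  · unfold wj
    apply Real.rpow_le_rpow_of_exponent_le hw
    exact pow_le_pow_of_le_one ¤ ¤ £
  rw [disjoint_left]
  intro p hp hp'
  rw [Bl, mem_Pr (le_max_of_le_left hy)] at hp hp'
  simp only [max_lt_iff] at hp hp'
  linarith [hp.2.1.2, hp'.2.2]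
end LN
end

section
open scoped Classical
open Finset Real
namespace LN
lemma one_sub_ge_exp {g : ℝ} (h0 : 0 ≤ g) (h1 : g ≤ 1/2) : Real.exp (-2 * g) ≤ 1 - g := by
  have h2 : 0 < 1 - g := ¢
  rw [show -2 * g = -(2*g) by ring, Real.exp_neg, inv_le_comm₀ (Real.exp_pos _) h2]
  have h3 := Real.add_one_le_exp (2 * g)
  refine le_trans ?_ h3
  rw [inv_le_iff_one_le_mul₀ h2]
  nlinarith
lemma sum_geom_le (J : ℕ) : ∑ i ∈ range J, (1/2:ℝ) ^ i ≤ 2 := by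
  have : ∑ i ∈ range J, (1/2:ℝ) ^ i = 2 - 2 * (1/2) ^ J
  · induction J with
    | zero => simp
    | succ n ih => rw [sum_range_succ, ih, pow_succ]; ring
  rw [this]
  have : ¥0 ≤ (1/2) ^ J := §
  linarith
lemma sum_geom_le' (J : ℕ) : ∑ i ∈ range J, ¥i * (1/2:ℝ) ^ i ≤ 2 := by
  have : ∑ i ∈ range J, ¥i * (1/2:ℝ) ^ i = 2 - (2 * J + 2) * (1/2) ^ J
  · induction J with
    | zero => simp
    | succ n ih => rw [sum_range_succ, ih, pow_succ]; push_cast; ring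
  rw [this]
  have : ¥0 ≤ (2 * J + 2) * (1/2) ^ J := §
  linarith
lemma sieve_final {X V t S1 S2 S3 U Er B : ℝ} {J : ℝ} (hX : 0 ≤ X) (hV : 0 ≤ V) (ht0 : 0 ≤ t) (ht1 : t ≤ 1)
    (h1 : -Er ≤ S2 - X * U) (h2 : S2 - X * U ≤ Er) (h3 : S1 ≤ S2) (h4 : S2 - S3 ≤ S1)
    (h5 : S3 ≤ X * (t * (1/8) * (V * (1 + t * (1/4)))) + J * Er) (h6 : V ≤ U) (h7 : U ≤ V * (1 + t * (1/4)))
    (h8 : 0 ≤ J * Er)(h10 : (1 + J) * Er ≤ B) :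
    |S1 - X * V| ≤ t * (X * V) + B := by
  have hXu1 := mL h6 hX
  have hXu2 := mL h7 hX
  rw [abs_le]
  have : X * (t * (1/8) * (V * (1 + t * (1/4)))) ≤ t * (X * V)
  · have h1 : (1/8:ℝ) * (1 + t * (1/4)) ≤ 1 := ¢
    calc _ = ((1/8:ℝ) * (1 + t * (1/4))) * (t * (X * V)) := by ring
      _ ≤ 1 * (t * (X * V)) := by gcongr
      _ = _ := one_mul _
  constructor <;> linarith
set_option maxHeartbeats 2000000 in
theorem sieve {y w : ℝ} (hyY : Real.exp 14 ≤ y) (hyw : y ≤ w) (b : ℕ) (A : Finset ℕ) (a g : ℕ → ℝ) (X E : ℝ)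
    (ha : ∀ n ∈ A, 0 ≤ a n) (hg : ∀ p ∈ Pr y w, 0 ≤ g p ∧ g p ≤ 2 / p) (hX : 0 ≤ X) (hE : 0 ≤ E)
    (hH : ∀ D ⊆ Pr y w, |∑ n ∈ A with ∀ p ∈ D, p ∣ n, a n - X * ∏ p ∈ D, g p| ≤ E * (∏ p ∈ D, ¥p) ^ 2) :
    |∑ n ∈ A with ∀ p ∈ Pr y w, ¬ p ∣ n, a n - X * ∏ p ∈ Pr y w, (1 - g p)| ≤
      (1/2) ^ b * (X * ∏ p ∈ Pr y w, (1 - g p)) + E * w ^ (12 * b + 260) := by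
  have hy15 : ¥15 ≤ y
  · have := Real.add_one_le_exp ¥14; linarith
  have hy0 : 0 ≤ y := ¢
  have hw1 : 1 ≤ w := ¢
  have hly : 14 ≤ Real.log y
  · rw [Real.le_log_iff_exp_le ¢]; exact hyY
  set J := ⌈Real.log w⌉₊ with hJ
  have hlw : 0 ≤ Real.log w := Real.log_nonneg hw1
  have hwJ : wj w J ≤ y
  · have h1 : Real.log w ≤ 2 ^ J
    · have h2 : Real.log w ≤ J := Nat.le_ceil _
      have h3 : ¥J ≤ 2 ^ J := by exact_mod_cast Nat.lt_two_pow_self.le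
      linarith
    have h4 : Real.log (wj w J) ≤ 1
    · unfold wj
      rw [Real.log_rpow ¢, one_div, inv_pow, inv_mul_le_iff₀ §]
      linarith
    have h5 := wj_ge hw1 J
    rw [← Real.exp_log (show 0 < wj w J by linarith)]
    refine le_trans (Real.exp_le_exp.2 (h4.trans (by norm_num : ¥1 ≤ 14))) hyY
  have hPe : Pr (max y (wj w J)) w = Pr y w := by rw [max_eq_left hwJ]
  have hprod : ∀ f : ℕ → ℝ, ∏ p ∈ Pr y w, f p = ∏ j ∈ range J, ∏ p ∈ Bl y w j, f p
  · intro f; rw [← hPe, Bl_prod hy0 hw1]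
  have hBsub : ∀ j, Bl y w j ⊆ Pr y w
  · intro j p hp
    rw [Bl, mem_Pr (le_max_of_le_left hy0)] at hp
    rw [mem_Pr hy0]
    simp only [max_lt_iff] at hp
    exact ⟨hp.1, hp.2.1.1, hp.2.2.trans (wj_le hw1 j)⟩
  have hgB : ∀ j, ∀ p ∈ Bl y w j, 0 ≤ g p ∧ g p ≤ 1/2
  · intro j p hp
    have h1 := hg p (hBsub j hp)
    have h2 := (mem_Pr hy0).1 (hBsub j hp)
    refine ⟨h1.1, h1.2.trans ?_⟩
    rw [div_le_div_iff₀ ¢ ¤]; linarith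
  have hG : ∀ j, ∑ p ∈ Bl y w j, g p ≤ 4
  · intro j
    set u := max y (wj w (j+1)) with hu
    have huy : y ≤ u := le_max_left _ _
    by_cases h : u ≤ wj w j
    · have h1 : ∑ p ∈ Bl y w j, g p ≤ 2 * ∑ p ∈ Pr u (wj w j), ¥1 / p
      · rw [mul_sum]
        apply sum_le_sum
        intro p hp
        rw [mul_one_div]; exact (hg p (hBsub j hp)).2
      have h2 := sum_inv_Pr (u := u) (w := wj w j) ¢ h
      have h3 : Real.log (wj w j) ≤ 2 * Real.log u
      · have h4 : wj w j ≤ u ^ 2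
        · rw [← wj_sq hw1 j]
          have := wj_ge hw1 (j+1)
          have : wj w (j+1) ≤ u := le_max_right _ _
          gcongr
        have h5 := Real.log_le_log (by linarith [wj_ge hw1 j]) h4
        rw [Real.log_pow] at h5
        exact_mod_cast h5
      have h6 : 14 ≤ Real.log u := hly.trans (Real.log_le_log ¢ huy)
      have h7 : (Real.log (wj w j) - Real.log u + 14) / Real.log u ≤ 2
      · rw [div_le_iff₀ ¢]; linarith
      linarith
    · have : Bl y w j = ∅
      · rw [eq_empty_iff_forall_notMem]
        intro p hp
        rw [Bl, ← hu, mem_Pr ¢] at hp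
        linarith [hp.2.1, hp.2.2]
      rw [this]; simp
  set m : ℕ → ℕ := fun j => 2 * (b + j + 20) with hm
  set h : ℕ → ℝ := fun j => (1/2) ^ (b + j + 20) with hh
  have hh0 : ∀ j, 0 ≤ h j := fun j => §
  set v : ℕ → ℝ := fun j => ∏ p ∈ Bl y w j, (1 - g p) with hv
  set u : ℕ → ℝ := fun j => us (Bl y w j) g (m j + 1) with hu
  set e : ℕ → ℝ := fun j => es (Bl y w j) g (m j + 1) with he
  have hvpos : ∀ j, Real.exp (-8) ≤ v j
  · intro j
    calc Real.exp (-8) ≤ Real.exp (∑ p ∈ Bl y w j, (-2 * g p)) := by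
          rw [Real.exp_le_exp, ← mul_sum]; linarith [hG j]
      _ = ∏ p ∈ Bl y w j, Real.exp (-2 * g p) := Real.exp_sum _ _
      _ ≤ v j := prod_le_prod (fun p _ => (Real.exp_pos _).le) (fun p hp => one_sub_ge_exp (hgB j p hp).1 (hgB j p hp).2)
  have hv0 : ∀ j, 0 < v j := fun j => (Real.exp_pos _).trans_le (hvpos j)
  have heb : ∀ j, e j ≤ v j * h j
  · intro j
    calc e j ≤ (∑ p ∈ Bl y w j, g p) ^ (m j + 1) / (m j + 1).factorial := es_le (fun p hp => (hgB j p hp).1) _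
      _ ≤ 4 ^ (m j + 1) / (m j + 1).factorial := by
          gcongr
          · exact sum_nonneg fun p hp => (hgB j p hp).1
          · exact hG j
      _ ≤ Real.exp (-8) * (1/2) ^ (m j + 1) := fact_bound (by simp only [hm]; omega)
      _ ≤ v j * h j := by
          exact mul_le_mul (hvpos j) (pow_le_pow_of_le_one ¤ ¤ (by simp only [hm]; omega))
            § (hv0 j).le
  have bonf : ∀ j (s : ℕ → ℝ), (∀ p ∈ Bl y w j, 0 ≤ s p ∧ s p ≤ 1) →
      ∏ p ∈ Bl y w j, (1 - s p) ≤ us (Bl y w j) s (m j + 1) ∧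
      us (Bl y w j) s (m j + 1) - ∏ p ∈ Bl y w j, (1 - s p) ≤ es (Bl y w j) s (m j + 1) := by
    intro j s hs
    have := bonferroni (Bl y w j) s hs (m j + 1)
    have h1 : (-1:ℝ) ^ (m j + 1) = -1
    · rw [pow_succ]; simp only [hm]; rw [pow_mul]; simp
    rw [h1] at this
    constructor <;> linarith [this.1, this.2]
  have hub : ∀ j, v j ≤ u j ∧ u j ≤ v j * (1 + h j)
  · intro j
    have := bonf j g (fun p hp => ⟨(hgB j p hp).1, by linarith [(hgB j p hp).2]⟩)
    refine ⟨this.1, ?_⟩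
    have h2 := heb j
    simp only [hu, hv, he] at *
    linarith [this.2]
  have hBb : ∀ j, ∑ D ∈ (Bl y w j).powerset with D.card ≤ m j + 1, (∏ p ∈ D, ¥p) ^ 2 ≤ wj w j ^ (3 * (m j + 1))
  · intro j
    have h1 : ∑ D ∈ (Bl y w j).powerset with D.card ≤ m j + 1, (∏ p ∈ D, ¥p) ^ 2 ≤ (1 + ∑ p ∈ Bl y w j, ¥p^2) ^ (m j + 1)
    · have := sum_powerset_le (P := Bl y w j) (h := fun p => ¥p^2) (fun p _ => by positivity) (m j + 1)
      simpa only [prod_pow] using this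
    refine h1.trans ?_
    rw [pow_mul]
    have hz := wj_ge hw1 j
    have h2 : (1 + ∑ p ∈ Bl y w j, ¥p^2) ≤ wj w j ^ 3
    · have h3 : ∑ p ∈ Bl y w j, ¥p^2 ≤ (Bl y w j).card • (wj w j)^2
      · apply sum_le_card_nsmul
        intro p hp
        rw [Bl, mem_Pr (le_max_of_le_left hy0)] at hp
        have := hp.2.2
        gcongr
      have h4 : (Bl y w j).card ≤ ⌊wj w j⌋₊ - 1
      · calc (Bl y w j).card ≤ (Finset.Ioc ⌊max y (wj w (j+1))⌋₊ ⌊wj w j⌋₊).card := card_filter_le _ _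
          _ = ⌊wj w j⌋₊ - ⌊max y (wj w (j+1))⌋₊ := Nat.card_Ioc _ _
          _ ≤ _ := by
            have : 1 ≤ ⌊max y (wj w (j+1))⌋₊ := Nat.le_floor (by
              push_cast; exact le_max_of_le_left ¢)
            omega
      have h5 : 1 ≤ ⌊wj w j⌋₊ := Nat.le_floor (by simpa using hz)
      have h6 : ((Bl y w j).card : ℝ) ≤ wj w j - 1
      · have : ((Bl y w j).card : ℝ) ≤ ((⌊wj w j⌋₊ - 1 : ℕ) : ℝ) := by exact_mod_cast h4
        rw [Nat.cast_sub h5] at this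
        have := Nat.floor_le (show 0 ≤ wj w j by linarith)
        push_cast at *
        linarith
      rw [nsmul_eq_mul] at h3
      have h7 : ((Bl y w j).card : ℝ) * wj w j ^ 2 ≤ (wj w j - 1) * wj w j ^ 2 := by gcongr
      nlinarith
    exact pow_le_pow_left₀ § h2 _
  have hBprod : ∏ j ∈ range J, wj w j ^ (3 * (m j + 1)) ≤ w ^ (12 * b + 258)
  · have h1 : ∀ j ∈ range J, wj w j ^ (3 * (m j + 1)) = w ^ ((1/2:ℝ) ^ j * (6 * b + 123 + 6 * j))
    · intro j _
      unfold wj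
      rw [← Real.rpow_natCast, ← Real.rpow_mul ¢]
      congr 2
      simp only [hm]; push_cast; ring
    rw [prod_congr rfl h1, ← Real.rpow_sum_of_pos ¢, ← Real.rpow_natCast]
    apply Real.rpow_le_rpow_of_exponent_le hw1
    have h2 : ∑ j ∈ range J, (1/2:ℝ) ^ j * (6 * b + 123 + 6 * j) = (6 * b + 123) * ∑ j ∈ range J, (1/2:ℝ) ^ j + 6 * ∑ j ∈ range J, j * (1/2:ℝ) ^ j
    · rw [mul_sum, mul_sum, ← sum_add]
      apply sum_congr rfl; intros; ring
    rw [h2]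
    have := sum_geom_le J
    have := sum_geom_le' J
    push_cast
    nlinarith [(nn0 b : ¥0 ≤ b)]
  set Er := E * w ^ (12 * b + 258) with hEr
  have exp0 : ∀ (t : ℕ → Finset (Finset ℕ)) (ζ : ℕ → Finset ℕ → ℝ), (∀ j D, |ζ j D| ≤ 1) →
     (∀ j, t j ⊆ (Bl y w j).powerset.filter (fun D => D.card ≤ m j + 1)) →
     |∑ n ∈ A, a n * ∏ j ∈ range J, ∑ D ∈ t j, ζ j D * ∏ p ∈ D, (if p ∣ n then 1 else 0)
      - X * ∏ j ∈ range J, ∑ D ∈ t j, ζ j D * ∏ p ∈ D, g p| ≤ Er := by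
    intro t ζ hζ ht
    have := expand A a g X E (Bl y w) (Pr y w) hH t ζ hζ (range J) (fun j _ => hBsub j)
      (fun i _ j _ hij => Bl_disj hy0 hw1 hij) (fun j _ D hD => by
        have := ht j hD
        rw [mem_filter, mem_powerset] at this
        exact this.1) ∅ (empty_subset _) (fun j _ => disjoint_empty_left _)
    simp only [notMem_empty, false_imp_iff, implies_true, filter_true, prod_empty, mul_one, one_pow] at this
    refine this.trans ?_
    rw [hEr]
    gcongr
    refine le_trans ?_ hBprod
    apply prod_le_prod
    · intro j _; positivity
    · intro j _
      refine le_trans ?_ (hBb j)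
      exact sub_sum (ht j) (fun D _ _ => by positivity)
  set s : ℕ → ℕ → ℝ := fun n p => if p ∣ n then 1 else 0 with hs
  have hs01 : ∀ n p, 0 ≤ s n p ∧ s n p ≤ 1
  · intro n p; simp only [hs]; split_ifs <;> norm_num
  set Un : ℕ → ℕ → ℝ := fun n j => us (Bl y w j) (s n) (m j + 1) with hUn
  set en : ℕ → ℕ → ℝ := fun n j => es (Bl y w j) (s n) (m j + 1) with hen
  set vn : ℕ → ℕ → ℝ := fun n j => ∏ p ∈ Bl y w j, (1 - s n p) with hvn
  have up : |∑ n ∈ A, a n * ∏ j ∈ range J, Un n j - X * ∏ j ∈ range J, u j| ≤ Er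
  · have := exp0 (fun j => (Bl y w j).powerset.filter (fun D => D.card ≤ m j)) (fun j D => (-1) ^ D.card)
      (fun j D => by simp) (fun j D hD => by
        rw [mem_filter] at hD ⊢; exact ⟨hD.1, £⟩)
    simp only [hUn, hu, us_eq]
    exact this
  have lo : ∀ j0, |∑ n ∈ A, a n * ∏ j ∈ range J, (if j = j0 then en n j else Un n j) -
      X * ∏ j ∈ range J, (if j = j0 then e j else u j)| ≤ Er := by
    intro j0
    have := exp0 (fun j => if j = j0 then (Bl y w j).powersetCard (m j + 1) else (Bl y w j).powerset.filter (fun D => D.card ≤ m j))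
      (fun j D => if j = j0 then 1 else (-1) ^ D.card)
      (fun j D => by split_ifs <;> simp) (fun j D hD => by
        rw [mem_filter, mem_powerset]
        split_ifs at hD
        · rw [mem_powersetCard] at hD; exact ⟨hD.1, £⟩
        · rw [mem_filter, mem_powerset] at hD; exact ⟨hD.1, £⟩)
    have e1 : ∀ (σ : ℕ → ℝ) j, (if j = j0 then es (Bl y w j) σ (m j + 1) else us (Bl y w j) σ (m j + 1)) =
      ∑ D ∈ (if j = j0 then (Bl y w j).powersetCard (m j + 1) else (Bl y w j).powerset.filter (fun D => D.card ≤ m j)),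
        (if j = j0 then 1 else (-1:ℝ) ^ D.card) * ∏ p ∈ D, σ p := by
      intro σ j
      by_cases hj : j = j0
      · simp only [if_pos hj, one_mul]; rfl
      · simp only [if_neg hj, us_eq]
    simp only [hen, hUn, he, hu, e1]
    exact this
  have hS : ∑ n ∈ A with ∀ p ∈ Pr y w, ¬ p ∣ n, a n = ∑ n ∈ A, a n * ∏ j ∈ range J, vn n j
  · rw [sum_filter]
    apply sum_congr rfl
    intro n _
    simp only [hvn, ← hprod, hs]
    have : ∀ p ∈ Pr y w, (1 - (if p ∣ n then ¥1 else 0)) = if ¬ p ∣ n then 1 else 0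
    · intro p _; split_ifs <;> simp_all
    rw [prod_congr rfl this, prod_ite_zero]
    split_ifs <;> simp
  have hn1 : ∀ n j, 0 ≤ vn n j ∧ vn n j ≤ Un n j ∧ Un n j - vn n j ≤ en n j
  · intro n j
    refine ⟨prod_nonneg fun p _ => by linarith [(hs01 n p).2], ?_, ?_⟩
    · exact (bonf j (s n) (fun p _ => hs01 n p)).1
    · exact (bonf j (s n) (fun p _ => hs01 n p)).2
  have hSup : ∑ n ∈ A, a n * ∏ j ∈ range J, vn n j ≤ ∑ n ∈ A, a n * ∏ j ∈ range J, Un n j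
  · apply sum_le_sum
    intro n hn
    have := ha n hn
    gcongr with j _
    · intro j _; exact (hn1 n j).1
    · exact (hn1 n j).2.1
  have hSlo : ∑ n ∈ A, a n * ∏ j ∈ range J, Un n j - ∑ j0 ∈ range J, ∑ n ∈ A, a n * ∏ j ∈ range J, (if j = j0 then en n j else Un n j)
      ≤ ∑ n ∈ A, a n * ∏ j ∈ range J, vn n j := by
    rw [sum_comm, sub_le_iff_le_add, ← sum_add]
    apply sum_le_sum
    intro n hn
    rw [← mul_sum, ← mul_add]
    apply mL _ (ha n hn)
    have := prod_diff (J := range J) (u := Un n) (v := vn n) (e := en n) (fun j _ => (hn1 n j).1) (fun j _ => (hn1 n j).2.1) (fun j _ => (hn1 n j).2.2)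
    linarith
  rw [hS, hprod]
  change |_ - X * ∏ j ∈ range J, v j| ≤ _ * (X * ∏ j ∈ range J, v j) + _
  have he0 : ∀ j, 0 ≤ e j := fun j => es_nonneg (fun p hp => (hgB j p hp).1) _
  have hEr0 : 0 ≤ Er := §
  clear_value v u e h Un en vn s m Er J
  set V := ∏ j ∈ range J, v j with hV
  have hV0 : 0 < V := prod_pos fun j _ => hv0 j
  have hsumh : ∑ j ∈ range J, h j ≤ (1/2) ^ b * (1/8)
  · have : ∀ j ∈ range J, h j = (1/2)^b * (1/2)^20 * (1/2) ^ j
    · intro j _; simp only [hh]; rw [← pow_add, ← pow_add]; congr 1; omega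
    rw [sum_congr rfl this, ← mul_sum]
    have h1 := sum_geom_le J
    have h2 : ¥0 ≤ (1/2)^b := §
    calc (1/2:ℝ)^b * (1/2)^20 * ∑ i ∈ range J, (1/2) ^ i ≤ (1/2:ℝ)^b * (1/2)^20 * 2 := by gcongr
      _ = (1/2) ^ b * (1/2^19) := by ring
      _ ≤ _ := by gcongr; norm_num
  have hb1 : (1/2:ℝ) ^ b ≤ 1 := pow_le_one₀ ¤ ¤
  have hb0 : ¥0 < (1/2:ℝ) ^ b := §
  have hPi : ∏ j ∈ range J, (1 + h j) ≤ 1 + (1/2) ^ b * (1/4)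
  · calc ∏ j ∈ range J, (1 + h j) ≤ ∏ j ∈ range J, Real.exp (h j) :=
          prod_le_prod (fun j _ => by linarith [hh0 j]) (fun j _ => by linarith [Real.add_one_le_exp (h j)])
      _ = Real.exp (∑ j ∈ range J, h j) := (Real.exp_sum _ _).symm
      _ ≤ _ := by
          set t := ∑ j ∈ range J, h j
          have ht0 : 0 ≤ t := sum_nonneg fun j _ => hh0 j
          have h1 : Real.exp (-2 * (t)) ≤ 1 - t := one_sub_ge_exp ht0 ¢
          have h2 : Real.exp t ≤ (1 - t)⁻¹
          · rw [le_inv_comm₀ (Real.exp_pos _) ¢, ← Real.exp_neg]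
            have := Real.add_one_le_exp (-t); linarith
          refine h2.trans ?_
          rw [inv_le_iff_one_le_mul₀ ¢]
          nlinarith
  have hu1 : V ≤ ∏ j ∈ range J, u j := prod_le_prod (fun j _ => (hv0 j).le) (fun j _ => (hub j).1)
  have hu2 : ∏ j ∈ range J, u j ≤ V * ∏ j ∈ range J, (1 + h j)
  · rw [hV, ← prod_mul_distrib]
    exact prod_le_prod (fun j _ => (hv0 j).le.trans (hub j).1) (fun j _ => (hub j).2)
  have hlo2 : ∀ j0 ∈ range J, ∏ j ∈ range J, (if j = j0 then e j else u j) ≤ h j0 * (V * ∏ j ∈ range J, (1 + h j))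
  · intro j0 hj0
    rw [hV, ← prod_mul_distrib, ← mul_prod_erase _ _ hj0, ← mul_prod_erase (range J) (fun j => v j * (1 + h j)) hj0, if_pos rfl]
    have h1 : ∏ x ∈ (range J).erase j0, (if x = j0 then e x else u x) ≤ ∏ x ∈ (range J).erase j0, (v x * (1 + h x))
    · apply prod_le_prod
      · intro x hx
        rw [if_neg (ne_of_mem_erase hx)]; exact (hv0 x).le.trans (hub x).1
      · intro x hx
        rw [if_neg (ne_of_mem_erase hx)]; exact (hub x).2
    have h2 : 0 ≤ ∏ x ∈ (range J).erase j0, (v x * (1 + h x)) :=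
      prod_nonneg fun x _ => mul_nonneg (hv0 x).le (by linarith [hh0 x])
    have h3 : 0 ≤ e j0 := he0 j0
    calc _ ≤ e j0 * ∏ x ∈ (range J).erase j0, (v x * (1 + h x)) := by gcongr
      _ ≤ (v j0 * h j0) * ∏ x ∈ (range J).erase j0, (v x * (1 + h x)) := by gcongr; exact heb j0
      _ ≤ (h j0 * (v j0 * (1 + h j0))) * ∏ x ∈ (range J).erase j0, (v x * (1 + h x)) := by
          apply mR _ h2
          have := mul_nonneg (mul_nonneg (hh0 j0) (hv0 j0).le) (hh0 j0)
          linarith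
      _ = _ := by ring
  have hErJ : (1 + J) * Er ≤ E * w ^ (12 * b + 260)
  · have h1 : ¥J ≤ Real.log w + 1 := by rw [hJ]; exact (Nat.ceil_lt_add_one hlw).le
    have h2 := Real.log_le_sub_one_of_pos (show 0 < w by linarith)
    have h3 : (1 + J : ℝ) ≤ w ^ 2 := by nlinarith
    calc (1 + J) * Er ≤ w ^ 2 * Er := by gcongr
      _ = _ := by rw [hEr]; ring
  have hup' := abs_le.1 up
  have hsumlo : ∑ j0 ∈ range J, ∑ n ∈ A, a n * ∏ j ∈ range J, (if j = j0 then en n j else Un n j) ≤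
      X * ((1/2) ^ b * (1/8) * (V * (1 + (1/2) ^ b * (1/4)))) + J * Er := by
    calc _ ≤ ∑ j0 ∈ range J, (X * (h j0 * (V * (1 + (1/2) ^ b * (1/4)))) + Er) := by
          apply sum_le_sum
          intro j0 hj0
          have h1 := (abs_le.1 (lo j0)).2
          have h2 := hlo2 j0 hj0
          have h3 : h j0 * (V * ∏ j ∈ range J, (1 + h j)) ≤ h j0 * (V * (1 + (1/2) ^ b * (1/4)))
          · have := hh0 j0
            gcongr
          have h4 := mL (h2.trans h3) hX
          linarith
      _ = X * ((∑ j ∈ range J, h j) * (V * (1 + (1/2) ^ b * (1/4)))) + J * Er := by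
          rw [sum_add, ← mul_sum, ← sum_mul]; simp
      _ ≤ _ := by gcongr
  have hJE : 0 ≤ J * Er := mul_nonneg (nn0 _) hEr0
  exact sieve_final hX hV0.le hb0.le hb1 hup'.1 hup'.2 hSup hSlo hsumlo hu1 (hu2.trans (by gcongr)) hJE hErJ
end LN
end

section
open scoped Classical
open Finset Real
namespace LN
section dich
local notation "PS" => PowerSeries ℝ
local notation "cf" => PowerSeries.coeff (R := ℝ)
noncomputable def tht (f : PowerSeries ℝ) : PowerSeries ℝ := PowerSeries.mk fun n => n * cf n f
lemma cf_tht (n : ℕ) (f : PS) : cf n (tht f) = n * cf n f := by simp [tht]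
lemma tht_mul (f g : PS) : tht (f * g) = tht f * g + f * tht g := by
  ext n
  rw [cf_tht, map_add, PowerSeries.coeff_mul, PowerSeries.coeff_mul, PowerSeries.coeff_mul, mul_sum, ← sum_add]
  apply sum_congr rfl
  intro p hp
  rw [cf_tht, cf_tht, ← mem_antidiagonal.1 hp]
  push_cast; ring
lemma cf_mul (n : ℕ) (f g : PS) : cf n (f * g) = ∑ i ∈ ¿n, cf i f * cf (n - i) g := by
  rw [PowerSeries.coeff_mul, Finset.Nat.sum_antidiagonal_eq_sum_range_succ (fun i j => cf i f * cf j g)]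
variable {X : Type*} [Fintype X]
noncomputable def nrm (a : X → ℝ) : ℝ := ‖(WithLp.toLp 2 a : EuclideanSpace ℝ X)‖
lemma nrm_sq (a : X → ℝ) : nrm a ^ 2 = ∑ x, a x ^ 2 := by
  rw [nrm, EuclideanSpace.norm_sq_eq]; simp
lemma nrm_nonneg (a : X → ℝ) : 0 ≤ nrm a := norm_nonneg _
lemma nrm_le {a : X → ℝ} {B : ℝ} (hB : 0 ≤ B) (h : ∑ x, a x ^ 2 ≤ B ^ 2) : nrm a ≤ B := by
  rw [← nrm_sq] at h; exact (pow_le_pow_iff_left₀ (nrm_nonneg _) hB ¤).1 h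
lemma abs_le_nrm (a : X → ℝ) (x : X) : |a x| ≤ nrm a := by
  rw [← abs_of_nonneg (nrm_nonneg a), ← sq_le_sq, nrm_sq]
  exact single_le_sum (f := fun x => a x ^ 2) (fun _ _ => sq_nonneg _) (mem_univ x)
lemma nrm_sum_le {ι : Type*} (S : Finset ι) (f : ι → X → ℝ) : nrm (fun x => ∑ i ∈ S, f i x) ≤ ∑ i ∈ S, nrm (f i) := by
  have : (WithLp.toLp 2 (fun x => ∑ i ∈ S, f i x) : EuclideanSpace ℝ X) = ∑ i ∈ S, WithLp.toLp 2 (f i)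
  · ext x; simp
  rw [nrm, this]; exact norm_sum_le _ _
lemma nrm_smul (c : ℝ) (f : X → ℝ) : nrm (fun x => c * f x) = |c| * nrm f := by
  have : (WithLp.toLp 2 (fun x => c * f x) : EuclideanSpace ℝ X) = c • WithLp.toLp 2 f
  · ext x; simp
  rw [nrm, this, norm_smul]; rfl
lemma nrm_add_le (f g : X → ℝ) : nrm (fun x => f x + g x) ≤ nrm f + nrm g := by
  have : (WithLp.toLp 2 (fun x => f x + g x) : EuclideanSpace ℝ X) = WithLp.toLp 2 f + WithLp.toLp 2 g
  · ext x; simp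
  rw [nrm, this]; exact norm_add_le _ _
lemma cs (f g : X → ℝ) : ∑ x, f x * g x ≤ nrm f * nrm g := by
  have := sum_mul_sq_le_sq_mul_sq univ f g
  rw [← nrm_sq, ← nrm_sq, ← mul_pow] at this
  exact le_of_sq_le_sq this (mul_nonneg (nrm_nonneg _) (nrm_nonneg _))
lemma nrm_mul_le {f g : X → ℝ} {B : ℝ} (hB : 0 ≤ B) (h : ∀ x, |f x| ≤ B) : nrm (fun x => f x * g x) ≤ B * nrm g := by
  apply nrm_le (mul_nonneg hB (nrm_nonneg _))
  rw [mul_pow, nrm_sq, mul_sum]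
  apply sum_le_sum
  intro x _
  rw [mul_pow]
  exact mR (sq_le_sq.2 (by rw [abs_of_nonneg hB]; exact h x)) (sq_nonneg _)
def Mass (P : PowerSeries ℝ) (M : ℝ) : Prop := (∀ i, 0 ≤ cf i P) ∧ ∀ n, ∑ i ∈ ¿n, cf i P ≤ M
lemma conv_nrm {P : PS} {M B : ℝ} (hP : Mass P M) (G : X → PS) (n : ℕ) (hB : ∀ i ≤ n, nrm (fun x => cf i (G x)) ≤ B) :
    nrm (fun x => cf n (P * G x)) ≤ M * B := by
  have hB0 : 0 ≤ B := (nrm_nonneg _).trans (hB 0 £)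
  simp_rw [cf_mul]
  refine (nrm_sum_le _ _).trans ?_
  calc _ ≤ ∑ i ∈ ¿n, cf i P * B := by
        apply sum_le_sum
        intro i _
        rw [nrm_smul, abs_of_nonneg (hP.1 i)]
        exact mL (hB _ £) (hP.1 i)
    _ ≤ _ := by
        rw [← sum_mul]
        exact mR (hP.2 n) hB0
lemma conv_abs {P : PS} {M B : ℝ} (hP : Mass P M) (G : PS) (n : ℕ) (hB : ∀ i ≤ n, |cf i G| ≤ B) :
    |cf n (P * G)| ≤ M * B := by
  have hB0 : 0 ≤ B := (abs_nonneg _).trans (hB 0 £)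
  rw [cf_mul]
  refine (abs_sum _ _).trans ?_
  calc _ ≤ ∑ i ∈ ¿n, cf i P * B := by
        apply sum_le_sum
        intro i _
        rw [abs_mul, abs_of_nonneg (hP.1 i)]
        exact mL (hB _ £) (hP.1 i)
    _ ≤ _ := by
        rw [← sum_mul]
        exact mR (hP.2 n) hB0
lemma conv_ge {K g : PS} {R n : ℕ} {m B : ℝ} (hK : ∀ i, 0 ≤ cf i K) (hKR : ∀ l > R, cf l K = 0)
    (hm : m ≤ ∑ l ∈ ¿R, cf l K) (hB : 0 ≤ B) (hRn : R ≤ n) (hg : ∀ i ≤ n, n ≤ i + R → B ≤ cf i g) :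
    m * B ≤ cf n (K * g) := by
  rw [cf_mul]
  calc m * B ≤ ∑ l ∈ ¿R, cf l K * B := by rw [← sum_mul]; gcongr
    _ ≤ ∑ l ∈ ¿R, cf l K * cf (n - l) g := by
        apply sum_le_sum
        intro l hl
        rw [mem_range] at hl
        exact mL (hg _ £ £) (hK l)
    _ = _ := by
        apply sum_subset (range_subset_range.2 £)
        intro l _ hl
        rw [mem_range] at hl
        rw [hKR l £, zero_mul]
lemma pick {a : ℕ → ℝ} {L M : ℕ} {δ κ c : ℝ} (hLM : L ≤ M) (hδ : 0 ≤ δ) (ha : ∀ i ≤ M, a i ≤ 1 + δ)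
    (hs : M - κ ≤ ∑ i ∈ ¿M, a i) (hc : κ + 1 + δ * L < c * (M - L)) (hc0 : 0 ≤ c):
    ∃ i, L ≤ i ∧ i ≤ M ∧ 1 - c ≤ a i := by
  by_contra! hcon
  have h1 : ∑ i ∈ ¿M, a i = ∑ i ∈ range L, a i + ∑ i ∈ Ico L (M+1), a i :=
    (sum_range_add_sum_Ico _ £).symm
  have h2 : ∑ i ∈ range L, a i ≤ L * (1 + δ)
  · have := sum_le_card_nsmul (range L) a (1 + δ) (fun i hi => ha i (by rw [mem_range] at hi; omega))
    rw [card_range, nsmul_eq_mul] at this; exact this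
  have h3 : ∑ i ∈ Ico L (M+1), a i ≤ (M + 1 - L) * (1 - c)
  · have := sum_le_card_nsmul (Ico L (M+1)) a (1 - c) (fun i hi => by
      rw [mem_Ico] at hi; exact (hcon i hi.1 £).le)
    rw [Nat.card_Ico, nsmul_eq_mul, Nat.cast_sub £] at this
    push_cast at this; exact this
  nlinarith
end dich
end LN
end

section
open scoped Classical
open Finset Real
namespace LN
section dich
local notation "PS" => PowerSeries ℝ
local notation "cf" => PowerSeries.coeff (R := ℝ)
variable {X : Type*} [Fintype X]
lemma Mass_mul {P P' : PS} {M M' : ℝ} (h : Mass P M) (h' : Mass P' M') : Mass (P * P') (M * M') := by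
  have hM' : 0 ≤ M' := (sum_nonneg fun i _ => h'.1 i).trans (h'.2 0)
  refine ⟨fun i => ?_, fun n => ?_⟩
  · rw [cf_mul]; exact sum_nonneg fun j _ => mul_nonneg (h.1 _) (h'.1 _)
  · simp_rw [cf_mul]
    calc ∑ i ∈ ¿n, ∑ j ∈ ¿i, cf j P * cf (i - j) P'
        = ∑ j ∈ ¿n, cf j P * ∑ i ∈ Ico j (n+1), cf (i - j) P' := by
          simp_rw [mul_sum, range_eq_Ico]
          apply sum_comm'
          intro a b; simp only [mem_Ico]; omega
      _ ≤ ∑ j ∈ ¿n, cf j P * M' := by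
          apply sum_le_sum
          intro j hj
          apply mL _ (h.1 j)
          rw [mem_range] at hj
          rw [sum_Ico_eq_sum_range]
          simp only [Nat.add_sub_cancel_left]
          rw [show n + 1 - j = (n - j) + 1 by omega]
          exact h'.2 _
      _ ≤ M * M' := by rw [← sum_mul]; exact mR (h.2 n) hM'
structure DH (N R : ℕ) (δ : ℝ) (K : PowerSeries ℝ) (v : X → PowerSeries ℝ) (s : X → ℝ) : Prop where
  K1 : Mass K 1
  KR : ∀ l > R, cf l K = 0
  Km : 1 - δ ≤ ∑ l ∈ ¿R, cf l K
  Kd : ∀ n, ∑ l ∈ range n, |cf (l+1) K - cf l K| + cf 0 K ≤ δ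
  RN : ¥R + 1 ≤ δ * N
  s1 : ∀ x, s x = 1 ∨ s x = -1
  hv : ∀ i ≤ N, ∑ x, cf i (v x) ^ 2 ≤ (1 + δ) ^ 2
  hr : ∀ n ≤ N, ∑ x, cf n (tht (K * v x) + v x * v x) ^ 2 ≤ (δ * N) ^ 2
  hr0 : ∀ n ≤ N, |∑ x, s x * cf n (tht (K * v x) + v x * v x)| ≤ δ * N
  h0 : ∀ i ≤ N, N ≤ i + 4 * R → ∑ x, s x * cf i (v x) ≤ -1 + δ
noncomputable def SS (s : X → ℝ) (w : X → PowerSeries ℝ) : PowerSeries ℝ := PowerSeries.mk fun n => ∑ x, s x * cf n (w x)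
lemma cf_SS (s : X → ℝ) (w : X → PS) (n : ℕ) : cf n (SS s w) = ∑ x, s x * cf n (w x) := by simp [SS]
lemma mul_SS (s : X → ℝ) (w : X → PS) (K : PS) : K * SS s w = SS s (fun x => K * w x) := by
  ext n
  rw [cf_SS, cf_mul]
  simp_rw [cf_SS, cf_mul, mul_sum]
  rw [sum_comm]
  exact sum_congr rfl fun x _ => sum_congr rfl fun i _ => by ring
variable {N R : ℕ} {δ : ℝ} {K : PowerSeries ℝ} {v : X → PowerSeries ℝ} {s : X → ℝ}
lemma DH.N1 (h : DH N R δ K v s) : 1 ≤ δ * N := by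
  have := h.RN; have := nn R; linarith
lemma DH.RleN (h : DH N R δ K v s) (hδ : δ ≤ 1/100) : 100 * R ≤ N := by
  have := h.RN; have h2 := nn N
  have : (100 * R : ℝ) ≤ N := by nlinarith
  exact_mod_cast this
lemma DH.nv (h : DH N R δ K v s) (hδ0 : 0 ≤ δ) {i : ℕ} (hi : i ≤ N) : nrm (fun x => cf i (v x)) ≤ 1 + δ :=
  nrm_le ¢ (h.hv i hi)
lemma DH.nKv (h : DH N R δ K v s) (hδ0 : 0 ≤ δ) {i : ℕ} (hi : i ≤ N) : nrm (fun x => cf i (K * v x)) ≤ 1 + δ := by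
  have := conv_nrm h.K1 v i (B := 1 + δ) fun j hj => h.nv hδ0 (hj.trans hi)
  linarith
lemma DH.nKKv (h : DH N R δ K v s) (hδ0 : 0 ≤ δ) {i : ℕ} (hi : i ≤ N) : nrm (fun x => cf i (K * (K * v x))) ≤ 1 + δ := by
  have := conv_nrm h.K1 (fun x => K * v x) i (B := 1 + δ) fun j hj => h.nKv hδ0 (hj.trans hi)
  linarith
lemma DH.nKKKv (h : DH N R δ K v s) (hδ0 : 0 ≤ δ) {i : ℕ} (hi : i ≤ N) : nrm (fun x => cf i (K * (K * (K * v x)))) ≤ 1 + δ := by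
  have := conv_nrm h.K1 (fun x => K * (K * v x)) i (B := 1 + δ) fun j hj => h.nKKv hδ0 (hj.trans hi)
  linarith
lemma DH.g0 (h : DH N R δ K v s) (hδ0 : 0 ≤ δ) (hδ : δ ≤ 1/100) {n : ℕ} (hn : n ≤ N) (hn' : N ≤ n + 3 * R) :
    (1 - 6 * δ) * N ≤ cf n (SS s (fun x => v x * v x)) := by
  have hR := h.RleN hδ
  have h1 : (1 - δ) * (1 - δ) ≤ cf n (K * (-SS s v))
  · apply conv_ge h.K1.1 h.KR h.Km ¢ £
    intro i hi hi'
    have := h.h0 i £ £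
    rw [map_neg, cf_SS]; linarith
  rw [mul_neg, map_neg, mul_SS, cf_SS] at h1
  have h2 := (abs_le.1 (h.hr0 n hn)).1
  simp_rw [map_add, cf_tht, mul_add, sum_add] at h2
  rw [cf_SS]
  have h3 : ∑ x, s x * (n * cf n (K * v x)) = n * ∑ x, s x * cf n (K * v x)
  · rw [mul_sum]; exact sum_congr rfl fun x _ => by ring
  rw [h3] at h2
  have hnr : ¥N ≤ n + 3 * R := by exact_mod_cast hn'
  have hRN := h.RN
  have h4 : (1 - 3 * δ) * N ≤ n := ¢
  have h5 : ¥n * ((1 - δ) * (1 - δ)) ≤ n * (-∑ x, s x * cf n (K * v x)) :=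
    mL h1 (nn0 _)
  have h6 : (1 - 3 * δ) * N * ((1 - δ) * (1 - δ)) ≤ n * ((1 - δ) * (1 - δ)) :=
    mR h4 (by nlinarith)
  have h7 : (1 - 5 * δ) * N ≤ (1 - 3 * δ) * N * ((1 - δ) * (1 - δ))
  · have : (1 - 5 * δ) ≤ (1 - 3 * δ) * ((1 - δ) * (1 - δ)) := by nlinarith [mul_nonneg hδ0 hδ0, mul_nonneg (mul_nonneg hδ0 hδ0) (sub_nonneg.2 hδ)]
    nlinarith
  linarith
lemma DH.gstep (h : DH N R δ K v s) (hδ0 : 0 ≤ δ) (hδ : δ ≤ 1/100) {G : PS} {k a : ℕ} (ha : a ≤ 10) (hk : k ≤ 3)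
    (hg : ∀ n ≤ N, N ≤ n + (k+1) * R → (1 - a * δ) * N ≤ cf n G) :
    ∀ n ≤ N, N ≤ n + k * R → (1 - (a+1 : ℕ) * δ) * N ≤ cf n (K * G) := by
  intro n hn hn'
  have hR := h.RleN hδ
  have hN0 := nn N
  have ha' : ¥a ≤ 10 := by exact_mod_cast ha
  have ha0 := nn a
  have := conv_ge (g := G) (n := n) (B := (1 - a * δ) * N) h.K1.1 h.KR h.Km (mul_nonneg (by nlinarith) hN0) (by nlinarith) (fun i hi hi' => hg i £ (by nlinarith))
  refine le_trans ?_ this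
  rw [← mul_assoc]
  apply mR _ hN0
  push_cast
  nlinarith [mul_nonneg ha0 (mul_nonneg hδ0 hδ0)]
lemma DH.g1 (h : DH N R δ K v s) (hδ0 : 0 ≤ δ) (hδ : δ ≤ 1/100) :
    ∀ n ≤ N, N ≤ n + 2 * R → (1 - (7:ℕ) * δ) * N ≤ cf n (K * SS s (fun x => v x * v x)) :=
  h.gstep hδ0 hδ (k := 2) (a := 6) ¤ ¤ fun n hn hn' => by
    have := h.g0 hδ0 hδ hn £; exact_mod_cast this
lemma DH.g2 (h : DH N R δ K v s) (hδ0 : 0 ≤ δ) (hδ : δ ≤ 1/100) :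
    ∀ n ≤ N, N ≤ n + 1 * R → (1 - (8:ℕ) * δ) * N ≤ cf n (K * (K * SS s (fun x => v x * v x))) :=
  h.gstep hδ0 hδ (k := 1) (a := 7) ¤ ¤ (h.g1 hδ0 hδ)
lemma DH.g3 (h : DH N R δ K v s) (hδ0 : 0 ≤ δ) (hδ : δ ≤ 1/100) :
    ∀ n ≤ N, N ≤ n + 0 * R → (1 - (9:ℕ) * δ) * N ≤ cf n (K * (K * (K * SS s (fun x => v x * v x)))) :=
  h.gstep hδ0 hδ (k := 0) (a := 8) ¤ ¤ (h.g2 hδ0 hδ)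
lemma SS_mul_le (hs : ∀ x, s x = 1 ∨ s x = -1) (w w' : X → PS) (n : ℕ) {B : ℝ}
    (hw : ∀ i ≤ n, nrm (fun x => cf i (w x)) ≤ B) :
    cf n (SS s (fun x => w x * w' x)) ≤ B * ∑ j ∈ ¿n, nrm (fun x => cf j (w' x)) := by
  rw [cf_SS]
  simp_rw [cf_mul, mul_sum]
  rw [sum_comm, ← sum_range_reflect (fun j => B * nrm (fun x => cf j (w' x)))]
  apply sum_le_sum
  intro i hi
  rw [mem_range] at hi
  rw [show n + 1 - 1 - i = n - i by omega]
  calc ∑ x, s x * (cf i (w x) * cf (n - i) (w' x)) = ∑ x, (s x * cf i (w x)) * cf (n - i) (w' x) :=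
        sum_congr rfl fun x _ => by ring
    _ ≤ _ := cs _ _
    _ ≤ _ := by
      apply mR _ (nrm_nonneg _)
      refine (nrm_mul_le zero_le_one fun x => ?_).trans (by rw [one_mul]; exact hw i £)
      rcases hs x with h | h <;> rw [h] <;> simp
lemma DH.s3 (h : DH N R δ K v s) (hδ0 : 0 ≤ δ) (hδ : δ ≤ 1/100) :
    N - 10 * δ * N ≤ ∑ j ∈ ¿N, nrm (fun x => cf j (K * (K * (K * v x)))) := by
  have h1 := h.g3 hδ0 hδ N le_rfl £
  have h2 : K * (K * (K * SS s (fun x => v x * v x))) = SS s (fun x => v x * (K * (K * (K * v x))))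
  · simp_rw [mul_SS]; congr 1; funext x; ring
  rw [h2] at h1
  have h3 := h1.trans (SS_mul_le h.s1 v _ N (B := 1 + δ) fun i hi => h.nv hδ0 hi)
  have hN0 := nn N
  push_cast at h3
  set S := ∑ j ∈ ¿N, nrm (fun x => cf j (K * (K * (K * v x))))
  by_contra! hcon
  have : (1 + δ) * S < (1 + δ) * (N - 10 * δ * N) := mul_lt_mul_of_pos_left hcon ¢
  nlinarith [mul_nonneg (mul_nonneg hδ0 hδ0) hN0]
lemma DH.MtK (h : DH N R δ K v s) : Mass (tht K) R := by
  refine ⟨fun i => by rw [cf_tht]; exact mul_nonneg (nn0 _) (h.K1.1 i), fun n => ?_⟩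
  calc ∑ i ∈ ¿n, cf i (tht K) ≤ ∑ i ∈ ¿n, R * cf i K := by
        apply sum_le_sum
        intro i _
        rw [cf_tht]
        by_cases hi : i ≤ R
        · exact mR (by exact_mod_cast hi) (h.K1.1 i)
        · rw [h.KR i £]; simp
    _ ≤ R * 1 := by rw [← mul_sum]; exact mL (h.K1.2 n) (nn0 _)
    _ = R := mul_one _
lemma DH.s4 (h : DH N R δ K v s) {η : ℝ} (hη0 : 0 < η) (hη : η ≤ 1/40) (hδ0 : 0 < δ) (hδ : 10^5 * δ ≤ η ^ 4) :
    ∃ j ≤ N, (1 - η) * N ≤ j ∧ 1 - 14 * δ / η ≤ nrm (fun x => cf j (K * (K * (K * v x)))) := by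
  have hη4 : η ^ 4 ≤ η / 40 ^ 3
  · have : η ^ 3 ≤ (1/40) ^ 3 := pow_le_pow_left₀ hη0.le hη 3
    nlinarith
  have hN0 := nn N
  have hN1 := h.N1
  have hL : ⌈(1 - η) * N⌉₊ ≤ N := Nat.ceil_le.2 (by nlinarith)
  have hL2 := Nat.ceil_lt_add_one (a := (1 - η) * ¥N) (mul_nonneg ¢ hN0)
  obtain ⟨j, h1, h2, h3⟩ := pick (a := fun j => nrm (fun x => cf j (K * (K * (K * v x))))) (c := 14 * δ / η) hL hδ0.le
    (fun i hi => h.nKKKv hδ0.le hi) (h.s3 hδ0.le ¢) (by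
      have : (⌈(1 - η) * N⌉₊ : ℝ) ≤ N := by exact_mod_cast hL
      have h6 : (η - δ) * N ≤ N - ⌈(1 - η) * N⌉₊ := ¢
      have h7 : 14 * δ / η * ((η - δ) * N) ≤ 14 * δ / η * (N - ⌈(1 - η) * N⌉₊) := mL h6 §
      have h8 : 14 * δ / η * ((η - δ) * N) = 14 * (δ * N) * (1 - δ / η) := by field_simp
      have h9 : δ / η ≤ 1/1000 := by rw [div_le_iff₀ hη0]; linarith
      nlinarith) §
  exact ⟨j, h2, (Nat.le_ceil _).trans (by exact_mod_cast h1), h3⟩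
lemma nrm_mul_series (w w' : X → PS) (n : ℕ) {B : ℝ} (hw : ∀ i ≤ n, nrm (fun x => cf i (w' x)) ≤ B) :
    nrm (fun x => cf n (w x * w' x)) ≤ (∑ i ∈ ¿n, ‖fun x => cf i (w x)‖) * B := by
  simp_rw [cf_mul]
  refine (nrm_sum_le _ _).trans ?_
  rw [sum_mul]
  apply sum_le_sum
  intro i hi
  refine (nrm_mul_le (norm_nonneg _) fun x => norm_le_pi_norm (fun x => cf i (w x)) x).trans ?_
  exact mL (hw _ £) (norm_nonneg _)
lemma sup_le_nrm (a : X → ℝ) : ‖a‖ ≤ nrm a := (pi_norm_le_iff_of_nonneg (nrm_nonneg _)).2 fun x => abs_le_nrm a x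
lemma DH.s5a (h : DH N R δ K v s) {η : ℝ} (hη0 : 0 < η) (hη : η ≤ 1/40) (hδ0 : 0 < δ) (hδ : 10^5 * δ ≤ η ^ 4) :
    ∃ j ≤ N, (1 - η) * N ≤ j ∧ j - (14 * δ / η + 6 * δ) * N ≤ ∑ i ∈ ¿j, ‖fun x => cf i (K * (K * v x))‖ := by
  obtain ⟨j, hj, hj1, hj2⟩ := h.s4 hη0 hη hδ0 hδ
  refine ⟨j, hj, hj1, ?_⟩
  have hη4 : η ^ 4 ≤ η ^ 2 / 40 ^ 2
  · have : η ^ 2 ≤ (1/40) ^ 2 := pow_le_pow_left₀ hη0.le hη 2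
    nlinarith [sq_nonneg η]
  have hδη : 1000 * δ ≤ η := by nlinarith
  have hj0 := nn j
  have hjN : ¥j ≤ N := by exact_mod_cast hj
  have hN1 := h.N1
  have hRN := h.RN
  set r : X → PS := fun x => tht (K * v x) + v x * v x with hr
  have e1 : ∀ x, ¥j * cf j (K * (K * (K * v x))) = cf j (tht K * (K * (K * v x))) + (cf j (tht K * (K * (K * v x))) + (cf j ((K * K) * r x) + -1 * cf j ((K * (K * v x)) * v x)))
  · intro x
    rw [← cf_tht, tht_mul, tht_mul]
    have : K * (tht K * (K * v x) + K * tht (K * v x)) = tht K * (K * (K * v x)) + ((K * K) * r x + PowerSeries.C (-1) * ((K * (K * v x)) * v x))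
    · rw [hr]; rw [map_neg, map_one]; ring
    rw [this, map_add, map_add, map_add, PowerSeries.coeff_C_mul]
  have e2 : ¥j * nrm (fun x => cf j (K * (K * (K * v x)))) = nrm (fun x => ¥j * cf j (K * (K * (K * v x))))
  · rw [nrm_smul, abs_of_nonneg hj0]
  have b1 : nrm (fun x => cf j (tht K * (K * (K * v x)))) ≤ R * (1 + δ) :=
    conv_nrm h.MtK (fun x => K * (K * v x)) j fun i hi => h.nKKv hδ0.le (hi.trans hj)
  have b2 : nrm (fun x => cf j ((K * K) * r x)) ≤ (1 * 1) * (δ * N) :=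
    conv_nrm (Mass_mul h.K1 h.K1) r j fun i hi => nrm_le § (h.hr i (hi.trans hj))
  have b3 := nrm_mul_series (fun x => K * (K * v x)) v j (B := 1 + δ) fun i hi => h.nv hδ0.le (hi.trans hj)
  set S := ∑ i ∈ ¿j, ‖fun x => cf i (K * (K * v x))‖
  have b4 : ¥j * nrm (fun x => cf j (K * (K * (K * v x)))) ≤ R * (1 + δ) + (R * (1 + δ) + ((1 * 1) * (δ * N) + S * (1 + δ)))
  · rw [e2]; simp_rw [e1]
    refine (nrm_add_le _ _).trans (add_le_add b1 ((nrm_add_le _ _).trans (add_le_add b1 ((nrm_add_le _ _).trans (add_le_add b2 ?_)))))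
    rw [nrm_smul]; simpa using b3
  have b5 : ¥j * (1 - 14 * δ / η) ≤ j * nrm (fun x => cf j (K * (K * (K * v x)))) := mL hj2 hj0
  set c1 := 14 * δ / η with hc1
  have hc10 : 0 ≤ c1 := §
  clear_value c1
  clear_value S
  clear hj2 e1 e2 b1 b2 b3 hr h hη4 hδ
  by_contra! hcon
  have : S * (1 + δ) < (j - (c1 + 6 * δ) * N) * (1 + δ) := mul_lt_mul_of_pos_right hcon ¢
  have h1 : ¥j * c1 ≤ N * c1 := mR hjN hc10
  have h3 : 0 ≤ (c1 + 6 * δ) * N * δ := §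
  have h4 : ¥j * δ ≤ N * δ := mR hjN hδ0.le
  nlinarith
lemma DH.s5 (h : DH N R δ K v s) {η : ℝ} (hη0 : 0 < η) (hη : η ≤ 1/40) (hδ0 : 0 < δ) (hδ : 10^5 * δ ≤ η ^ 4) :
    ∃ i ≤ N, (1 - 2 * η) * N ≤ i ∧ ∃ x, 1 - 20 * δ / η ^ 2 ≤ |cf i (K * (K * v x))| := by
  obtain ⟨j, hj, hj1, b6⟩ := h.s5a hη0 hη hδ0 hδ
  have hη4 : η ^ 4 ≤ η ^ 2 / 40 ^ 2
  · have : η ^ 2 ≤ (1/40) ^ 2 := pow_le_pow_left₀ hη0.le hη 2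
    nlinarith [sq_nonneg η]
  have hδη : 1000 * δ ≤ η := by nlinarith
  have hN0 := nn N
  have hjN : ¥j ≤ N := by exact_mod_cast hj
  have hN1 := h.N1
  set c1 := 14 * δ / η with hc1
  have hc10 : 0 ≤ c1 := §
  have hc11 : c1 * η = 14 * δ := by rw [hc1]; field_simp
  clear_value c1
  have hL2 := Nat.ceil_lt_add_one (a := (1 - 2 * η) * ¥N) (mul_nonneg ¢ hN0)
  have hL : ⌈(1 - 2 * η) * N⌉₊ ≤ j := Nat.ceil_le.2 (by nlinarith)
  set c2 := 20 * δ / η ^ 2 with hc2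
  have hc20 : 0 < c2 := §
  have hc21 : c2 * η = 20 * δ / η := by rw [hc2]; field_simp
  have hc22 : c2 * η = 20 / 14 * c1 := by rw [hc21, div_eq_iff hη0.ne']; linarith
  have hc23 : c2 * η ^ 2 = 20 * δ := by rw [hc2]; field_simp
  clear_value c2
  obtain ⟨i, h1, h2, h3⟩ := pick (a := fun i => ‖fun x => cf i (K * (K * v x))‖) (c := c2) hL hδ0.le
    (fun i hi => (sup_le_nrm _).trans (h.nKKv hδ0.le (hi.trans hj))) b6 (by
      have h5 : (c1 + 8 * δ) * N ≥ (c1 + 6 * δ) * N + 1 + δ * ⌈(1 - 2 * η) * N⌉₊ := by nlinarith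
      have h6 : (η - δ) * N ≤ j - ⌈(1 - 2 * η) * N⌉₊ := ¢
      have h7 : c2 * ((η - δ) * N) ≤ c2 * (j - ⌈(1 - 2 * η) * N⌉₊) := mL h6 hc20.le
      have h8 : c2 * δ ≤ c2 * (η / 1000) := mL ¢ hc20.le
      have h9 : c1 * η ≤ c1 * (1/40) := mL hη hc10
      nlinarith) hc20.le
  refine ⟨i, h2.trans hj, (Nat.le_ceil _).trans (by exact_mod_cast h1), ?_⟩
  by_contra! hcon
  have h4 : c2 < 1
  · have : ¥0 < η ^ 2 := §
    by_contra! h5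
    nlinarith
  exact absurd h3 (not_le.2 ((pi_norm_lt_iff ¢).2 fun x => hcon x))
end dich
end LN
end

section
open scoped Classical
open Finset Real
namespace LN
section dich
local notation "PS" => PowerSeries ℝ
local notation "cf" => PowerSeries.coeff (R := ℝ)
noncomputable def sgn (t : ℝ) : ℝ := if t < 0 then -1 else 1
lemma sgn_cases (t : ℝ) : (sgn t = 1 ∧ 0 ≤ t) ∨ (sgn t = -1 ∧ t < 0) := by
  unfold sgn; split_ifs with h
  · right; exact ⟨rfl, h⟩
  · left; exact ⟨rfl, not_lt.1 h⟩
lemma sgn_mul_self (t : ℝ) : sgn t * t = |t| := by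
  rcases sgn_cases t with ⟨h, h'⟩ | ⟨h, h'⟩ <;> rw [h]
  · rw [abs_of_nonneg h', one_mul]
  · rw [abs_of_neg h']; ring
noncomputable def Bad (ρ σ : ℕ → ℝ) (i0 : ℕ) : Finset (Σ _ : ℕ, ℕ) :=
  (range (i0+1)).sigma fun n => (¿n).filter fun i => sgn (σ n) ≠ sgn (ρ i) * sgn (ρ (n - i))
lemma bad_card {ρ σ : ℕ → ℝ} {i0 N : ℕ} {δ c : ℝ} (hi0 : i0 ≤ N) (hδ0 : 0 < δ) (hδ1 : δ ≤ 1/100) (hN : 1 ≤ δ * N)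
    (hρ : ∀ i ≤ N, |ρ i| ≤ 1 + δ) (hσ : ∀ i ≤ N, |σ i| ≤ 1 + δ)
    (hr : ∀ n ≤ N, |∑ i ∈ ¿n, ρ i * ρ (n - i) - n * σ n| ≤ δ * N)
    (hs : ∑ i ∈ range (i0+1), (1 + δ - |σ i|) ≤ c * N) : ((Bad ρ σ i0).card : ℝ) ≤ (c + 8 * δ) * N ^ 2 := by
  have hN0 := nn N
  have hi0r : ¥i0 ≤ N := by exact_mod_cast hi0
  rw [Bad, card_sigma, Nat.cast_sum]
  have key : ∀ n ∈ range (i0+1), (((¿n).filter fun i => sgn (σ n) ≠ sgn (ρ i) * sgn (ρ (n - i))).card : ℝ)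
      ≤ N * (1 + δ - |σ n|) + 6 * δ * N := by
    intro n hn
    rw [mem_range] at hn
    have hnN : n ≤ N := £
    have hnr : ¥n ≤ N := by exact_mod_cast hnN
    have h1 : (((¿n).filter fun i => sgn (σ n) ≠ sgn (ρ i) * sgn (ρ (n - i))).card : ℝ)
        ≤ ∑ i ∈ ¿n, ((1 + δ) ^ 2 - sgn (σ n) * (ρ i * ρ (n - i))) := by
      rw [card_filter, Nat.cast_sum]
      apply sum_le_sum
      intro i hi
      rw [mem_range] at hi
      split_ifs with hb
      · have : sgn (σ n) * (ρ i * ρ (n - i)) ≤ 0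
        · rcases sgn_cases (σ n) with ⟨h, _⟩ | ⟨h, _⟩ <;> rcases sgn_cases (ρ i) with ⟨h2, h2'⟩ | ⟨h2, h2'⟩ <;>
          rcases sgn_cases (ρ (n - i)) with ⟨h3, h3'⟩ | ⟨h3, h3'⟩ <;> rw [h] <;> rw [h, h2, h3] at hb <;> first | (exfalso; apply hb; norm_num; done) | nlinarith
        push_cast; nlinarith
      · push_cast
        have a3 : |sgn (σ n) * (ρ i * ρ (n - i))| ≤ (1 + δ) ^ 2
        · rw [abs_mul, abs_mul, sq]
          have : |sgn (σ n)| = 1 := by rcases sgn_cases (σ n) with ⟨h, _⟩ | ⟨h, _⟩ <;> rw [h] <;> simp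
          rw [this, one_mul]
          exact mul_le_mul (hρ i £) (hρ _ £) (abs_nonneg _) ¢
        linarith [le_abs_self (sgn (σ n) * (ρ i * ρ (n - i)))]
    refine h1.trans ?_
    rw [sum_sub, sum_const, card_range, nsmul_eq_mul, ← mul_sum]
    have h2 := abs_le.1 (hr n hnN)
    have h3 : n * |σ n| - δ * N ≤ sgn (σ n) * ∑ i ∈ ¿n, ρ i * ρ (n - i)
    · have := sgn_mul_self (σ n)
      rcases sgn_cases (σ n) with ⟨h, _⟩ | ⟨h, _⟩ <;> rw [h] at this ⊢ <;> nlinarith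
    have h4 := hσ n hnN
    push_cast
    have h5 : n * (1 + δ - |σ n|) ≤ N * (1 + δ - |σ n|) := mR hnr ¢
    have h6 : δ * n ≤ δ * N := mL hnr hδ0.le
    have h7 : δ * (δ * n) ≤ (1/100) * (δ * N) := mul_le_mul hδ1 h6 § ¤
    nlinarith
  refine (sum_le_sum key).trans ?_
  rw [sum_add, ← mul_sum, sum_const, card_range, nsmul_eq_mul]
  have := mL hs hN0
  push_cast
  have h8 : (¥i0 + 1) * (6 * δ * N) ≤ (N + δ * N) * (6 * δ * N) := mR ¢ §
  have h9 : δ * N * (6 * δ * N) ≤ (1/100) * N * (6 * δ * N)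
  · apply mR _ §
    exact mR hδ1 hN0
  nlinarith [mul_nonneg hδ0.le (sq_nonneg ¥N)]
lemma not_bad {ρ σ : ℕ → ℝ} {i0 n i : ℕ} (hn : n ≤ i0) (hi : i ≤ n) (h : (⟨n, i⟩ : Σ _ : ℕ, ℕ) ∉ Bad ρ σ i0) :
    sgn (σ n) = sgn (ρ i) * sgn (ρ (n - i)) := by
  by_contra hcon
  apply h
  simp only [Bad, mem_sigma, mem_filter, mem_range]
  exact ⟨£, £, hcon⟩
lemma five_card {B : Finset (Σ _ : ℕ, ℕ)} {T : Finset (ℕ × ℕ × ℕ)} {H : ℕ} (f : Fin 5 → ℕ × ℕ × ℕ → (Σ _ : ℕ, ℕ)) (u : Fin 5 → ℕ × ℕ × ℕ → ℕ)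
    (hu : ∀ k, ∀ t ∈ T, u k t < H)
    (hinj : ∀ k, Set.InjOn (fun t => (f k t, u k t)) T) (hf : ∀ t ∈ T, ∃ k, f k t ∈ B) : T.card ≤ 5 * (B.card * H) := by
  have h1 : T ⊆ (univ : Finset (Fin 5)).biUnion fun k => T.filter fun t => f k t ∈ B
  · intro t ht
    obtain ⟨k, hk⟩ := hf t ht
    rw [mem_biUnion]
    exact ⟨k, mem_univ _, by rw [mem_filter]; exact ⟨ht, hk⟩⟩
  refine (card_le_card h1).trans (card_biUnion_le.trans ?_)
  have : ∀ k ∈ (univ : Finset (Fin 5)), (T.filter fun t => f k t ∈ B).card ≤ B.card * H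
  · intro k _
    rw [show B.card * H = (B ×ˢ range H).card by rw [card_product, card_range]]
    apply card_le_card_of_injOn (fun t => (f k t, u k t))
    · intro t ht
      have ht := mem_filter.1 ht
      exact mem_coe.2 (mem_product.2 ⟨ht.2, mem_range.2 (hu k t ht.1)⟩)
    · exact (hinj k).mono fun t ht => (mem_filter.1 ht).1
  refine (sum_le_card_nsmul _ _ _ this).trans ?_
  simp
lemma neg_card {ρ σ : ℕ → ℝ} {i0 H M : ℕ} {Bm : Finset ℕ} (hM : 2 * M ≤ i0) (hMH : M + 2 * H ≤ i0)
    (hB : ∀ m ∈ Bm, H ≤ m ∧ m ≤ M ∧ σ (2 * m) < 0) : Bm.card * H ≤ 5 * (Bad ρ σ i0).card := by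
  rcases Nat.eq_zero_or_pos H with h0 | hpos
  · simp [h0]
  have := five_card (B := Bad ρ σ i0) (T := Bm ×ˢ (range H ×ˢ range H)) (H := H)
    (fun k t => ![⟨t.1 + t.2.2, t.1 - t.2.1⟩, ⟨t.1 + t.2.2, t.1⟩, ⟨t.1 + t.2.2 + t.2.1, t.1⟩, ⟨t.1 + t.2.2 + t.2.1, t.2.2⟩, ⟨2 * t.1, t.1 - t.2.1⟩] k)
    (fun k t => ![t.2.1, t.2.1, t.2.1, t.2.1, t.2.2] k) ?_ ?_ ?_
  · rw [card_product, card_product, card_range] at this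
    have h2 : (Bm.card * H) * H ≤ (5 * (Bad ρ σ i0).card) * H
    · calc _ = Bm.card * (H * H) := by ring
        _ ≤ _ := this
        _ = _ := by ring
    exact Nat.le_of_mul_le_mul_right h2 hpos
  · rintro k ⟨m, c, t⟩ ht
    simp only [mem_product, mem_range] at ht
    fin_cases k <;> simp <;> omega
  · rintro k ⟨m, c, t⟩ ht ⟨m', c', t'⟩ ht' heq
    simp only [coe_product, Set.mem_prod, mem_coe, mem_range] at ht ht'
    have a := hB m ht.1
    have a' := hB m' ht'.1
    fin_cases k <;> simp at heq <;> simp <;> omega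
  · rintro ⟨m, c, t⟩ ht
    simp only [mem_product, mem_range] at ht
    obtain ⟨a1, a2, a3⟩ := hB m ht.1
    by_contra! hcon
    have b0 := not_bad (n := m+t) (i := m-c) £ £ (hcon 0)
    have b1 := not_bad (n := m+t) (i := m) £ £ (hcon 1)
    have b2 := not_bad (n := m+t+c) (i := m) £ £ (hcon 2)
    have b3 := not_bad (n := m+t+c) (i := t) £ £ (hcon 3)
    have b4 := not_bad (n := 2*m) (i := m-c) £ £ (hcon 4)
    rw [show m + t - (m - c) = t + c by omega] at b0
    rw [show m + t - m = t by omega, b0] at b1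
    rw [show m + t + c - m = t + c by omega] at b2
    rw [show m + t + c - t = m + c by omega, b2] at b3
    rw [show 2 * m - (m - c) = m + c by omega] at b4
    have e : sgn (σ (2 * m)) = -1 := by unfold sgn; rw [if_pos a3]
    rw [e] at b4
    rcases sgn_cases (ρ m) with ⟨h1, _⟩ | ⟨h1, _⟩ <;> rcases sgn_cases (ρ t) with ⟨h2, _⟩ | ⟨h2, _⟩ <;>
    rcases sgn_cases (ρ (t + c)) with ⟨h3, _⟩ | ⟨h3, _⟩ <;> rcases sgn_cases (ρ (m + c)) with ⟨h4, _⟩ | ⟨h4, _⟩ <;>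
    rcases sgn_cases (ρ (m - c)) with ⟨h5, _⟩ | ⟨h5, _⟩ <;> simp only [h1, h2, h3, h4, h5] at b1 b3 b4 <;> (try norm_num at b1) <;> (try norm_num at b3) <;> (try norm_num at b4)
lemma seq_arith {δ η c4 b N : ℝ} (hη0 : 0 < η) (hη : η ≤ 1/40) (hδ0 : 0 < δ) (hδ : 10^5 * δ ≤ η ^ 4) (hN : 1 ≤ δ * N)
    (hc40 : 0 < c4) (hc42 : c4 * η ^ 2 = 21 * δ) (hN0 : 0 ≤ N) (k4 : b * (η / 2) ≤ 5 * ((c4 + 8 * δ) * N)) :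
    c4 * N + (N + 1) * (4 * δ) + 2 * b * 3 ≤ η * N := by
  have hη2 : η ^ 2 ≤ (1/40) ^ 2 := pow_le_pow_left₀ hη0.le hη 2
  have hη2p : 0 < η ^ 2 := §
  have hδη2 : 1000 * δ ≤ η ^ 2 / 100 := by nlinarith
  have hηη : η ^ 2 ≤ η / 40 := by nlinarith
  have c4b : c4 ≤ η ^ 2 / 1000
  · have : c4 * η ^ 2 ≤ η ^ 2 / 1000 * η ^ 2 := by rw [hc42]; linarith [(by ring : η ^ 2 / 1000 * η ^ 2 = η ^ 4 / 1000)]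
    exact le_of_mul_le_mul_right this hη2p
  have k6 : b ≤ (11/1000) * η * N
  · have h1 : (c4 + 8 * δ) * N ≤ (η ^ 2 * (11/10000)) * N := mR ¢ hN0
    have h2 : b * (η / 2) ≤ (11/1000) * η * N * (η / 2) := by linarith [(by ring : (11/1000) * η * N * (η / 2) = 5 * (η ^ 2 * (11/10000) * N))]
    exact le_of_mul_le_mul_right h2 ¢
  have k7 : c4 * N ≤ η / 1000 * N := mR ¢ hN0
  have k9 : δ * N ≤ η / 4000 * N := mR ¢ hN0
  nlinarith
lemma seq_concl {ρ σ : ℕ → ℝ} {i0 N : ℕ} {δ η : ℝ} (hη0 : 0 < η) (hη : η ≤ 1/40) (hδ0 : 0 < δ) (hδ : 10^5 * δ ≤ η ^ 4) (hi0 : i0 ≤ N)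
    (hi1 : (1 - 2 * η) * N ≤ i0) (hN : 1 ≤ δ * N)
    (hρ : ∀ i ≤ N, |ρ i| ≤ 1 + δ) (hσ : ∀ i ≤ N, |σ i| ≤ 1 + δ)
    (hr : ∀ n ≤ N, |∑ i ∈ ¿n, ρ i * ρ (n - i) - n * σ n| ≤ δ * N)
    (hs : ∑ i ∈ range (i0+1), (1 + δ - |σ i|) ≤ 21 * δ / η ^ 2 * N)
    (hd : ∀ n, n + 1 ≤ N → |σ (n+1) - σ n| ≤ δ * (1 + δ)) :
    ∑ n ∈ (¿N).filter (fun n : ℕ => 4 * η * N ≤ ¥n ∧ 10 * n ≤ 8 * N), (1 + δ - σ n) ≤ η * N := by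
  have hη3 : η ^ 3 ≤ (1/40) ^ 3 := pow_le_pow_left₀ hη0.le hη 3
  have hη2 : η ^ 2 ≤ (1/40) ^ 2 := pow_le_pow_left₀ hη0.le hη 2
  have hη3p : 0 < η ^ 3 := §
  have hδη : 10^9 * δ ≤ η := by nlinarith
  have hN0 := nn N
  have hNp : ¥0 < N := by nlinarith
  have hbad := bad_card (c := 21 * δ / η ^ 2) hi0 hδ0 ¢ hN hρ hσ hr hs
  set c4 := 21 * δ / η ^ 2 with hc4
  have hc40 : 0 < c4 := §
  have hc42 : c4 * η ^ 2 = 21 * δ := by rw [hc4]; field_simp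
  clear_value c4
  set H := ⌊η * N⌋₊ with hH
  have hH1 : ¥H ≤ η * N := Nat.floor_le §
  have hH2 : η * N < H + 1 := Nat.lt_floor_add_one _
  clear_value H
  set M := 2 * N / 5 with hM
  set Bm := (¿N).filter fun m => H ≤ m ∧ m ≤ M ∧ σ (2 * m) < 0 with hBm
  have hMr : ¥M ≤ 2 * N / 5 := by rw [le_div_iff₀ ¤]; exact_mod_cast (by omega : M * 5 ≤ 2 * N)
  have hcard := neg_card (ρ := ρ) (σ := σ) (i0 := i0) (H := H) (M := M) (Bm := Bm)
    (by have : ((2 * M : ℕ):ℝ) ≤ i0 := by push_cast; nlinarith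
        exact_mod_cast this)
    (by have : ((M + 2 * H : ℕ):ℝ) ≤ i0 := by push_cast; nlinarith
        exact_mod_cast this)
    (fun m hm => (mem_filter.1 hm).2)
  have hcard' : (Bm.card : ℝ) * H ≤ 5 * ((c4 + 8 * δ) * N ^ 2)
  · have : ((Bm.card * H : ℕ) : ℝ) ≤ ((5 * (Bad ρ σ i0).card : ℕ) : ℝ) := by exact_mod_cast hcard
    push_cast at this; linarith
  set F := (¿N).filter fun n : ℕ => 4 * η * N ≤ ¥n ∧ 10 * n ≤ 8 * N with hF
  set Ng := F.filter fun n => σ n < -(2 * δ) with hNg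
  have hNgc : Ng.card ≤ 2 * Bm.card
  · have : Ng ⊆ Bm.biUnion fun m => {2 * m, 2 * m + 1}
    · intro n hn
      rw [hNg, mem_filter, hF, mem_filter, mem_range] at hn
      obtain ⟨⟨h1, h2, h3⟩, h4⟩ := hn
      rw [mem_biUnion]
      refine ⟨n / 2, ?_, by simp; omega⟩
      have hcase : 2 * (n / 2) = n ∨ 2 * (n / 2) + 1 = n := £
      rw [hBm, mem_filter, mem_range]
      refine ⟨£, ?_, £, ?_⟩
      · have h5 : ¥n ≤ 2 * ((n / 2 : ℕ) : ℝ) + 1 := by exact_mod_cast (by omega : n ≤ 2 * (n/2) + 1)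
        have : ¥H ≤ ((n / 2 : ℕ) : ℝ) := by nlinarith
        exact_mod_cast this
      · rcases hcase with h | h
        · rw [h]; linarith
        · have := abs_le.1 (hd (2 * (n/2)) £)
          rw [h] at this
          nlinarith
    refine (card_le_card this).trans (card_biUnion_le.trans ?_)
    refine (sum_le_card_nsmul _ _ 2 fun m _ => card_le_two).trans ?_
    simp [mul_comm]
  have hsum : ∑ n ∈ F, (1 + δ - σ n) ≤ ∑ n ∈ F, ((1 + δ - |σ n|) + 4 * δ + if σ n < -(2 * δ) then 3 else 0)
  · apply sum_le_sum
    intro n hn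
    rw [hF, mem_filter, mem_range] at hn
    have := abs_le.1 (hσ n £)
    split_ifs with h
    · rw [abs_of_neg ¢]; linarith
    · rcases le_or_gt 0 (σ n) with h5 | h5
      · rw [abs_of_nonneg h5]; linarith
      · rw [abs_of_neg h5]; linarith
  refine hsum.trans ?_
  rw [sum_add, sum_add, ← sum_filter, sum_const, sum_const, nsmul_eq_mul, nsmul_eq_mul]
  have hFs : F ⊆ range (i0+1)
  · intro n hn
    rw [hF, mem_filter, mem_range] at hn
    rw [mem_range]
    have h3 : 10 * ¥n ≤ 8 * N := by exact_mod_cast hn.2.2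
    have : ¥n ≤ i0 := by nlinarith
    have : n ≤ i0 := by exact_mod_cast this
    omega
  have k1 : ∑ n ∈ F, (1 + δ - |σ n|) ≤ c4 * N
  · refine le_trans (sub_sum hFs fun i hi _ => ?_) hs
    rw [mem_range] at hi
    have := hσ i £; linarith
  have k2 : (F.card : ℝ) ≤ N + 1
  · have := card_filter_le (¿N) fun n : ℕ => 4 * η * N ≤ ¥n ∧ 10 * n ≤ 8 * N
    rw [card_range] at this
    exact_mod_cast this
  have k3 : (Ng.card : ℝ) ≤ 2 * Bm.card := by exact_mod_cast hNgc
  have k4 : (Bm.card : ℝ) * (η / 2) ≤ 5 * ((c4 + 8 * δ) * N)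
  · have h1 : η / 2 * N ≤ H := by linarith [mR hδη hN0]
    have h2 : (Bm.card:ℝ) * (η / 2 * N) ≤ 5 * ((c4 + 8 * δ) * N ^ 2) := (mL h1 (nn0 _)).trans hcard'
    have h3 : (Bm.card:ℝ) * (η / 2) * N ≤ 5 * ((c4 + 8 * δ) * N) * N := by linarith [(by ring : (Bm.card:ℝ) * (η / 2) * N = (Bm.card:ℝ) * (η / 2 * N)), (by ring : 5 * ((c4 + 8 * δ) * N) * N = 5 * ((c4 + 8 * δ) * N ^ 2))]
    exact le_of_mul_le_mul_right h3 hNp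
  have k5 : (F.card:ℝ) * (4 * δ) ≤ (N + 1) * (4 * δ) := mR k2 §
  have := seq_arith hη0 hη hδ0 hδ hN hc40 hc42 hN0 k4
  linarith
end dich
end LN
end

section
open scoped Classical
open Finset Real
namespace LN
section dich
local notation "PS" => PowerSeries ℝ
local notation "cf" => PowerSeries.coeff (R := ℝ)
variable {X : Type*} [Fintype X]
variable {N R : ℕ} {δ : ℝ} {K : PowerSeries ℝ} {v : X → PowerSeries ℝ} {s : X → ℝ}
lemma s6_arith {δ η c2 i0 N S R : ℝ} (hδ0 : 0 < δ) (hδ : δ ≤ 1/1000) (hη0 : 0 < η) (hη : η ≤ 1/40) (hN : 1 ≤ δ * N)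
    (hc0 : 0 < c2) (hc2 : c2 * η ^ 2 = 20 * δ) (hi : i0 ≤ N) (hi0 : 0 ≤ i0) (hR : R + 1 ≤ δ * N) (hR0 : 0 ≤ R)
    (h : i0 * (1 - c2) ≤ R * (1 + δ) + (1 * (δ * N) + (1 + δ) * S)) :
    (i0 + 1) * (1 + δ) - S ≤ 21 * δ / η ^ 2 * N := by
  have hη2 : η ^ 2 ≤ (1/40) ^ 2 := pow_le_pow_left₀ hη0.le hη 2
  have hη2p : 0 < η ^ 2 := §
  have hNp : 0 < N := by by_contra! hc; nlinarith
  have h1 : 21 * δ / η ^ 2 = 21 / 20 * c2 := by rw [div_eq_iff hη2p.ne']; linarith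
  rw [h1]
  have h2 : 1000 * δ ≤ c2
  · have : 20 * δ ≤ c2 * (1/40)^2 := by rw [← hc2]; exact mL hη2 hc0.le
    linarith
  have h3 : 1000 * (δ * N) ≤ c2 * N := by have := mR h2 hNp.le; linarith
  have h4 : i0 * c2 ≤ N * c2 := mR hi hc0.le
  have h5 : i0 * δ ≤ N * δ := mR hi hδ0.le
  have h6 : R * δ ≤ 1 * (δ * N) := by nlinarith
  by_contra! hcon
  have h7 : S * (1 + δ) < ((i0 + 1) * (1 + δ) - 21 / 20 * c2 * N) * (1 + δ) := mul_lt_mul_of_pos_right ¢ ¢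
  have h8 : 0 ≤ c2 * N * δ := §
  have h9 : i0 * δ * δ ≤ N * δ * 1 := mul_le_mul h5 ¢ hδ0.le §
  nlinarith
lemma DH.hd (h : DH N R δ K v s) (hδ0 : 0 < δ) (x : X) (n : ℕ) (hn : n + 1 ≤ N) :
    |(-cf (n+1) (K * v x)) - -cf n (K * v x)| ≤ δ * (1 + δ) := by
  have hv : ∀ i ≤ N, |cf i (v x)| ≤ 1 + δ := fun i hi => (abs_le_nrm (fun x => cf i (v x)) x).trans (h.nv hδ0.le hi)
  have e : cf (n+1) (K * v x) - cf n (K * v x) = ∑ i ∈ ¿n, (cf (i+1) K - cf i K) * cf (n - i) (v x) + cf 0 K * cf (n+1) (v x)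
  · rw [cf_mul, cf_mul, sum_range_succ']
    simp only [Nat.add_sub_add_right, sub_mul, sum_sub, Nat.sub_zero]
    ring
  rw [neg_sub_neg, abs_sub_comm, e]
  refine (abs_add_le _ _).trans ?_
  have h1 : |∑ i ∈ ¿n, (cf (i+1) K - cf i K) * cf (n - i) (v x)| ≤ ∑ i ∈ ¿n, |cf (i+1) K - cf i K| * (1 + δ)
  · refine (abs_sum _ _).trans (sum_le_sum fun i _ => ?_)
    rw [abs_mul]
    exact mL (hv _ £) (abs_nonneg _)
  have h2 : |cf 0 K * cf (n+1) (v x)| ≤ cf 0 K * (1 + δ)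
  · rw [abs_mul, abs_of_nonneg (h.K1.1 0)]
    exact mL (hv _ hn) (h.K1.1 0)
  rw [← sum_mul] at h1
  have := mR (h.Kd (n+1)) (by linarith : 0 ≤ 1 + δ)
  linarith
lemma DH.s9 (h : DH N R δ K v s) {η : ℝ} (hη0 : 0 < η) (hη : η ≤ 1/40) (hδ0 : 0 < δ) (hδ : 10^5 * δ ≤ η ^ 4) :
    ∃ x, ∑ n ∈ (¿N).filter (fun n : ℕ => 4 * η * N ≤ ¥n ∧ 10 * n ≤ 8 * N), (1 + δ + cf n (K * v x)) ≤ η * N := by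
  obtain ⟨i0, hi0, hi1, x, hx⟩ := h.s5 hη0 hη hδ0 hδ
  have hδ1 : δ ≤ 1/1000
  · have : η ^ 4 ≤ 1 := pow_le_one₀ hη0.le ¢
    linarith
  refine ⟨x, ?_⟩
  have hv : ∀ i ≤ N, |cf i (v x)| ≤ 1 + δ := fun i hi => (abs_le_nrm (fun x => cf i (v x)) x).trans (h.nv hδ0.le hi)
  have hKv : ∀ i ≤ N, |cf i (K * v x)| ≤ 1 + δ := fun i hi => (abs_le_nrm (fun x => cf i (K * v x)) x).trans (h.nKv hδ0.le hi)
  set r : PS := tht (K * v x) + v x * v x with hr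
  have hrb : ∀ n ≤ N, |cf n r| ≤ δ * N := fun n hn =>
    (abs_le_nrm (fun x => cf n (tht (K * v x) + v x * v x)) x).trans (nrm_le § (h.hr n hn))
  have hi0r : ¥i0 ≤ N := by exact_mod_cast hi0
  have e1 : ¥i0 * cf i0 (K * (K * v x)) = cf i0 (tht K * (K * v x)) + (cf i0 (K * r) - cf i0 ((K * v x) * v x))
  · rw [← cf_tht, tht_mul, map_add, ← map_sub]
    congr 2; rw [hr]; ring
  have b3 : |cf i0 ((K * v x) * v x)| ≤ (1 + δ) * ∑ i ∈ range (i0+1), |cf i (K * v x)|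
  · rw [cf_mul, mul_sum]
    refine (abs_sum _ _).trans (sum_le_sum fun i _ => ?_)
    rw [abs_mul, mul_comm]
    exact mR (hv _ £) (abs_nonneg _)
  have b0 : ¥i0 * (1 - 20 * δ / η ^ 2) ≤ R * (1 + δ) + (1 * (δ * N) + (1 + δ) * ∑ i ∈ range (i0+1), |cf i (K * v x)|)
  · calc ¥i0 * (1 - 20 * δ / η ^ 2) ≤ i0 * |cf i0 (K * (K * v x))| := mL hx (nn0 _)
      _ = |i0 * cf i0 (K * (K * v x))| := by rw [abs_mul, abs_of_nonneg (nn0 i0 : ¥0 ≤ i0)]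
      _ ≤ _ := by
        rw [e1]
        refine (abs_add_le _ _).trans (add_le_add ?_ ((abs_sub _ _).trans (add_le_add ?_ b3)))
        · exact conv_abs h.MtK _ _ fun i hi => hKv i (hi.trans hi0)
        · exact conv_abs h.K1 _ _ fun i hi => hrb i (hi.trans hi0)
  have b6 := s6_arith hδ0 hδ1 hη0 hη h.N1 § (by field_simp) hi0r (nn0 _) h.RN (nn0 _) b0
  have := seq_concl (ρ := fun i => -cf i (v x)) (σ := fun i => -cf i (K * v x)) hη0 hη hδ0 hδ hi0 hi1 h.N1
    (fun i hi => by rw [abs_neg]; exact hv i hi) (fun i hi => by rw [abs_neg]; exact hKv i hi)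
    (fun n hn => by
      have := hrb n hn
      rw [hr, map_add, cf_tht, cf_mul n (v x)] at this
      simp only [neg_mul_neg]
      convert this using 2; ring)
    (by
      simp only [abs_neg]
      rw [sum_sub, sum_const, card_range, nsmul_eq_mul]; push_cast; exact b6)
    (fun n hn => h.hd hδ0 x n hn)
  simpa only [sub_neg_eq_add] using this
lemma sgn_sum_le (hs : ∀ x, s x = 1 ∨ s x = -1) (a b : X → ℝ) {U : ℝ} (ha : ∑ x, a x ^ 2 ≤ U) (hb : ∑ x, b x ^ 2 ≤ U) {x0 : X} (h0 : s x0 = -1) :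
    ∑ x, s x * (a x * b x) ≤ U - (2 * (-a x0 + -b x0) - 2) := by
  have h1 : ∀ x ∈ (univ : Finset X).erase x0, s x * (a x * b x) ≤ (a x ^ 2 + b x ^ 2) / 2
  · intro x _
    rcases hs x with h | h <;> rw [h] <;> nlinarith [sq_nonneg (a x + b x), sq_nonneg (a x - b x)]
  have h2 := sum_le_sum h1
  rw [← add_sum_erase univ _ (mem_univ x0), h0]
  have h3 : ∑ x, (a x ^ 2 + b x ^ 2) / 2 ≤ U
  · rw [← sum_div, sum_add]; linarith
  rw [← add_sum_erase univ _ (mem_univ x0)] at h3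
  nlinarith [sq_nonneg (a x0 + b x0 + 2)]
lemma DH.s10 (h : DH N R δ K v s) (hδ0 : 0 < δ) (hδ : δ ≤ 1/1000) {x : X} (hx : s x = -1)
    (hsum : ∑ n ∈ (¿N).filter (fun n : ℕ => N ≤ 5 * n ∧ 5 * n ≤ 4 * N), (1 + δ + cf n (K * v x)) ≤ N / 10) : False := by
  have hN0 := nn N
  have hN1 := h.N1
  have h1 := h.g2 hδ0.le ¢ N le_rfl £
  have h2 : K * (K * SS s (fun x => v x * v x)) = SS s (fun x => (K * v x) * (K * v x))
  · simp_rw [mul_SS]; congr 1; funext x; ring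
  rw [h2, cf_SS] at h1
  simp_rw [cf_mul N (K * v _), mul_sum] at h1
  rw [sum_comm] at h1
  set σ : ℕ → ℝ := fun n => cf n (K * v x) with hσ
  have hKv : ∀ i ≤ N, ∑ y, cf i (K * v y) ^ 2 ≤ (1 + δ) ^ 2 := fun i hi => by
    rw [← nrm_sq (fun y => cf i (K * v y))]; exact pow_le_pow_left₀ (nrm_nonneg _) (h.nKv hδ0.le hi) 2
  set mid := (¿N).filter (fun n : ℕ => N ≤ 5 * n ∧ 5 * n ≤ 4 * N) with hmid
  have h3 : ∀ i ∈ ¿N, ∑ y, s y * (cf i (K * v y) * cf (N - i) (K * v y)) ≤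
      (1 + δ) ^ 2 - if i ∈ mid then (2 * (-σ i + -σ (N - i)) - 2) else 0 := by
    intro i hi
    rw [mem_range] at hi
    split_ifs with hm
    · exact sgn_sum_le h.s1 _ _ (hKv i £) (hKv (N - i) £) hx
    · rw [sub_zero]
      have : ∀ y ∈ univ, s y * (cf i (K * v y) * cf (N - i) (K * v y)) ≤ (cf i (K * v y) ^ 2 + cf (N - i) (K * v y) ^ 2) / 2
      · intro y _
        rcases h.s1 y with hh | hh <;> rw [hh] <;> nlinarith [sq_nonneg (cf i (K * v y) + cf (N - i) (K * v y)), sq_nonneg (cf i (K * v y) - cf (N - i) (K * v y))]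
      refine (sum_le_sum this).trans ?_
      rw [← sum_div, sum_add]
      have a1 := hKv i £
      have a2 := hKv (N - i) £
      linarith
  have h4 := h1.trans (sum_le_sum h3)
  rw [sum_sub, sum_const, card_range, nsmul_eq_mul, ← sum_filter] at h4
  have hmm : (¿N).filter (fun i => i ∈ mid) = mid
  · ext i; simp only [mem_filter, hmid]; tauto
  rw [hmm, sum_sub, ← mul_sum, sum_add] at h4
  have hrefl : ∑ i ∈ mid, -σ (N - i) = ∑ i ∈ mid, -σ i
  · apply sum_nbij' (fun i => N - i) (fun i => N - i)
    · intro i hi; simp only [hmid, mem_filter, mem_range] at hi ⊢; omega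
    · intro i hi; simp only [hmid, mem_filter, mem_range] at hi ⊢; omega
    · intro i hi; simp only [hmid, mem_filter, mem_range] at hi; omega
    · intro i hi; simp only [hmid, mem_filter, mem_range] at hi; omega
    · intro i hi; rfl
  rw [hrefl, sum_const, nsmul_eq_mul, sum_neg_distrib] at h4
  rw [sum_add, sum_const, nsmul_eq_mul] at hsum
  have hcard : ¥N / 2 ≤ mid.card
  · have : Icc (N / 5 + 1) (4 * N / 5) ⊆ mid
    · intro i hi; rw [mem_Icc] at hi; simp only [hmid, mem_filter, mem_range]; omega
    have := card_le_card this
    rw [Nat.card_Icc] at this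
    have h5 : 3 * N ≤ 5 * mid.card + 5 := £
    have h6 : (3 * N : ℝ) ≤ 5 * mid.card + 5 := by exact_mod_cast h5
    nlinarith
  clear_value mid
  set A := ∑ i ∈ mid, σ i
  clear_value A
  clear hσ h3 hKv h2 h1 hrefl hmm
  push_cast at h4
  have hc0 : 0 ≤ δ * (mid.card:ℝ) := §
  have h7 : δ * N ≤ 1/1000 * N := mR hδ hN0
  have h8 : δ * (δ * N) ≤ 1 * (δ * N) := mR ¢ §
  nlinarith
theorem dich_abs {ε : ℝ} (hε0 : 0 < ε) (hε : ε ≤ 1/10) (hδ0 : 0 < δ) (hδ : 10^5 * δ ≤ (ε/4) ^ 4) (h : DH N R δ K v s) :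
    ∃ x, s x = 1 ∧ ∑ n ∈ (¿N).filter (fun n : ℕ => ε * N ≤ ¥n ∧ 10 * n ≤ 8 * N), (1 + δ + cf n (K * v x)) ≤ ε * N := by
  obtain ⟨x, hx⟩ := h.s9 (η := ε/4) § ¢ hδ0 hδ
  have hN0 := nn N
  rw [show 4 * (ε / 4) = ε by ring] at hx
  refine ⟨x, (h.s1 x).resolve_right fun hs => ?_, hx.trans (mR ¢ hN0)⟩
  have hδ1 : δ ≤ 1/1000
  · have : (ε/4) ^ 4 ≤ 1 := pow_le_one₀ § ¢
    linarith
  apply h.s10 hδ0 hδ1 hs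
  refine (sub_sum ?_ fun i hi _ => ?_).trans (hx.trans ?_)
  · intro i hi
    rw [mem_filter] at hi ⊢
    have : ¥N ≤ 5 * i := by exact_mod_cast hi.2.1
    exact ⟨hi.1, by nlinarith, £⟩
  · rw [mem_filter, mem_range] at hi
    have := (abs_le_nrm (fun x => cf i (K * v x)) x).trans (h.nKv hδ0.le £)
    have := (abs_le.1 this).1
    linarith
  · nlinarith
end dich
end LN
end

section
open scoped Classical
open Finset Real
namespace LN
section dichV
local notation "PS" => PowerSeries ℝ
local notation "cf" => PowerSeries.coeff (R := ℝ)
variable {X V : Type*} [Fintype X] [Fintype V] [CommGroup V]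
structure Chars (χ : X → V → ℝ) : Prop where
  sq : ∀ v : V, v * v = 1
  mul : ∀ x u v, χ x (u * v) = χ x u * χ x v
  pm : ∀ x v, χ x v = 1 ∨ χ x v = -1
  orth : ∀ v, ∑ x, χ x v = if v = 1 then (ϕ V : ℝ) else 0
noncomputable def hat (χ : X → V → ℝ) (F : V → ℝ) (x : X) : ℝ := (∑ h, χ x h * F h) / ϕ V
variable {χ : X → V → ℝ}
lemma card_pos' : ¥0 < ϕ V := by exact_mod_cast Fintype.card_pos_iff.2 ⟨(1:V)⟩
lemma Chars.inv (hχ : Chars χ) (F : V → ℝ) (v : V) : ∑ x, χ x v * hat χ F x = F v := by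
  simp_rw [hat, mul_div_assoc', ← sum_div, mul_sum, ← mul_assoc, ← hχ.mul]
  rw [sum_comm]
  simp_rw [← sum_mul, hχ.orth]
  rw [sum_eq_single v]
  · rw [if_pos (hχ.sq v)]; field_simp
  · intro h _ hne
    rw [if_neg, zero_mul]
    intro he
    apply hne
    calc h = v * v * h := by rw [hχ.sq, one_mul]
      _ = v * (v * h) := mul_assoc _ _ _
      _ = v := by rw [he, mul_one]
  · intro h; exact absurd (mem_univ v) h
lemma Chars.hat_mul (hχ : Chars χ) (F G : V → ℝ) (x : X) :
    hat χ F x * hat χ G x = hat χ (fun v => (∑ h, F h * G (v * h)) / ϕ V) x := by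
  simp only [hat]
  have e : ∑ v, χ x v * ((∑ h, F h * G (v * h)) / ϕ V) = (∑ v, χ x v * ∑ h, F h * G (v * h)) / ϕ V
  · rw [sum_div]; exact sum_congr rfl fun _ _ => by ring
  rw [e, div_mul_div_comm, div_div]
  congr 1
  rw [sum_mul_sum]
  simp_rw [mul_sum]
  rw [sum_comm (s := univ) (f := fun i j => χ x i * _)]
  apply sum_congr rfl
  intro h _
  rw [← Equiv.sum_comp (Equiv.mulRight h)]
  apply sum_congr rfl
  intro v _
  simp only [Equiv.coe_mulRight]
  have : χ x h * χ x h = 1 := by rcases hχ.pm x h with e | e <;> rw [e] <;> norm_num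
  rw [hχ.mul]
  linear_combination (χ x v * F h * G (v * h)) * this
lemma Chars.parseval (hχ : Chars χ) (F : V → ℝ) : ∑ x, hat χ F x ^ 2 = (∑ h, F h ^ 2) / ϕ V := by
  have := hχ.inv (fun v => (∑ h, F h * F (v * h)) / ϕ V) 1
  have e : ∀ x, hat χ (fun v => (∑ h, F h * F (v * h)) / ϕ V) x = hat χ F x * hat χ F x := fun x => (hχ.hat_mul F F x).symm
  simp only [e, one_mul] at this
  simp_rw [pow_two]
  rw [← this]
  apply sum_congr rfl
  intro x _
  have : χ x 1 = 1
  · have h := hχ.mul x 1 1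
    rw [mul_one] at h
    rcases hχ.pm x 1 with e | e
    · exact e
    · rw [e] at h; norm_num at h
  rw [this, one_mul]
lemma Chars.parseval_le (hχ : Chars χ) {F : V → ℝ} {B : ℝ} (h : ∀ v, |F v| ≤ B) : ∑ x, hat χ F x ^ 2 ≤ B ^ 2 := by
  rw [hχ.parseval, div_le_iff₀ card_pos']
  have : ∀ v ∈ univ, F v ^ 2 ≤ B ^ 2 := fun v _ => sq_le_sq.2 ((h v).trans (le_abs_self _))
  refine (sum_le_card_nsmul _ _ _ this).trans ?_
  rw [nsmul_eq_mul, card_univ, mul_comm]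
lemma hat_add (F G : V → ℝ) (x : X) : hat χ (fun v => F v + G v) x = hat χ F x + hat χ G x := by
  simp_rw [hat, mul_add, sum_add, add_div]
lemma hat_smul (c : ℝ) (F : V → ℝ) (x : X) : hat χ (fun v => c * F v) x = c * hat χ F x := by
  simp_rw [hat, mul_div_assoc', mul_sum]
  congr 1; exact sum_congr rfl fun _ _ => by ring
lemma hat_sum {ι : Type*} (S : Finset ι) (F : ι → V → ℝ) (x : X) : hat χ (fun v => ∑ i ∈ S, F i v) x = ∑ i ∈ S, hat χ (F i) x := by
  simp_rw [hat, mul_sum, ← sum_div]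
  rw [sum_comm]
theorem dich_V (hχ : Chars χ) {ε δ : ℝ} {N R : ℕ} (hε0 : 0 < ε) (hε : ε ≤ 1/10) (hδ0 : 0 < δ) (hδ : 10^5 * δ ≤ (ε/4) ^ 4)
    (k : ℕ → ℝ) (hk0 : ∀ l, 0 ≤ k l) (hk1 : ∀ n, ∑ l ∈ ¿n, k l ≤ 1) (hkR : ∀ l > R, k l = 0)
    (hkm : 1 - δ ≤ ∑ l ∈ ¿R, k l) (hkd : ∀ n, ∑ l ∈ range n, |k (l+1) - k l| + k 0 ≤ δ)
    (hRN : ¥R + 1 ≤ δ * N) (φ : ℕ → V → ℝ) (v₀ : V) (hφ : ∀ i ≤ N, ∀ v, |φ i v| ≤ 1 + δ)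
    (hrec : ∀ n ≤ N, ∀ v, |n * ∑ l ∈ ¿n, k l * φ (n - l) v + ∑ i ∈ ¿n, (∑ h, φ i h * φ (n - i) (v * h)) / ϕ V| ≤ δ * N)
    (h0 : ∀ i ≤ N, N ≤ i + 4 * R → φ i v₀ ≤ -1 + δ) :
    ∃ x, χ x v₀ = 1 ∧ ∑ n ∈ (¿N).filter (fun n : ℕ => ε * N ≤ ¥n ∧ 10 * n ≤ 8 * N),
      (1 + δ + ∑ l ∈ ¿n, k l * hat χ (φ (n - l)) x) ≤ ε * N := by
  set v : X → PS := fun x => PowerSeries.mk fun i => hat χ (φ i) x with hv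
  have cv : ∀ i x, cf i (v x) = hat χ (φ i) x := fun i x => by simp [hv]
  have er : ∀ n x, cf n (tht (PowerSeries.mk k * v x) + v x * v x) =
      hat χ (fun v => n * ∑ l ∈ ¿n, k l * φ (n - l) v + ∑ i ∈ ¿n, (∑ h, φ i h * φ (n - i) (v * h)) / ϕ V) x := by
    intro n x
    rw [map_add, cf_tht, cf_mul, cf_mul, hat_add, hat_smul, hat_sum, hat_sum]
    simp_rw [cv, PowerSeries.coeff_mk, hat_smul, hχ.hat_mul]
  have hD : DH N R δ (PowerSeries.mk k) v (fun x => χ x v₀) :=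
    { K1 := ⟨fun i => by simpa using hk0 i, fun n => by simpa using hk1 n⟩
      KR := fun l hl => by simpa using hkR l hl
      Km := by simpa using hkm
      Kd := fun n => by simpa using hkd n
      RN := hRN
      s1 := fun x => hχ.pm x v₀
      hv := fun i hi => by simp_rw [cv]; exact hχ.parseval_le (hφ i hi)
      hr := fun n hn => by simp_rw [er]; exact hχ.parseval_le (hrec n hn)
      hr0 := fun n hn => by simp_rw [er]; rw [hχ.inv]; exact hrec n hn v₀
      h0 := fun i hi hi' => by simp_rw [cv]; rw [hχ.inv]; exact h0 i hi hi' }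
  obtain ⟨x, hx, hx'⟩ := dich_abs hε0 hε hδ0 hδ hD
  refine ⟨x, hx, ?_⟩
  simp_rw [cf_mul, cv, PowerSeries.coeff_mk] at hx'
  exact hx'
end dichV
end LN
end

section
open scoped Classical
open Finset Real
namespace LN
structure CD {V : Type} [CommGroup V] [Fintype V] (y : ℝ) (Q : ℕ) (c : ℕ → V) (ν : ℕ) : Prop where
  Qpos : 0 < Q
  vsq : ∀ v : V, v * v = 1
  cmul : ∀ m n : ℕ, m.Coprime Q → n.Coprime Q → c (m * n) = c m * c n
  cper : ∀ m n : ℕ, m ≡ n [MOD Q] → c m = c n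
  fib : ∀ v, #{r ∈ range Q | r.Coprime Q ∧ c r = v} = ν
  pQ : ∀ p : ℕ, p.Prime → (p ∣ Q ↔ ¥p ≤ y)
  Qle : ¥Q ≤ exp (1.4 * y)
  Vle : (ϕ V : ℝ) ≤ exp (y / 100)
  hy : exp 14 ≤ y
lemma CD.Q0 {V : Type} [CommGroup V] [Fintype V] {y : ℝ} {Q : ℕ} {c : ℕ → V} {ν : ℕ} (h : CD y Q c ν) : ¥0 < Q := Nat.cast_pos.2 h.Qpos
def Rough (z : ℝ) (n : ℕ) : Prop := ∀ p : ℕ, p.Prime → p ∣ n → z < p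
lemma per_count {Q ν : ℕ} (p : ℕ → Prop) (hp : Function.Periodic p Q) (hc : #{n ∈ range Q | p n} = ν) (hQ : 0 < Q)
    {X : ℝ} (hX : 0 ≤ X) : |(#{n ∈ ° ⌊X⌋₊ | p n} : ℝ) - ν * X / Q| ≤ ν := by
  have h1 : ∀ q : ℕ, #{n ∈ ° (q * Q) | p n} = q * ν
  · intro q
    induction q with
    | zero => simp
    | succ q ih =>
      have hs : ° ((q+1) * Q) = ° (q * Q) ∪ Ico (q*Q+1) (q*Q+1+Q)
      · ext n; simp only [mem_Ioc, mem_union, mem_Ico, Nat.add_mul]; omega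
      rw [hs, filter_union, card_union_of_disjoint, ih, Nat.filter_Ico_card_eq_of_periodic _ _ _ hp,
        Nat.count_eq_card_filter_range, hc]
      · ring
      · apply disjoint_filter_filter
        rw [disjoint_left]; intro n; simp only [mem_Ioc, mem_Ico]; omega
  set M := ⌊X⌋₊
  have hd := Nat.div_add_mod M Q
  have hm := Nat.mod_lt M hQ
  set q := M / Q
  have hl : q * ν ≤ #{n ∈ ° M | p n}
  · rw [← h1]; apply card_le_card; apply filter_subset_filter; apply Ioc_subset_Ioc_right
    rw [mul_comm]; omega
  have hu : #{n ∈ ° M | p n} ≤ (q + 1) * ν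
  · rw [← h1]; apply card_le_card; apply filter_subset_filter; apply Ioc_subset_Ioc_right
    rw [add_mul, mul_comm]; omega
  have hQ' : ¥0 < Q := by exact_mod_cast hQ
  have hq1 : ¥q ≤ X / Q
  · rw [le_div_iff₀ hQ']
    have : q * Q ≤ M := by rw [mul_comm]; omega
    exact le_trans (by exact_mod_cast this) (Nat.floor_le hX)
  have hq2 : X / Q ≤ q + 1
  · rw [div_le_iff₀ hQ']
    have : M + 1 ≤ (q + 1) * Q := by rw [add_mul, mul_comm]; omega
    exact le_trans (Nat.lt_floor_add_one X).le (by exact_mod_cast this)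
  have hl' : ¥q * ν ≤ #{n ∈ ° M | p n} := by exact_mod_cast hl
  have hu' : (#{n ∈ ° M | p n} : ℝ) ≤ (q + 1) * ν := by exact_mod_cast hu
  have hν : ¥0 ≤ ν := nn0 _
  have e : ν * X / Q = X / Q * ν := by ring
  have a1 := mR hq1 hν
  have a2 := mR hq2 hν
  rw [e, abs_le]; constructor <;> linarith
lemma sum_Ioc_dvd (N d : ℕ) (hd : 0 < d) (f : ℕ → ℝ) :
    ∑ n ∈ ° N with d ∣ n, f n = ∑ m ∈ ° (N / d), f (d * m) := by
  symm
  refine sum_nbij' (fun m => d * m) (fun n => n / d) ?_ ?_ ?_ ?_ ?_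
  · intro m hm
    simp only [mem_Ioc, mem_filter] at hm ⊢
    exact ⟨⟨Nat.mul_pos hd hm.1, by rw [mul_comm]; exact (ldi hd).1 hm.2⟩, dvd_mul_right _ _⟩
  · intro n hn
    simp only [mem_Ioc, mem_filter] at hn ⊢
    exact ⟨Nat.div_pos (Nat.le_of_dvd hn.1.1 hn.2) hd, Nat.div_le_div_right hn.1.2⟩
  · intro m hm; exact Nat.mul_div_cancel_left _ hd
  · intro n hn; simp only [mem_filter] at hn; exact Nat.mul_div_cancel' hn.2
  · intro m hm; rfl
lemma Pr_dvd_iff (D : Finset ℕ) (hD : ∀ p ∈ D, p.Prime) (n : ℕ) : (∀ p ∈ D, p ∣ n) ↔ (∏ p ∈ D, p) ∣ n := by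
  constructor
  · intro h
    exact Finset.prod_primes_dvd n (fun p hp => (hD p hp).prime) h
  · intro h p hp; exact (dvd_prod_of_mem _ hp).trans h
section
variable {V : Type} [CommGroup V] [Fintype V] {y : ℝ} {Q : ℕ} {c : ℕ → V} {ν : ℕ}
lemma CD.ypos (h : CD y Q c ν) : 0 < y := ltl (exp_pos _) h.hy
lemma CD.y1000 (h : CD y Q c ν) : 1000000 ≤ y := by
  refine le_trans ?_ h.hy
  have h1 : exp ¥14 = (exp 1)^14 := by rw [← exp_nat_mul]; norm_num
  have h2 := Real.exp_one_gt_d9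
  rw [h1]
  calc ¥1000000 ≤ 2.7182818283^14 := ¤
    _ ≤ _ := by gcongr
lemma CD.c1 (h : CD y Q c ν) : c 1 = 1 := by
  have := h.cmul 1 1 (Nat.coprime_one_left _) (Nat.coprime_one_left _)
  simpa using this
lemma CD.inv (h : CD y Q c ν) (v : V) : v⁻¹ = v := inv_eq_of_mul_eq_one_left (h.vsq v)
lemma CD.cper' (h : CD y Q c ν) (v : V) : Function.Periodic (fun n : ℕ => n.Coprime Q ∧ c n = v) Q := by
  intro n
  simp only [Nat.coprime_add_self_left]
  rw [h.cper (n + Q) n (by simp [Nat.ModEq])]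
lemma CD.count (h : CD y Q c ν) (v : V) {X : ℝ} (hX : 0 ≤ X) :
    |(#{n ∈ ° ⌊X⌋₊ | n.Coprime Q ∧ c n = v} : ℝ) - ν * X / Q| ≤ ν := by
  have := per_count _ (h.cper' v) (by convert h.fib v) h.Qpos hX
  convert this
lemma CD.nuV (h : CD y Q c ν) : ¥ν * ϕ V = Q.totient := by
  rw [Nat.totient_eq_card_coprime]
  have : #{a ∈ range Q | Q.Coprime a} = ∑ v : V, #{r ∈ range Q | r.Coprime Q ∧ c r = v}
  · rw [card_eq_sum_card_fiberwise (f := c) (t := univ) ¶]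
    refine sum_congr rfl fun v _ => ?_
    rw [filter_filter]
    congr 1; ext r; simp [Nat.coprime_comm]
  rw [this, sum_congr rfl (fun v _ => h.fib v)]
  simp; ring
lemma CD.cop (h : CD y Q c ν) {p : ℕ} (hp : p.Prime) (hy : y < p) : p.Coprime Q := by
  rw [hp.coprime_iff_not_dvd, h.pQ p hp]; exact not_le.2 hy
lemma CD.copD (h : CD y Q c ν) {w : ℝ} {D : Finset ℕ} (hD : D ⊆ Pr y w) : (∏ p ∈ D, p).Coprime Q :=
  Nat.Coprime.prod_left fun p hp => h.cop ((mem_Pr h.ypos.le).1 (hD hp)).1 ((mem_Pr h.ypos.le).1 (hD hp)).2.1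
lemma CD.rcop (h : CD y Q c ν) {n : ℕ} (hr : Rough y n) : n.Coprime Q := by
  apply Nat.Coprime.symm
  apply Nat.coprime_of_dvd
  intro p hp hpQ hpn
  exact absurd ((h.pQ p hp).1 hpQ) (not_le.2 (hr p hp hpn))
lemma Rough.mono {z w : ℝ} (hzw : z ≤ w) {n : ℕ} (h : Rough w n) : Rough z n :=
  fun p hp hd => lt_of_le_of_lt hzw (h p hp hd)
lemma Rough.one (z : ℝ) : Rough z 1 := fun p hp hd => absurd hd (by simpa using hp.one_lt.ne')
lemma Rough.mul_iff {z : ℝ} {m n : ℕ} : Rough z (m * n) ↔ Rough z m ∧ Rough z n := by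
  constructor
  · intro h; exact ⟨fun p hp hd => h p hp (hd.mul_right _), fun p hp hd => h p hp (hd.mul_left _)⟩
  · rintro ⟨h1, h2⟩ p hp hd
    rcases hp.dvd_mul.1 hd with h | h
    exacts [h1 p hp h, h2 p hp h]
lemma Rough.lt {z : ℝ} {n : ℕ} (h : Rough z n) (h0 : 0 < n) (h1 : n ≠ 1) : z < n :=
  ltl (h _ (Nat.minFac_prime h1) (Nat.minFac_dvd n)) (by exact_mod_cast Nat.minFac_le h0)
lemma CD.rough_iff (h : CD y Q c ν) {w : ℝ} (hw : y ≤ w) {n : ℕ} :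
    Rough w n ↔ n.Coprime Q ∧ ∀ p ∈ Pr y w, ¬ p ∣ n := by
  constructor
  · intro hr
    refine ⟨h.rcop (hr.mono hw), fun p hp hd => ?_⟩
    rw [mem_Pr h.ypos.le] at hp
    exact absurd (hr p hp.1 hd) (not_lt.2 hp.2.2)
  · rintro ⟨h1, h2⟩ p hp hd
    by_contra hc
    by_cases hpy : y < p
    · exact h2 p ((mem_Pr h.ypos.le).2 ⟨hp, hpy, not_lt.1 hc⟩) hd
    · have := (h.pQ p hp).2 (not_lt.1 hpy)
      exact (Nat.not_coprime_of_dvd_of_dvd hp.one_lt hd this) h1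
lemma CD.sieve_count (h : CD y Q c ν) {w X : ℝ} (hw : y ≤ w) (hX : 0 ≤ X) (b : ℕ) (v : V) :
    |(#{n ∈ ° ⌊X⌋₊ | Rough w n ∧ c n = v} : ℝ) - ν * X / Q * ∏ p ∈ Pr y w, (1 - 1 / ¥p)|
      ≤ (1/2)^b * (ν * X / Q * ∏ p ∈ Pr y w, (1 - 1 / ¥p)) + ν * w ^ (12 * b + 260) := by
  have hQ := h.Q0
  have hs := sieve h.hy hw b ((° ⌊X⌋₊).filter fun n : ℕ => n.Coprime Q ∧ c n = v) (fun _ => 1)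
    (fun p => 1 / ¥p) (ν * X / Q) ν (by intros; norm_num)
    (fun p hp => ⟨§, by gcongr; norm_num⟩) § § ?_
  · convert hs using 3
    rw [sum_const, nsmul_eq_mul, mul_one, filter_filter]
    congr 2; ext n
    simp only [mem_filter, h.rough_iff hw]; tauto
  · intro D hD
    have hDp : ∀ p ∈ D, p.Prime := fun p hp => ((mem_Pr h.ypos.le).1 (hD hp)).1
    set d := ∏ p ∈ D, p with hd
    have hd0 : 0 < d := prod_pos fun p hp => (hDp p hp).pos
    have hdc := h.copD hD
    have e1 : ∑ n ∈ ((° ⌊X⌋₊).filter fun n : ℕ => n.Coprime Q ∧ c n = v) with ∀ p ∈ D, p ∣ n, ¥1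
        = #{m ∈ ° ⌊X / d⌋₊ | m.Coprime Q ∧ c m = v * c d} := by
      have e2 : (((° ⌊X⌋₊).filter fun n : ℕ => n.Coprime Q ∧ c n = v).filter fun n => ∀ p ∈ D, p ∣ n)
          = ((° ⌊X⌋₊).filter fun n => d ∣ n).filter fun n : ℕ => n.Coprime Q ∧ c n = v := by
        ext n; simp only [mem_filter, Pr_dvd_iff D hDp, ← hd]; tauto
      rw [e2, sum_filter, sum_Ioc_dvd _ _ hd0, ← sum_filter, Nat.floor_div_natCast]
      rw [sum_const, nsmul_eq_mul, mul_one]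
      congr 2; ext m
      simp only [mem_filter, Nat.coprime_mul_iff_left]
      constructor
      · rintro ⟨a1, ⟨a2, a3⟩, a4⟩
        refine ⟨a1, a3, ?_⟩
        rw [← a4, h.cmul _ _ hdc a3, mul_comm (c d), mul_assoc, h.vsq, mul_one]
      · rintro ⟨a1, a3, a4⟩
        refine ⟨a1, ⟨hdc, a3⟩, ?_⟩
        rw [h.cmul _ _ hdc a3, a4, mul_comm, mul_assoc, h.vsq, mul_one]
    have e3 : ν * X / Q * ∏ p ∈ D, (1 / ¥p) = ν * (X / d) / Q
    · rw [prod_div_distrib, prod_const_one, hd]; push_cast; ring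
    rw [e1, e3]
    refine (h.count _ §).trans ?_
    have : ¥1 ≤ (∏ p ∈ D, ¥p) ^ 2
    · have : ¥1 ≤ ∏ p ∈ D, ¥p := by rw [← Nat.cast_prod]; exact_mod_cast hd0
      nlinarith
    nlinarith [(nn0 ν : ¥0 ≤ ν)]
end
end LN
end

section
open scoped Classical
open Finset Real
namespace LN
noncomputable def PP (u w : ℝ) : ℝ := ∏ p ∈ Pr u w, (1 - 1 / ¥p)
lemma PP_ge {u w : ℝ} (hu : 1 ≤ u) (hw : 1 ≤ w) : 1 / w ≤ PP u w := by
  have h1 : ∀ N : ℕ, 1 ≤ N → ∏ n ∈ Ioc 1 N, (1 - 1 / ¥n) = 1 / N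
  · intro N hN
    induction N, hN using Nat.le_induction with
    | base => simp
    | succ n hn ih =>
      have : ¥0 < n := by exact_mod_cast hn
      rw [← insI £, prod_insert ¶, ih]
      push_cast; field_simp; ring
  have hN : 1 ≤ ⌊w⌋₊ := (Nat.one_le_floor_iff _).2 hw
  have h2 := h1 _ hN
  have hsub : Pr u w ⊆ Ioc 1 ⌊w⌋₊
  · intro p hp
    rw [mem_Pr ¢] at hp
    rw [mem_Ioc]; exact ⟨hp.1.one_lt, Nat.le_floor hp.2.2⟩
  have hf : ∀ n ∈ Ioc 1 ⌊w⌋₊, ¥0 ≤ 1 - 1 / ¥n ∧ 1 - 1 / ¥n ≤ 1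
  · intro n hn
    have : ¥1 ≤ n := by exact_mod_cast (mem_Ioc.1 hn).1.le
    refine ⟨?_, by have : 0 ≤ 1 / ¥n := §
                   linarith⟩
    rw [sub_nonneg, div_le_one ¢]; exact this
  rw [← prod_sdiff hsub] at h2
  have hA : ∏ n ∈ Ioc 1 ⌊w⌋₊ \ Pr u w, (1 - 1 / ¥n) ≤ 1 :=
    prod_le_one (fun n hn => (hf n (mem_sdiff.1 hn).1).1) (fun n hn => (hf n (mem_sdiff.1 hn).1).2)
  have hB : 0 ≤ PP u w := prod_nonneg fun n hn => (hf n (hsub hn)).1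
  have h3 : 1 / w ≤ 1 / (⌊w⌋₊:ℝ)
  · apply odl (by exact_mod_cast hN) (Nat.floor_le ¢)
  rw [← h2] at h3
  exact h3.trans (mul_le_of_le_one_left hB hA)
lemma Pr_union {a b d : ℝ} (ha : 0 ≤ a) (hab : a ≤ b) (hbd : b ≤ d) : Pr a b ∪ Pr b d = Pr a d := by
  ext p; simp only [mem_union, mem_Pr ha, mem_Pr (ha.trans hab)]
  constructor
  · rintro (h | h)
    · exact ⟨h.1, h.2.1, h.2.2.trans hbd⟩
    · exact ⟨h.1, lt_of_le_of_lt hab h.2.1, h.2.2⟩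
  · rintro ⟨h1, h2, h3⟩
    rcases le_or_gt ¥p b with h | h
    · exact Or.inl ⟨h1, h2, h⟩
    · exact Or.inr ⟨h1, h, h3⟩
lemma Pr_disj {a b d : ℝ} (ha : 0 ≤ a) (hab : a ≤ b) : Disjoint (Pr a b) (Pr b d) := by
  rw [disjoint_left]; intro p h1 h2
  rw [mem_Pr ha] at h1; rw [mem_Pr (ha.trans hab)] at h2
  linarith [h1.2.2, h2.2.1]
lemma PP_mul {a b d : ℝ} (ha : 0 ≤ a) (hab : a ≤ b) (hbd : b ≤ d) : PP a b * PP b d = PP a d := by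
  unfold PP
  rw [← prod_union (Pr_disj ha hab), Pr_union ha hab hbd]
lemma PP_nonneg {u w : ℝ} : 0 ≤ PP u w := by
  unfold PP Pr
  refine prod_nonneg fun p hp => ?_
  have : ¥1 ≤ p := by exact_mod_cast (mem_filter.1 hp).2.one_lt.le
  rw [sub_nonneg, div_le_one ¢]; exact this
lemma PP_le_one {u w : ℝ} : PP u w ≤ 1 := by
  unfold PP Pr
  refine prod_le_one (fun p hp => ?_) fun p hp => ?_
  · have : ¥1 ≤ p := by exact_mod_cast (mem_filter.1 hp).2.one_lt.le
    rw [sub_nonneg, div_le_one ¢]; exact this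
  · have : 0 ≤ 1 / ¥p := §
    linarith
lemma PP_ratio {a w z : ℝ} (ha : 0 ≤ a) (haw : a ≤ w) (hw : 2 ≤ w) (hwz : w ≤ z) :
    PP a w ≤ PP a z * exp (2 * ((log z - log w + 14) / log w)) := by
  rw [← PP_mul ha haw hwz]
  have h1 : exp (-(2 * ((log z - log w + 14) / log w))) ≤ PP w z
  · have h2 := sum_inv_Pr hw hwz
    calc exp (-(2 * ((log z - log w + 14) / log w))) ≤ exp (∑ p ∈ Pr w z, (-2 * (1/¥p))) := by
          rw [← mul_sum]; apply exp_le_exp.2; linarith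
      _ = ∏ p ∈ Pr w z, exp (-2 * (1/¥p)) := by rw [exp_sum]
      _ ≤ _ := by
        refine prod_le_prod (fun _ _ => (exp_nonneg _)) fun p hp => ?_
        rw [mem_Pr ¢] at hp
        exact one_sub_ge_exp § (by apply odl ¤; linarith [hp.2.1])
  rw [exp_neg] at h1
  have h3 : 1 ≤ PP w z * exp (2 * ((log z - log w + 14) / log w))
  · rwa [inv_le_iff_one_le_mul₀ (exp_pos _)] at h1
  rw [mul_assoc]
  exact le_mul_of_one_le_right PP_nonneg h3
section
variable {V : Type} [CommGroup V] [Fintype V] {y : ℝ} {Q : ℕ} {c : ℕ → V} {ν : ℕ}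
lemma CD.tot (h : CD y Q c ν) : ¥ν / Q * ϕ V = PP 1 y := by
  have hQ := h.Q0
  have h1 := Nat.totient_eq_mul_prod_factors Q
  have h2 : (Q.totient : ℝ) = Q * ∏ p ∈ Q.primeFactors, (1 - ¥p⁻¹)
  · have := congrArg (fun q : ℚ => ¥q) h1
    push_cast at this; exact this
  have h3 : Q.primeFactors = Pr 1 y
  · ext p
    rw [mem_Pr ¤, Nat.mem_primeFactors]
    constructor
    · rintro ⟨a, b, -⟩; exact ⟨a, by exact_mod_cast a.one_lt, (h.pQ p a).1 b⟩
    · rintro ⟨a, -, b⟩; exact ⟨a, (h.pQ p a).2 b, h.Qpos.ne'⟩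
  rw [dmd, h.nuV, h2, h3, mul_div_cancel_left₀ _ hQ.ne']
  unfold PP; simp only [one_div]
noncomputable def kap (y : ℝ) (Q ν : ℕ) : ℝ := ν / Q * PP y ¡y
lemma CD.kapV (h : CD y Q c ν) : kap y Q ν * ϕ V ≤ 1 / (4 * y) := by
  have hy := h.y1000
  have hz : 4 * y + 1 ≤ ¡y := add_one_le_exp _
  have e : kap y Q ν * ϕ V = PP 1 ¡y
  · rw [← PP_mul ¤ (by linarith : ¥1 ≤ y) (by linarith : y ≤ ¡y), ← h.tot]
    unfold kap; ring
  rw [e]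
  have := prod_primes_le (z := ¡y) ¢
  rwa [log_exp] at this
lemma CD.nupos (h : CD y Q c ν) : ¥0 < ν := by
  have h1 := h.nuV
  have : ¥0 < Q.totient := by exact_mod_cast Nat.totient_pos.2 h.Qpos
  rcases Nat.eq_zero_or_pos ν with h0 | h0
  · rw [h0] at h1; simp at h1; linarith
  · exact_mod_cast h0
lemma CD.kappos (h : CD y Q c ν) : 0 < kap y Q ν := by
  have hQ := h.Q0
  have hy := h.y1000
  have hz : 4 * y + 1 ≤ ¡y := add_one_le_exp _
  have := PP_ge (u := y) (w := ¡y) ¢ ¢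
  have h2 : 0 < PP y ¡y := ltl § this
  have := h.nupos
  unfold kap; positivity
noncomputable def Rc (c : ℕ → V) (z : ℝ) (v : V) (X : ℝ) : ℝ := #{n ∈ ° ⌊X⌋₊ | Rough z n ∧ c n = v}
lemma Rc_nonneg (c : ℕ → V) (z : ℝ) (v : V) (X : ℝ) : 0 ≤ Rc c z v X := nn0 _
lemma CD.rough_big (h : CD y Q c ν) (v : V) {X : ℝ} (hX : exp (4192 * y) ≤ X) :
    |Rc c ¡y v X - kap y Q ν * X| ≤ 3 * (kap y Q ν * X) * exp (- (log X / (200 * y))) := by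
  have hQ := h.Q0
  have hy := h.y1000
  have hz : 4 * y + 1 ≤ ¡y := add_one_le_exp _
  have hX0 : 0 < X := ltl (exp_pos _) hX
  have hlX : 4192 * y ≤ log X := (le_log_iff_exp_le hX0).2 hX
  set s := log X / (4 * y) with hs
  have hls : log X = 4 * y * s := by rw [hs]; field_simp
  have hs1 : 1048 ≤ s := by rw [hs, le_div_iff₀ ¢]; linarith
  set b := ⌊s / 24⌋₊
  have hb1 : ¥b ≤ s / 24 := Nat.floor_le ¢
  have hb2 : s / 24 < b + 1 := Nat.lt_floor_add_one _
  have hsv := h.sieve_count (w := ¡y) ¢ hX0.le b v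
  have hmain : ¥ν * X / Q * ∏ p ∈ Pr y ¡y, (1 - 1 / ¥p) = kap y Q ν * X
  · unfold kap PP; ring
  rw [hmain] at hsv
  have hP := PP_ge (u := y) (w := ¡y) ¢ ¢
  refine hsv.trans ?_
  have hk : 0 < kap y Q ν * X := mul_pos h.kappos hX0
  have t1 : (1/2:ℝ)^b ≤ 2 * exp (-(log X / (200*y)))
  · have h2 : exp (-(log 2 * b)) = (1/2:ℝ)^b
    · rw [exp_neg, exp_mul, exp_log ¤, rpow_natCast]; simp
    have h3 : ¥2 * exp (-(log X / (200*y))) = exp (log 2 - log X / (200*y))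
    · rw [sub_eq_add_neg, exp_add, exp_log ¤]
    rw [← h2, h3]
    apply exp_le_exp.2
    have h4 : log X / (200*y) = s / 50 := by rw [hls]; field_simp; ring
    rw [h4]
    have hl2 := Real.log_two_gt_d9
    nlinarith
  have t2 : ¥ν * ¡y ^ (12*b+260) ≤ kap y Q ν * X * exp (-(log X / (200*y)))
  · have h1 : ¡y ^ (12*b+260) = exp (4*y*(12*b+260))
    · rw [← exp_nat_mul]; congr 1; push_cast; ring
    have h2 : ¥ν * exp (-(5.4*y)) ≤ kap y Q ν
    · unfold kap
      rw [div_eq_mul_inv, mul_assoc]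
      apply mL _ h.nupos.le
      have h3 : exp (-(1.4*y)) ≤ ¥Q⁻¹
      · rw [exp_neg]; exact inv_anti₀ hQ h.Qle
      have h4 : exp (-(4*y)) ≤ PP y ¡y := by rw [exp_neg, ← one_div]; exact hP
      calc exp (-(5.4*y)) = exp (-(1.4*y)) * exp (-(4*y)) := by rw [← exp_add]; congr 1; ring
        _ ≤ _ := mul_le_mul h3 h4 (exp_nonneg _) §
    rw [h1]
    have h5 : exp (4*y*(12*b+260)) ≤ exp (-(5.4*y)) * (X * exp (-(log X / (200*y))))
    · rw [← exp_log hX0, log_exp, ← exp_add, ← exp_add]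
      apply exp_le_exp.2
      have h4 : log X / (200*y) = s / 50 := by rw [hls]; field_simp; ring
      rw [h4, hls]
      have : 12 * ¥b + 260 ≤ s/2 + 260 := ¢
      nlinarith
    calc ¥ν * exp (4*y*(12*b+260)) ≤ ν * (exp (-(5.4*y)) * (X * exp (-(log X / (200*y))))) :=
          mL h5 h.nupos.le
      _ = (ν * exp (-(5.4*y))) * (X * exp (-(log X / (200*y)))) := by ring
      _ ≤ kap y Q ν * (X * exp (-(log X / (200*y)))) :=
          mR h2 §
      _ = _ := by ring
  have := mR t1 hk.le
  linarith
lemma CD.rough_small (h : CD y Q c ν) (v : V) {X : ℝ} (hX : ¡y ≤ X) :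
    Rc c ¡y v X ≤ exp 4002 * (kap y Q ν * X) := by
  have hQ := h.Q0
  have hy := h.y1000
  have hX0 : 0 < X := ltl (exp_pos _) hX
  have hyw : y ≤ exp (y/500)
  · have := quadratic_le_exp_of_nonneg (x := y/500) §
    nlinarith
  have hwz : exp (y/500) ≤ ¡y := exp_le_exp.2 ¢
  have hsv := h.sieve_count (w := exp (y/500)) hyw hX0.le 0 v
  have hmono : Rc c ¡y v X ≤ #{n ∈ ° ⌊X⌋₊ | Rough (exp (y/500)) n ∧ c n = v}
  · unfold Rc
    apply Nat.cast_le.2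
    apply card_le_card
    intro n hn
    rw [mem_filter] at hn ⊢
    exact ⟨hn.1, hn.2.1.mono hwz, hn.2.2⟩
  have h1 := PP_ratio h.ypos.le hyw ¢ hwz
  have h2 := PP_ge (u := y) (w := exp (y/500)) ¢ ¢
  change |_ - ¥ν * X / Q * PP y (exp (y/500))| ≤ (1/2)^0 * (¥ν * X / Q * PP y (exp (y/500))) + _ at hsv
  simp only [pow_zero, one_mul, mul_zero, zero_add] at hsv
  have h3 : ¥ν * exp (y/500) ^ 260 ≤ ¥ν * X / Q * PP y (exp (y/500))
  · rw [← exp_nat_mul, mul_div_assoc, mul_assoc]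
    apply mL _ h.nupos.le
    have a1 : exp (2.6*y) ≤ X / Q
    · rw [le_div_iff₀ hQ]
      calc exp (2.6*y) * Q ≤ exp (2.6*y) * exp (1.4*y) := mL h.Qle (exp_nonneg _)
        _ = ¡y := by rw [← exp_add]; congr 1; ring
        _ ≤ X := hX
    have a2 : exp (-(y/500)) ≤ PP y (exp (y/500)) := by rw [exp_neg, ← one_div]; exact h2
    refine le_trans ?_ (mul_le_mul a1 a2 (exp_nonneg _) §)
    rw [← exp_add]; apply exp_le_exp.2; push_cast; linarith
  have h4 : exp (2 * ((log ¡y - log (exp (y/500)) + 14) / log (exp (y/500)))) ≤ exp 4000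
  · apply exp_le_exp.2
    rw [log_exp, log_exp]
    have : (4 * y - y/500 + 14) / (y/500) ≤ 2000 := by rw [div_le_iff₀ ¢]; linarith
    linarith
  have h5 : ¥3 ≤ exp 2 := by linarith [add_one_le_exp ¥2]
  have h6 : PP y (exp (y/500)) ≤ PP y ¡y * exp 4000 :=
    h1.trans (mL h4 PP_nonneg)
  have h7 : Rc c ¡y v X ≤ 3 * (¥ν * X / Q * PP y (exp (y/500)))
  · have := (abs_le.1 hsv).2
    linarith
  refine h7.trans ?_
  have h8 : ¥ν * X / Q * PP y (exp (y/500)) ≤ kap y Q ν * X * exp 4000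
  · have := mL h6 (by positivity : 0 ≤ ¥ν * X / Q)
    refine this.trans (le_of_eq ?_)
    unfold kap; ring
  have h9 : exp 4002 = exp 2 * exp 4000 := by rw [← exp_add]; norm_num
  rw [h9]
  have hk : 0 < kap y Q ν * X * exp 4000 := mul_pos (mul_pos h.kappos hX0) (exp_pos _)
  have := mR h5 hk.le
  linarith
lemma CD.rough_err (h : CD y Q c ν) (v : V) {X : ℝ} (hX : ¡y ≤ X) :
    |Rc c ¡y v X - kap y Q ν * X| ≤ exp 5000 * (kap y Q ν * X) * exp (- (log X / (200 * y))) := by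
  have hy0 := h.ypos
  have hX0 : 0 < X := ltl (exp_pos _) hX
  have hk : 0 < kap y Q ν * X := mul_pos h.kappos hX0
  rcases le_or_gt (exp (4192*y)) X with h1 | h1
  · refine (h.rough_big v h1).trans ?_
    apply mR _ (exp_nonneg _)
    apply mR _ hk.le
    linarith [add_one_le_exp ¥5000]
  · have h2 := h.rough_small v hX
    have h3 : 1 ≤ exp 4002 := one_le_exp ¤
    have h4 : log X ≤ 4192 * y := (log_le_iff_le_exp hX0).2 h1.le
    have h5 : exp (-998) ≤ exp (-(log X / (200*y)))
    · apply exp_le_exp.2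
      have : log X / (200*y) ≤ 998 := by rw [div_le_iff₀ ¢]; linarith
      linarith
    have h6 : |Rc c ¡y v X - kap y Q ν * X| ≤ exp 4002 * (kap y Q ν * X)
    · have := Rc_nonneg c ¡y v X
      rw [abs_le]; constructor <;> nlinarith
    refine h6.trans ?_
    calc exp 4002 * (kap y Q ν * X) = exp 5000 * (kap y Q ν * X) * exp (-998) := by
          rw [(by norm_num : ¥4002 = 5000 + -998), exp_add]; ring
      _ ≤ _ := mL h5 §
lemma rough_eq_one {z : ℝ} {n : ℕ} (h : Rough z n) (h0 : 0 < n) (hn : ¥n ≤ z) : n = 1 := by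
  by_contra h1
  linarith [h.lt h0 h1]
lemma CD.rough_all (h : CD y Q c ν) {X : ℝ} (hX : 0 ≤ X) :
    (#{n ∈ ° ⌊X⌋₊ | Rough ¡y n} : ℝ) ≤ 1 + exp 4002 * (X / (4 * y)) := by
  have hy0 := h.ypos
  rcases le_or_gt ¡y X with h1 | h1
  · have e : (#{n ∈ ° ⌊X⌋₊ | Rough ¡y n} : ℝ) = ∑ v : V, Rc c ¡y v X
    · unfold Rc
      rw [card_eq_sum_card_fiberwise (f := c) (t := univ) ¶]
      push_cast
      refine sum_congr rfl fun v _ => ?_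
      rw [filter_filter]
    rw [e]
    calc ∑ v : V, Rc c ¡y v X ≤ ∑ v : V, exp 4002 * (kap y Q ν * X) :=
          sum_le_sum fun v _ => h.rough_small v h1
      _ = exp 4002 * X * (kap y Q ν * ϕ V) := by
          rw [sum_const, nsmul_eq_mul, card_univ]; ring
      _ ≤ exp 4002 * X * (1 / (4*y)) := mL h.kapV §
      _ ≤ _ := by linarith [(by ring : exp 4002 * X * (1 / (4*y)) = exp 4002 * (X / (4 * y)))]
  · have : #{n ∈ ° ⌊X⌋₊ | Rough ¡y n} ≤ 1
    · rw [card_le_one_iff_subset_singleton]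
      refine ⟨1, fun n hn => ?_⟩
      simp only [mem_filter, mem_Ioc] at hn
      rw [mem_singleton]
      exact rough_eq_one hn.2 hn.1.1 ((le_trans (by exact_mod_cast hn.1.2) (Nat.floor_le hX)).trans h1.le)
    have h2 : (#{n ∈ ° ⌊X⌋₊ | Rough ¡y n} : ℝ) ≤ 1 := by exact_mod_cast this
    have : 0 ≤ exp 4002 * (X / (4 * y)) := §
    linarith
end
end LN
end

section
open scoped Classical
open Finset Real
namespace LN
local notation "Λ" => ArithmeticFunction.vonMangoldt
lemma conv_sum (N : ℕ) (h : ℕ → ℕ → ℝ) :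
    ∑ k ∈ ° N, ∑ x ∈ k.divisorsAntidiagonal, h x.1 x.2 = ∑ d ∈ ° N, ∑ e ∈ ° (N / d), h d e := by
  rw [sum_sigma', sum_sigma']
  refine sum_nbij' (fun a => ⟨a.2.1, a.2.2⟩) (fun a => ⟨a.1 * a.2, (a.1, a.2)⟩) ?_ ?_ ?_ ?_ ?_
  · rintro ⟨k, d, e⟩ ha
    simp only [mem_sigma, mem_Ioc, mdA] at ha ⊢
    obtain ⟨⟨h1, h2⟩, h3, h4⟩ := ha
    have hd : 0 < d := Nat.pos_of_ne_zero (by rintro rfl; simp at h3; omega)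
    have he : 0 < e := Nat.pos_of_ne_zero (by rintro rfl; simp at h3; omega)
    refine ⟨⟨hd, ?_⟩, he, ?_⟩
    · nlinarith
    · rw [ldi hd]; linarith [mul_comm d e]
  · rintro ⟨d, e⟩ ha
    simp only [mem_sigma, mem_Ioc, mdA] at ha ⊢
    obtain ⟨⟨h1, h2⟩, h3, h4⟩ := ha
    rw [ldi h1] at h4
    exact ⟨⟨Nat.mul_pos h1 h3, by linarith [mul_comm d e]⟩, trivial, (Nat.mul_pos h1 h3).ne'⟩
  · rintro ⟨k, d, e⟩ ha
    simp only [mem_sigma, mdA] at ha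
    obtain ⟨-, h3, -⟩ := ha
    subst h3; rfl
  · rintro ⟨d, e⟩ _; rfl
  · rintro ⟨k, d, e⟩ _; rfl
noncomputable def L2 (k : ℕ) : ℝ := Λ k * log k + ∑ x ∈ k.divisorsAntidiagonal, Λ x.1 * Λ x.2
lemma L2_nonneg (k : ℕ) : 0 ≤ L2 k :=
  add_nonneg (mul_nonneg Lnn (log_natCast_nonneg k))
    (sum_nonneg fun x _ => mul_nonneg Lnn Lnn)
lemma L2_eq (k : ℕ) : L2 k = ∑ x ∈ k.divisorsAntidiagonal, (ArithmeticFunction.moebius x.1 : ℝ) * log x.2 ^ 2 := by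
  set L := ArithmeticFunction.log
  have h1 : (L.pmul Λ + Λ * Λ) * (ArithmeticFunction.zeta : ArithmeticFunction ℝ) = L.pmul L
  · rw [add_mul, mul_assoc, ArithmeticFunction.vonMangoldt_mul_zeta]
    ext n
    rw [ArithmeticFunction.add_apply, ArithmeticFunction.coe_mul_zeta_apply, ArithmeticFunction.mul_apply,
      ← Nat.sum_divisorsAntidiagonal (fun i _ => L.pmul Λ i), ← sum_add,
      ArithmeticFunction.pmul_apply]
    have h2 : L n = ∑ x ∈ n.divisorsAntidiagonal, Λ x.1
    · have := congrArg (fun f => f n) ArithmeticFunction.vonMangoldt_mul_zeta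
      simp only [ArithmeticFunction.coe_mul_zeta_apply] at this
      rw [← this, ← Nat.sum_divisorsAntidiagonal (fun i _ => Λ i)]
    nth_rewrite 2 [h2]
    rw [mul_sum]
    refine sum_congr rfl fun x hx => ?_
    rw [mdA] at hx
    have hx1 : x.1 ≠ 0 := by rintro h; rw [h] at hx; simp at hx; exact hx.2 hx.1.symm
    have hx2 : x.2 ≠ 0 := by rintro h; rw [h] at hx; simp at hx; exact hx.2 hx.1.symm
    simp only [ArithmeticFunction.pmul_apply, L, ArithmeticFunction.log_apply]
    rw [← hx.1]; push_cast
    rw [Real.log_mul (by exact_mod_cast hx1) (by exact_mod_cast hx2)]; ring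
  have h3 : L.pmul Λ + Λ * Λ = (ArithmeticFunction.moebius : ArithmeticFunction ℝ) * L.pmul L
  · rw [← h1, mul_comm _ (_ * _), mul_assoc, ArithmeticFunction.coe_zeta_mul_coe_moebius, mul_one]
  have h4 := congrArg (fun f => f k) h3
  simp only [ArithmeticFunction.add_apply, ArithmeticFunction.mul_apply, ArithmeticFunction.pmul_apply, L,
    ArithmeticFunction.log_apply, ArithmeticFunction.intCoe_apply] at h4
  unfold L2
  rw [mul_comm, h4]
  exact sum_congr rfl fun x _ => by ring
lemma abel_nonneg {N : ℕ} (d w : ℕ → ℝ) (hd : ∀ n, 1 ≤ n → n ≤ N → 0 ≤ ∑ k ∈ ° n, d k)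
    (hw : ∀ n, 1 ≤ n → n < N → w (n + 1) ≤ w n) (hw0 : 0 ≤ w N) : 0 ≤ ∑ k ∈ ° N, d k * w k := by
  rcases Nat.eq_zero_or_pos N with h0 | h0
  · subst h0; simp
  have key : ∀ m, 1 ≤ m → m ≤ N → w m * ∑ k ∈ ° m, d k ≤ ∑ k ∈ ° m, d k * w k
  · intro m hm
    induction m, hm using Nat.le_induction with
    | base => intro _; simp [mul_comm]
    | succ m hm ih =>
      intro hmN
      rw [← insI £, sum_insert ¶, sum_insert ¶]
      have h1 := ih £
      have h2 := mR (hw m hm £) (hd m hm £)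
      linarith [(by ring : w (m+1) * (d (m+1) + ∑ k ∈ ° m, d k) = d (m+1) * w (m+1) + w (m+1) * ∑ k ∈ ° m, d k)]
  exact le_trans (mul_nonneg hw0 (hd N h0 le_rfl)) (key N h0 le_rfl)
lemma abel_le {N : ℕ} (hN : 1 ≤ N) {K0 K : ℝ} (b w : ℕ → ℝ)
    (hb : ∀ n, 1 ≤ n → n ≤ N → ∑ k ∈ ° n, b k ≤ K0 + K * n)
    (hw : ∀ n, 1 ≤ n → n < N → w (n + 1) ≤ w n) (hw0 : 0 ≤ w N) :
    ∑ k ∈ ° N, b k * w k ≤ K0 * w 1 + K * ∑ k ∈ ° N, w k := by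
  have := abel_nonneg (fun k => (if k = 1 then K0 else 0) + K - b k) w (N := N) ?_ hw hw0
  · simp only [sub_mul, add_mul, sum_sub, sum_add, ite_mul, zero_mul, sum_ite_eq', mem_Ioc,
      ← mul_sum] at this
    rw [if_pos ⟨¤, hN⟩] at this
    linarith
  · intro n h1 h2
    have := hb n h1 h2
    simp only [sum_sub, sum_add, sum_ite_eq', mem_Ioc, sum_const, Nat.card_Ioc, nsmul_eq_mul]
    rw [if_pos ⟨¤, h1⟩]
    push_cast [Nat.sub_zero]
    linarith
lemma abel_abs {N : ℕ} (hN : 1 ≤ N) {K0 K : ℝ} (b w : ℕ → ℝ)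
    (hb : ∀ n, 1 ≤ n → n ≤ N → |∑ k ∈ ° n, b k| ≤ K0 + K * n)
    (hw : ∀ n, 1 ≤ n → n < N → w (n + 1) ≤ w n) (hw0 : 0 ≤ w N) :
    |∑ k ∈ ° N, b k * w k| ≤ K0 * w 1 + K * ∑ k ∈ ° N, w k := by
  rw [abs_le']
  refine ⟨abel_le hN b w (fun n h1 h2 => (abs_le'.1 (hb n h1 h2)).1) hw hw0, ?_⟩
  have := abel_le hN (fun k => - b k) w (fun n h1 h2 => by rw [sum_neg_distrib]; exact (abs_le'.1 (hb n h1 h2)).2) hw hw0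
  simp only [neg_mul, sum_neg_distrib] at this
  exact this
lemma abel_mono {N : ℕ} (hN : 1 ≤ N) {M : ℝ} (b w : ℕ → ℝ) (hb : ∀ n, 1 ≤ n → n ≤ N → |∑ k ∈ ° n, b k| ≤ M)
    (hw : ∀ n, 1 ≤ n → n < N → w n ≤ w (n + 1)) (hw1 : 0 ≤ w 1) (hwN : 0 ≤ w N) :
    |∑ k ∈ ° N, b k * w k| ≤ 2 * w N * M := by
  have h1 := abel_abs hN (K0 := M) (K := 0) b (fun k => w N - w k) (by simpa using hb)
    (fun n a1 a2 => by linarith [hw n a1 a2]) ¶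
  have e : ∑ k ∈ ° N, b k * w k = w N * ∑ k ∈ ° N, b k - ∑ k ∈ ° N, b k * (w N - w k)
  · rw [mul_sum, ← sum_sub]; exact sum_congr rfl fun k _ => by ring
  have hM : 0 ≤ M := le_trans (abs_nonneg _) (hb N hN le_rfl)
  have h2 : |w N * ∑ k ∈ ° N, b k| ≤ w N * M
  · rw [abs_mul, abs_of_nonneg hwN]; exact mL (hb N hN le_rfl) hwN
  rw [e]
  refine (abs_sub _ _).trans ?_
  have := mul_nonneg hM hw1
  linarith
lemma sum_rpow_le {η : ℝ} (h0 : 0 < η) (h1 : η ≤ 1) (N : ℕ) :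
    ∑ d ∈ ° N, ¥d ^ (-1 + η) ≤ ¥N ^ η / η := by
  induction N with
  | zero => simp; positivity
  | succ n ih =>
    rw [← insI £, sum_insert ¶]
    have hn : ¥0 < ((n+1 : ℕ) : ℝ) := §
    have h2 : ¥n ^ η ≤ ((n+1:ℕ):ℝ) ^ η * (1 + η * (-(1 / ((n+1:ℕ):ℝ))))
    · have h3 := rpow_one_add_le_one_add_mul_self (s := -(1 / ((n+1:ℕ):ℝ))) (p := η) (by
        rw [neg_le_neg_iff, div_le_one hn]; push_cast; linarith [(nn0 n : ¥0 ≤ n)]) h0.le h1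
      have h4 : ¥n = ((n+1:ℕ):ℝ) * (1 + -(1 / ((n+1:ℕ):ℝ))) := by field_simp; push_cast; ring
      nth_rewrite 1 [h4]
      rw [mul_rpow hn.le]
      · exact mL h3 §
      · have : 1 / ((n+1:ℕ):ℝ) ≤ 1
        · rw [div_le_one hn]; push_cast; linarith [(nn0 n : ¥0 ≤ n)]
        linarith
    have h5 : ((n+1:ℕ):ℝ) ^ (-1 + η) = ((n+1:ℕ):ℝ) ^ η * (1 / ((n+1:ℕ):ℝ))
    · rw [rpow_add hn, rpow_neg_one]; ring
    rw [h5]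
    rw [le_div_iff₀ h0, add_mul]
    have := (le_div_iff₀ h0).1 ih
    linarith [(by ring : ((n+1:ℕ):ℝ) ^ η * (1 + η * (-(1 / ((n+1:ℕ):ℝ)))) = ((n+1:ℕ):ℝ) ^ η - ((n+1:ℕ):ℝ) ^ η * (1 / ((n+1:ℕ):ℝ)) * η)]
end LN
end

section
open scoped Classical
open Finset Real
namespace LN
local notation "Λ" => ArithmeticFunction.vonMangoldt
section
variable {V : Type} [CommGroup V] [Fintype V] {y : ℝ} {Q : ℕ} {c : ℕ → V} {ν : ℕ}
noncomputable def ind (c : ℕ → V) (v : V) (k : ℕ) : ℝ := (if c k = v then 1 else 0) - 1 / ϕ V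
noncomputable def indr (c : ℕ → V) (z : ℝ) (v : V) (k : ℕ) : ℝ := if Rough z k then ind c v k else 0
lemma cardV_pos : ¥0 < ϕ V := by
  haveI : Nonempty V := ⟨1⟩
  exact_mod_cast Fintype.card_pos
lemma ind_abs (c : ℕ → V) (v : V) (k : ℕ) : |ind c v k| ≤ 1 := by
  haveI : Nonempty V := ⟨1⟩
  have h1 : ¥1 ≤ ϕ V := by exact_mod_cast Fintype.card_pos
  have h2 : 1 / (ϕ V:ℝ) ≤ 1 := by rw [div_le_one ¢]; exact h1
  have h3 : 0 ≤ 1 / (ϕ V:ℝ) := §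
  unfold ind
  rw [abs_le]; split_ifs <;> constructor <;> linarith
lemma sum_indr (c : ℕ → V) (z : ℝ) (v : V) (n : ℕ) :
    ∑ k ∈ ° n, indr c z v k = Rc c z v n - (∑ u, Rc c z u n) / ϕ V := by
  have e1 : ∀ u, Rc c z u n = ∑ k ∈ ° n, if Rough z k ∧ c k = u then ¥1 else 0
  · intro u; unfold Rc; rw [Nat.floor_natCast, sum_boole]
  simp only [e1]
  rw [sum_comm, sum_div, ← sum_sub]
  refine sum_congr rfl fun k _ => ?_
  unfold indr ind
  by_cases h : Rough z k <;> simp [h]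
lemma Rc_lt (c : ℕ → V) {z : ℝ} (v : V) {n : ℕ} (hn : ¥n ≤ z) (h1 : 1 ≤ n) :
    ∑ k ∈ ° n, indr c z v k = ind c v 1 := by
  rw [sum_eq_single 1]
  · unfold indr; rw [if_pos (Rough.one z)]
  · intro k hk hk1
    unfold indr; rw [if_neg]
    intro hr
    rw [mem_Ioc] at hk
    exact hk1 (rough_eq_one hr hk.1 (le_trans (by exact_mod_cast hk.2) hn))
  · intro h; exact absurd (mem_Ioc.2 ⟨¤, h1⟩) h
lemma t_exp {t η : ℝ} (ht : 0 < t) : t * exp (-(log t * η)) = t ^ (1 - η) := by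
  rw [rpow_sub ht, rpow_one, rpow_def_of_pos ht, exp_neg]; rfl
lemma CD.B_le (h : CD y Q c ν) (u : V) {X : ℝ} (hX : ¡y ≤ X) (n : ℕ) (h1 : 1 ≤ n) (hn : ¥n ≤ X) :
    |∑ k ∈ ° n, indr c ¡y u k| ≤ exp 5001 * kap y Q ν * X ^ (1 - 1/(200*y)) := by
  have hy := h.y1000
  have hη : 1/(200*y) ≤ 1 := by rw [div_le_one §]; linarith
  have hk := h.kappos
  have hz0 : 0 < ¡y := exp_pos _
  have he : exp 5001 = exp 1 * exp 5000 := by rw [← exp_add]; norm_num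
  have he1 : ¥2 ≤ exp 1 := by linarith [add_one_le_exp ¥1]
  rcases le_or_gt ¥n ¡y with hn2 | hn2
  · rw [Rc_lt c u hn2 h1]
    refine (ind_abs _ _ _).trans ?_
    have h2 := h.rough_small (1:V) le_rfl
    have h3 : 1 ≤ Rc c ¡y 1 ¡y
    · unfold Rc
      rw [Nat.one_le_cast, Nat.one_le_iff_ne_zero, card_ne_zero]
      refine ⟨1, ?_⟩
      simp only [mem_filter, mem_Ioc]
      exact ⟨⟨¤, (Nat.one_le_floor_iff _).2 (one_le_exp ¢)⟩, Rough.one _, h.c1⟩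
    have h4 : ¡y * exp (-1) ≤ X ^ (1 - 1/(200*y))
    · refine le_trans ?_ (rpow_le_rpow hz0.le hX ¢)
      rw [← t_exp hz0, log_exp]
      apply mL _ hz0.le
      apply exp_le_exp.2
      have : 4 * y * (1/(200*y)) = 1/50 := by field_simp; norm_num
      rw [this]; norm_num
    calc ¥1 ≤ exp 4002 * (kap y Q ν * ¡y) := h3.trans h2
      _ = exp 4003 * kap y Q ν * (¡y * exp (-1)) := by
          rw [(by norm_num : ¥4002 = 4003 + -1), exp_add]; ring
      _ ≤ exp 5001 * kap y Q ν * (¡y * exp (-1)) := by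
          apply mR _ §
          exact mR (exp_le_exp.2 ¤) hk.le
      _ ≤ _ := mL h4 §
  · have hn0 : ¥0 < n := by exact_mod_cast h1
    set G := exp 5000 * (kap y Q ν * n) * exp (-(log n / (200*y))) with hG
    have hR : ∀ v, |Rc c ¡y v n - kap y Q ν * n| ≤ G := fun v => h.rough_err v hn2.le
    have hV := cardV_pos (V := V)
    have h5 : |(∑ v, Rc c ¡y v n) / ϕ V - kap y Q ν * n| ≤ G
    · have e : (∑ v, Rc c ¡y v n) / ϕ V - kap y Q ν * n
          = (∑ v, (Rc c ¡y v n - kap y Q ν * n)) / ϕ V := by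
        rw [sum_sub, sum_const, nsmul_eq_mul, card_univ]; field_simp
      rw [e, abs_div, abs_of_pos hV, div_le_iff₀ hV]
      refine (abs_sum _ _).trans ((sum_le_sum fun v _ => hR v).trans (le_of_eq ?_))
      rw [sum_const, nsmul_eq_mul, card_univ]; ring
    rw [sum_indr]
    have h6 : G ≤ exp 5000 * kap y Q ν * X ^ (1 - 1/(200*y))
    · have : G = exp 5000 * kap y Q ν * ¥n ^ (1 - 1/(200*y))
      · rw [hG, ← t_exp hn0, mul_one_div]; ring
      rw [this]
      apply mL (rpow_le_rpow hn0.le hn ¢) §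
    have h7 : 0 ≤ exp 5000 * kap y Q ν * X ^ (1 - 1/(200*y))
    · have : 0 ≤ X := hz0.le.trans hX
      positivity
    have h8 := mR he1 h7
    rw [he]
    have a1 := abs_le.1 (hR u)
    have a2 := abs_le.1 h5
    rw [abs_le]; constructor <;> linarith
lemma CD.E_le (h : CD y Q c ν) (u : V) (M : ℕ) :
    |∑ e ∈ ° M, indr c ¡y u e * log e ^ 2| ≤
      exp 5020 * kap y Q ν * y ^ 2 * ¥M ^ (1 - 1/(400*y)) := by
  have hy := h.y1000
  have hk := h.kappos
  rcases le_or_gt ¥M ¡y with h1 | h1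
  · rw [sum_eq_zero, abs_zero]
    · positivity
    · intro e he
      rw [mem_Ioc] at he
      unfold indr
      split_ifs with hr
      · rw [rough_eq_one hr he.1 (le_trans (by exact_mod_cast he.2) h1)]; simp
      · simp
  · have hM : ¥1 < M := lt_of_le_of_lt (one_le_exp ¢) h1
    have hM0 : ¥0 < M := ¢
    have hM1 : 1 ≤ M := by exact_mod_cast hM.le
    have h2 := abel_mono hM1 (M := exp 5001 * kap y Q ν * ¥M ^ (1 - 1/(200*y)))
      (fun k => indr c ¡y u k) (fun k => log k ^ 2)
      (fun n a1 a2 => h.B_le u h1.le n a1 (by exact_mod_cast a2)) (by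
        intro n a1 a2
        have : ¥1 ≤ n := by exact_mod_cast a1
        have := log_nonneg this
        apply pow_le_pow_left₀ this
        apply log_le_log ¢
        push_cast; linarith) § §
    refine h2.trans ?_
    have h3 : log M ^ 2 ≤ 320000 * y ^ 2 * ¥M ^ (1/(400*y))
    · have h4 : 0 ≤ log M := log_nonneg hM.le
      have h5 := quadratic_le_exp_of_nonneg (x := log M * (1/(400*y))) §
      rw [rpow_def_of_pos hM0]
      have h6 : (log M * (1/(400*y))) ^ 2 ≤ 2 * exp (log M * (1/(400*y)))
      · have : 0 ≤ log M * (1/(400*y)) := §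
        linarith
      calc log M ^ 2 = 160000 * y^2 * (log M * (1/(400*y))) ^ 2 := by field_simp; norm_num
        _ ≤ 160000 * y^2 * (2 * exp (log M * (1/(400*y)))) := mL h6 §
        _ = _ := by ring
    have h7 : ¥M ^ (1/(400*y)) * ¥M ^ (1 - 1/(200*y)) = ¥M ^ (1 - 1/(400*y))
    · rw [← rpow_add hM0]; congr 1; field_simp; ring
    have h8 : exp 5020 = exp 19 * exp 5001 := by rw [← exp_add]; norm_num
    have h9 : ¥640000 ≤ exp 19
    · have h1 : exp ¥19 = (exp 1)^19 := by rw [← exp_nat_mul]; norm_num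
      have h2 := Real.exp_one_gt_d9
      rw [h1]
      calc ¥640000 ≤ 2.7182818283^19 := ¤
        _ ≤ _ := by gcongr
    have h10 : 0 ≤ exp 5001 * kap y Q ν * ¥M ^ (1 - 1/(200*y)) := §
    have h11 := mR h3 h10
    have h12 : 0 ≤ exp 5001 * kap y Q ν * y^2 * ¥M ^ (1 - 1/(400*y)) := §
    have h13 := mR h9 h12
    rw [h8, ← h7]
    rw [← h7] at h13
    linarith
lemma CD.indr_mul (h : CD y Q c ν) (v : V) {d e : ℕ} :
    indr c ¡y v (d * e) = if Rough ¡y d then indr c ¡y (v * c d) e else 0 := by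
  have hyz : y ≤ ¡y := by linarith [add_one_le_exp (4*y), h.ypos]
  unfold indr
  rw [Rough.mul_iff]
  by_cases hd : Rough ¡y d
  · by_cases he : Rough ¡y e
    · simp only [hd, he, and_self, if_true]
      unfold ind
      rw [h.cmul d e (h.rcop (hd.mono hyz)) (h.rcop (he.mono hyz))]
      congr 2
      apply propext
      constructor
      · rintro rfl; rw [mul_comm, ← mul_assoc, h.vsq, one_mul]
      · intro h1; rw [h1, mul_comm, mul_assoc, h.vsq, mul_one]
    · simp [hd, he]
  · simp [hd]
theorem CD.delta (h : CD y Q c ν) (v : V) (N : ℕ) :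
    |∑ k ∈ ° N, L2 k * indr c ¡y v k| ≤ exp 9100 * (y / ϕ V) * N := by
  have hy := h.y1000
  have hy0 := h.ypos
  have hk := h.kappos
  rcases Nat.eq_zero_or_pos N with h0 | hN
  · subst h0; simp
  have hN0 : ¥0 < N := by exact_mod_cast hN
  have hη0 : 0 < 1/(400*y) := §
  have hη : 1/(400*y) ≤ 1 := by rw [div_le_one §]; linarith
  have e1 : ∑ k ∈ ° N, L2 k * indr c ¡y v k = ∑ d ∈ ° N, (ArithmeticFunction.moebius d : ℝ) *
      (if Rough ¡y d then ∑ e ∈ ° (N/d), indr c ¡y (v * c d) e * log e ^ 2 else 0) := by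
    have := conv_sum N (fun d e => (ArithmeticFunction.moebius d : ℝ) * log e ^ 2 * indr c ¡y v (d*e))
    rw [sum_congr rfl fun k hk => ?_, this]
    · refine sum_congr rfl fun d _ => ?_
      simp only [h.indr_mul]
      split_ifs
      · rw [mul_sum]; exact sum_congr rfl fun e _ => by ring
      · simp
    · rw [L2_eq, sum_mul]
      refine sum_congr rfl fun x hx => ?_
      rw [(mdA.1 hx).1]
  rw [e1]
  set K := exp 5020 * kap y Q ν * y ^ 2 with hK
  have hK0 : 0 ≤ K := §
  set η := 1/(400*y) with hηd
  have h2 : |∑ d ∈ ° N, (ArithmeticFunction.moebius d : ℝ) *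
      (if Rough ¡y d then ∑ e ∈ ° (N/d), indr c ¡y (v * c d) e * log e ^ 2 else 0)|
      ≤ K * ¥N ^ (1 - η) * ∑ d ∈ ° N, (if Rough ¡y d then 1 else 0) * ¥d ^ (-1 + η) := by
    rw [mul_sum]
    refine (abs_sum _ _).trans (sum_le_sum fun d hd => ?_)
    have hd0 : ¥0 < d := by exact_mod_cast (mem_Ioc.1 hd).1
    split_ifs with hr
    · rw [abs_mul]
      have m1 : |(ArithmeticFunction.moebius d : ℝ)| ≤ 1
      · exact_mod_cast ArithmeticFunction.abs_moebius_le_one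
      have m2 := h.E_le (v * c d) (N/d)
      have m3 : ((N/d : ℕ):ℝ) ^ (1 - η) ≤ ¥N ^ (1 - η) * (1 * ¥d ^ (-1 + η))
      · have : ((N/d : ℕ):ℝ) ≤ ¥N / d := Nat.cast_div_le
        refine (rpow_le_rpow § this ¢).trans (le_of_eq ?_)
        rw [div_rpow hN0.le hd0.le, one_mul, div_eq_mul_inv, ← rpow_neg hd0.le]; congr 2; ring
      refine (mul_le_of_le_one_left (abs_nonneg _) m1).trans (m2.trans ?_)
      rw [mul_assoc K]
      exact mL m3 hK0
    · simp
  have h3 := abel_le hN (K0 := 1) (K := exp 4002 / (4*y)) (fun d => if Rough ¡y d then ¥1 else 0)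
    (fun d => ¥d ^ (-1 + η)) (by
      intro n h1 h2
      have := h.rough_all (X := n) §
      rw [Nat.floor_natCast] at this
      rw [sum_boole]
      refine this.trans (le_of_eq (by ring))) (by
      intro n h1 h2
      have : ¥0 < n := by exact_mod_cast h1
      apply rpow_le_rpow_of_nonpos this (by push_cast; linarith) ¢) §
  have h4 := sum_rpow_le hη0 hη N
  refine h2.trans ?_
  have h5 : ∑ d ∈ ° N, (if Rough ¡y d then ¥1 else 0) * ¥d ^ (-1 + η) ≤
      (1 + exp 4002 * 100) * ¥N ^ η := by
    have h6 : ¥1 ≤ ¥N ^ η := one_le_rpow (by exact_mod_cast hN) hη0.le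
    have h7 : exp 4002 / (4*y) * (¥N ^ η / η) = exp 4002 * 100 * ¥N ^ η
    · rw [hηd]; field_simp; norm_num
    have h8 := mL h4 (by positivity : 0 ≤ exp 4002 / (4*y))
    rw [h7] at h8
    rw [Nat.cast_one, one_rpow] at h3
    linarith
  have h9 := mL h5 (by positivity : 0 ≤ K * ¥N ^ (1 - η))
  refine h9.trans ?_
  have h10 : ¥N ^ (1 - η) * ¥N ^ η = N := by rw [← rpow_add hN0]; simp
  have h11 : K * ¥N ^ (1 - η) * ((1 + exp 4002 * 100) * ¥N ^ η) = K * (1 + exp 4002 * 100) * N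
  · linear_combination K * (1 + exp 4002 * 100) * h10
  rw [h11]
  apply mR _ hN0.le
  have hV := cardV_pos (V := V)
  have h12 : kap y Q ν * y ≤ 1 / ϕ V
  · have := h.kapV
    rw [le_div_iff₀ hV]
    calc kap y Q ν * y * ϕ V = kap y Q ν * ϕ V * y := by ring
      _ ≤ 1 / (4*y) * y := mR this hy0.le
      _ = 1/4 := by field_simp
      _ ≤ 1 := ¤
  have h13 : exp 5020 * (1 + exp 4002 * 100) ≤ exp 9100
  · have : 1 + exp 4002 * 100 ≤ exp 4002 * 101 := by linarith [one_le_exp (by norm_num : ¥0 ≤ 4002)]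
    have : exp 9100 = exp 5020 * (exp 4002 * exp 78) := by rw [← exp_add, ← exp_add]; norm_num
    rw [this]
    apply mL _ (exp_nonneg _)
    have h103 : ¥101 ≤ exp 78
    · have := quadratic_le_exp_of_nonneg (x := ¥78) ¤
      linarith
    have := mL h103 (exp_pos 4002).le
    linarith
  calc K * (1 + exp 4002 * 100) = exp 5020 * (1 + exp 4002 * 100) * (kap y Q ν * y) * y := by rw [hK]; ring
    _ ≤ exp 9100 * (1 / ϕ V) * y := by
        apply mR _ hy0.le
        apply mul_le_mul h13 h12 § (exp_nonneg _)
    _ = _ := by ring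
end
end LN
end

section
open scoped Classical
open Finset Real
namespace LN
local notation "Λ" => ArithmeticFunction.vonMangoldt
noncomputable def Ex (i : ℕ) : ℕ := ⌊exp ¥i⌋₊
lemma le_Ex {a i : ℕ} (ha : 0 < a) : a ≤ Ex i ↔ ⌈log a⌉₊ ≤ i := by
  unfold Ex
  rw [Nat.le_floor_iff (exp_nonneg _), Nat.ceil_le, log_le_iff_le_exp (by exact_mod_cast ha)]
lemma Ex_pos (i : ℕ) : 1 ≤ Ex i := (Nat.one_le_floor_iff _).2 (one_le_exp §)
lemma Ex_le (i : ℕ) : (Ex i : ℝ) ≤ exp i := Nat.floor_le (exp_nonneg _)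
lemma Ex_mono {i j : ℕ} (h : i ≤ j) : Ex i ≤ Ex j := Nat.floor_le_floor (exp_le_exp.2 (by exact_mod_cast h))
lemma cnt_bounds (a b n : ℕ) (ha : 0 < a) (hb : 0 < b) :
    #{i ∈ range n | a * b ≤ Ex i} ≤ #{i ∈ ¿n | a ≤ Ex i ∧ b ≤ Ex (n - i)} ∧
    #{i ∈ ¿n | a ≤ Ex i ∧ b ≤ Ex (n - i)} ≤ #{i ∈ ¿n | a * b ≤ Ex i} := by
  simp only [le_Ex ha, le_Ex hb, le_Ex (Nat.mul_pos ha hb)]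
  set A := ⌈log a⌉₊
  set B := ⌈log b⌉₊
  set C := ⌈log ((a * b : ℕ):ℝ)⌉₊
  have hl : log ((a*b:ℕ):ℝ) = log a + log b
  · push_cast; exact log_mul (by exact_mod_cast ha.ne') (by exact_mod_cast hb.ne')
  have hla : 0 ≤ log ¥a := log_natCast_nonneg a
  have hlb : 0 ≤ log ¥b := log_natCast_nonneg b
  have h1 : C ≤ A + B
  · apply Nat.ceil_le.2
    rw [hl]; push_cast; exact add_le_add (Nat.le_ceil _) (Nat.le_ceil _)
  have h2 : A + B ≤ C + 1
  · have a1 := Nat.ceil_lt_add_one hla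
    have a2 := Nat.ceil_lt_add_one hlb
    have a3 : log ¥a + log b ≤ ¥C := hl ▸ Nat.le_ceil (log ((a*b:ℕ):ℝ))
    have : ((A + B : ℕ):ℝ) < ((C + 2 : ℕ):ℝ) := by push_cast; linarith
    have : A + B < C + 2 := by exact_mod_cast this
    omega
  have e1 : ∀ m, {i ∈ range m | C ≤ i} = Ico C m := by intro m; ext i; simp; omega
  have e2 : {i ∈ ¿n | A ≤ i ∧ B ≤ n - i} = if B ≤ n then Icc A (n - B) else ∅
  · ext i; split_ifs with h <;> simp <;> omega
  rw [e1, e1, e2, Nat.card_Ico, Nat.card_Ico]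
  split_ifs with h
  · rw [Nat.card_Icc]; omega
  · simp; omega
section
variable {V : Type} [CommGroup V] [Fintype V] {y : ℝ} {Q : ℕ} {c : ℕ → V} {ν : ℕ}
noncomputable def Sv (c : ℕ → V) (g : ℕ → ℝ) (v : V) (i : ℕ) : ℝ := ∑ k ∈ ° (Ex i), if c k = v then g k else 0
lemma Sv_nonneg (g : ℕ → ℝ) (hg : ∀ k, 0 ≤ g k) (v : V) (i : ℕ) : 0 ≤ Sv c g v i :=
  sum_nonneg fun k _ => by split_ifs; exacts [hg k, le_rfl]
lemma Sv_mono (g g' : ℕ → ℝ) (v : V) (i : ℕ) (hg : ∀ k ∈ ° (Ex i), g k ≤ g' k) : Sv c g v i ≤ Sv c g' v i :=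
  sum_le_sum fun k hk => by split_ifs; exacts [hg k hk, le_rfl]
lemma Sv_mono_i (g : ℕ → ℝ) (hg : ∀ k, 0 ≤ g k) (v : V) {i j : ℕ} (hij : i ≤ j) : Sv c g v i ≤ Sv c g v j :=
  sub_sum (Ioc_subset_Ioc_right (Ex_mono hij))
    fun k _ _ => by split_ifs; exacts [hg k, le_rfl]
lemma sum_Sv (g : ℕ → ℝ) (i : ℕ) : ∑ v, Sv c g v i = ∑ k ∈ ° (Ex i), g k := by
  unfold Sv; rw [sum_comm]; exact sum_congr rfl fun k _ => ¶
lemma Sv_ext (g : ℕ → ℝ) (v : V) {i N : ℕ} (h : Ex i ≤ N) :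
    Sv c g v i = ∑ k ∈ ° N, if k ≤ Ex i then (if c k = v then g k else 0) else 0 := by
  unfold Sv
  rw [← sum_filter (fun k : ℕ => k ≤ Ex i) (fun k : ℕ => if c k = v then g k else 0)]
  apply sum_congr _ fun _ _ => rfl
  ext k; simp only [mem_Ioc, mem_filter]; omega
noncomputable def am (β z : ℝ) (k : ℕ) : ℝ := if Rough z k then Λ k * ¥k ^ (-1 + β) else 0
noncomputable def dm (β z : ℝ) (k : ℕ) : ℝ :=
  if Rough z k then (∑ x ∈ k.divisorsAntidiagonal, Λ x.1 * Λ x.2) * ¥k ^ (-1 + β) else 0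
noncomputable def sm (β z : ℝ) (k : ℕ) : ℝ := if Rough z k then L2 k * ¥k ^ (-1 + β) else 0
noncomputable def um (β z : ℝ) (k : ℕ) : ℝ := am β z k * log k
lemma am_nonneg (β z : ℝ) (k : ℕ) : 0 ≤ am β z k := by
  unfold am; split_ifs
  · exact mul_nonneg Lnn §
  · exact le_rfl
lemma um_nonneg (β z : ℝ) (k : ℕ) : 0 ≤ um β z k := mul_nonneg (am_nonneg _ _ _) (log_natCast_nonneg k)
lemma dm_nonneg (β z : ℝ) (k : ℕ) : 0 ≤ dm β z k := by
  unfold dm; split_ifs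
  · exact mul_nonneg (sum_nonneg fun x _ => mul_nonneg Lnn
      Lnn) §
  · exact le_rfl
lemma sm_eq (β z : ℝ) (k : ℕ) : sm β z k = um β z k + dm β z k := by
  unfold sm um dm am L2; split_ifs <;> ring
lemma Sv_sm (β z : ℝ) (v : V) (i : ℕ) : Sv c (sm β z) v i = Sv c (um β z) v i + Sv c (dm β z) v i := by
  unfold Sv; rw [← sum_add]
  exact sum_congr rfl fun k _ => by rw [sm_eq]; split_ifs <;> ring
lemma CD.Sv_dm (h : CD y Q c ν) (β : ℝ) (v : V) {i N : ℕ} (hN : Ex i ≤ N) :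
    Sv c (dm β ¡y) v i = ∑ a ∈ ° N, ∑ b ∈ ° N,
      if a * b ≤ Ex i then (if c b = v * c a then am β ¡y a * am β ¡y b else 0) else 0 := by
  have hyz : y ≤ ¡y := by linarith [add_one_le_exp (4*y), h.ypos]
  have e1 : Sv c (dm β ¡y) v i = ∑ k ∈ ° (Ex i), ∑ x ∈ k.divisorsAntidiagonal,
      (fun a b => if c b = v * c a then am β ¡y a * am β ¡y b else 0) x.1 x.2 := by
    unfold Sv
    refine sum_congr rfl fun k hk => ?_
    have e2 : (if c k = v then dm β ¡y k else 0) = ∑ x ∈ k.divisorsAntidiagonal,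
        if c k = v then (if Rough ¡y k then Λ x.1 * Λ x.2 * ¥k ^ (-1 + β) else 0) else 0 := by
      unfold dm; split_ifs <;> simp [sum_mul]
    rw [e2]
    refine sum_congr rfl fun x hx => ?_
    rw [mdA] at hx
    obtain ⟨hx1, -⟩ := hx
    subst hx1
    simp only [Rough.mul_iff, am]
    by_cases ha : Rough ¡y x.1
    · by_cases hb : Rough ¡y x.2
      · simp only [ha, hb, and_self, if_true]
        rw [h.cmul _ _ (h.rcop (ha.mono hyz)) (h.rcop (hb.mono hyz))]
        have : (c x.1 * c x.2 = v) ↔ (c x.2 = v * c x.1)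
        · constructor
          · rintro rfl; rw [mul_comm, ← mul_assoc, h.vsq, one_mul]
          · intro h1; rw [h1, mul_comm, mul_assoc, h.vsq, mul_one]
        simp only [this]
        split_ifs
        · push_cast; rw [mul_rpow § §]; ring
        · rfl
      · simp [hb]
    · simp [ha]
  rw [e1, conv_sum (Ex i) (fun a b => if c b = v * c a then am β ¡y a * am β ¡y b else 0)]
  have hsub : ° (Ex i) ⊆ ° N := Ioc_subset_Ioc_right hN
  rw [sum_subset hsub]
  · refine sum_congr rfl fun a ha => ?_
    have ha0 := (mem_Ioc.1 ha).1
    rw [← sum_filter (fun b : ℕ => a * b ≤ Ex i)]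
    apply sum_congr _ fun _ _ => rfl
    ext b
    simp only [mem_Ioc, mem_filter, ldi ha0, mul_comm b a]
    constructor
    · rintro ⟨h1, h2⟩
      exact ⟨⟨h1, le_trans (by nlinarith) (h2.trans hN)⟩, h2⟩
    · rintro ⟨⟨h1, _⟩, h2⟩; exact ⟨h1, h2⟩
  · intro a ha ha2
    rw [Nat.div_eq_of_lt]
    · simp
    · simp only [mem_Ioc] at ha ha2; omega
lemma CD.Z_bounds (h : CD y Q c ν) (β : ℝ) (v : V) (n : ℕ) :
    let Z := ∑ i ∈ ¿n, ∑ u, Sv c (am β ¡y) u i * Sv c (am β ¡y) (v * u) (n - i)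
    ∑ i ∈ range n, Sv c (dm β ¡y) v i ≤ Z ∧ Z ≤ ∑ i ∈ ¿n, Sv c (dm β ¡y) v i := by
  intro Z
  set g := am β ¡y
  set N := Ex n
  set W : ℕ → ℕ → ℝ := fun a b => if c b = v * c a then g a * g b else 0
  have hW : ∀ a b, 0 ≤ W a b := fun a b => by
    simp only [W]; split_ifs; exacts [mul_nonneg (am_nonneg _ _ _) (am_nonneg _ _ _), le_rfl]
  have eZ : Z = ∑ a ∈ ° N, ∑ b ∈ ° N, (#{i ∈ ¿n | a ≤ Ex i ∧ b ≤ Ex (n - i)} : ℝ) * W a b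
  · have : ∀ i ∈ ¿n, ∑ u, Sv c g u i * Sv c g (v * u) (n - i) =
        ∑ a ∈ ° N, ∑ b ∈ ° N, (if a ≤ Ex i ∧ b ≤ Ex (n - i) then W a b else 0) := by
      intro i hi
      rw [mem_range] at hi
      have : ∀ u, Sv c g u i * Sv c g (v * u) (n - i) = ∑ a ∈ ° N, ∑ b ∈ ° N,
          if c a = u then (if a ≤ Ex i ∧ b ≤ Ex (n - i) then W a b else 0) else 0 := by
        intro u
        rw [Sv_ext g u (Ex_mono (by omega : i ≤ n)), Sv_ext g (v*u) (Ex_mono (by omega : n - i ≤ n)), sum_mul_sum]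
        refine sum_congr rfl fun a _ => sum_congr rfl fun b _ => ?_
        simp only [W]
        by_cases h1 : c a = u
        · subst h1
          by_cases h2 : a ≤ Ex i <;> by_cases h3 : b ≤ Ex (n - i) <;> by_cases h4 : c b = v * c a <;>
            simp [h2, h3, h4]
        · simp [h1]
      simp only [this]
      rw [sum_comm]
      refine sum_congr rfl fun a _ => ?_
      rw [sum_comm]
      exact sum_congr rfl fun b _ => ¶
    simp only [Z]
    rw [sum_congr rfl this, sum_comm]
    refine sum_congr rfl fun a _ => ?_
    rw [sum_comm]
    refine sum_congr rfl fun b _ => ?_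
    rw [← sum_filter, sum_const, nsmul_eq_mul]
  have eD : ∀ m, m ≤ n + 1 → ∑ i ∈ range m, Sv c (dm β ¡y) v i =
      ∑ a ∈ ° N, ∑ b ∈ ° N, (#{i ∈ range m | a * b ≤ Ex i} : ℝ) * W a b := by
    intro m hm
    have : ∀ i ∈ range m, Sv c (dm β ¡y) v i =
        ∑ a ∈ ° N, ∑ b ∈ ° N, if a * b ≤ Ex i then W a b else 0 := by
      intro i hi
      rw [mem_range] at hi
      exact h.Sv_dm β v (Ex_mono £)
    rw [sum_congr rfl this, sum_comm]
    refine sum_congr rfl fun a _ => ?_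
    rw [sum_comm]
    refine sum_congr rfl fun b _ => ?_
    rw [← sum_filter, sum_const, nsmul_eq_mul]
  rw [eD n £, eD (n+1) le_rfl, eZ]
  constructor
  · refine sum_le_sum fun a ha => sum_le_sum fun b hb => mR ?_ (hW _ _)
    exact_mod_cast (cnt_bounds a b n (mem_Ioc.1 ha).1 (mem_Ioc.1 hb).1).1
  · refine sum_le_sum fun a ha => sum_le_sum fun b hb => mR ?_ (hW _ _)
    exact_mod_cast (cnt_bounds a b n (mem_Ioc.1 ha).1 (mem_Ioc.1 hb).1).2
lemma J_bounds (β z : ℝ) (v : V) (n : ℕ) :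
    ∑ i ∈ range n, Sv c (um β z) v i ≤ n * ∑ i ∈ range n, Sv c (am β z) v i ∧
    n * ∑ i ∈ range n, Sv c (am β z) v i ≤ ∑ i ∈ range n, Sv c (um β z) v i
      + 2 * ∑ i ∈ range n, (¥n - i) * Sv c (am β z) v i := by
  set P := fun i => Sv c (am β z) v i with hP
  have hlog : ∀ i k, k ∈ ° (Ex i) → log ¥k ≤ i
  · intro i k hk
    rw [mem_Ioc] at hk
    exact Nat.ceil_le.1 ((le_Ex hk.1).1 hk.2)
  constructor
  · rw [mul_sum]
    refine sum_le_sum fun i hi => ?_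
    unfold Sv; rw [mul_sum]
    refine sum_le_sum fun k hk => ?_
    split_ifs
    · unfold um
      rw [mul_comm]
      apply mR _ (am_nonneg _ _ _)
      have : ¥i ≤ n := by exact_mod_cast (mem_range.1 hi).le
      linarith [hlog i k hk]
    · simp
  · have key : ∀ i : ℕ, ¥i * P i ≤ Sv c (um β z) v i + ∑ j ∈ ¿i, P j
    · intro i
      have e1 : ∑ j ∈ ¿i, P j = ∑ k ∈ ° (Ex i), (#{j ∈ ¿i | k ≤ Ex j} : ℝ) *
          (if c k = v then am β z k else 0) := by
        rw [sum_congr rfl fun j hj => Sv_ext (am β z) v (Ex_mono (by have := mem_range.1 hj; omega : j ≤ i)), sum_comm]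
        refine sum_congr rfl fun k _ => ?_
        rw [← sum_filter, sum_const, nsmul_eq_mul]
      rw [e1, hP]
      simp only [Sv]
      rw [mul_sum, ← sum_add]
      refine sum_le_sum fun k hk => ?_
      split_ifs
      · unfold um
        rw [mul_comm (am β z k), ← add_mul]
        apply mR _ (am_nonneg _ _ _)
        rw [mem_Ioc] at hk
        have hC := (le_Ex hk.1).1 hk.2
        have : {j ∈ ¿i | k ≤ Ex j} = Ico ⌈log k⌉₊ (i+1)
        · ext j; simp only [mem_filter, mem_range, mem_Ico, le_Ex hk.1]; omega
        rw [this, Nat.card_Ico, Nat.cast_sub £]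
        have := Nat.ceil_lt_add_one (log_natCast_nonneg k)
        push_cast; linarith
      · simp
    have e2 : ∀ n : ℕ, ∑ i ∈ range n, ∑ j ∈ ¿i, P j = ∑ i ∈ range n, (¥n - i) * P i
    · intro n
      induction n with
      | zero => simp
      | succ n ih =>
        rw [sum_range_succ, ih, sum_range_succ _ n, sum_range_succ (fun i => ((n+1:ℕ) - ¥i) * P i)]
        have : ∑ i ∈ range n, (((n+1:ℕ):ℝ) - i) * P i = ∑ i ∈ range n, (¥n - i) * P i + ∑ i ∈ range n, P i
        · rw [← sum_add]; exact sum_congr rfl fun i _ => by push_cast; ring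
        rw [this]; push_cast; ring
    have e3 : ¥n * ∑ i ∈ range n, P i = ∑ i ∈ range n, (¥n - i) * P i + ∑ i ∈ range n, ¥i * P i
    · rw [mul_sum, ← sum_add]; exact sum_congr rfl fun i _ => by ring
    have e4 := sum_le_sum fun i (_ : i ∈ range n) => key i
    rw [sum_add, e2] at e4
    rw [e3]; linarith
end
end LN
end

section
open scoped Classical
open Finset Real
namespace LN
local notation "Λ" => ArithmeticFunction.vonMangoldt
lemma Ex_rpow {β : ℝ} (hβ : 0 < β) (i : ℕ) : ((Ex i : ℕ) : ℝ) ^ β ≤ exp (β * i) := by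
  rw [mul_comm, exp_mul]
  exact rpow_le_rpow § (Ex_le i) hβ.le
lemma log_Ex {i k : ℕ} (hk : k ∈ ° (Ex i)) : log ¥k ≤ i := by
  rw [mem_Ioc] at hk
  exact Nat.ceil_le.1 ((le_Ex hk.1).1 hk.2)
lemma sum_rpow_ge {η : ℝ} (h0 : 0 < η) (h1 : η ≤ 1) (N : ℕ) :
    ((¥N + 1) ^ η - 1) / η ≤ ∑ d ∈ ° N, ¥d ^ (-1 + η) := by
  induction N with
  | zero => simp
  | succ n ih =>
    rw [← insI £, sum_insert ¶]
    have hn : ¥0 < ((n+1 : ℕ) : ℝ) := §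
    have h2 : (1 + 1 / ((n+1:ℕ):ℝ)) ^ η ≤ 1 + η * (1 / ((n+1:ℕ):ℝ)) :=
      rpow_one_add_le_one_add_mul_self (le_trans ¤ (by positivity : ¥0 ≤ 1 / ((n+1:ℕ):ℝ))) h0.le h1
    have e1 : ((n+1:ℕ):ℝ) + 1 = ((n+1:ℕ):ℝ) * (1 + 1 / ((n+1:ℕ):ℝ)) := by field_simp
    have e2 : ((n+1:ℕ):ℝ) ^ (-1 + η) = ((n+1:ℕ):ℝ) ^ η * (1 / ((n+1:ℕ):ℝ))
    · rw [rpow_add hn, rpow_neg_one]; field_simp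
    have h3 : (((n+1:ℕ):ℝ) + 1) ^ η ≤ ((n+1:ℕ):ℝ) ^ η * (1 + η * (1 / ((n+1:ℕ):ℝ)))
    · rw [e1, mul_rpow hn.le §]
      exact mL h2 §
    rw [div_le_iff₀ h0] at ih ⊢
    rw [e2, add_mul]
    have : (¥n + 1) ^ η = ((n+1:ℕ):ℝ) ^ η := by push_cast; rfl
    rw [this] at ih
    linarith
lemma lam_sum {β : ℝ} (hβ : 0 < β) {M : ℕ} (hM : 1 ≤ M) :
    |∑ k ∈ ° M, Λ k * ¥k ^ (-1 + β) - ∑ k ∈ ° M, ¥k ^ (-1 + β)| ≤ 16 * ¥M ^ β := by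
  have := abel_mono hM (M := 8) (fun k => Λ k / k - ¥k⁻¹) (fun k => ¥k ^ β) ?_ ?_ § §
  · rw [← sum_sub]
    convert this using 1
    · congr 1
      refine sum_congr rfl fun k hk => ?_
      have : ¥0 < k := by exact_mod_cast (mem_Ioc.1 hk).1
      rw [rpow_add this, rpow_neg_one]; ring
    · ring
  · intro n h1 _
    rw [sum_sub]
    have hm := abs_le.1 (mertens (x := n) (by exact_mod_cast h1))
    rw [Nat.floor_natCast] at hm
    have e : ∑ k ∈ ° n, ¥k⁻¹ = (harmonic n : ℝ)
    · rw [harmonic_eq_sum_Icc]; push_cast; rfl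
    have h2 := harmonic_le_one_add_log n
    have h3 := log_le_harmonic_floor ¥n §
    rw [Nat.floor_natCast] at h3
    rw [e, abs_le]; constructor <;> linarith
  · intro n _ _
    exact rpow_le_rpow § (by push_cast; linarith) hβ.le
lemma lam_le {β : ℝ} (hβ : 0 < β) (hβ1 : β ≤ 1/16) (M : ℕ) :
    ∑ k ∈ ° M, Λ k * ¥k ^ (-1 + β) ≤ (1/β + 16) * ¥M ^ β := by
  rcases Nat.eq_zero_or_pos M with h0 | h0
  · subst h0; simp; positivity
  have h1 := (abs_le.1 (lam_sum hβ h0)).2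
  have h2 := sum_rpow_le hβ ¢ M
  have : (1/β + 16) * ¥M ^ β = ¥M^β/β + 16 * ¥M^β := by ring
  linarith
lemma am_le (β z : ℝ) (k : ℕ) : am β z k ≤ Λ k * ¥k ^ (-1 + β) := by
  unfold am; split_ifs
  · exact le_rfl
  · exact mul_nonneg Lnn §
lemma am_sum_le {β : ℝ} (hβ : 0 < β) (hβ1 : β ≤ 1/16) (z : ℝ) (i : ℕ) :
    ∑ k ∈ ° (Ex i), am β z k ≤ (1/β + 16) * exp (β * i) :=
  (sum_le_sum fun k _ => am_le β z k).trans ((lam_le hβ hβ1 _).trans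
    (mL (Ex_rpow hβ i) §))
lemma sm_sum_le {β : ℝ} (hβ : 0 < β) (hβ1 : β ≤ 1/16) (z : ℝ) (i : ℕ) :
    ∑ k ∈ ° (Ex i), sm β z k ≤ 2/β * exp (β * i) * (2 * i + 7) := by
  have hu : ∑ k ∈ ° (Ex i), um β z k ≤ i * ((1/β + 16) * exp (β * i))
  · refine le_trans ?_ (mL (am_sum_le hβ hβ1 z i) §)
    rw [mul_sum]
    refine sum_le_sum fun k hk => ?_
    unfold um; rw [mul_comm]
    exact mR (log_Ex hk) (am_nonneg _ _ _)
  have hd : ∑ k ∈ ° (Ex i), dm β z k ≤ (1/β + 16) * exp (β * i) * (i + 7)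
  · have s1 : ∑ k ∈ ° (Ex i), dm β z k ≤ ∑ k ∈ ° (Ex i), ∑ x ∈ k.divisorsAntidiagonal,
        (fun a b : ℕ => Λ a * ¥a ^ (-1 + β) * (Λ b * ¥b ^ (-1 + β))) x.1 x.2 := by
      refine sum_le_sum fun k hk => ?_
      have e : ∑ x ∈ k.divisorsAntidiagonal, (fun a b : ℕ => Λ a * ¥a ^ (-1 + β) * (Λ b * ¥b ^ (-1 + β))) x.1 x.2
          = (∑ x ∈ k.divisorsAntidiagonal, Λ x.1 * Λ x.2) * ¥k ^ (-1 + β) := by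
        rw [sum_mul]
        refine sum_congr rfl fun x hx => ?_
        rw [mdA] at hx
        rw [← hx.1]; push_cast; rw [mul_rpow § §]; ring
      rw [e]; unfold dm; split_ifs
      · exact le_rfl
      · exact mul_nonneg (sum_nonneg fun x _ => mul_nonneg Lnn
          Lnn) §
    refine s1.trans ?_
    rw [conv_sum (Ex i) (fun a b : ℕ => Λ a * ¥a ^ (-1 + β) * (Λ b * ¥b ^ (-1 + β)))]
    have s2 : ∀ a ∈ ° (Ex i), ∑ b ∈ ° (Ex i / a), Λ a * ¥a ^ (-1 + β) * (Λ b * ¥b ^ (-1 + β)) ≤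
        (1/β + 16) * exp (β * i) * (Λ a / a) := by
      intro a ha
      have ha0 : ¥0 < a := by exact_mod_cast (mem_Ioc.1 ha).1
      rw [← mul_sum]
      have h1 := lam_le hβ hβ1 (Ex i / a)
      have h2 : ((Ex i / a : ℕ):ℝ) ^ β ≤ exp (β * i) / ¥a^β
      · calc ((Ex i / a : ℕ):ℝ) ^ β ≤ ((Ex i : ℝ) / a) ^ β := rpow_le_rpow § Nat.cast_div_le hβ.le
          _ = (Ex i : ℝ)^β / ¥a^β := div_rpow § § _
          _ ≤ _ := dR (Ex_rpow hβ i) §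
      calc Λ a * ¥a ^ (-1 + β) * ∑ b ∈ ° (Ex i / a), Λ b * ¥b ^ (-1 + β)
          ≤ Λ a * ¥a ^ (-1 + β) * ((1/β + 16) * (exp (β * i) / ¥a^β)) := by
            apply mL _ (mul_nonneg Lnn §)
            exact h1.trans (mL h2 §)
        _ = _ := by
            rw [rpow_add ha0, rpow_neg_one]
            have : ¥a^β ≠ 0 := (rpow_pos_of_pos ha0 _).ne'
            field_simp
    refine (sum_le_sum s2).trans ?_
    rw [← mul_sum]
    apply mL _ §
    have := (abs_le.1 (mertens (x := exp i) (one_le_exp §))).2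
    rw [log_exp] at this
    unfold Ex; linarith
  have e : ∑ k ∈ ° (Ex i), sm β z k = ∑ k ∈ ° (Ex i), um β z k + ∑ k ∈ ° (Ex i), dm β z k
  · rw [← sum_add]; exact sum_congr rfl fun k _ => sm_eq _ _ _
  have hb : 1/β + 16 ≤ 2/β
  · have : 16 ≤ 1/β := by rw [le_div_iff₀ hβ]; linarith
    have : 2/β = 1/β + 1/β := by ring
    linarith
  rw [e]
  calc _ ≤ (1/β + 16) * (exp (β * i) * (2 * i + 7)) := ¢
    _ ≤ 2/β * (exp (β * i) * (2 * i + 7)) := mR hb §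
    _ = _ := by ring
lemma nonrough {β : ℝ} (hβ : 0 < β) (hβ1 : β ≤ 1/16) {z : ℝ} (hz : 1 ≤ z) (i : ℕ) :
    ∑ k ∈ ° (Ex i), Λ k * ¥k ^ (-1 + β) ≤ ∑ k ∈ ° (Ex i), am β z k + 4 * z * (2 * i + 1) := by
  set T := (° (Ex i)).filter (fun k => ¬ Rough z k ∧ IsPrimePow k) with hT
  have h1 : ∀ k ∈ ° (Ex i), Λ k * ¥k ^ (-1 + β) ≤ am β z k + if (¬ Rough z k ∧ IsPrimePow k) then 2 else 0
  · intro k hk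
    have hk0 : ¥0 < k := by exact_mod_cast (mem_Ioc.1 hk).1
    unfold am
    by_cases hr : Rough z k
    · simp [hr]
    by_cases hp : IsPrimePow k
    · simp only [hr, hp, if_false, not_false_eq_true, and_self, if_true, zero_add]
      have a1 : Λ k ≤ log k := ArithmeticFunction.vonMangoldt_le_log
      have a2 := log_le_rpow_div hk0.le (ε := 1 - β) ¢
      calc Λ k * ¥k ^ (-1 + β) ≤ ¥k ^ (1 - β) / (1 - β) * ¥k ^ (-1 + β) :=
            mR (a1.trans a2) §
        _ = 1 / (1 - β) := by
            rw [dmd, ← rpow_add hk0]; norm_num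
        _ ≤ 2 := by rw [div_le_iff₀ ¢]; linarith
    · have : Λ k = 0 := ArithmeticFunction.vonMangoldt_eq_zero_iff.2 hp
      simp [hr, hp, this]
  have h2 := sum_le_sum h1
  rw [sum_add, ← sum_filter, sum_const, nsmul_eq_mul] at h2
  have h3 : T ⊆ ((range (⌊z⌋₊ + 1)) ×ˢ (range (2 * i + 1))).image (fun x => x.1 ^ x.2)
  · intro k hk
    rw [hT, mem_filter] at hk
    obtain ⟨hk, hr, hp⟩ := hk
    obtain ⟨p, a, hp1, ha, rfl⟩ := hp
    have hp1 := hp1.nat_prime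
    simp only [mem_image, mem_product, mem_range, Prod.exists]
    refine ⟨p, a, ⟨?_, ?_⟩, rfl⟩
    · unfold Rough at hr; push Not at hr
      obtain ⟨q, hq, hqd, hqz⟩ := hr
      have : q = p := (Nat.prime_dvd_prime_iff_eq hq hp1).1 (hq.dvd_of_dvd_pow hqd)
      subst this
      exact Nat.lt_succ_of_le (Nat.le_floor hqz)
    · have := log_Ex hk
      push_cast at this
      rw [log_pow] at this
      have h4 : log 2 ≤ log p := log_le_log ¤ (by exact_mod_cast hp1.two_le)
      have h5 := log_two_gt_d9
      have h6 : ¥a * (1/2) ≤ i := le_trans (mL ¢ §) this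
      have h7 : ¥a ≤ ((2 * i : ℕ) : ℝ) := by push_cast; linarith
      have : a ≤ 2 * i := by exact_mod_cast h7
      omega
  have h4 : (#T : ℝ) ≤ (⌊z⌋₊ + 1) * (2 * i + 1)
  · have := (card_le_card h3).trans card_image_le
    rw [card_product, card_range, card_range] at this
    exact_mod_cast this
  have h5 : (⌊z⌋₊ : ℝ) ≤ z := Nat.floor_le ¢
  have h6 : (#T : ℝ) ≤ 2 * z * (2 * i + 1) := h4.trans (mR ¢ §)
  refine h2.trans ?_
  have e : #(filter (fun k => ¬ Rough z k ∧ IsPrimePow k) (° (Ex i))) = #T := rfl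
  rw [e]; linarith
section
variable {V : Type} [CommGroup V] [Fintype V] {y : ℝ} {Q : ℕ} {c : ℕ → V} {ν : ℕ}
lemma CD.Sdiff (h : CD y Q c ν) {β : ℝ} (hβ : 0 < β) (hβ1 : β ≤ 1/16) (v : V) (i : ℕ) :
    |Sv c (sm β ¡y) v i - (∑ k ∈ ° (Ex i), sm β ¡y k) / ϕ V| ≤
      exp 9100 * (y / ϕ V) * (exp (β * i) / β) := by
  have e : Sv c (sm β ¡y) v i - (∑ k ∈ ° (Ex i), sm β ¡y k) / ϕ V
      = ∑ k ∈ ° (Ex i), L2 k * indr c ¡y v k * ¥k ^ (-1 + β) := by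
    unfold Sv; rw [sum_div, ← sum_sub]
    refine sum_congr rfl fun k _ => ?_
    unfold sm indr ind; split_ifs <;> ring
  rw [e]
  have hy := h.ypos
  have := abel_abs (Ex_pos i) (K0 := 0) (K := exp 9100 * (y / ϕ V))
    (fun k => L2 k * indr c ¡y v k) (fun k => ¥k ^ (-1 + β))
    (fun n _ _ => by rw [zero_add]; exact h.delta v n)
    (fun n h1 _ => by
      apply rpow_le_rpow_of_nonpos (by exact_mod_cast h1) (by push_cast; linarith) ¢) §
  refine this.trans ?_
  rw [zero_mul, zero_add]
  apply mL _ §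
  exact (sum_rpow_le hβ ¢ _).trans (dR (Ex_rpow hβ i) hβ.le)
end
end LN
end

section
open scoped Classical
open Finset Real
namespace LN
local notation "Λ" => ArithmeticFunction.vonMangoldt
noncomputable def lam (β : ℝ) : ℝ := exp β - 1
noncomputable def kp (β : ℝ) (l : ℕ) : ℝ := if l = 0 then 0 else lam β * exp (-(β * l))
lemma lam_ge (β : ℝ) : β ≤ lam β := by unfold lam; linarith [add_one_le_exp β]
lemma lam_le2 {β : ℝ} (h0 : 0 < β) (h1 : β ≤ 1/16) : lam β ≤ β + β^2 := by
  have := abs_exp_sub_one_sub_id_le (x := β) (by rw [abs_of_pos h0]; linarith)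
  unfold lam; linarith [(abs_le.1 this).2]
lemma kp_nonneg {β : ℝ} (h0 : 0 < β) (l : ℕ) : 0 ≤ kp β l := by
  unfold kp; split_ifs
  · exact le_rfl
  · have := lam_ge β; exact mul_nonneg ¢ (exp_nonneg _)
lemma kp_conv (β : ℝ) (g : ℕ → ℝ) (n : ℕ) :
    ∑ l ∈ ¿n, kp β l * g (n - l) = ∑ i ∈ range n, lam β * exp (-(β * (n - i))) * g i := by
  rw [sum_range_succ', ← sum_range_reflect (fun i : ℕ => lam β * exp (-(β * (n - i))) * g i)]
  simp only [kp, if_true, zero_mul, add_zero, Nat.add_eq_zero_iff, one_ne_zero, and_false, if_false]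
  refine sum_congr rfl fun l hl => ?_
  rw [mem_range] at hl
  have e : n - 1 - l = n - (l+1) := £
  rw [e, Nat.cast_sub £]; congr 4; ring
lemma exp_step (β : ℝ) (n : ℕ) : exp (-(β * (n+1:ℕ))) * exp β = exp (-(β * n)) := by
  rw [← exp_add]; congr 1; push_cast; ring
lemma kp_sum (β : ℝ) (n : ℕ) : ∑ l ∈ ¿n, kp β l = 1 - exp (-(β * n)) := by
  induction n with
  | zero => simp [kp]
  | succ n ih =>
    rw [sum_range_succ, ih]
    have e := exp_step β n
    simp only [kp, Nat.add_eq_zero_iff, one_ne_zero, and_false, if_false, lam]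
    rw [← e]; ring
lemma kp_mom {β : ℝ} (h0 : 0 < β) (h1 : β ≤ 1/16) (n : ℕ) : ∑ l ∈ ¿n, ¥l * kp β l ≤ 2/β := by
  have hl : 0 < lam β := ltl h0 (lam_ge β)
  have key : ∀ n : ℕ, ∑ l ∈ ¿n, ¥l * kp β l = (1 - exp (-(β * n))) * (exp β / lam β) - n * exp (-(β * n))
  · intro n
    induction n with
    | zero => simp
    | succ n ih =>
      rw [sum_range_succ, ih]
      have e := exp_step β n
      simp only [kp, Nat.add_eq_zero_iff, one_ne_zero, and_false, if_false]
      rw [← e]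
      have e2 : exp β = lam β + 1 := by unfold lam; ring
      rw [e2]; field_simp; push_cast; ring
  rw [key]
  have hu := exp_pos (-(β * n))
  have h3 : exp β / lam β ≤ 2/β
  · rw [div_le_div_iff₀ hl h0]
    have e2 : exp β = lam β + 1 := by unfold lam; ring
    have h5 := lam_ge β
    rw [e2]; nlinarith
  have h4 : 0 ≤ exp β / lam β := §
  have : 0 ≤ ¥n * exp (-(β * n)) := §
  nlinarith
noncomputable def f0 (β y : ℝ) (i : ℕ) : ℝ := lam β * exp (-(β * i)) * ∑ k ∈ ° (Ex i), am β ¡y k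
lemma f0_nonneg {β y : ℝ} (h0 : 0 < β) (i : ℕ) : 0 ≤ f0 β y i :=
  mul_nonneg (mul_nonneg (h0.le.trans (lam_ge β)) (exp_nonneg _)) (sum_nonneg fun k _ => am_nonneg _ _ _)
lemma f0_le {β y : ℝ} (h0 : 0 < β) (h1 : β ≤ 1/16) (i : ℕ) : f0 β y i ≤ 1 + 18 * β := by
  have hl : 0 < lam β := ltl h0 (lam_ge β)
  have a := am_sum_le h0 h1 ¡y i
  calc f0 β y i ≤ lam β * exp (-(β * i)) * ((1/β + 16) * exp (β * i)) := mL a §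
    _ = lam β * (1/β + 16) := by rw [exp_neg]; field_simp
    _ ≤ (β + β^2) * (1/β + 16) := mR (lam_le2 h0 h1) §
    _ = 1 + 17 * β + 16 * β^2 := by field_simp; ring
    _ ≤ _ := by nlinarith
lemma by_pos {β y : ℝ} (h0 : 0 < β) (h1 : β ≤ 1/16) (hy : 100 ≤ β^2 * y) : 0 < y ∧ 1600 ≤ β * y ∧ 25600 ≤ y := by
  have hy0 : 0 < y := pos_of_mul_pos_right (ltl ¤ hy) §
  have h2 : β^2 * y ≤ 1/16 * (β * y)
  · rw [sq, mul_assoc]; exact mR h1 §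
  have h3 : β * y ≤ 1/16 * y := mR h1 hy0.le
  exact ⟨hy0, ¢, ¢⟩
lemma f0_near {β y : ℝ} (h0 : 0 < β) (h1 : β ≤ 1/16) (hy : 100 ≤ β^2 * y) {i : ℕ} (hi : 16 * y ≤ β * i) :
    |f0 β y i - 1| ≤ 40 * β := by
  have hl : 0 < lam β := ltl h0 (lam_ge β)
  have hl2 := lam_le2 h0 h1
  obtain ⟨hy0, hby, hy1⟩ := by_pos h0 h1 hy
  rw [abs_le]
  refine ⟨?_, by linarith [f0_le (y := y) h0 h1 i]⟩
  have a := nonrough h0 h1 (z := ¡y) (one_le_exp §) i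
  have b := (abs_le.1 (lam_sum h0 (Ex_pos i))).1
  have c := sum_rpow_ge h0 ¢ (Ex i)
  have d := Ex_rpow h0 i
  have e : exp (β * i) ≤ ((Ex i : ℝ) + 1) ^ β
  · rw [mul_comm, exp_mul]
    exact rpow_le_rpow (exp_nonneg _) (Nat.lt_floor_add_one _).le h0.le
  have e' : (exp (β * i) - 1) / β ≤ (((Ex i : ℝ) + 1) ^ β - 1) / β := dR ¢ h0.le
  set A := ∑ k ∈ ° (Ex i), am β ¡y k with hA
  have f : (exp (β * i) - 1) / β - 16 * exp (β * i) - 4 * ¡y * (2 * i + 1) ≤ A := ¢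
  set t := β * i with ht
  have g1 : lam β * exp (-t) * ((exp t - 1) / β - 16 * exp t - 4 * ¡y * (2 * i + 1)) ≤ f0 β y i :=
    mL f §
  have g2 : lam β * exp (-t) * ((exp t - 1) / β - 16 * exp t - 4 * ¡y * (2 * i + 1)) =
      lam β / β * (1 - exp (-t)) - 16 * lam β - lam β * (4 * (2 * i + 1)) * (¡y * exp (-t)) := by
    have : exp (-t) * exp t = 1 := by rw [← exp_add]; simp
    linear_combination (lam β / β - 16 * lam β) * this
  have hty : exp (-t) ≤ β / 100
  · have : exp (-t) ≤ 1 / (t+1)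
    · rw [exp_neg, ← one_div]; exact odl ¢ (add_one_le_exp t)
    refine this.trans ?_
    rw [div_le_iff₀ ¢]; nlinarith
  have g3 : 1 - exp (-t) ≤ lam β / β * (1 - exp (-t))
  · have : 1 ≤ lam β / β := by rw [le_div_iff₀ h0]; linarith [lam_ge β]
    nlinarith
  have g4 : lam β * (4 * (2 * i + 1)) ≤ 16 * (t + 1)
  · have := nn i
    have : lam β ≤ 2 * β := by nlinarith
    calc lam β * (4 * (2 * i + 1)) ≤ 2 * β * (4 * (2 * i + 1)) := mR this §
      _ = 16 * t + 8 * β := by rw [ht]; ring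
      _ ≤ _ := ¢
  have g5 : (t + 1) * (¡y * exp (-t)) ≤ β / 100
  · have a1 : t + 1 ≤ 2 * exp (t/2) := by linarith [add_one_le_exp (t/2)]
    have a2 : exp (t/2) * (¡y * exp (-t)) ≤ exp (-(4*y))
    · rw [← exp_add, ← exp_add]; apply exp_le_exp.2; linarith
    have a3 : exp (-(4*y)) ≤ 1/(4*y)
    · rw [exp_neg, ← one_div]; exact odl ¢ (by linarith [add_one_le_exp (4*y)])
    have a4 : 1/(4*y) ≤ β/400 := by rw [div_le_iff₀ ¢]; linarith
    have a5 : 0 < ¡y * exp (-t) := §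
    nlinarith
  have g6 : lam β * (4 * (2 * i + 1)) * (¡y * exp (-t)) ≤ 16 * (β/100)
  · refine (mR g4 §).trans ?_
    rw [mul_assoc]; exact mL g5 ¤
  have g7 : 16 * lam β ≤ 32 * β := by nlinarith
  linarith
noncomputable def ft0 (β y : ℝ) (n : ℕ) : ℝ := ∑ l ∈ ¿n, kp β l * f0 β y (n - l)
lemma ft0_nonneg {β y : ℝ} (h0 : 0 < β) (i : ℕ) : 0 ≤ ft0 β y i :=
  sum_nonneg fun _ _ => mul_nonneg (kp_nonneg h0 _) (f0_nonneg h0 _)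
lemma ft0_le {β y : ℝ} (h0 : 0 < β) (h1 : β ≤ 1/16) (n : ℕ) : ft0 β y n ≤ 1 + 18 * β := by
  calc ft0 β y n ≤ ∑ l ∈ ¿n, kp β l * (1 + 18 * β) :=
        sum_le_sum fun l _ => mL (f0_le h0 h1 _) (kp_nonneg h0 _)
    _ = (1 - exp (-(β * n))) * (1 + 18 * β) := by rw [← sum_mul, kp_sum]
    _ ≤ 1 * (1 + 18 * β) := mR (by linarith [exp_pos (-(β * n))]) ¢
    _ = _ := one_mul _
lemma ft0_near {β y : ℝ} (h0 : 0 < β) (h1 : β ≤ 1/16) (hy : 100 ≤ β^2 * y) {n : ℕ} (hn : 33 * y ≤ β * n) :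
    |ft0 β y n - 1| ≤ 50 * β := by
  obtain ⟨hy0, hby, hy1⟩ := by_pos h0 h1 hy
  rw [abs_le]
  refine ⟨?_, by linarith [ft0_le (y := y) h0 h1 n]⟩
  set m := ⌊16 * y / β⌋₊ with hm
  have m1 : ¥m ≤ 16 * y / β := Nat.floor_le §
  have m2 : 16 * y / β ≤ 2 * m
  · have := Nat.lt_floor_add_one (16*y/β)
    have h3 : 2 ≤ 16 * y / β := by rw [le_div_iff₀ h0]; linarith
    have : ¥1 ≤ m
    · have : (1:ℕ) ≤ m := Nat.le_floor (by push_cast; linarith)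
      exact_mod_cast this
    linarith
  rw [le_div_iff₀ h0] at m1
  rw [div_le_iff₀ h0] at m2
  have hmn : m ≤ n
  · have : ¥m ≤ n := by by_contra hc; push Not at hc; nlinarith
    exact_mod_cast this
  have s1 : ∑ l ∈ ¿m, kp β l * (1 - 40 * β) ≤ ft0 β y n
  · refine le_trans (sum_le_sum fun l hl => ?_) (sub_sum (range_subset_range.2 (by omega : m+1 ≤ n+1))
      fun l _ _ => mul_nonneg (kp_nonneg h0 _) (f0_nonneg h0 _))
    apply mL _ (kp_nonneg h0 _)
    have hlm : l ≤ m := by rw [mem_range] at hl; omega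
    have := f0_near h0 h1 hy (i := n - l) (by
      rw [Nat.cast_sub £]
      have : ¥l ≤ m := by exact_mod_cast hlm
      nlinarith)
    linarith [(abs_le.1 this).1]
  rw [← sum_mul, kp_sum] at s1
  have : exp (-(β * m)) ≤ β
  · have : exp (-(β * m)) ≤ 1 / (β * m+1)
    · rw [exp_neg, ← one_div]; exact odl § (add_one_le_exp _)
    refine this.trans ?_
    rw [div_le_iff₀ §]; nlinarith
  nlinarith [exp_pos (-(β * m))]
lemma T0_near {β y : ℝ} (h0 : 0 < β) (h1 : β ≤ 1/16) (hy : 100 ≤ β^2 * y) (n : ℕ) :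
    |n * ft0 β y n + ∑ i ∈ ¿n, f0 β y i * f0 β y (n - i) - 2 * n| ≤ 250 * β * n + 1000 * (y / β) := by
  obtain ⟨hy0, hby, hy1⟩ := by_pos h0 h1 hy
  set q := y / β with hq
  have hqb : q * β = y := by rw [hq]; field_simp
  have hq1 : 1600 ≤ q := by rw [hq, le_div_iff₀ h0]; nlinarith
  have p1 : |n * (ft0 β y n - 1)| ≤ 50 * β * n + 100 * q
  · rw [abs_mul, abs_of_nonneg (nn0 n)]
    by_cases hn : 33 * y ≤ β * n
    · have := ft0_near h0 h1 hy hn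
      nlinarith
    · have a1 : |ft0 β y n - 1| ≤ 2
      · rw [abs_le]; constructor <;> linarith [ft0_le (y := y) h0 h1 n, ft0_nonneg (y := y) h0 n]
      have a2 : ¥n ≤ 33 * q
      · rw [hq]; rw [← mul_div_assoc, le_div_iff₀ h0]; linarith
      have : 0 ≤ 50 * β * n := §
      have := mL a1 (nn0 (α := ℝ) n)
      linarith
  have p2 : ∀ i ∈ ¿n, |f0 β y i * f0 β y (n - i) - 1| ≤ 160 * β +
      (8 * (if i < ⌈16 * q⌉₊ then 1 else 0) + 8 * (if n - i < ⌈16 * q⌉₊ then 1 else 0)) := by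
    intro i _
    have b1 := f0_le (y := y) h0 h1 i
    have b2 := f0_le (y := y) h0 h1 (n - i)
    have b3 := f0_nonneg (y := y) h0 i
    have b4 := f0_nonneg (y := y) h0 (n - i)
    have near : ∀ j : ℕ, ¬ j < ⌈16 * q⌉₊ → |f0 β y j - 1| ≤ 40 * β
    · intro j hj
      apply f0_near h0 h1 hy
      have : 16 * q ≤ j := Nat.ceil_le.1 (not_lt.1 hj)
      nlinarith
    have triv : |f0 β y i * f0 β y (n - i) - 1| ≤ 8
    · rw [abs_le]
      constructor
      · linarith [mul_nonneg b3 b4]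
      · nlinarith
    by_cases c1 : i < ⌈16 * q⌉₊
    · rw [if_pos c1]; split_ifs <;> linarith
    by_cases c2 : n - i < ⌈16 * q⌉₊
    · rw [if_pos c2, if_neg c1]; linarith
    rw [if_neg c1, if_neg c2]
    have d1 := near _ c1
    have d2 := near _ c2
    have : f0 β y i * f0 β y (n - i) - 1 = (f0 β y i - 1) * f0 β y (n - i) + (f0 β y (n - i) - 1) := by ring
    rw [this]
    refine (abs_add_le _ _).trans ?_
    rw [abs_mul, abs_of_nonneg b4]
    have : |f0 β y i - 1| * f0 β y (n - i) ≤ (40 * β) * 3 := mul_le_mul d1 ¢ b4 §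
    linarith
  have p3 : |∑ i ∈ ¿n, (f0 β y i * f0 β y (n - i) - 1)| ≤ 160 * β * (n+1) + 16 * ⌈16 * q⌉₊
  · refine (abs_sum _ _).trans ((sum_le_sum p2).trans ?_)
    rw [sum_add, sum_const, card_range, nsmul_eq_mul, sum_add, ← mul_sum, ← mul_sum, sum_boole, sum_boole]
    have c1 : #{i ∈ ¿n | i < ⌈16 * q⌉₊} ≤ ⌈16 * q⌉₊
    · calc _ ≤ #(range ⌈16 * q⌉₊) := card_le_card fun i hi => by simp at hi ⊢; exact hi.2
        _ = _ := card_range _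
    have c2 : #{i ∈ ¿n | n - i < ⌈16 * q⌉₊} ≤ ⌈16 * q⌉₊
    · calc _ ≤ #((range ⌈16 * q⌉₊).image fun j => n - j) := card_le_card fun i hi => by
              simp only [mem_filter, mem_range, mem_image] at hi ⊢
              exact ⟨n - i, hi.2, £⟩
        _ ≤ _ := card_image_le.trans (card_range _).le
    have c1' : (#{i ∈ ¿n | i < ⌈16 * q⌉₊} : ℝ) ≤ ⌈16 * q⌉₊ := by exact_mod_cast c1
    have c2' : (#{i ∈ ¿n | n - i < ⌈16 * q⌉₊} : ℝ) ≤ ⌈16 * q⌉₊ := by exact_mod_cast c2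
    push_cast
    linarith
  have p4 : (⌈16 * q⌉₊ : ℝ) ≤ 17 * q
  · have := Nat.ceil_lt_add_one (a := 16 * q) §
    linarith
  have e : n * ft0 β y n + ∑ i ∈ ¿n, f0 β y i * f0 β y (n - i) - 2 * n =
      n * (ft0 β y n - 1) + ∑ i ∈ ¿n, (f0 β y i * f0 β y (n - i) - 1) + 1 := by
    rw [sum_sub, sum_const, card_range, nsmul_eq_mul]; push_cast; ring
  rw [e, abs_le]
  have q1 := abs_le.1 p1
  have q3 := abs_le.1 p3
  have : 0 ≤ β * n := §
  constructor <;> linarith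
end LN
end

section
open scoped Classical
open Finset Real
namespace LN
local notation "Λ" => ArithmeticFunction.vonMangoldt
section
variable {V : Type} [CommGroup V] [Fintype V] {y : ℝ} {Q : ℕ} {c : ℕ → V} {ν : ℕ} {β : ℝ}
noncomputable def ff (β y : ℝ) (c : ℕ → V) (i : ℕ) (v : V) : ℝ :=
  ϕ V * lam β * exp (-(β * i)) * Sv c (am β ¡y) v i
noncomputable def ft (β y : ℝ) (c : ℕ → V) (n : ℕ) (v : V) : ℝ := ∑ l ∈ ¿n, kp β l * ff β y c (n - l) v
noncomputable def TT (β y : ℝ) (c : ℕ → V) (n : ℕ) (v : V) : ℝ :=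
  n * ft β y c n v + ∑ i ∈ ¿n, (∑ h, ff β y c i h * ff β y c (n - i) (v * h)) / ϕ V
lemma ff_nonneg (h0 : 0 < β) (i : ℕ) (v : V) : 0 ≤ ff β y c i v := by
  have := lam_ge β
  exact mul_nonneg (mul_nonneg (mul_nonneg § ¢) (exp_nonneg _)) (Sv_nonneg _ (am_nonneg _ _) _ _)
lemma ft_nonneg (h0 : 0 < β) (i : ℕ) (v : V) : 0 ≤ ft β y c i v :=
  sum_nonneg fun _ _ => mul_nonneg (kp_nonneg h0 _) (ff_nonneg h0 _ _)
lemma exp_split (β : ℝ) (n i : ℕ) : exp (-(β * (¥n - i))) * exp (-(β * i)) = exp (-(β * n)) := by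
  rw [← exp_add]; congr 1; ring
lemma ft_eq (n : ℕ) (v : V) : ft β y c n v =
    ϕ V * lam β ^ 2 * exp (-(β * n)) * ∑ i ∈ range n, Sv c (am β ¡y) v i := by
  unfold ft
  rw [kp_conv β (fun i => ff β y c i v), mul_sum]
  refine sum_congr rfl fun i _ => ?_
  unfold ff; rw [← exp_split β n i]; ring
lemma sum_ff (i : ℕ) : ∑ v, ff β y c i v = ϕ V * f0 β y i := by
  unfold ff f0; rw [← mul_sum, sum_Sv]; ring
lemma sum_ft (n : ℕ) : ∑ v, ft β y c n v = ϕ V * ft0 β y n := by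
  unfold ft ft0; rw [sum_comm, mul_sum]
  refine sum_congr rfl fun l _ => ?_
  rw [← mul_sum, sum_ff]; ring
lemma sum_TT (n : ℕ) : ∑ v, TT β y c n v =
    ϕ V * (n * ft0 β y n + ∑ i ∈ ¿n, f0 β y i * f0 β y (n - i)) := by
  unfold TT
  rw [sum_add, ← mul_sum, sum_ft, sum_comm, mul_add, mul_sum ¿n]
  congr 1
  · ring
  refine sum_congr rfl fun i _ => ?_
  rw [← sum_div, sum_comm]
  have : ∀ h, ∑ v, ff β y c i h * ff β y c (n - i) (v * h) = ff β y c i h * (ϕ V * f0 β y (n - i))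
  · intro h
    rw [← mul_sum, ← sum_ff (c := c)]
    congr 1
    exact Fintype.sum_equiv (Equiv.mulRight h) _ _ fun v => rfl
  simp only [this]
  rw [← sum_mul, sum_ff]; field_simp
lemma TT_eq (n : ℕ) (v : V) : TT β y c n v = ϕ V * lam β ^ 2 * exp (-(β * n)) *
    (n * ∑ i ∈ range n, Sv c (am β ¡y) v i +
      ∑ i ∈ ¿n, ∑ u, Sv c (am β ¡y) u i * Sv c (am β ¡y) (v * u) (n - i)) := by
  unfold TT
  rw [ft_eq, mul_add, mul_sum ¿n]
  congr 1
  · ring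
  refine sum_congr rfl fun i hi => ?_
  rw [mul_sum, sum_div]
  refine sum_congr rfl fun u _ => ?_
  rw [mem_range] at hi
  unfold ff
  rw [← exp_split β n i, Nat.cast_sub £]; field_simp
lemma CD.S_le (h : CD y Q c ν) (h0 : 0 < β) (h1 : β ≤ 1/16) (v : V) (i : ℕ) :
    ϕ V * lam β ^ 2 * exp (-(β * i)) * Sv c (sm β ¡y) v i ≤ 8 * β * (2 * i + 7) + 4 * β * exp 9100 * y := by
  have hm := cardV_pos (V := V)
  have hl : 0 < lam β := ltl h0 (lam_ge β)
  have hl2 := lam_le2 h0 h1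
  have hy := h.ypos
  have a := (abs_le.1 (h.Sdiff h0 h1 v i)).2
  have b := sm_sum_le h0 h1 ¡y i
  have b' := dR b hm.le
  have s : Sv c (sm β ¡y) v i ≤ 2/β * exp (β * i) * (2 * i + 7) / ϕ V
    + exp 9100 * (y / ϕ V) * (exp (β * i) / β) := ¢
  have l4 : lam β ^ 2 ≤ 4 * β^2
  · have : lam β ≤ 2 * β := by nlinarith
    calc lam β ^ 2 ≤ (2*β)^2 := pow_le_pow_left₀ hl.le this 2
      _ = _ := by ring
  have e1 : exp (-(β * i)) * exp (β * i) = 1 := by rw [← exp_add]; simp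
  calc _ ≤ ϕ V * lam β ^ 2 * exp (-(β * i)) * (2/β * exp (β * i) * (2 * i + 7) / ϕ V
    + exp 9100 * (y / ϕ V) * (exp (β * i) / β)) := mL s §
    _ = lam β ^ 2 * ((2 * (2 * i + 7) + exp 9100 * y) / β) * (exp (-(β * i)) * exp (β * i)) := by field_simp
    _ ≤ 4 * β^2 * ((2 * (2 * i + 7) + exp 9100 * y) / β) := by
        rw [e1, mul_one]; exact mR l4 §
    _ = _ := by field_simp; ring
lemma CD.ff_le (h : CD y Q c ν) (h0 : 0 < β) (h1 : β ≤ 1/16) (v : V) (i : ℕ) :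
    ff β y c i v ≤ exp 9100 + (4 * i + 14) / y := by
  have hl : 0 < lam β := ltl h0 (lam_ge β)
  have hy := h.ypos
  have h2 : 4 * y * Sv c (am β ¡y) v i ≤ Sv c (sm β ¡y) v i
  · unfold Sv; rw [mul_sum]
    refine sum_le_sum fun k hk => ?_
    split_ifs
    · rw [sm_eq]
      refine le_trans ?_ (le_add_of_nonneg_right (dm_nonneg _ _ _))
      unfold um am
      split_ifs with hr
      · rw [mul_comm (4*y)]
        by_cases hk1 : k = 1
        · subst hk1; simp
        · apply mL _ (mul_nonneg Lnn §)
          have hz : ¡y < k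
          · by_contra hc; push Not at hc
            exact hk1 (rough_eq_one hr (mem_Ioc.1 hk).1 hc)
          rw [le_log_iff_exp_le (lt_trans (exp_pos _) hz)]; exact hz.le
      · simp
    · simp
  have a := h.S_le h0 h1 v i
  have b : 4 * y * (lam β * ff β y c i v) ≤ 8 * β * (2 * i + 7) + 4 * β * exp 9100 * y
  · refine le_trans (le_of_eq ?_) ((mL h2 (by positivity :
      0 ≤ ϕ V * lam β ^ 2 * exp (-(β * i)))).trans a)
    unfold ff; ring
  have c' : β * ff β y c i v ≤ lam β * ff β y c i v := mR (lam_ge β) (ff_nonneg h0 _ _)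
  have d : 4 * y * (β * ff β y c i v) ≤ 8 * β * (2 * i + 7) + 4 * β * exp 9100 * y :=
    (mL c' §).trans b
  have e : ff β y c i v = 4 * y * (β * ff β y c i v) / (4 * y * β) := by field_simp
  rw [e, div_le_iff₀ §]
  refine d.trans (le_of_eq ?_)
  field_simp; ring
lemma avg_close {s θ : V → ℝ} {A B t : ℝ} (hs : ∀ v, |s v - (∑ u, s u) / ϕ V| ≤ A)
    (hθ : ∀ v, 0 ≤ θ v ∧ θ v ≤ B) (ht : ∑ v, (s v + θ v) = ϕ V * t) (v : V) : |s v + θ v - t| ≤ A + B := by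
  have hm := cardV_pos (V := V)
  have e : t = (∑ u, s u) / ϕ V + (∑ u, θ u) / ϕ V
  · rw [← add_div, ← sum_add, ht]; field_simp
  have h1 : 0 ≤ (∑ u, θ u) / ϕ V := div_nonneg (sum_nonneg fun u _ => (hθ u).1) hm.le
  have h2 : (∑ u, θ u) / ϕ V ≤ B
  · rw [div_le_iff₀ hm]
    refine (sum_le_sum fun u _ => (hθ u).2).trans (le_of_eq ?_)
    rw [sum_const, card_univ, nsmul_eq_mul]; ring
  have h3 := abs_le.1 (hs v)
  rw [e, abs_le]
  constructor <;> linarith [(hθ v).1, (hθ v).2]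
theorem CD.TT_near (h : CD y Q c ν) (h0 : 0 < β) (h1 : β ≤ 1/16) (hyb : 100 ≤ β^2 * y) (n : ℕ) (v : V) :
    |TT β y c n v - 2 * n| ≤ 300 * β * n + (1100 + 8 * exp 9100) * (y / β) := by
  obtain ⟨hy0, hby, hy1⟩ := by_pos h0 h1 hyb
  have hl : 0 < lam β := ltl h0 (lam_ge β)
  have hl2 : lam β ≤ 2 * β := by have := lam_le2 h0 h1; nlinarith
  set W := ϕ V * lam β ^ 2 * exp (-(β * n)) with hW
  have hW0 : 0 < W := §
  set s : V → ℝ := fun v => W * ∑ i ∈ range n, Sv c (sm β ¡y) v i with hs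
  set θ : V → ℝ := fun v => TT β y c n v - s v with hθ
  have hS : ∀ v, |s v - (∑ u, s u) / ϕ V| ≤ 2 * exp 9100 * y
  · intro v
    have e : s v - (∑ u, s u) / ϕ V = W * ∑ i ∈ range n,
        (Sv c (sm β ¡y) v i - (∑ k ∈ ° (Ex i), sm β ¡y k) / ϕ V) := by
      simp only [hs]
      rw [← mul_sum, sum_comm, sum_sub, mul_sub]
      simp only [sum_Sv]
      rw [← sum_div, mul_div_assoc]
    rw [e, abs_mul, abs_of_pos hW0]
    have b1 : |∑ i ∈ range n, (Sv c (sm β ¡y) v i - (∑ k ∈ ° (Ex i), sm β ¡y k) / ϕ V)|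
        ≤ ∑ i ∈ range n, exp 9100 * (y / ϕ V) * (exp (β * i) / β) :=
      (abs_sum _ _).trans (sum_le_sum fun i _ => h.Sdiff h0 h1 v i)
    refine (mL b1 hW0.le).trans ?_
    have e2 : W * ∑ i ∈ range n, exp 9100 * (y / ϕ V) * (exp (β * i) / β) =
        lam β / β * exp 9100 * y * ∑ l ∈ ¿n, kp β l := by
      have := kp_conv β (fun _ => 1) n
      simp only [mul_one] at this
      rw [this, mul_sum, mul_sum]
      refine sum_congr rfl fun i _ => ?_
      rw [hW, ← exp_split β n i]
      have e1 : exp (-(β * i)) * exp (β * i) = 1 := by rw [← exp_add]; simp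
      field_simp
      linear_combination e1
    rw [e2, kp_sum]
    have : lam β / β ≤ 2 := by rw [div_le_iff₀ h0]; exact hl2
    have a1 : lam β / β * exp 9100 * y ≤ 2 * exp 9100 * y :=
      mR (mR this (exp_nonneg _)) hy0.le
    calc _ ≤ lam β / β * exp 9100 * y * 1 :=
          mL (by linarith [exp_pos (-(β * n))]) §
      _ ≤ _ := by rw [mul_one]; exact a1
  have hT : ∀ v, 0 ≤ θ v ∧ θ v ≤ 20 * β * n + 2 * exp 9100 * y + y
  · intro v
    obtain ⟨z1, z2⟩ := h.Z_bounds β v n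
    obtain ⟨j1, j2⟩ := J_bounds (c := c) β ¡y v n
    have e : ∑ i ∈ range n, Sv c (sm β ¡y) v i = ∑ i ∈ range n, Sv c (um β ¡y) v i +
        ∑ i ∈ range n, Sv c (dm β ¡y) v i := by
      rw [← sum_add]; exact sum_congr rfl fun i _ => Sv_sm _ _ _ _
    simp only [hθ, hs]
    rw [TT_eq, ← hW, ← mul_sub]
    constructor
    · apply mul_nonneg hW0.le; rw [e]; linarith
    · rw [sum_range_succ (fun i => Sv c (dm β ¡y) v i)] at z2
      have d1 : Sv c (dm β ¡y) v n ≤ Sv c (sm β ¡y) v n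
      · rw [Sv_sm]; linarith [Sv_nonneg (c := c) _ (um_nonneg β ¡y) v n]
      refine (mL (b := _) (c := Sv c (sm β ¡y) v n +
        2 * ∑ i ∈ range n, (¥n - i) * Sv c (am β ¡y) v i) (by rw [e]; linarith) hW0.le).trans ?_
      rw [mul_add]
      have a1 := h.S_le h0 h1 v n
      have a2 : W * (2 * ∑ i ∈ range n, (¥n - i) * Sv c (am β ¡y) v i) =
          2 * ∑ i ∈ range n, lam β * exp (-(β * (n - i))) * ((¥n - i) * ff β y c i v) := by
        rw [mul_left_comm, mul_sum]
        congr 1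
        refine sum_congr rfl fun i _ => ?_
        rw [hW, ← exp_split β n i]; unfold ff; ring
      set F := exp 9100 + (4 * n + 14) / y with hF
      have hF0 : 0 < F := §
      have a3 : ∑ i ∈ range n, lam β * exp (-(β * (n - i))) * ((¥n - i) * ff β y c i v) ≤ 2/β * F
      · have : ∑ i ∈ range n, lam β * exp (-(β * (n - i))) * ((¥n - i) * ff β y c i v) ≤
            ∑ i ∈ range n, lam β * exp (-(β * (n - i))) * ((n - i : ℕ) * F) := by
          refine sum_le_sum fun i hi => ?_
          have hi' : i ≤ n := (mem_range.1 hi).le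
          have hin : ¥i ≤ n := by exact_mod_cast hi'
          rw [Nat.cast_sub hi']
          apply mL _ §
          apply mL _ ¢
          refine (h.ff_le h0 h1 v i).trans (add_le_add_right (dR ¢ hy0.le) _)
        refine this.trans ?_
        rw [← kp_conv β (fun i => ((n - i : ℕ) : ℝ) * F) n]
        refine le_trans (le_of_eq ?_) (mR (kp_mom h0 h1 n) hF0.le)
        rw [sum_mul]
        refine sum_congr rfl fun l hl => ?_
        have : n - (n - l) = l := by rw [mem_range] at hl; omega
        rw [this]; ring
      rw [a2]
      have a4 : 2 * (2/β * F) = 4 / β * exp 9100 + (16 * n + 56) / (β * y) := by rw [hF]; field_simp; ring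
      have a5 : 4 / β ≤ y := by rw [div_le_iff₀ h0]; linarith
      have a6 : (16 * n + 56) / (β * y) ≤ β * n + 1
      · rw [div_le_iff₀ §]
        have := nn n
        have := mR hyb this
        linarith
      have a7 : 4 / β * exp 9100 ≤ y * exp 9100 := mR a5 (exp_nonneg _)
      have a8 : 4 * β * exp 9100 * y ≤ 1/4 * exp 9100 * y :=
        mR (mR ¢ (exp_nonneg _)) hy0.le
      have a9 : 0 ≤ β * n := §
      have a10 : 0 < exp 9100 * y := §
      linarith
  have A := avg_close hS hT (t := n * ft0 β y n + ∑ i ∈ ¿n, f0 β y i * f0 β y (n - i))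
    (by rw [← sum_TT (c := c)]; exact sum_congr rfl fun v _ => by simp [hθ]) v
  have B := T0_near h0 h1 hyb n
  have e3 : s v + θ v = TT β y c n v := by simp [hθ]
  rw [e3] at A
  have hq : y ≤ y / β := by rw [le_div_iff₀ h0]; nlinarith
  have hq2 : exp 9100 * y ≤ exp 9100 * (y / β) := mL hq (exp_nonneg _)
  have hA := abs_le.1 A
  have hB := abs_le.1 B
  have a9 : 0 ≤ β * n := §
  have a10 : 0 < exp 9100 * y := §
  rw [abs_le]
  constructor <;> linarith
end
end LN
end

section
open scoped Classical
open Finset Real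
namespace LN
local notation "cf" => PowerSeries.coeff (R := ℝ)
section
variable {β : ℝ}
noncomputable def k2 (β : ℝ) (l : ℕ) : ℝ := if l = 0 then 0 else (¥l - 1) * lam β ^ 2 * exp (-(β * l))
noncomputable def tl (β : ℝ) (n : ℕ) : ℝ := (1 + lam β * n) * exp (-(β * n))
noncomputable def kt (β : ℝ) (R l : ℕ) : ℝ := if l ≤ R then k2 β l else 0
lemma k2_nonneg (l : ℕ) : 0 ≤ k2 β l := by
  unfold k2; split_ifs with h
  · exact le_rfl
  · have : ¥1 ≤ l := by exact_mod_cast Nat.one_le_iff_ne_zero.2 h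
    exact mul_nonneg (mul_nonneg ¢ (sq_nonneg _)) (exp_nonneg _)
lemma tl_pos (h0 : 0 < β) (n : ℕ) : 0 < tl β n := by
  have := lam_ge β; unfold tl
  have : 0 < lam β := ¢
  positivity
lemma k2_step (n : ℕ) : k2 β (n+1) = tl β n - tl β (n+1) := by
  unfold k2 tl
  have e := exp_step β n
  have e2 : exp β = lam β + 1 := by unfold lam; ring
  rw [if_neg £, ← e, e2]; push_cast; ring
lemma k2_sum (n : ℕ) : ∑ l ∈ ¿n, k2 β l = 1 - tl β n := by
  induction n with
  | zero => simp [k2, tl]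
  | succ n ih => rw [sum_range_succ, ih, k2_step]; ring
lemma k2_conv (l : ℕ) : ∑ j ∈ ¿l, kp β j * kp β (l - j) = k2 β l := by
  rw [kp_conv]
  rcases l with _ | l
  · simp [k2]
  rw [sum_range_succ']
  simp only [kp, k2, if_true, mul_zero, add_zero, Nat.add_eq_zero_iff, one_ne_zero, and_false, if_false]
  have : ∀ i ∈ range l, lam β * exp (-(β * ((l+1:ℕ) - (i+1:ℕ)))) * (lam β * exp (-(β * (i+1:ℕ)))) = lam β ^ 2 * exp (-(β * (l+1:ℕ)))
  · intro i _
    rw [← exp_split β (l+1) (i+1)]; ring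
  rw [sum_congr rfl this, sum_const, card_range, nsmul_eq_mul]; push_cast; ring
lemma k2_mom (h0 : 0 < β) (h1 : β ≤ 1/16) (n : ℕ) : ∑ l ∈ ¿n, ¥l * k2 β l ≤ 4/β := by
  have hl : 0 < lam β := ltl h0 (lam_ge β)
  have e : ∀ n : ℕ, ∑ l ∈ ¿n, ¥l * k2 β l = ∑ l ∈ range n, tl β l - n * tl β n
  · intro n
    induction n with
    | zero => simp
    | succ n ih => rw [sum_range_succ, ih, sum_range_succ, k2_step]; push_cast; ring
  have h2 : ∑ l ∈ ¿n, tl β l ≤ ∑ l ∈ ¿n, ((if l = 0 then 1 else 0) + kp β l / lam β + l * kp β l)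
  · refine sum_le_sum fun l _ => ?_
    unfold tl kp
    split_ifs with h
    · subst h; simp
    · apply le_of_eq; field_simp; ring
  rw [sum_add, sum_add, sum_ite_eq', if_pos ¶, ← sum_div, kp_sum] at h2
  have h3 := kp_mom h0 h1 n
  have h4 : (1 - exp (-(β * n))) / lam β ≤ 1/β :=
    div_le_div₀ ¤ (by linarith [exp_pos (-(β * n))]) h0 (lam_ge β)
  have h5 : 1 ≤ 1/β := by rw [le_div_iff₀ h0]; linarith
  rw [sum_range_succ] at h2
  have h6 := tl_pos h0 n
  have h7 : 0 ≤ ¥n * tl β n := §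
  rw [e]
  have : 4/β = 1/β + 1/β + 2/β := by ring
  linarith
lemma tl_le (h0 : 0 < β) (h1 : β ≤ 1/16) (n : ℕ) : n * tl β n ≤ 5/β := by
  have hl2 : lam β ≤ 2 * β := by have := lam_le2 h0 h1; nlinarith
  unfold tl
  set t := β * n with ht
  have ht0 : 0 ≤ t := §
  have h2 := quadratic_le_exp_of_nonneg ht0
  have h3 : lam β * n ≤ 2 * t := by rw [ht]; nlinarith [nn0 (α := ℝ) n]
  have e : ¥n = t / β := by rw [ht]; field_simp
  rw [exp_neg, ← div_eq_mul_inv, ← mul_div_assoc, div_le_iff₀ (exp_pos t)]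
  have h4 : ¥n * (1 + lam β * n) ≤ t / β * (1 + 2 * t)
  · rw [← e]; exact mL ¢ §
  refine h4.trans ?_
  rw [dmd, dmd]
  apply dR _ h0.le
  nlinarith
lemma kt_nonneg (R l : ℕ) : 0 ≤ kt β R l := by
  unfold kt; split_ifs; exacts [k2_nonneg l, le_rfl]
lemma kt_le (R l : ℕ) : kt β R l ≤ k2 β l := by
  unfold kt; split_ifs; exacts [le_rfl, k2_nonneg l]
lemma kt_sum (R : ℕ) : ∑ l ∈ ¿R, kt β R l = 1 - tl β R := by
  rw [← k2_sum]
  exact sum_congr rfl fun l hl => by unfold kt; rw [if_pos (by rw [mem_range] at hl; omega)]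
lemma kt_sum_le (h0 : 0 < β) (R n : ℕ) : ∑ l ∈ ¿n, kt β R l ≤ 1 :=
  (sum_le_sum fun l _ => kt_le R l).trans (by rw [k2_sum]; linarith [tl_pos h0 n])
lemma kt_sum_ge (h0 : 0 < β) (R n : ℕ) : 1 - tl β n - tl β R ≤ ∑ l ∈ ¿n, kt β R l := by
  rcases le_total n R with h | h
  · have : ∑ l ∈ ¿n, kt β R l = 1 - tl β n
    · rw [← k2_sum]
      exact sum_congr rfl fun l hl => by unfold kt; rw [if_pos (by rw [mem_range] at hl; omega)]
    linarith [tl_pos h0 R]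
  · have := sub_sum (range_subset_range.2 (by omega : R+1 ≤ n+1)) fun l _ _ => kt_nonneg (β := β) R l
    rw [kt_sum] at this
    linarith [tl_pos h0 n]
lemma kt_diff (h0 : 0 < β) (R n : ℕ) : ∑ l ∈ ¿n, (k2 β l - kt β R l) ≤ tl β R := by
  rw [sum_sub, k2_sum]
  linarith [kt_sum_ge h0 R n]
lemma kt_var (h0 : 0 < β) (h1 : β ≤ 1/16) (R n : ℕ) :
    ∑ l ∈ range n, |kt β R (l+1) - kt β R l| + kt β R 0 ≤ 20 * β := by
  have hl : 0 < lam β := ltl h0 (lam_ge β)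
  have hl2 : lam β ≤ 2 * β := by have := lam_le2 h0 h1; nlinarith
  have z : kt β R 0 = 0 := by simp [kt, k2]
  have a1 : ∀ l : ℕ, |k2 β (l+1) - k2 β l| ≤ lam β * (kp β l + β * (l * kp β l))
  · intro l
    rcases Nat.eq_zero_or_pos l with h | h
    · subst h; simp [k2, kp]
    have hl1 : ¥1 ≤ l := by exact_mod_cast h
    have e : k2 β (l+1) - k2 β l = lam β ^ 2 * exp (-(β * l)) * (1 - l * (1 - exp (-β)))
    · have e1 : exp (-(β * (l+1:ℕ))) = exp (-(β * l)) * exp (-β) := by rw [← exp_add]; congr 1; push_cast; ring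
      unfold k2; rw [if_neg £, if_neg £, e1]; push_cast; ring
    have e2 : kp β l = lam β * exp (-(β * l)) := by unfold kp; rw [if_neg £]
    rw [e, abs_mul, abs_of_pos §, e2]
    have h2 : 0 ≤ 1 - exp (-β) := by rw [sub_nonneg]; exact exp_le_one_iff.2 ¢
    have h3 : 1 - exp (-β) ≤ β := by linarith [add_one_le_exp (-β)]
    have h4 : ¥l * (1 - exp (-β)) ≤ β * l := by rw [mul_comm β]; exact mL h3 ¢
    have h4' : 0 ≤ ¥l * (1 - exp (-β)) := §
    have h5 : |1 - ¥l * (1 - exp (-β))| ≤ 1 + β * l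
    · rw [abs_le]; constructor <;> linarith
    calc _ ≤ lam β ^ 2 * exp (-(β * l)) * (1 + β * l) := mL h5 §
      _ = _ := by ring
  have a2 : k2 β R ≤ 4 * β
  · unfold k2; split_ifs with h
    · linarith
    have h2 : exp (-(β * R)) * (β * R) ≤ 1
    · rw [exp_neg, ← div_eq_inv_mul, div_le_one (exp_pos _)]; linarith [add_one_le_exp (β * R)]
    have h3 : lam β ^ 2 ≤ 4 * β^2
    · calc lam β ^ 2 ≤ (2*β)^2 := pow_le_pow_left₀ hl.le hl2 2
        _ = _ := by ring
    calc (¥R - 1) * lam β ^ 2 * exp (-(β * R)) ≤ ¥R * (4 * β^2) * exp (-(β * R)) := by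
          apply mR _ (exp_nonneg _)
          exact mul_le_mul ¢ h3 (sq_nonneg _) §
      _ = 4 * β * (exp (-(β * R)) * (β * R)) := by ring
      _ ≤ 4 * β * 1 := mL h2 ¢
      _ = _ := mul_one _
  have a3 : ∀ l : ℕ, |kt β R (l+1) - kt β R l| ≤ lam β * (kp β l + β * (l * kp β l)) + if l = R then 4 * β else 0
  · intro l
    have p : 0 ≤ lam β * (kp β l + β * (l * kp β l)) := (abs_nonneg _).trans (a1 l)
    unfold kt
    by_cases c1 : l + 1 ≤ R
    · rw [if_pos c1, if_pos £, if_neg £, add_zero]; exact a1 l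
    by_cases c2 : l = R
    · subst c2
      rw [if_neg £, if_pos le_rfl, if_pos rfl, zero_sub, abs_neg, abs_of_nonneg (k2_nonneg _)]; linarith
    · rw [if_neg c1, if_neg £, if_neg c2]; simpa using p
  rw [z, add_zero]
  have a4 : ∑ l ∈ range n, |kt β R (l+1) - kt β R l| ≤ ∑ l ∈ ¿n, (lam β * (kp β l + β * (l * kp β l)) + if l = R then 4 * β else 0) :=
    (sub_sum (range_subset_range.2 £) fun _ _ _ => abs_nonneg _).trans (sum_le_sum fun l _ => a3 l)
  rw [sum_add, ← mul_sum, sum_add, ← mul_sum, kp_sum] at a4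
  have a5 : ∑ l ∈ ¿n, (if l = R then 4 * β else 0) ≤ 4 * β
  · rw [sum_ite_eq']; split_ifs <;> linarith
  have a6 := kp_mom h0 h1 n
  have a7 : β * ∑ l ∈ ¿n, ¥l * kp β l ≤ 2
  · calc _ ≤ β * (2/β) := mL a6 h0.le
      _ = 2 := by field_simp
  have a8 : lam β * (1 - exp (-(β * n)) + β * ∑ l ∈ ¿n, ¥l * kp β l) ≤ (2 * β) * 3
  · apply mul_le_mul hl2 (by linarith [exp_pos (-(β * n))]) _ ¢
    have : exp (-(β * n)) ≤ 1 := exp_le_one_iff.2 (by rw [neg_nonpos]; positivity)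
    have : 0 ≤ ∑ l ∈ ¿n, ¥l * kp β l := sum_nonneg fun l _ => mul_nonneg § (kp_nonneg h0 l)
    have := mul_nonneg h0.le this
    linarith
  linarith
end
section
variable {V : Type} [CommGroup V] [Fintype V] {y : ℝ} {c : ℕ → V} {β : ℝ}
lemma smooth (n : ℕ) (v : V) : ∑ l ∈ ¿n, k2 β l * TT β y c (n - l) v =
    ∑ l ∈ ¿n, k2 β l * ((n - l : ℕ) * ft β y c (n - l) v) +
    ∑ i ∈ ¿n, (∑ h, ft β y c i h * ft β y c (n - i) (v * h)) / ϕ V := by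
  set K : PowerSeries ℝ := PowerSeries.mk (kp β)
  set F : V → PowerSeries ℝ := fun h => PowerSeries.mk fun i => ff β y c i h
  have eK : ∀ l, cf l (K * K) = k2 β l
  · intro l; rw [cf_mul, ← k2_conv]; simp [K]
  have eF : ∀ i h, cf i (K * F h) = ft β y c i h
  · intro i h; rw [cf_mul]; simp [K, F, ft]
  have e1 : ∀ h, cf n ((K * K) * (F h * F (v * h))) = cf n ((K * F h) * (K * F (v * h)))
  · intro h; congr 1; ring
  have e2 : ∑ i ∈ ¿n, (∑ h, ft β y c i h * ft β y c (n - i) (v * h)) / ϕ V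
      = (∑ h, cf n ((K * F h) * (K * F (v * h)))) / ϕ V := by
    rw [← sum_div, sum_comm]
    congr 1
    refine sum_congr rfl fun h _ => ?_
    rw [cf_mul]; simp only [eF]
  rw [e2]
  unfold TT
  simp only [mul_add, sum_add]
  congr 1
  have e3 : ∀ h, cf n ((K * F h) * (K * F (v * h))) = ∑ l ∈ ¿n, k2 β l *
      ∑ i ∈ range (n - l + 1), ff β y c i h * ff β y c (n - l - i) (v * h) := by
    intro h
    rw [← e1, cf_mul]
    refine sum_congr rfl fun l _ => ?_
    rw [eK, cf_mul]
    simp [F]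
  rw [sum_congr rfl fun h _ => e3 h, sum_comm, sum_div]
  refine sum_congr rfl fun l _ => ?_
  rw [← mul_sum, mul_div_assoc, sum_comm, sum_div]
end
end LN
end

section
open scoped Classical
open Finset Real
namespace LN
section
variable {V : Type} [CommGroup V] [Fintype V] {y : ℝ} {Q : ℕ} {c : ℕ → V} {ν : ℕ} {β : ℝ}
noncomputable def BB : ℝ := 1100 + 8 * exp 9100
lemma BB_pos : 1100 ≤ BB := by unfold BB; linarith [exp_pos 9100]
noncomputable def Cf (β : ℝ) : ℝ := 2 + 300 * β + BB / β
lemma Cf_ge (h0 : 0 < β) : 2 ≤ Cf β := by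
  have : 0 ≤ BB / β := div_nonneg (by linarith [BB_pos]) h0.le
  unfold Cf; linarith
lemma ft_small (n : ℕ) (v : V) (hn : ¥n ≤ 4 * y) : ft β y c n v = 0 := by
  rw [ft_eq, sum_eq_zero, mul_zero]
  intro i hi
  refine sum_eq_zero fun k hk => ?_
  rw [mem_range] at hi; rw [mem_Ioc] at hk
  have : am β ¡y k = 0
  · unfold am
    split_ifs with h
    · have h2 : ¥k ≤ ¡y
      · refine ((Nat.cast_le.2 hk.2).trans (Ex_le i)).trans (exp_le_exp.2 ?_)
        have : ¥i ≤ n := by exact_mod_cast hi.le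
        linarith
      rw [rough_eq_one h hk.1 h2]; simp
    · rfl
  rw [this]; simp
lemma CD.ft_le (h : CD y Q c ν) (h0 : 0 < β) (h1 : β ≤ 1/16) (hyb : 100 ≤ β^2 * y) (n : ℕ) (v : V) :
    n * ft β y c n v ≤ 2 * n + 300 * β * n + BB * (y / β) := by
  have a := (abs_le.1 (h.TT_near h0 h1 hyb n v)).2
  have b : n * ft β y c n v ≤ TT β y c n v
  · unfold TT
    have : 0 ≤ ∑ i ∈ ¿n, (∑ h, ff β y c i h * ff β y c (n - i) (v * h)) / ϕ V :=
      sum_nonneg fun i _ => div_nonneg (sum_nonneg fun h _ => mul_nonneg (ff_nonneg h0 _ _) (ff_nonneg h0 _ _)) (nn0 _)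
    linarith
  unfold BB; linarith
lemma CD.ft_leC (h : CD y Q c ν) (h0 : 0 < β) (h1 : β ≤ 1/16) (hyb : 100 ≤ β^2 * y) (n : ℕ) (v : V) :
    ft β y c n v ≤ Cf β := by
  obtain ⟨hy0, hby, hy1⟩ := by_pos h0 h1 hyb
  rcases le_or_gt ¥n (4*y) with hn | hn
  · rw [ft_small n v hn]; linarith [Cf_ge h0]
  · have a := h.ft_le h0 h1 hyb n v
    have hn0 : ¥0 < n := ¢
    have : BB * (y / β) ≤ n * (BB / β)
    · rw [mul_div_assoc', mul_div_assoc']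
      refine dR ?_ h0.le
      have := BB_pos
      nlinarith
    refine le_of_mul_le_mul_left ?_ hn0
    unfold Cf; linarith
lemma ft0_dev (h0 : 0 < β) (h1 : β ≤ 1/16) (hyb : 100 ≤ β^2 * y) (n : ℕ) :
    |∑ i ∈ ¿n, (ft0 β y i - 1)| ≤ 50 * β * n + 68 * (y / β) := by
  obtain ⟨hy0, hby, hy1⟩ := by_pos h0 h1 hyb
  have hq : y / β * β = y := by field_simp
  have hq1 : 1600 ≤ y / β := by rw [le_div_iff₀ h0]; nlinarith
  have p : ∀ i ∈ ¿n, |ft0 β y i - 1| ≤ 50 * β + (if β * i < 33 * y then ¥2 else 0)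
  · intro i _
    split_ifs with hi
    · have a := ft0_nonneg (y := y) h0 i
      have b := ft0_le (y := y) h0 h1 i
      rw [abs_le]; constructor <;> linarith
    · linarith [ft0_near h0 h1 hyb (not_lt.1 hi)]
  refine (abs_sum _ _).trans ((sum_le_sum p).trans ?_)
  rw [sum_add, ← sum_filter, sum_const, sum_const, card_range, nsmul_eq_mul, nsmul_eq_mul]
  have hc : (#((¿n).filter fun i : ℕ => β * ¥i < 33 * y) : ℝ) ≤ 33 * (y / β) + 1
  · have : ((¿n).filter fun i : ℕ => β * ¥i < 33 * y) ⊆ range (⌊33 * (y / β)⌋₊ + 1)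
    · intro i hi
      rw [mem_filter] at hi
      rw [mem_range, Nat.lt_succ_iff, Nat.le_floor_iff ¢]
      refine le_of_mul_le_mul_left ?_ h0
      linarith [hi.2]
    have := Nat.cast_le (α := ℝ) |>.2 (card_le_card this)
    rw [card_range, Nat.cast_add, Nat.cast_one] at this
    exact this.trans (by linarith [Nat.floor_le (a := 33 * (y / β)) ¢])
  push_cast
  linarith
lemma conv_sub (n : ℕ) (v : V) :
    ∑ i ∈ ¿n, (∑ h, (ft β y c i h - 1) * (ft β y c (n - i) (v * h) - 1)) / ϕ V =
    ∑ i ∈ ¿n, (∑ h, ft β y c i h * ft β y c (n - i) (v * h)) / ϕ V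
      - 2 * ∑ i ∈ ¿n, (ft0 β y i - 1) - (n + 1) := by
  have e : ∀ i, (∑ h, (ft β y c i h - 1) * (ft β y c (n - i) (v * h) - 1)) / ϕ V =
      (∑ h, ft β y c i h * ft β y c (n - i) (v * h)) / ϕ V - ft0 β y i - ft0 β y (n - i) + 1 := by
    intro i
    have e2 : ∑ h, ft β y c (n - i) (v * h) = ϕ V * ft0 β y (n - i)
    · rw [← sum_ft (c := c)]; exact Fintype.sum_equiv (Equiv.mulLeft v) _ _ fun h => rfl
    have : ∑ h, (ft β y c i h - 1) * (ft β y c (n - i) (v * h) - 1) =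
      ∑ h, ft β y c i h * ft β y c (n - i) (v * h) - ∑ h, ft β y c i h - ∑ h, ft β y c (n - i) (v * h) + ∑ h : V, 1 := by
      rw [← sum_sub, ← sum_sub, ← sum_add]
      exact sum_congr rfl fun h _ => by ring
    rw [this, sum_ft, e2, sum_const, card_univ, nsmul_eq_mul]
    field_simp
  have er : ∑ i ∈ ¿n, ft0 β y (n - i) = ∑ i ∈ ¿n, ft0 β y i
  · rw [← sum_range_reflect (fun i => ft0 β y i) (n+1)]
    exact sum_congr rfl fun i _ => by congr 1
  rw [sum_congr rfl fun i _ => e i, sum_add, sum_sub, sum_sub, sum_const, card_range,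
    er, sum_sub, sum_const, card_range]
  simp only [nsmul_eq_mul]; push_cast; ring
lemma CD.rel (h : CD y Q c ν) (h0 : 0 < β) (h1 : β ≤ 1/16) (hyb : 100 ≤ β^2 * y) (R n : ℕ) (v : V) :
    |n * ∑ l ∈ ¿n, kt β R l * (ft β y c (n - l) v - 1) +
      ∑ i ∈ ¿n, (∑ h, (ft β y c i h - 1) * (ft β y c (n - i) (v * h) - 1)) / ϕ V| ≤
    400 * β * n + (Cf β + 1) * (n * tl β R) + (BB + Cf β + 200) * (y / β) := by
  obtain ⟨hy0, hby, hy1⟩ := by_pos h0 h1 hyb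
  have hq1 : 25600 * (1 / β) ≤ y / β
  · rw [mul_one_div]; exact dR hy1 h0.le
  have hb : 16 ≤ 1 / β := by rw [le_div_iff₀ h0]; linarith
  have hC := Cf_ge h0
  have hC' := h.ft_leC h0 h1 hyb
  rw [conv_sub]
  have e1 := smooth (β := β) (y := y) (c := c) n v
  set CV := ∑ i ∈ ¿n, (∑ h, ft β y c i h * ft β y c (n - i) (v * h)) / ϕ V
  set S2 := ∑ l ∈ ¿n, k2 β l with hS2
  set St := ∑ l ∈ ¿n, kt β R l with hSt
  have d1 : ∑ l ∈ ¿n, kt β R l * (ft β y c (n - l) v - 1) = ∑ l ∈ ¿n, kt β R l * ft β y c (n - l) v - St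
  · rw [hSt, ← sum_sub]; exact sum_congr rfl fun l _ => by ring
  set A := ∑ l ∈ ¿n, kt β R l * ft β y c (n - l) v with hA
  set D := ∑ l ∈ ¿n, (k2 β l - kt β R l) * ft β y c (n - l) v with hD
  set M := ∑ l ∈ ¿n, (l * k2 β l) * ft β y c (n - l) v with hM
  set ML := ∑ l ∈ ¿n, ¥l * k2 β l with hML
  set G := ∑ l ∈ ¿n, k2 β l * (TT β y c (n - l) v - 2 * (n - l : ℕ)) with hG
  have d2 : ∑ l ∈ ¿n, k2 β l * ((n - l : ℕ) * ft β y c (n - l) v) = n * A + n * D - M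
  · rw [hA, hD, hM, mul_sum, mul_sum, ← sum_add, ← sum_sub]
    refine sum_congr rfl fun l hl => ?_
    rw [Nat.cast_sub (by rw [mem_range] at hl; omega)]; ring
  have d3 : ∑ l ∈ ¿n, k2 β l * TT β y c (n - l) v = G + 2 * n * S2 - 2 * ML
  · rw [hG, hS2, hML, mul_sum, mul_sum, ← sum_add, ← sum_sub]
    refine sum_congr rfl fun l hl => ?_
    rw [Nat.cast_sub (by rw [mem_range] at hl; omega)]; ring
  have hS2e : S2 = 1 - tl β n := k2_sum n
  have bD0 : 0 ≤ D := sum_nonneg fun l _ => mul_nonneg (by linarith [kt_le (β := β) R l]) (ft_nonneg h0 _ _)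
  have bD : D ≤ tl β R * Cf β
  · refine le_trans (sum_le_sum fun l _ => mL (hC' _ _) (by linarith [kt_le (β := β) R l])) ?_
    rw [← sum_mul]; exact mR (kt_diff h0 R n) ¢
  have bM0 : 0 ≤ M := sum_nonneg fun l _ => mul_nonneg (mul_nonneg (nn0 _) (k2_nonneg _)) (ft_nonneg h0 _ _)
  have bM : M ≤ 4 / β * Cf β
  · refine le_trans (sum_le_sum fun l _ => mL (hC' _ _) (mul_nonneg (nn0 _) (k2_nonneg _))) ?_
    rw [← sum_mul]; exact mR (k2_mom h0 h1 n) ¢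
  have bL0 : 0 ≤ ML := sum_nonneg fun l _ => mul_nonneg (nn0 _) (k2_nonneg _)
  have bL : ML ≤ 4 / β := k2_mom h0 h1 n
  have hX : 0 ≤ 300 * β * n + BB * (y / β)
  · have := BB_pos; have : 0 ≤ β * n := §
    have : 0 ≤ BB * (y/β) := by apply mul_nonneg <;> linarith
    linarith
  have bG : |G| ≤ 300 * β * n + BB * (y / β)
  · refine (abs_sum _ _).trans ?_
    have : ∀ l ∈ ¿n, |k2 β l * (TT β y c (n - l) v - 2 * (n - l : ℕ))| ≤ k2 β l * (300 * β * n + BB * (y / β))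
    · intro l _
      rw [abs_mul, abs_of_nonneg (k2_nonneg l)]
      refine mL ((h.TT_near h0 h1 hyb _ v).trans ?_) (k2_nonneg l)
      have : ((n - l : ℕ):ℝ) ≤ n := by exact_mod_cast Nat.sub_le _ _
      have := mL this (show 0 ≤ 300 * β by linarith)
      unfold BB; linarith
    refine (sum_le_sum this).trans ?_
    rw [← sum_mul]
    refine mul_le_of_le_one_left hX ?_
    rw [k2_sum]; linarith [tl_pos h0 n]
  have bT := ft0_dev h0 h1 hyb n
  set T := ∑ i ∈ ¿n, (ft0 β y i - 1)
  have bn := tl_le h0 h1 n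
  have bn0 : 0 ≤ n * tl β n := mul_nonneg (nn0 _) (tl_pos h0 n).le
  have bS1 : St ≤ 1 := kt_sum_le h0 R n
  have bS2 : 1 - tl β n - tl β R ≤ St := kt_sum_ge h0 R n
  have hn := nn n
  have bs1 := mL bS1 hn
  have bs2 := mL bS2 hn
  have bd := mL bD hn
  have bd0 := mul_nonneg hn bD0
  have eq : n * (∑ l ∈ ¿n, kt β R l * (ft β y c (n - l) v - 1)) + (CV - 2 * T - (n+1)) =
      G - n * D + M - 2 * ML - 2 * (n * tl β n) + n * (1 - St) - 2 * T - 1 := by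
    rw [d1]
    have : CV = G + 2 * n * S2 - 2 * ML - (n * A + n * D - M) := by rw [← d3, ← d2]; linarith
    rw [this, hS2e]; ring
  rw [eq]
  have f1 : 4 / β = 4 * (1/β) := by ring
  have f2 : 5 / β = 5 * (1/β) := by ring
  rw [f1] at bM bL
  rw [f2] at bn
  have f3 : Cf β * (1/β) * 25600 ≤ Cf β * (y/β)
  · rw [mul_assoc]; exact mL ¢ ¢
  have f5 : 0 ≤ n * tl β R := mul_nonneg hn (tl_pos h0 R).le
  rw [abs_le] at bG bT ⊢
  constructor <;> linarith [bG.1, bG.2, bT.1, bT.2]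
end
end LN
end

section
open scoped Classical
open Finset Real
namespace LN
section
variable {X V : Type} [Fintype X] [CommGroup V] [Fintype V] {y : ℝ} {Q : ℕ} {c : ℕ → V} {ν : ℕ} {β : ℝ} {χ : X → V → ℝ}
lemma trunc_rel (φ : ℕ → V → ℝ) {C : ℝ} (hφ : ∀ i v, |φ i v| ≤ C) (k : ℕ → ℝ) (hk0 : ∀ l, 0 ≤ k l)
    (hk1 : ∀ n, ∑ l ∈ ¿n, k l ≤ 1) (R n1 n : ℕ) (hkR : ∀ l > R, k l = 0) (v : V) :
    |(n * ∑ l ∈ ¿n, k l * φ (n - l) v + ∑ i ∈ ¿n, (∑ h, φ i h * φ (n - i) (v * h)) / ϕ V)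
     - (n * ∑ l ∈ ¿n, k l * (if n1 ≤ n - l then φ (n - l) v else 0) + ∑ i ∈ ¿n,
      (∑ h, (if n1 ≤ i then φ i h else 0) * (if n1 ≤ n - i then φ (n - i) (v * h) else 0)) / ϕ V)|
     ≤ (n1 + R) * C + 2 * n1 * C^2 := by
  have hm := cardV_pos (V := V)
  have hC : 0 ≤ C := (abs_nonneg _).trans (hφ 0 1)
  rw [show ∀ a b a' b' : ℝ, (a + b) - (a' + b') = (a - a') + (b - b') by intros; ring, ← mul_sub, ← sum_sub, ← sum_sub]
  refine (abs_add_le _ _).trans (add_le_add ?_ ?_)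
  · rcases Nat.lt_or_ge n (n1 + R) with hn | hn
    · rw [abs_mul, abs_of_nonneg (nn0 _)]
      have : |∑ l ∈ ¿n, (k l * φ (n - l) v - k l * (if n1 ≤ n - l then φ (n - l) v else 0))| ≤ C
      · have t : ∀ l ∈ ¿n, |k l * φ (n - l) v - k l * (if n1 ≤ n - l then φ (n - l) v else 0)| ≤ k l * C
        · intro l _
          rw [← mul_sub, abs_mul, abs_of_nonneg (hk0 l)]
          refine mL ?_ (hk0 l)
          split_ifs
          · simpa using hC
          · simpa using hφ _ _
        refine (abs_sum _ _).trans ((sum_le_sum t).trans ?_)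
        rw [← sum_mul]; exact mul_le_of_le_one_left hC (hk1 n)
      refine mul_le_mul ?_ this (abs_nonneg _) §
      exact_mod_cast hn.le
    · rw [sum_eq_zero]
      · simp only [mul_zero, abs_zero]; positivity
      · intro l _
        by_cases hl : l ≤ R
        · rw [if_pos £, sub_self]
        · rw [hkR l £]; simp
  · have t : ∀ i ∈ ¿n, |(∑ h, φ i h * φ (n - i) (v * h)) / ϕ V -
        (∑ h, (if n1 ≤ i then φ i h else 0) * (if n1 ≤ n - i then φ (n - i) (v * h) else 0)) / ϕ V| ≤
        (if i < n1 then C^2 else 0) + (if n - i < n1 then C^2 else 0) := by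
      intro i _
      rw [← sub_div, abs_div, abs_of_pos hm, div_le_iff₀ hm, ← sum_sub]
      refine (abs_sum _ _).trans ?_
      have : ∀ h ∈ (univ : Finset V), |φ i h * φ (n - i) (v * h) - (if n1 ≤ i then φ i h else 0) * (if n1 ≤ n - i then φ (n - i) (v * h) else 0)| ≤
        (if i < n1 then C^2 else 0) + (if n - i < n1 then C^2 else 0) := by
        intro h _
        have hp : |φ i h * φ (n - i) (v * h)| ≤ C^2
        · rw [abs_mul, sq]; exact mul_le_mul (hφ _ _) (hφ _ _) (abs_nonneg _) hC
        have hC2 := sq_nonneg C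
        by_cases h1 : n1 ≤ i <;> by_cases h2 : n1 ≤ n - i
        · simp [h1, h2, not_lt.2 h1, not_lt.2 h2]
        · simp only [h1, h2, not_lt.2 h1, not_le.1 h2, if_true, if_false, mul_zero, sub_zero]; linarith
        · simp only [h1, h2, not_lt.2 h2, not_le.1 h1, if_true, if_false, zero_mul, sub_zero]; linarith
        · simp only [h1, h2, not_le.1 h2, not_le.1 h1, if_true, if_false, zero_mul, sub_zero]; linarith
      refine (sum_le_card_nsmul _ _ _ this).trans ?_
      rw [card_univ, nsmul_eq_mul, mul_comm]
    refine (abs_sum _ _).trans ((sum_le_sum t).trans ?_)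
    have r : ∑ i ∈ ¿n, (if n - i < n1 then C^2 else 0) = ∑ i ∈ ¿n, (if i < n1 then C^2 else 0)
    · rw [← sum_range_reflect (fun i => if i < n1 then C^2 else 0) (n+1)]
      exact sum_congr rfl fun i _ => by rfl
    have b : ∑ i ∈ ¿n, (if i < n1 then C^2 else 0) ≤ n1 * C^2
    · rw [← sum_filter, sum_const, nsmul_eq_mul]
      refine mR ?_ (sq_nonneg C)
      have : (¿n).filter (fun i : ℕ => i < n1) ⊆ range n1
      · intro i hi; rw [mem_filter] at hi; exact mem_range.2 hi.2
      have := card_le_card this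
      rw [card_range] at this; exact_mod_cast this
    rw [sum_add, r]; linarith
structure GP (ε δ β y : ℝ) (R n1 N : ℕ) : Prop where
  e0 : 0 < ε
  e1 : ε ≤ 1/10
  d0 : 0 < δ
  de : 10^5 * δ ≤ (ε/4)^4
  b0 : 0 < β
  bd : 1200 * β ≤ δ
  yb : 100 ≤ β^2 * y
  tR : (Cf β + 1) * tl β R ≤ δ / 3
  n1b : BB * (y / β) ≤ δ / 2 * n1
  ha : (BB + Cf β + 200) * (y / β) + (n1 + R) * Cf β + 2 * n1 * Cf β ^ 2 ≤ δ / 3 * N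
  hb : ¥R + 1 ≤ δ * N
  hc : ¥n1 + 4 * R ≤ ε * N
  hd : 33 * y ≤ β * (ε * N - R)
  hf : 4 * y ≤ ε * N
  hg : 2 * ¥R + 3 ≤ 0.1 * N
lemma GP.d1 {ε δ β y : ℝ} {R n1 N : ℕ} (g : GP ε δ β y R n1 N) : δ ≤ 1 / 10^5 := by
  have h1 := g.e1; have h0 := g.e0
  have : (ε/4)^4 ≤ 1 := pow_le_one₀ ¢ ¢
  linarith [g.de]
lemma GP.b1 {ε δ β y : ℝ} {R n1 N : ℕ} (g : GP ε δ β y R n1 N) : β ≤ 1/16 := by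
  have := g.d1; linarith [g.bd]
lemma CD.step1 (h : CD y Q c ν) (hχ : Chars χ) (v₀ : V) {ε δ : ℝ} {R n1 N : ℕ} (g : GP ε δ β y R n1 N) :
    (∃ i ≤ N, N ≤ i + 4 * R ∧ δ < ft β y c i v₀) ∨
    ∃ x, χ x v₀ = 1 ∧ ∑ n ∈ (¿N).filter (fun n : ℕ => ε * N ≤ ¥n ∧ 10 * n ≤ 8 * N),
      (1 + δ + ∑ l ∈ ¿n, kt β R l * hat χ (fun v => ft β y c (n - l) v - 1) x) ≤ ε * N := by
  by_cases hE : ∃ i ≤ N, N ≤ i + 4 * R ∧ δ < ft β y c i v₀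
  · exact Or.inl hE
  right
  push Not at hE
  have h0 := g.b0
  have h1 := g.b1
  have hd1 := g.d1
  have hC := Cf_ge h0
  obtain ⟨hy0, hby, hy1⟩ := by_pos h0 h1 g.yb
  have hn1 : ¥n1 + 4 * R ≤ N := g.hc.trans (by nlinarith [g.e1, nn0 (α := ℝ) N])
  have hn1' : n1 + 4 * R ≤ N := by exact_mod_cast hn1
  have hR0 : ∀ l > R, kt β R l = 0 := fun l hl => by unfold kt; rw [if_neg £]
  have hd0 := g.d0
  have htR : tl β R ≤ δ := by nlinarith [g.tR, tl_pos h0 R]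
  have hφC : ∀ i v, |ft β y c i v - 1| ≤ Cf β := fun i v => by
    have a := ft_nonneg (y := y) (c := c) h0 i v
    have b := h.ft_leC h0 h1 g.yb i v
    rw [abs_le]; constructor <;> linarith
  obtain ⟨x, hx, hs⟩ := dich_V hχ (ε := ε) (δ := δ) (N := N) (R := R) g.e0 g.e1 g.d0 g.de (kt β R) (fun l => kt_nonneg R l)
    (fun n => kt_sum_le h0 R n) hR0 (by rw [kt_sum]; linarith)
    (fun n => (kt_var h0 h1 R n).trans (by linarith [g.bd]))
    g.hb (fun i v => if n1 ≤ i then ft β y c i v - 1 else 0) v₀ (by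
      intro i hi v
      show |(if n1 ≤ i then ft β y c i v - 1 else 0)| ≤ 1 + δ
      split_ifs with hni
      · have a := ft_nonneg (y := y) (c := c) h0 i v
        have b := h.ft_le h0 h1 g.yb i v
        have hni' : ¥n1 ≤ i := by exact_mod_cast hni
        have hn0 : ¥0 < n1
        · have := g.n1b
          have h3 : 0 < BB * (y/β) := mul_pos (by linarith [BB_pos]) (div_pos hy0 h0)
          by_contra hh
          have : δ / 2 * ¥n1 ≤ 0 := mul_nonpos_of_nonneg_of_nonpos ¢ (not_lt.1 hh)
          linarith
        have c1 : ft β y c i v ≤ 2 + δ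
        · have i0 : ¥0 < i := ¢
          refine le_of_mul_le_mul_left ?_ i0
          have : δ/2 * ¥n1 ≤ δ/2 * i := mL hni' ¢
          have : 1200 * β * i ≤ δ * i := mR g.bd i0.le
          have : 0 ≤ δ * i := mul_nonneg hd0.le i0.le
          linarith [g.n1b]
        rw [abs_le]; constructor <;> linarith
      · rw [abs_zero]; linarith)
    (by
      intro n hn v
      have a := h.rel h0 h1 g.yb R n v
      have b := trunc_rel (fun i v => ft β y c i v - 1) hφC (kt β R) (fun l => kt_nonneg R l)
        (fun n => kt_sum_le h0 R n) R n1 n hR0 v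
      have hnN : ¥n ≤ N := by exact_mod_cast hn
      have b1 : 400 * β * n ≤ δ / 3 * N
      · refine mul_le_mul ?_ hnN (nn0 _) ¢
        linarith [g.bd]
      have b2 : (Cf β + 1) * (n * tl β R) ≤ δ / 3 * N
      · rw [mul_left_comm, mul_comm ¥n]
        exact mul_le_mul g.tR hnN (nn0 _) ¢
      have b3 := g.ha
      rw [abs_sub_comm] at b
      have tri := abs_sub_le_iff.1 b
      have a' := abs_le.1 a
      rw [abs_le]
      constructor <;> linarith [tri.1, tri.2, a'.1, a'.2])
    (by
      intro i hi hiN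
      show (if n1 ≤ i then ft β y c i v₀ - 1 else 0) ≤ -1 + δ
      rw [if_pos £]
      linarith [hE i hi hiN])
  refine ⟨x, hx, le_trans (le_of_eq ?_) hs⟩
  refine sum_congr rfl fun n hn => ?_
  rw [mem_filter] at hn
  congr 1
  refine sum_congr rfl fun l _ => ?_
  by_cases hl : l ≤ R
  · congr 2
    have : n1 + 4 * R ≤ n := by exact_mod_cast g.hc.trans hn.2.1
    funext v
    rw [if_pos £]
  · rw [hR0 l £]; simp
end
end LN
end

section
open scoped Classical
open Finset Real
namespace LN
section
variable {X V : Type} [Fintype X] [CommGroup V] [Fintype V] {y : ℝ} {Q : ℕ} {c : ℕ → V} {ν : ℕ} {β : ℝ} {χ : X → V → ℝ}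
lemma Chars.sum_zero (hχ : Chars χ) (x : X) (hx : ∃ h, χ x h ≠ 1) : ∑ h, χ x h = 0 := by
  obtain ⟨u, hu⟩ := hx
  have : ∑ h, χ x (u * h) = ∑ h, χ x h := Fintype.sum_equiv (Equiv.mulLeft u) _ _ fun h => rfl
  simp_rw [hχ.mul, ← mul_sum] at this
  have h2 : (χ x u - 1) * ∑ h, χ x h = 0 := ¢
  exact (mul_eq_zero.1 h2).resolve_left (sub_ne_zero.2 hu)
noncomputable def GG (χ : V → ℝ) (β y : ℝ) (c : ℕ → V) (m : ℕ) : ℝ := (∑ v, (1 + χ v) * ft β y c m v) / ϕ V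
lemma Chars.ge0 (hχ : Chars χ) (x : X) (v : V) : 0 ≤ 1 + χ x v := by
  rcases hχ.pm x v with h | h <;> rw [h] <;> norm_num
lemma GG_nonneg (hχ : Chars χ) (x : X) (h0 : 0 < β) (m : ℕ) : 0 ≤ GG (χ x) β y c m :=
  div_nonneg (sum_nonneg fun v _ => mul_nonneg (hχ.ge0 x v) (ft_nonneg h0 _ _)) (nn0 _)
lemma GG_eq (x : X) (m : ℕ) : GG (χ x) β y c m = ft0 β y m + hat χ (ft β y c m) x := by
  unfold GG hat
  rw [sum_congr rfl fun v _ => add_mul _ _ _, sum_add, add_div]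
  simp only [one_mul]
  rw [sum_ft]; field_simp
lemma GG_ge (hχ : Chars χ) (x : X) (P : Finset ℕ) (hP : ∀ p ∈ P, p.Prime ∧ ¡y < p) (m : ℕ) :
    ∑ p ∈ P, (1 + χ x (c p)) * (log p * ¥p^(-1+β)) * (lam β ^2 * exp (-(β * m)) * (m - ⌈log p⌉₊ : ℕ)) ≤ GG (χ x) β y c m := by
  have hm := cardV_pos (V := V)
  have e1 : GG (χ x) β y c m = lam β ^2 * exp (-(β * m)) * ∑ i ∈ range m, ∑ k ∈ ° (Ex i), (1 + χ x (c k)) * am β ¡y k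
  · have : ∀ i, ∑ k ∈ ° (Ex i), (1 + χ x (c k)) * am β ¡y k = ∑ v, (1 + χ x v) * Sv c (am β ¡y) v i
    · intro i
      unfold Sv
      simp_rw [mul_sum]
      rw [sum_comm]
      refine sum_congr rfl fun k _ => ?_
      simp
    simp_rw [this]
    unfold GG
    rw [sum_comm, div_eq_iff hm.ne', mul_sum, sum_mul]
    refine sum_congr rfl fun v _ => ?_
    rw [ft_eq, ← mul_sum]; ring
  rw [e1]
  have e2 : ∀ i, ∑ p ∈ P, (if ⌈log p⌉₊ ≤ i then (1 + χ x (c p)) * (log p * ¥p^(-1+β)) else 0) ≤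
      ∑ k ∈ ° (Ex i), (1 + χ x (c k)) * am β ¡y k := by
    intro i
    rw [← sum_filter (fun p : ℕ => ⌈log p⌉₊ ≤ i) (fun p : ℕ => (1 + χ x (c p)) * (log p * ¥p^(-1+β)))]
    have : ∀ p ∈ P.filter (fun p : ℕ => ⌈log p⌉₊ ≤ i), (1 + χ x (c p)) * (log p * ¥p^(-1+β)) = (1 + χ x (c p)) * am β ¡y p
    · intro p hp
      rw [mem_filter] at hp
      obtain ⟨hpp, hpz⟩ := hP p hp.1
      unfold am
      rw [if_pos, ArithmeticFunction.vonMangoldt_apply_prime hpp]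
      intro q hq hqp
      rwa [(Nat.prime_dvd_prime_iff_eq hq hpp).1 hqp]
    rw [sum_congr rfl this]
    refine sub_sum ?_ fun k _ _ => mul_nonneg (hχ.ge0 _ _) (am_nonneg _ _ _)
    intro p hp
    rw [mem_filter] at hp
    have := (hP p hp.1).1.pos
    exact mem_Ioc.2 ⟨this, (le_Ex this).2 hp.2⟩
  refine le_trans (le_of_eq ?_) (mL (sum_le_sum fun i _ => e2 i) §)
  rw [sum_comm, mul_sum]
  refine sum_congr rfl fun p _ => ?_
  rw [← sum_filter (fun i : ℕ => ⌈log ¥p⌉₊ ≤ i) (fun i : ℕ => (1 + χ x (c p)) * (log p * ¥p^(-1+β))), sum_const, nsmul_eq_mul]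
  have : (range m).filter (fun i : ℕ => ⌈log ¥p⌉₊ ≤ i) = Ico ⌈log ¥p⌉₊ m
  · ext i; simp only [mem_filter, mem_range, mem_Ico]; tauto
  rw [this, Nat.card_Ico]; ring
lemma CD.step2 (h : CD y Q c ν) (hχ : Chars χ) {ε δ : ℝ} {R n1 N : ℕ} (g : GP ε δ β y R n1 N) (x : X)
    (hs : ∑ n ∈ (¿N).filter (fun n : ℕ => ε * N ≤ ¥n ∧ 10 * n ≤ 8 * N),
      (1 + δ + ∑ l ∈ ¿n, kt β R l * hat χ (fun v => ft β y c (n - l) v - 1) x) ≤ ε * N) :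
    (∃ h, χ x h ≠ 1) ∧ ∑ p ∈ Pr (exp (ε * N)) (exp (0.7 * N)), (1 + χ x (c p)) * (log p / p) ≤ 10 * ε * N := by
  have h0 := g.b0
  have h1 := g.b1
  have hd1 := g.d1
  have hd0 := g.d0
  have hbd := g.bd
  have he1 := g.e1
  have he0 := g.e0
  have hC := Cf_ge h0
  have hg := g.hg
  have hf := g.hf
  obtain ⟨hy0, hby, hy1⟩ := by_pos h0 h1 g.yb
  have hR0 : ∀ l > R, kt β R l = 0 := fun l hl => by unfold kt; rw [if_neg £]
  have htR : tl β R ≤ δ := by nlinarith [g.tR, tl_pos h0 R]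
  set A := (¿N).filter (fun n : ℕ => ε * N ≤ ¥n ∧ 10 * n ≤ 8 * N) with hA
  have hN0 := nn N
  have nt : ∃ h, χ x h ≠ 1
  · by_contra hcon
    push Not at hcon
    have hat1 : ∀ m, hat χ (fun v => ft β y c m v - 1) x = ft0 β y m - 1
    · intro m
      unfold hat
      simp only [hcon, one_mul]
      rw [sum_sub, sum_ft, sum_const, card_univ, nsmul_eq_mul]; field_simp
    have t : ∀ n ∈ A, 1 ≤ 1 + δ + ∑ l ∈ ¿n, kt β R l * hat χ (fun v => ft β y c (n - l) v - 1) x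
    · intro n hn
      rw [hA, mem_filter] at hn
      have : ∑ l ∈ ¿n, kt β R l * (-(50 * β)) ≤ ∑ l ∈ ¿n, kt β R l * hat χ (fun v => ft β y c (n - l) v - 1) x
      · refine sum_le_sum fun l hl => ?_
        by_cases hlR : l ≤ R
        · refine mL ?_ (kt_nonneg R l)
          rw [hat1]
          refine (abs_le.1 (ft0_near h0 h1 g.yb (g.hd.trans (mL ?_ h0.le)))).1
          rw [Nat.cast_sub (by rw [mem_range] at hl; omega)]
          have : ¥l ≤ R := by exact_mod_cast hlR
          linarith [hn.2.1]
        · rw [hR0 l £]; simp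
      rw [← sum_mul] at this
      have k1 := kt_sum_le h0 R n
      have : ∑ l ∈ ¿n, kt β R l * (50 * β) ≤ 50 * β
      · rw [← sum_mul]; exact mul_le_of_le_one_left ¢ k1
      rw [← sum_mul] at this
      linarith
    have t2 := (sum_le_sum t).trans hs
    rw [sum_const, nsmul_eq_mul, mul_one] at t2
    have sub : Ico ⌈ε * ¥N⌉₊ ⌊0.8 * ¥N⌋₊ ⊆ A
    · intro n hn
      rw [mem_Ico] at hn
      have a := Nat.ceil_le.1 hn.1
      have b := (Nat.le_floor_iff ¢).1 hn.2.le
      have c1 : ¥10 * n ≤ 8 * N := ¢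
      have c2 : 10 * n ≤ 8 * N := by exact_mod_cast c1
      rw [hA, mem_filter, mem_range]
      exact ⟨£, a, c2⟩
    have t3 := card_le_card sub
    rw [Nat.card_Ico] at t3
    have t4 : ⌊0.8 * ¥N⌋₊ ≤ #A + ⌈ε * ¥N⌉₊ := £
    have t5 : (⌊0.8 * ¥N⌋₊:ℝ) ≤ #A + ⌈ε * ¥N⌉₊ := by exact_mod_cast t4
    have t6 := Nat.lt_floor_add_one (0.8 * ¥N)
    have t7 := Nat.ceil_lt_add_one (a := ε * ¥N) §
    have : ε * ¥N ≤ 1/10 * N := mR he1 hN0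
    linarith
  refine ⟨nt, ?_⟩
  have s0 := hχ.sum_zero x nt
  have hat2 : ∀ m, hat χ (fun v => ft β y c m v - 1) x = hat χ (ft β y c m) x
  · intro m
    unfold hat
    simp_rw [mul_sub, mul_one]
    rw [sum_sub, s0, sub_zero]
  have t1 : ∑ n ∈ A, ∑ l ∈ ¿n, kt β R l * GG (χ x) β y c (n - l) ≤ ε * N
  · refine le_trans (sum_le_sum fun n _ => ?_) hs
    have : ∑ l ∈ ¿n, kt β R l * ft0 β y (n - l) ≤ 1 + δ
    · have : ∑ l ∈ ¿n, kt β R l * ft0 β y (n - l) ≤ ∑ l ∈ ¿n, kt β R l * (1 + 18 * β) :=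
        sum_le_sum fun l _ => mL (ft0_le h0 h1 _) (kt_nonneg R l)
      rw [← sum_mul] at this
      have k := mR (kt_sum_le h0 R n) (show 0 ≤ 1 + 18 * β by linarith)
      linarith
    simp_rw [GG_eq, hat2, mul_add, sum_add]
    linarith
  set A' := (¿N).filter (fun m : ℕ => ε * N ≤ ¥m ∧ 10 * (m + R) ≤ 8 * N) with hA'
  have t2 : (1 - tl β R) * ∑ m ∈ A', GG (χ x) β y c m ≤ ε * N
  · refine le_trans ?_ t1
    rw [← kt_sum R, sum_mul, sum_comm' (t' := ¿N) (s' := fun l => A.filter fun n : ℕ => l ≤ n)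
      (by
        intro n l
        simp only [hA, mem_filter, mem_range]
        constructor
        · rintro ⟨⟨a, b⟩, d⟩; exact ⟨⟨⟨a, b⟩, £⟩, £⟩
        · rintro ⟨⟨⟨a, b⟩, d⟩, e⟩; exact ⟨⟨a, b⟩, £⟩)]
    have hRN : R ≤ N
    · have : ¥R ≤ N := ¢
      exact_mod_cast this
    refine le_trans (sum_le_sum fun l hl => ?_) (sub_sum (range_subset_range.2 (by omega : R + 1 ≤ N + 1))
      fun l _ _ => sum_nonneg fun n _ => mul_nonneg (kt_nonneg R l) (GG_nonneg hχ x h0 _))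
    rw [← mul_sum]
    refine mL ?_ (kt_nonneg R l)
    have e : ∑ m ∈ A', GG (χ x) β y c m = ∑ n ∈ A'.map (addRightEmbedding l), GG (χ x) β y c (n - l)
    · rw [sum_map]; exact sum_congr rfl fun m _ => ¶
    rw [e]
    refine sub_sum ?_ fun n _ _ => GG_nonneg hχ x h0 _
    intro n hn
    rw [mem_map] at hn
    obtain ⟨m, hm', rfl⟩ := hn
    rw [hA', mem_filter, mem_range] at hm'
    rw [mem_range] at hl
    simp only [addRightEmbedding_apply, hA, mem_filter, mem_range]
    refine ⟨⟨£, ?_, £⟩, £⟩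
    push_cast; linarith [hm'.2.1, nn0 (α := ℝ) l]
  set P := Pr (exp (ε * N)) (exp (0.7 * N)) with hP
  have hPm : ∀ p ∈ P, p.Prime ∧ ε * N < log p ∧ log p ≤ 0.7 * N
  · intro p hp
    rw [hP, mem_Pr (exp_nonneg _)] at hp
    have : ¥0 < p := by exact_mod_cast hp.1.pos
    exact ⟨hp.1, (lt_log_iff_exp_lt this).2 hp.2.1, (log_le_iff_le_exp this).2 hp.2.2⟩
  have t3 : ∑ p ∈ P, (1 + χ x (c p)) * (log p / p) * ((1 - tl β R) * exp (-β)) ≤ ∑ m ∈ A', GG (χ x) β y c m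
  · refine le_trans ?_ (sum_le_sum fun m _ => GG_ge (β := β) (y := y) (c := c) hχ x P (by
      intro p hp
      obtain ⟨a, b, _⟩ := hPm p hp
      exact ⟨a, (lt_log_iff_exp_lt (by exact_mod_cast a.pos)).1 ¢⟩) m)
    rw [sum_comm]
    refine sum_le_sum fun p hp => ?_
    obtain ⟨hpp, hp1, hp2⟩ := hPm p hp
    have hp0 : ¥0 < p := by exact_mod_cast hpp.pos
    have hlp : 0 ≤ log p := log_natCast_nonneg p
    rw [← mul_sum, mul_assoc, mul_assoc (1 + χ x (c p))]
    refine mL ?_ (hχ.ge0 _ _)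
    set j := ⌈log ¥p⌉₊ with hj
    have hj1 : ¥j < log p + 1 := Nat.ceil_lt_add_one hlp
    have hj2 : log p ≤ j := Nat.le_ceil _
    have e3 : exp (-(β * j)) * (1 - tl β R) ≤ ∑ m ∈ A', lam β ^2 * exp (-(β * m)) * (m - j : ℕ)
    · have e : exp (-(β * j)) * (1 - tl β R) ≤ ∑ m ∈ (¿R).map (addRightEmbedding j), lam β ^2 * exp (-(β * m)) * (m - j : ℕ)
      · rw [sum_map, ← k2_sum, mul_sum]
        refine sum_le_sum fun t _ => ?_
        simp only [addRightEmbedding_apply, Nat.add_sub_cancel]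
        push_cast
        rw [show -(β * (¥t + j)) = -(β * j) + -(β * t) by ring, exp_add]
        unfold k2
        split_ifs with ht
        · simp [ht]
        · have : ¥0 ≤ exp (-(β * j)) * exp (-(β * t)) * lam β ^ 2 := §
          nlinarith
      refine e.trans (sub_sum ?_ fun m _ _ => by positivity)
      intro m hm'
      rw [mem_map] at hm'
      obtain ⟨t, ht, rfl⟩ := hm'
      rw [mem_range] at ht
      have htR' : ¥t ≤ R := by exact_mod_cast Nat.lt_succ_iff.1 ht
      have c1 : ¥10 * (t + j + R) ≤ 8 * N := ¢
      have c2 : 10 * (t + j + R) ≤ 8 * N := by exact_mod_cast c1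
      simp only [addRightEmbedding_apply, hA', mem_filter, mem_range]
      refine ⟨£, ?_, c2⟩
      push_cast; linarith [nn0 (α := ℝ) t]
    refine le_trans ?_ (mL e3 (mul_nonneg hlp §))
    have e4 : ¥p^(-1+β) = 1/p * exp (β * log p)
    · rw [rpow_add hp0, rpow_neg_one, rpow_def_of_pos hp0]; rw [mul_comm (log ¥p)]; ring
    rw [e4]
    have e5 : exp (-β) ≤ exp (β * log p) * exp (-(β * j))
    · rw [← exp_add, exp_le_exp]
      nlinarith
    have : 0 ≤ log p / p * (1 - tl β R) := mul_nonneg § ¢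
    have := mL e5 this
    calc _ = log p / p * (1 - tl β R) * exp (-β) := by ring
      _ ≤ _ := this
      _ = _ := by ring
  rw [← sum_mul] at t3
  set S := ∑ p ∈ P, (1 + χ x (c p)) * (log p / p) with hS
  have hS0 : 0 ≤ S := sum_nonneg fun p _ => mul_nonneg (hχ.ge0 _ _) (div_nonneg (log_natCast_nonneg p) (nn0 _))
  have eb : 1/2 ≤ exp (-β) := by linarith [add_one_le_exp (-β)]
  have q1 : 1/2 ≤ 1 - tl β R := ¢
  have q2 : 1/4 ≤ (1 - tl β R) * exp (-β) := by nlinarith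
  have q3 : S * (1/4) ≤ ∑ m ∈ A', GG (χ x) β y c m := (mL q2 hS0).trans t3
  have q4 : 1/2 * ∑ m ∈ A', GG (χ x) β y c m ≤ ε * N :=
    (mR q1 (sum_nonneg fun m _ => GG_nonneg hχ x h0 _)).trans t2
  nlinarith
theorem GP_exists {ε : ℝ} (he0 : 0 < ε) (he : ε ≤ 1/10) : ∃ β δ : ℝ, ∃ R : ℕ, ∃ L Y : ℝ, 0 < β ∧ β ≤ 1/16 ∧ 0 < δ ∧
    0 < L ∧ ∀ (y : ℝ) (N : ℕ), Y ≤ y → L * y ≤ N → ∃ n1, GP ε δ β y R n1 N := by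
  set δ := (ε/4)^4/10^5 with hδ
  have hd0 : 0 < δ := §
  have hd1 : δ ≤ 1
  · have : (ε/4)^4 ≤ 1 := pow_le_one₀ ¢ ¢
    rw [hδ, div_le_one ¤]; linarith
  set β := δ / 1200 with hβ
  have h0 : 0 < β := §
  have h1 : β ≤ 1/16 := by rw [hβ]; linarith
  have hC := Cf_ge h0
  have hB := BB_pos
  set R := ⌈15 * (Cf β + 1) / (β * δ)⌉₊ + 1 with hR
  have hRp : ¥0 < R := by rw [hR]; positivity
  have htR : (Cf β + 1) * tl β R ≤ δ / 3
  · have a := tl_le h0 h1 R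
    have b : 15 * (Cf β + 1) / (β * δ) ≤ R
    · rw [hR]; push_cast; linarith [Nat.le_ceil (15 * (Cf β + 1) / (β * δ))]
    rw [div_le_iff₀ §] at b
    rw [le_div_iff₀ h0] at a
    have c1 : R * tl β R * β * (Cf β + 1) ≤ 5 * (Cf β + 1) := mR a ¢
    have : (R * β) * ((Cf β + 1) * tl β R) ≤ (R * β) * (δ / 3) := ¢
    exact le_of_mul_le_mul_left this §
  set D := 2 * BB / (β * δ) + 1 with hD
  have hDp : 0 < D := §
  set K1 := (BB + Cf β + 200) / β + (D + 1) * Cf β + 2 * D * Cf β ^ 2 with hK1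
  have hK1p : 0 < K1 := §
  have hL : 0 < 3 * K1 / δ + 2 / δ + (D + 4) / ε + (33 / β + 1) / ε + 4 / ε + 50 := §
  refine ⟨β, δ, R, 3 * K1 / δ + 2 / δ + (D + 4) / ε + (33 / β + 1) / ε + 4 / ε + 50, R + 100/β^2 + 1, h0, h1, hd0, hL, ?_⟩
  intro y N hy hN
  have hb2 : 0 < 100/β^2 := §
  have hy0 : 0 < y := ¢
  refine ⟨⌈2 * BB / (β * δ) * y⌉₊, ?_⟩
  have n1a := Nat.le_ceil (2 * BB / (β * δ) * y)
  have n1b := Nat.ceil_lt_add_one (a := 2 * BB / (β * δ) * y) §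
  set n1 := ⌈2 * BB / (β * δ) * y⌉₊
  have p1 : 0 ≤ 3 * K1 / δ * y := §
  have p2 : 0 ≤ 2 / δ * y := §
  have p3 : 0 ≤ (D + 4) / ε * y := §
  have p4 : 0 ≤ (33/β + 1) / ε * y := §
  have p5 : 0 ≤ 4 / ε * y := §
  simp only [add_mul (_ + _) _ y] at hN
  have hN' : 3 * K1 / δ * y + 2 / δ * y + (D + 4) / ε * y + (33/β + 1) / ε * y + 4 / ε * y + 50 * y ≤ N
  · linarith
  have hC0 : 0 ≤ Cf β := ¢
  refine ⟨he0, he, hd0, ?_, h0, ?_, ?_, htR, ?_, ?_, ?_, ?_, ?_, ?_, ?_⟩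
  · rw [hδ]; linarith
  · rw [hβ]; linarith
  · have : 100/β^2 ≤ y := ¢
    rw [div_le_iff₀ §] at this; linarith
  · have : BB * (y / β) = δ / 2 * (2 * BB / (β * δ) * y) := by field_simp
    rw [this]; exact mL n1a §
  · have k : 3 * K1 / δ * y ≤ N := ¢
    have k2 : δ / 3 * (3 * K1 / δ * y) ≤ δ / 3 * N := mL k §
    have k3 : δ / 3 * (3 * K1 / δ * y) = K1 * y := by field_simp
    rw [k3] at k2
    refine le_trans ?_ k2
    have a1 : (¥n1 + R) * Cf β ≤ (D * y + y) * Cf β := mR ¢ hC0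
    have a2 : 2 * ¥n1 * Cf β ^ 2 ≤ 2 * (D * y) * Cf β ^ 2 := mR ¢ §
    have a3 : K1 * y = (BB + Cf β + 200) * (y / β) + (D * y + y) * Cf β + 2 * (D * y) * Cf β ^ 2 := by rw [hK1]; ring
    linarith
  · have k : 2 / δ * y ≤ N := ¢
    have k2 := mL k hd0.le
    have k3 : δ * (2 / δ * y) = 2 * y := by field_simp
    linarith
  · have k : (D + 4) / ε * y ≤ N := ¢
    have k2 := mL k he0.le
    have k3 : ε * ((D + 4) / ε * y) = (D + 4) * y := by field_simp
    linarith
  · have k : (33/β + 1) / ε * y ≤ N := ¢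
    have k2 := mL k he0.le
    have k3 : ε * ((33/β + 1) / ε * y) = (33/β + 1) * y := by field_simp
    have k4 : β * ((33/β) * y) ≤ β * (ε * N - R) := mL ¢ h0.le
    have k5 : β * ((33/β) * y) = 33 * y := by field_simp
    linarith
  · have k : 4 / ε * y ≤ N := ¢
    have k2 := mL k he0.le
    have k3 : ε * (4 / ε * y) = 4 * y := by field_simp
    linarith
  · linarith
end
end LN
end

section
open scoped Classical
open Finset Real
namespace LN
local notation "Λ" => ArithmeticFunction.vonMangoldt
variable {V : Type} [CommGroup V] [Fintype V] {y : ℝ} {Q : ℕ} {c : ℕ → V} {ν : ℕ} {ψ : V → ℝ}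
structure Ps (ψ : V → ℝ) : Prop where
  mul : ∀ u v, ψ (u * v) = ψ u * ψ v
  pm : ∀ v, ψ v = 1 ∨ ψ v = -1
  sz : ∑ v, ψ v = 0
noncomputable def Xc (Q : ℕ) (c : ℕ → V) (ψ : V → ℝ) (k : ℕ) : ℝ := if k.Coprime Q then ψ (c k) else 0
local notation "χ" => Xc Q c ψ
noncomputable def SX (Q : ℕ) (c : ℕ → V) (ψ : V → ℝ) (n : ℕ) : ℝ := ∑ k ∈ ° n, Xc Q c ψ k / k
local notation "S" => SX Q c ψ
lemma Ps.one (s : Ps ψ) : ψ 1 = 1 := by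
  have := s.mul 1 1; rcases s.pm 1 with h | h <;> rw [mul_one, h] at this <;> linarith
lemma CD.Xmul (h : CD y Q c ν) (s : Ps ψ) (m n : ℕ) : χ (m * n) = χ m * χ n := by
  unfold Xc
  simp only [Nat.coprime_mul_iff_left]
  by_cases hm : m.Coprime Q
  · by_cases hn : n.Coprime Q
    · rw [if_pos ⟨hm, hn⟩, if_pos hm, if_pos hn, h.cmul m n hm hn, s.mul]
    · rw [if_neg (fun a => hn a.2), if_neg hn, mul_zero]
  · rw [if_neg (fun a => hm a.1), if_neg hm, zero_mul]
lemma CD.X1 (h : CD y Q c ν) (s : Ps ψ) : χ 1 = 1 := by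
  simp [Xc, h.c1, s.one]
lemma Ps.Xabs (s : Ps ψ) (n : ℕ) : |χ n| ≤ 1 := by
  unfold Xc; split_ifs
  · rcases s.pm (c n) with h | h <;> simp [h]
  · simp
lemma CD.Xsum (h : CD y Q c ν) (s : Ps ψ) (n : ℕ) : |∑ k ∈ ° n, χ k| ≤ Q := by
  have e : ∑ k ∈ ° n, χ k = ∑ v, ψ v * (#{k ∈ ° ⌊¥n⌋₊ | k.Coprime Q ∧ c k = v} - ν * n / Q)
  · simp_rw [mul_sub, sum_sub, ← sum_mul, s.sz, zero_mul, sub_zero, Nat.floor_natCast, card_filter, Nat.cast_sum,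
      mul_sum]
    rw [sum_comm]
    refine sum_congr rfl fun k _ => ?_
    unfold Xc
    by_cases hk : k.Coprime Q
    · rw [if_pos hk]; simp only [eq_true hk, true_and, Nat.cast_ite, mul_ite]; simp
    · simp only [hk, false_and, if_false]; simp
  rw [e]
  refine (abs_sum _ _).trans ?_
  have : ∀ v ∈ univ, |ψ v * (#{k ∈ ° ⌊¥n⌋₊ | k.Coprime Q ∧ c k = v} - ν * n / Q : ℝ)| ≤ ν
  · intro v _
    have := h.count v (nn0 n : ¥0 ≤ n)
    rw [abs_mul]; rcases s.pm v with h | h <;> simpa [h] using this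
  refine (sum_le_sum this).trans ?_
  rw [sum_const, nsmul_eq_mul, card_univ]
  have := h.nuV
  rw [mul_comm, this]
  exact_mod_cast Nat.totient_le Q
lemma CD.Stail (h : CD y Q c ν) (s : Ps ψ) {M N : ℕ} (hM : 1 ≤ M) (hN : M ≤ N) : |S N - S M| ≤ 2 * Q / M := by
  have hM' : ¥0 < M := by exact_mod_cast hM
  have h1 := abel_abs (hM.trans hN) (K0 := Q) (K := 0) χ (fun k => 1 / (max k M : ℕ)) (fun n _ _ => by simpa using h.Xsum s n)
    (fun n _ _ => odl (by exact_mod_cast hM.trans (le_max_right _ _)) (by exact_mod_cast max_le_max_right _ (Nat.le_succ n)))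
    §
  have e : ∀ n, M ≤ n → ∑ k ∈ ° n, χ k * (1 / (max k M : ℕ)) = S n - S M + (∑ k ∈ ° M, χ k) / M
  · intro n hn
    induction n, hn using Nat.le_induction with
    | base =>
      rw [sub_self, zero_add, sum_div]
      exact sum_congr rfl fun k hk => by rw [max_eq_right (mem_Ioc.1 hk).2]; ring
    | succ n hn ih =>
      unfold SX at ih ⊢
      rw [← insI £, sum_insert ¶, sum_insert ¶, ih,
        max_eq_left £]
      ring
  rw [e N hN, zero_mul, add_zero, max_eq_right hM] at h1
  have h2 := (abs_div (∑ k ∈ ° M, χ k) ¥M).le.trans (dR (h.Xsum s M) (abs_nonneg _))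
  rw [abs_of_pos hM'] at h2
  have := abs_sub (S N - S M + (∑ k ∈ ° M, χ k) / M) ((∑ k ∈ ° M, χ k) / M)
  rw [add_sub_cancel_right] at this
  calc _ ≤ _ := this
    _ ≤ Q * (1 / M) + Q / M := add_le_add h1 h2
    _ = _ := by ring
lemma CD.ell (h : CD y Q c ν) (s : Ps ψ) : ∃ l : ℝ, Filter.Tendsto S Filter.atTop (nhds l) ∧ ∀ M : ℕ, 1 ≤ M → |S M - l| ≤ 2 * Q / M := by
  have hc : CauchySeq (fun n => S (n+1))
  · refine cauchySeq_of_le_tendsto_0' (fun M : ℕ => 2 * Q / ((M + 1 : ℕ) : ℝ)) ?_ ?_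
    · intro M N hMN
      rw [dist_comm, dist_eq_norm, norm_eq_abs]
      exact h.Stail s £ £
    · exact (Filter.tendsto_add_atTop_iff_nat (f := fun M : ℕ => (2 * Q / ¥M : ℝ)) 1).2 (tendsto_const_div_atTop_nhds_zero_nat (2 * Q : ℝ))
  obtain ⟨l, hl⟩ := cauchySeq_tendsto_of_complete hc
  replace hl := (Filter.tendsto_add_atTop_iff_nat 1).1 hl
  refine ⟨l, hl, fun M hM => ?_⟩
  rw [abs_sub_comm]
  refine le_of_tendsto ((hl.sub_const _).abs) ?_
  filter_upwards [Filter.eventually_ge_atTop M] with N hN using h.Stail s hM hN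
end LN
end

section
open scoped Classical
open Finset Real
namespace LN
local notation "Λ" => ArithmeticFunction.vonMangoldt
variable {V : Type} [CommGroup V] [Fintype V] {y : ℝ} {Q : ℕ} {c : ℕ → V} {ν : ℕ} {ψ : V → ℝ}
local notation "χ" => Xc Q c ψ
local notation "S" => SX Q c ψ
noncomputable def rr (Q : ℕ) (c : ℕ → V) (ψ : V → ℝ) (n : ℕ) : ℝ := ∑ d ∈ n.divisors, Xc Q c ψ d
local notation "r" => rr Q c ψ
noncomputable def XA (Q : ℕ) (c : ℕ → V) (ψ : V → ℝ) : ArithmeticFunction ℝ := ⟨fun n => if n = 0 then 0 else Xc Q c ψ n, ¶⟩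
lemma CD.Xpow (h : CD y Q c ν) (s : Ps ψ) (p k : ℕ) : χ (p ^ k) = χ p ^ k := by
  induction k with
  | zero => simpa using h.X1 s
  | succ k ih => rw [pow_succ, h.Xmul s, ih, pow_succ]
lemma Ps.X3 (s : Ps ψ) (p : ℕ) : χ p = 0 ∨ χ p = 1 ∨ χ p = -1 := by
  unfold Xc; split_ifs
  · exact Or.inr (s.pm _)
  · simp
lemma CD.rmul (h : CD y Q c ν) (s : Ps ψ) {n : ℕ} (hn : n ≠ 0) : r n = n.factorization.prod fun p k => r (p ^ k) := by
  have hX : (XA Q c ψ).IsMultiplicative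
  · refine ⟨by simp [XA, h.X1 s], fun {m n} _ => ?_⟩
    simp only [XA, ArithmeticFunction.coe_mk]
    by_cases hm : m = 0
    · simp [hm]
    by_cases hn : n = 0
    · simp [hn]
    simp [hm, hn, h.Xmul s]
  have hR := hX.mul (ArithmeticFunction.isMultiplicative_zeta.natCast (R := ℝ))
  have e : ∀ n, (XA Q c ψ * (ArithmeticFunction.zeta : ArithmeticFunction ℝ)) n = r n := fun n => by
    rw [ArithmeticFunction.coe_mul_zeta_apply]
    exact sum_congr rfl fun d hd => if_neg (Nat.pos_of_mem_divisors hd).ne'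
  have := hR.multiplicative_factorization _ hn
  simpa only [e] using this
lemma CD.rpp (h : CD y Q c ν) (s : Ps ψ) {p : ℕ} (hp : p.Prime) (k : ℕ) : 0 ≤ r (p ^ k) ∧ (Even k → 1 ≤ r (p ^ k)) := by
  have e : r (p ^ k) = ∑ i ∈ ¿k, χ p ^ i
  · simp only [rr, Nat.sum_divisors_prime_pow hp, h.Xpow s]
  rw [e]
  rcases s.X3 (Q := Q) (c := c) p with h | h | h <;> rw [h]
  · rw [sum_range_succ']; simp
  · simp; positivity
  · rw [neg_one_geom_sum]
    split_ifs with h1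
    · rw [Nat.even_add_one] at h1; simp [h1]
    · simp
lemma CD.r0 (h : CD y Q c ν) (s : Ps ψ) (n : ℕ) : 0 ≤ r n := by
  by_cases hn : n = 0
  · simp [hn, rr]
  rw [h.rmul s hn]
  exact prod_nonneg fun p hp => (h.rpp s (Nat.prime_of_mem_primeFactors hp) _).1
lemma CD.rsq (h : CD y Q c ν) (s : Ps ψ) {n : ℕ} (hn : n ≠ 0) : 1 ≤ r (n ^ 2) := by
  rw [h.rmul s (pow_ne_zero 2 hn)]
  have : ∀ t : Finset ℕ, (∀ p ∈ t, p.Prime) → 1 ≤ ∏ p ∈ t, r (p ^ (n ^ 2).factorization p)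
  · intro t ht
    calc ¥1 = ∏ p ∈ t, 1 := ¶
      _ ≤ _ := prod_le_prod (fun _ _ => zero_le_one) fun p hp => (h.rpp s (ht p hp) _).2 (by simp [Nat.factorization_pow])
  exact this _ fun p hp => Nat.prime_of_mem_primeFactors hp
noncomputable def kf (v : ℝ) : ℝ := 1 / (exp v - 1) - 1 / v
lemma kf_mem {v : ℝ} (hv : 0 < v) : 0 ≤ kf v + 1 ∧ kf v + 1 ≤ 1 := by
  have h1 := add_one_le_exp v
  have h2 : 0 < exp v - 1 := ¢
  unfold kf
  constructor
  · have h3 := add_one_le_exp (-v)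
    have h4 : exp v * exp (-v) = 1 := by rw [← exp_add]; simp
    have h5 := mL h3 (exp_pos v).le
    have : 1 / v ≤ 1 / (exp v - 1) + 1
    · rw [div_add_one h2.ne', div_le_div_iff₀ hv h2]; nlinarith
    linarith
  · have := odl hv (by linarith : v ≤ exp v - 1)
    linarith
lemma kf_mono : MonotoneOn kf (Set.Ioi 0) := by
  have hd : ∀ v ∈ Set.Ioi ¥0, HasDerivAt kf (-exp v / (exp v - 1) ^ 2 - -1 / v ^ 2) v
  · intro v hv
    have hv : 0 < v := hv
    have h2 : exp v - 1 ≠ 0 := by linarith [add_one_lt_exp hv.ne']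
    unfold kf
    simp only [one_div]
    exact (((hasDerivAt_exp v).sub_const 1).inv h2).sub ((hasDerivAt_id v).inv hv.ne')
  refine monotoneOn_of_deriv_nonneg (convex_Ioi 0) (fun v hv => (hd v hv).continuousAt.continuousWithinAt)
    (fun v hv => (hd v (interior_subset hv)).differentiableAt.differentiableWithinAt) fun v hv => ?_
  rw [interior_Ioi] at hv
  rw [(hd v hv).deriv]
  have hv : 0 < v := hv
  have h2 : 0 < exp v - 1 := by linarith [add_one_lt_exp hv.ne']
  have h3 : v / 2 ≤ sinh (v / 2) := self_le_sinh_iff.2 ¢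
  rw [sinh_eq] at h3
  have e : exp v = exp (v/2) * exp (v/2) := by rw [← exp_add]; ring_nf
  have e2 : exp (v/2) * exp (-(v/2)) = 1 := by rw [← exp_add]; simp
  have h4 : v * exp (v/2) ≤ exp v - 1 := by nlinarith [exp_pos (v/2)]
  have h5 : v ^ 2 * exp v ≤ (exp v - 1) ^ 2
  · calc v ^ 2 * exp v = (v * exp (v/2)) ^ 2 := by rw [e]; ring
      _ ≤ _ := pow_le_pow_left₀ § h4 2
  have : exp v / (exp v - 1) ^ 2 ≤ 1 / v ^ 2
  · rw [div_le_div_iff₀ § §]; linarith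
  rw [neg_div, neg_div]; linarith
lemma CD.lambert (h : CD y Q c ν) (s : Ps ψ) {n M : ℕ} (hn : 1 ≤ n) (hM : n ^ 2 ≤ M) :
    n * exp (-1) - M * exp (-1 / n ^ 2) ^ M / (1 - exp (-1 / n ^ 2)) ≤ n ^ 2 * S M + 3 * Q := by
  have hn2 : ¥0 < ¥n^2 := §
  set q := exp (-1 / n ^ 2) with hq
  have q0 : 0 < q := exp_pos _
  have q1 : q < 1 := by rw [hq, exp_lt_one_iff]; exact div_neg_of_neg_of_pos ¤ hn2
  have hM1 : 1 ≤ M := le_trans (Nat.one_le_pow _ _ hn) hM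
  have qd : ∀ d ∈ ° M, q ^ d ≤ q := fun d hd => pow_le_of_le_one q0.le q1.le (by have := mem_Ioc.1 hd; omega)
  have hk : ∀ d ∈ ° M, q ^ d / (1 - q ^ d) = n ^ 2 / d + kf (d / n ^ 2)
  · intro d hd
    have hd0 : ¥0 < d := by exact_mod_cast (mem_Ioc.1 hd).1
    have := qd d hd
    have e : q ^ d * exp (d / n ^ 2) = 1
    · rw [hq, ← exp_nat_mul, ← exp_add]; simp; field_simp; simp
    have h2 : 0 < exp (d / n ^ 2 : ℝ) - 1
    · have := add_one_lt_exp (div_pos hd0 hn2).ne'; have := div_pos hd0 hn2; linarith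
    have e3 : q ^ d / (1 - q ^ d) = 1 / (exp (d / n ^ 2) - 1)
    · rw [div_eq_div_iff ¢ h2.ne']; linarith
    rw [e3, kf, one_div_div]; ring
  have h1 : ∑ d ∈ ° M, χ d * (q ^ d / (1 - q ^ d)) = n ^ 2 * S M + ∑ d ∈ ° M, χ d * kf (d / n ^ 2)
  · rw [SX, mul_sum, ← sum_add]
    exact sum_congr rfl fun d hd => by rw [hk d hd]; ring
  have h2 : |∑ d ∈ ° M, χ d * (kf (d / n ^ 2) + 1)| ≤ 2 * Q
  · have p : ∀ d : ℕ, 1 ≤ d → ¥0 < d / n ^ 2 := fun d hd => div_pos (by exact_mod_cast hd) hn2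
    refine (abel_mono hM1 χ _ (fun k _ _ => h.Xsum s k) (fun d h1 _ => ?_) (kf_mem (p 1 le_rfl)).1 (kf_mem (p M hM1)).1).trans ?_
    · have := kf_mono (p d h1) (p (d+1) £) (dR ¶ hn2.le)
      linarith
    · have := (kf_mem (p M hM1)).2
      nlinarith
  simp only [mul_add, sum_add, mul_one] at h2
  have h3 := h.Xsum s M
  have h4 : ∑ k ∈ ° M, r k * q ^ k - M * q ^ M / (1 - q) ≤ ∑ d ∈ ° M, χ d * (q ^ d / (1 - q ^ d))
  · have e : ∑ k ∈ ° M, r k * q ^ k = ∑ d ∈ ° M, χ d * ∑ e ∈ ° (M / d), q ^ (d * e)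
    · simp_rw [mul_sum]
      rw [← conv_sum M (fun d e => χ d * q ^ (d * e))]
      refine sum_congr rfl fun k _ => ?_
      rw [rr, ← Nat.sum_divisorsAntidiagonal (fun i _ => χ i), sum_mul]
      exact sum_congr rfl fun x hx => by rw [(mdA.1 hx).1]
    rw [e, sub_le_iff_le_add, ← sub_le_iff_le_add', ← sum_sub]
    have : ∀ d ∈ ° M, χ d * ∑ e ∈ ° (M / d), q ^ (d * e) - χ d * (q ^ d / (1 - q ^ d)) ≤ q ^ M / (1 - q)
    · intro d hd
      have hd' := mem_Ioc.1 hd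
      have := qd d hd
      have e2 : ∑ e ∈ ° (M / d), q ^ (d * e) = q ^ d / (1 - q ^ d) - q ^ (d * (M / d + 1)) / (1 - q ^ d)
      · have e3 : ∀ K, ∑ e ∈ ° K, q ^ (d * e) = q ^ d / (1 - q ^ d) - q ^ (d * (K + 1)) / (1 - q ^ d)
        · intro K
          induction K with
          | zero => simp
          | succ K ih =>
            rw [← insI £, sum_insert ¶, ih]
            have : 1 - q ^ d ≠ 0 := ¢
            field_simp; ring
        exact e3 _
      rw [e2]
      have h5 : 0 ≤ q ^ (d * (M / d + 1)) / (1 - q ^ d) := div_nonneg § ¢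
      have h6 : q ^ (d * (M / d + 1)) / (1 - q ^ d) ≤ q ^ M / (1 - q)
      · refine div_le_div₀ § (pow_le_pow_of_le_one q0.le q1.le (Nat.lt_mul_div_succ M hd'.1).le) ¢ ¢
      have := neg_le_of_abs_le (s.Xabs (Q := Q) (c := c) d)
      nlinarith
    refine (sum_le_sum this).trans ?_
    rw [sum_const, Nat.card_Ioc, nsmul_eq_mul, Nat.sub_zero, mul_div_assoc]
  have h5 : n * exp (-1) ≤ ∑ k ∈ ° M, r k * q ^ k
  · have e : ¥n * exp (-1) = ∑ j ∈ ° n, exp (-1) := ¶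
    rw [e]
    calc _ ≤ ∑ j ∈ ° n, r (j^2) * q ^ (j^2) := sum_le_sum fun j hj => by
          have hj := mem_Ioc.1 hj
          have a := h.rsq s (n := j) £
          have b : exp (-1) ≤ q ^ (j^2)
          · calc exp (-1) = q ^ (n^2) := by rw [hq, ← exp_nat_mul]; congr 1; push_cast; field_simp
              _ ≤ _ := pow_le_pow_of_le_one q0.le q1.le (Nat.pow_le_pow_left hj.2 2)
          nlinarith [exp_pos (-1)]
      _ = ∑ k ∈ (° n).image (· ^ 2), r k * q ^ k := by
          rw [sum_image]; intro a _ b _ hab; exact Nat.pow_left_injective ¤ hab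
      _ ≤ _ := sub_sum (fun k hk => by
          obtain ⟨j, hj, rfl⟩ := mem_image.1 hk
          have hj := mem_Ioc.1 hj
          exact mem_Ioc.2 ⟨Nat.pow_pos hj.1, (Nat.pow_le_pow_left hj.2 2).trans hM⟩) fun k _ _ => mul_nonneg (h.r0 s k) §
  rw [abs_le] at h2 h3
  linarith [h2.2, h3.1]
lemma CD.ell_ge (h : CD y Q c ν) (s : Ps ψ) {l : ℝ} (hl : Filter.Tendsto S Filter.atTop (nhds l)) : 1 / (200 * Q) ≤ l := by
  have hQ := h.Q0
  have hQ1 : 1 ≤ Q := h.Qpos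
  set n := 12 * Q with hn
  have hn' : ¥n = 12 * Q := by rw [hn]; push_cast; ring
  set q := exp (-1 / ¥n ^ 2) with hq
  have q1 : q < 1 := by rw [hq, exp_lt_one_iff]; exact div_neg_of_neg_of_pos ¤ (by rw [hn']; positivity)
  have h1 : ¥n * exp (-1) - 0 / (1 - q) ≤ n ^ 2 * l + 3 * Q
  · refine le_of_tendsto_of_tendsto (tendsto_const_nhds.sub ((tendsto_self_mul_const_pow_of_lt_one (exp_nonneg _) q1).div_const _))
      ((hl.const_mul _).add_const _) ?_
    filter_upwards [Filter.eventually_ge_atTop (n^2)] with M hM using h.lambert s £ hM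
  have h2 : (1/3 : ℝ) ≤ exp (-1)
  · rw [exp_neg, one_div]; exact inv_anti₀ (exp_pos _) (by linarith [exp_one_lt_d9])
  rw [hn', zero_div] at h1
  rw [div_le_iff₀ §]
  have h3 : ¥Q ≤ Q * (144 * Q * l) := by nlinarith
  have h4 := le_of_mul_le_mul_left (by simpa using h3 : ¥Q * 1 ≤ Q * (144 * Q * l)) hQ
  nlinarith
end LN
end

section
open scoped Classical
open Finset Real
namespace LN
local notation "Λ" => ArithmeticFunction.vonMangoldt
variable {V : Type} [CommGroup V] [Fintype V] {y : ℝ} {Q : ℕ} {c : ℕ → V} {ν : ℕ} {ψ : V → ℝ}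
local notation "χ" => Xc Q c ψ
local notation "S" => SX Q c ψ
noncomputable def Cp : ℝ := Chebyshev.psi_sub_theta_le_mul_sqrt.choose
lemma Cp_sp (N : ℕ) : ∑ k ∈ ° N, (if k.Prime then 0 else Λ k) ≤ Cp * √N := by
  have := Chebyshev.psi_sub_theta_le_mul_sqrt.choose_spec N
  rw [Chebyshev.psi_sub_theta_eq_sum_not_prime, sum_filter, Nat.floor_natCast] at this
  exact (sum_congr rfl fun k _ => by split_ifs <;> rfl).le.trans this
lemma Cp0 : 0 ≤ Cp := by have := Cp_sp 1; simp at this; exact this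
lemma Cp_sum (N : ℕ) : ∑ k ∈ ° N, (if k.Prime then 0 else Λ k) / k ≤ 2 * Cp := by
  rcases Nat.eq_zero_or_pos N with h0 | h0
  · subst h0; simp [Cp0]
  have h1 := abel_nonneg (N := N) (fun k => Cp * (√k - √(k - 1)) - if k.Prime then 0 else Λ k) (fun k => 1 / ¥k)
    (fun n _ _ => by
      rw [sum_sub, sub_nonneg, ← mul_sum]
      have : ∀ n : ℕ, ∑ k ∈ ° n, (√¥k - √(¥k - 1)) = √n
      · intro n
        induction n with
        | zero => simp
        | succ n ih => rw [← insI £, sum_insert ¶, ih]; simp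
      rw [this]; exact Cp_sp n)
    (fun n h1 _ => odl (by exact_mod_cast h1) ¶) §
  have h2 : ∀ n : ℕ, 1 ≤ n → ∑ k ∈ ° n, (√¥k - √(¥k - 1)) * (1 / ¥k) ≤ 2 - 1 / √n
  · intro n hn
    induction n, hn using Nat.le_induction with
    | base => norm_num
    | succ n hn ih =>
      rw [← insI £, sum_insert ¶]
      push_cast; rw [add_sub_cancel_right]
      have hn' : ¥0 < n := by exact_mod_cast hn
      set a := √¥n with ha
      set b := √(¥n + 1) with hb
      have a0 : 0 < a := sqrt_pos.2 hn'
      have ab : a ≤ b := sqrt_le_sqrt ¢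
      have b0 : 0 < b := a0.trans_le ab
      have hb2 : ¥n + 1 = b * b := (mul_self_sqrt ¢).symm
      have : (b - a) * (1 / (n + 1)) ≤ 1 / a - 1 / b
      · rw [hb2, div_sub_div _ _ a0.ne' b0.ne', mul_one_div, one_mul, mul_one]
        exact div_le_div_of_nonneg_left ¢ § (mR ab b0.le)
      linarith
  have h3 := h2 N h0
  simp only [sub_mul, sum_sub, mul_assoc, ← mul_sum] at h1 h3
  have h5 := mL (h3.trans (sub_le_self _ §)) Cp0
  have e : ∑ k ∈ ° N, (if k.Prime then 0 else Λ k) / ¥k = ∑ k ∈ ° N, (if k.Prime then 0 else Λ k) * (1 / ¥k) :=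
    sum_congr rfl fun k _ => by ring
  linarith
lemma CD.Q3 (h : CD y Q c ν) : 3 ≤ Q := by
  have := h.y1000
  exact Nat.le_of_dvd h.Qpos ((h.pQ 3 Nat.prime_three).2 (by push_cast; linarith))
lemma Ps.Sle (s : Ps ψ) {n : ℕ} (hn : n ≤ Q) : |S n| ≤ 1 + log Q := by
  rcases Nat.eq_zero_or_pos n with h0 | h0
  · subst h0; simp [SX]; positivity
  have := harmonic_le_one_add_log n
  rw [harmonic_eq_sum_Icc] at this
  push_cast at this
  have h2 := log_le_log (by exact_mod_cast h0) (by exact_mod_cast hn : ¥n ≤ Q)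
  refine le_trans (abs_sum _ _) (le_trans (sum_le_sum fun k hk => ?_) (this.trans ¢))
  rw [abs_div, Nat.abs_cast]
  exact (dR (s.Xabs k) §).trans (by rw [one_div])
variable {l : ℝ}
lemma CD.l_le (h : CD y Q c ν) (s : Ps ψ) (hl : ∀ M : ℕ, 1 ≤ M → |S M - l| ≤ 2 * Q / M) : |l| ≤ 3 + log Q := by
  have hQ : ¥Q ≠ 0 := by exact_mod_cast h.Qpos.ne'
  have h1 := hl Q h.Qpos
  rw [mul_div_assoc, div_self hQ] at h1
  have h2 := s.Sle (Q := Q) (c := c) le_rfl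
  have := abs_sub (S Q) (S Q - l)
  rw [sub_sub_cancel] at this; linarith
lemma CD.Xlog (h : CD y Q c ν) (s : Ps ψ) {N : ℕ} (hN : Q ≤ N) : |∑ k ∈ ° N, χ k * (log k / k)| ≤ log Q * (log Q + 3) := by
  have hQ3 := h.Q3
  have hQ := h.Q0
  have hlQ : 0 ≤ log Q := log_natCast_nonneg Q
  have e3 : exp 1 ≤ 3 := by linarith [exp_one_lt_d9]
  have h1 := abel_abs (h.Qpos.trans_le hN) (K0 := Q) (K := 0) χ (fun k => log (max k Q : ℕ) / (max k Q : ℕ)) (fun n _ _ => by simpa using h.Xsum s n)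
    (fun n _ _ => log_div_self_antitoneOn (e3.trans (by exact_mod_cast hQ3.trans (le_max_right _ _)))
      (e3.trans (by exact_mod_cast hQ3.trans (le_max_right _ _))) (by exact_mod_cast max_le_max_right _ (Nat.le_succ n)))
    (div_nonneg (log_natCast_nonneg _) (nn0 _))
  rw [zero_mul, add_zero, max_eq_right h.Qpos, mul_div_cancel₀ _ hQ.ne'] at h1
  have e : ∑ k ∈ ° N, χ k * (log k / k) - ∑ k ∈ ° N, χ k * (log (max k Q : ℕ) / (max k Q : ℕ))
      = ∑ k ∈ ° Q, χ k * (log k / k - log Q / Q) := by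
    rw [← sum_sub, ← sum_subset (Ioc_subset_Ioc_right hN)]
    · exact sum_congr rfl fun k hk => by rw [max_eq_right (mem_Ioc.1 hk).2]; ring
    · intro k hk hk2
      simp only [mem_Ioc] at hk hk2
      rw [max_eq_left £, sub_self]
  have h2 : |∑ k ∈ ° Q, χ k * (log k / k - log Q / Q)| ≤ log Q * (1 + log Q) + log Q
  · calc _ ≤ ∑ k ∈ ° Q, (log Q * ¥k⁻¹ + log Q / Q) := (abs_sum _ _).trans (sum_le_sum fun k hk => by
            rw [abs_mul]
            have hk := mem_Ioc.1 hk
            have a1 : log k / k ≤ log Q * ¥k⁻¹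
            · rw [div_eq_mul_inv]
              exact mR (log_le_log (by exact_mod_cast hk.1) (by exact_mod_cast hk.2)) §
            have a2 : 0 ≤ log k / k := div_nonneg (log_natCast_nonneg _) (nn0 _)
            have a3 : 0 ≤ log Q / Q := div_nonneg hlQ hQ.le
            calc _ ≤ 1 * |log k / k - log Q / Q| := mR (s.Xabs k) (abs_nonneg _)
              _ ≤ _ := by rw [one_mul, abs_le]; constructor <;> linarith)
      _ = log Q * ∑ k ∈ ° Q, ¥k⁻¹ + log Q := by
          rw [sum_add, mul_sum, sum_const, Nat.card_Ioc, Nat.sub_zero, nsmul_eq_mul, mul_div_cancel₀ _ hQ.ne']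
      _ ≤ _ := by
          have := harmonic_le_one_add_log Q
          rw [harmonic_eq_sum_Icc] at this
          push_cast at this
          have := mL this hlQ
          exact add_le_add_left this _
  rw [← e] at h2
  have := abs_add_le (∑ k ∈ ° N, χ k * (log k / k) - ∑ k ∈ ° N, χ k * (log (max k Q : ℕ) / (max k Q : ℕ))) (∑ k ∈ ° N, χ k * (log (max k Q : ℕ) / (max k Q : ℕ)))
  rw [sub_add_cancel] at this
  linarith
lemma CD.LX (h : CD y Q c ν) (s : Ps ψ) (hl : ∀ M : ℕ, 1 ≤ M → |S M - l| ≤ 2 * Q / M) {N : ℕ} (hN : Q ≤ N) :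
    |l * ∑ d ∈ ° N, Λ d / d * χ d| ≤ 7 * y ^ 2 := by
  have hQ := h.Q0
  have hlQ : 0 ≤ log Q := log_natCast_nonneg Q
  have hy := h.y1000
  have hLy : log Q ≤ 1.4 * y := by rw [log_le_iff_le_exp hQ]; exact h.Qle
  have hN0 : ¥0 < N := by exact_mod_cast h.Qpos.trans_le hN
  have h1 := h.Xlog s hN
  have e : ∑ k ∈ ° N, χ k * (log k / k) = ∑ d ∈ ° N, Λ d / d * χ d * S (N / d)
  · simp_rw [SX, mul_sum]
    rw [← conv_sum N (fun d e => Λ d / d * χ d * (χ e / e))]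
    refine sum_congr rfl fun k hk => ?_
    have h2 : log k = ∑ x ∈ k.divisorsAntidiagonal, Λ x.1
    · have := congrArg (fun f => f k) ArithmeticFunction.vonMangoldt_mul_zeta
      simp only [ArithmeticFunction.coe_mul_zeta_apply] at this
      rw [← ArithmeticFunction.log_apply, ← this, ← Nat.sum_divisorsAntidiagonal (fun i _ => Λ i)]
    rw [h2, sum_div, mul_sum]
    refine sum_congr rfl fun x hx => ?_
    rw [← (mdA.1 hx).1, h.Xmul s]; push_cast
    rw [dmd, div_mul_div_comm, mul_div_assoc']; congr 1; ring
  have hK : ∀ u : ℕ, 1 ≤ u → |S u - l| ≤ 4 + 2 * log Q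
  · intro u hu
    rcases le_total u Q with h2 | h2
    · have := abs_sub (S u) l
      linarith [s.Sle (c := c) h2, h.l_le s hl]
    · have : 2 * Q / ¥u ≤ 2
      · rw [div_le_iff₀ (by exact_mod_cast hu)]
        have : ¥Q ≤ u := by exact_mod_cast h2
        linarith
      linarith [hl u hu]
  have h3 : |∑ d ∈ ° N, Λ d / d * χ d * (S (N / d) - l)| ≤ ∑ d ∈ ° (N / Q), Λ d * (4 * Q / N) + ∑ d ∈ Ioc (N / Q) N, Λ d / d * (4 + 2 * log Q)
  · have hs : ° N = ° (N / Q) ∪ Ioc (N / Q) N := (Ioc_union_Ioc_eq_Ioc (Nat.zero_le _) (Nat.div_le_self _ _)).symm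
    rw [hs, sum_union (by rw [disjoint_left]; intro a ha hb; exact absurd (mem_Ioc.1 ha).2 (not_le.2 (mem_Ioc.1 hb).1))]
    have hb : ∀ d : ℕ, |Λ d / d * χ d * (S (N / d) - l)| ≤ Λ d / d * |S (N / d) - l|
    · intro d
      have p : 0 ≤ Λ d / ¥d := div_nonneg Lnn (nn0 _)
      rw [abs_mul, abs_mul, abs_of_nonneg p]
      exact mR ((mL (s.Xabs d) p).trans (by rw [mul_one])) (abs_nonneg _)
    refine (abs_add_le _ _).trans (add_le_add ((abs_sum _ _).trans (sum_le_sum fun d hd => ?_)) ((abs_sum _ _).trans (sum_le_sum fun d hd => ?_)))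
    · have hd := mem_Ioc.1 hd
      have hd0 : ¥0 < d := by exact_mod_cast hd.1
      have hdN : d ≤ N := hd.2.trans (Nat.div_le_self _ _)
      have hu : 1 ≤ N / d := (Nat.one_le_div_iff hd.1).2 hdN
      have hu2 : ¥N ≤ 2 * d * (N / d : ℕ)
      · have := Nat.lt_mul_div_succ N hd.1
        have : N ≤ 2 * d * (N / d) := by nlinarith
        exact_mod_cast this
      refine (hb d).trans ?_
      rw [dmd, mul_div_assoc]
      refine mL ?_ Lnn
      rw [div_le_iff₀ hd0]
      refine (hl _ hu).trans ?_
      have hu0 : ¥0 < (N / d : ℕ) := by exact_mod_cast hu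
      rw [dmd, div_le_div_iff₀ hu0 hN0]
      have := mL hu2 hQ.le
      linarith
    · have hd := mem_Ioc.1 hd
      refine (hb d).trans (mL (hK _ ((Nat.one_le_div_iff ((Nat.zero_le _).trans_lt hd.1)).2 hd.2)) (div_nonneg Lnn (nn0 _)))
  have h4 : ∑ d ∈ ° (N / Q), Λ d * (4 * Q / N) ≤ 24
  · have := Chebyshev.psi_le_const_mul_self (x := ¥N / Q) §
    rw [Chebyshev.psi, Nat.floor_div_eq_div] at this
    have l4 : log 4 ≤ 2 := by rw [show ¥4 = 2 * 2 by norm_num, log_mul ¤ ¤]; linarith [log_two_lt_d9]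
    rw [← sum_mul]
    calc _ ≤ (log 4 + 4) * (N / Q) * (4 * Q / N) := mR this §
      _ = 4 * (log 4 + 4) := by field_simp
      _ ≤ _ := ¢
  have h5 : ∑ d ∈ Ioc (N / Q) N, Λ d / d ≤ log Q + 14
  · have m1 := mertens (x := N) (by exact_mod_cast h.Qpos.trans_le hN)
    have m2 := mertens (x := ¥N / Q) (by rw [le_div_iff₀ hQ]; simpa using hN)
    rw [Nat.floor_natCast] at m1
    rw [Nat.floor_div_eq_div, log_div hN0.ne' hQ.ne'] at m2
    have := sum_Ioc_consecutive (fun d => Λ d / ¥d) (Nat.zero_le _) (Nat.div_le_self N Q)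
    rw [abs_le] at m1 m2
    linarith
  have h6 : l * ∑ d ∈ ° N, Λ d / d * χ d = ∑ k ∈ ° N, χ k * (log k / k) - ∑ d ∈ ° N, Λ d / d * χ d * (S (N / d) - l)
  · rw [e, ← sum_sub, mul_sum]; exact sum_congr rfl fun d _ => by ring
  rw [h6]
  rw [← sum_mul (Ioc (N / Q) N)] at h3
  have h7 := mR h5 (by linarith : 0 ≤ 4 + 2 * log Q)
  refine (abs_sub _ _).trans ?_
  nlinarith
lemma CD.Nle (h : CD y Q c ν) (s : Ps ψ) (hl0 : 0 < l) (hl : ∀ M : ℕ, 1 ≤ M → |S M - l| ≤ 2 * Q / M) {ε : ℝ} {N : ℕ}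
    (he : ε ≤ 1 / 100) (hf : 4 * y ≤ ε * N)
    (hs : ∑ p ∈ Pr (exp (ε * N)) (exp (0.7 * N)), (1 + ψ (c p)) * (log p / p) ≤ 10 * ε * N) :
    N ≤ (50 + 8 * Cp) * (y ^ 2 / l) := by
  have hQ := h.Q0
  have hy := h.y1000
  have hLy : log Q ≤ 1.4 * y := by rw [log_le_iff_le_exp hQ]; exact h.Qle
  have hN0 := nn N
  have hab : exp (ε * N) ≤ exp (0.7 * N) := exp_le_exp.2 (by nlinarith)
  have hQa : ¥Q ≤ exp (ε * N) := h.Qle.trans (exp_le_exp.2 ¢)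
  have hya : y ≤ exp (ε * N) := by linarith [add_one_le_exp (ε * N)]
  have key : ∀ t, exp (ε * N) ≤ t → |∑ d ∈ ° ⌊t⌋₊, Λ d / d * χ d| ≤ 7 * (y ^ 2 / l)
  · intro t ht
    have := h.LX s hl (Nat.le_floor (hQa.trans ht))
    rw [abs_mul, abs_of_pos hl0] at this
    rw [mul_div_assoc', le_div_iff₀ hl0]; linarith
  have k1 := key _ le_rfl
  have k2 := key _ hab
  have m1 := mertens (x := exp (ε * N)) (one_le_exp ¢)
  have m2 := mertens (x := exp (0.7 * N)) (one_le_exp ¢)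
  rw [log_exp] at m1 m2
  have hfl := Nat.floor_le_floor hab
  have s1 := sum_Ioc_consecutive (fun d => Λ d / ¥d) (Nat.zero_le _) hfl
  have s2 := sum_Ioc_consecutive (fun d => Λ d / ¥d * χ d) (Nat.zero_le _) hfl
  have s3 : ∑ d ∈ Ioc ⌊exp (ε * N)⌋₊ ⌊exp (0.7 * N)⌋₊, (Λ d / d + Λ d / d * χ d) ≤
      ∑ p ∈ Pr (exp (ε * N)) (exp (0.7 * N)), (1 + ψ (c p)) * (log p / p) + 2 * (2 * Cp) := by
    have e1 : Pr (exp (ε * N)) (exp (0.7 * N)) = (Ioc ⌊exp (ε * N)⌋₊ ⌊exp (0.7 * N)⌋₊).filter Nat.Prime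
    · ext p
      rw [mem_Pr (exp_nonneg _), mem_filter, mem_Ioc, Nat.floor_lt (exp_nonneg _), Nat.le_floor_iff (exp_nonneg _)]; tauto
    rw [e1, sum_filter]
    have e2 : ∑ k ∈ Ioc ⌊exp (ε * N)⌋₊ ⌊exp (0.7 * N)⌋₊, (if k.Prime then 0 else Λ k) / ¥k ≤ 2 * Cp :=
      (sub_sum (Ioc_subset_Ioc_left (Nat.zero_le _)) fun k _ _ => div_nonneg (by
        split_ifs; exacts [le_rfl, Lnn]) (nn0 _)).trans (Cp_sum _)
    have e3 := mL e2 (by norm_num : ¥0 ≤ 2)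
    refine le_trans ?_ (add_le_add_right e3 _)
    rw [mul_sum, ← sum_add]
    refine sum_le_sum fun d hd => ?_
    rw [mem_Ioc, Nat.floor_lt (exp_nonneg _)] at hd
    by_cases hp : d.Prime
    · rw [if_pos hp, if_pos hp, ArithmeticFunction.vonMangoldt_apply_prime hp, Xc, if_pos (h.cop hp (hya.trans_lt hd.1))]
      apply le_of_eq; ring
    · rw [if_neg hp, if_neg hp]
      have p : 0 ≤ Λ d / ¥d := div_nonneg Lnn (nn0 _)
      have := mL (abs_le.1 (s.Xabs (Q := Q) (c := c) d)).2 p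
      linarith
  rw [sum_add] at s3
  rw [abs_le] at k1 k2 m1 m2
  have hl2 := (le_abs_self l).trans (h.l_le s hl)
  have h1 : 1 ≤ y ^ 2 / l := by rw [le_div_iff₀ hl0]; nlinarith
  have := Cp0
  have a1 := mL h1 this
  have a2 := mR he hN0
  obtain ⟨b1, b2⟩ := k1
  obtain ⟨b3, b4⟩ := k2
  obtain ⟨b5, b6⟩ := m1
  obtain ⟨b7, b8⟩ := m2
  clear hl key
  generalize y ^ 2 / l = Y at *
  linarith
end LN
end

section
open scoped Classical
open Finset Real
namespace LN
variable {V : Type} [CommGroup V] [Fintype V] {y : ℝ} {Q : ℕ} {c : ℕ → V} {ν : ℕ} {ψ : V → ℝ} {l : ℝ}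
local notation "χ" => Xc Q c ψ
local notation "S" => SX Q c ψ
local notation "r" => rr Q c ψ
lemma CD.hecke (h : CD y Q c ν) (s : Ps ψ) {p m : ℕ} (hp : p.Prime) (hm : m ≠ 0) :
    r (p * m) = (1 + χ p) * r m - χ p * if p ∣ m then r (m / p) else 0 := by
  have h1 : (p * m).divisors = m.divisors ∪ m.divisors.image (p * ·)
  · ext d
    simp only [Nat.mem_divisors, mem_union, mem_image, ne_eq, mul_eq_zero, hp.ne_zero, hm, or_self, not_false_eq_true, and_true]
    constructor
    · intro hd
      by_cases hpd : p ∣ d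
      · obtain ⟨e, rfl⟩ := hpd
        exact Or.inr ⟨e, Nat.dvd_of_mul_dvd_mul_left hp.pos hd, rfl⟩
      · exact Or.inl (Nat.Coprime.dvd_of_dvd_mul_left ((hp.coprime_iff_not_dvd.2 hpd).symm) hd)
    · rintro (hd | ⟨e, he, rfl⟩)
      · exact hd.mul_left p
      · exact mul_dvd_mul_left p he
  have inj : ∀ t : Finset ℕ, Set.InjOn (p * ·) (t : Set ℕ) := fun t a _ b _ hab => Nat.eq_of_mul_eq_mul_left hp.pos hab
  have h2 : ∀ t : Finset ℕ, ∑ d ∈ t.image (p * ·), χ d = χ p * ∑ d ∈ t, χ d := fun t => by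
    rw [sum_image (inj t), mul_sum]; exact sum_congr rfl fun d _ => h.Xmul s p d
  have h3 := sum_union_inter (s₁ := m.divisors) (s₂ := m.divisors.image (p * ·)) (f := χ)
  rw [h2] at h3
  have h4 : ∑ d ∈ m.divisors ∩ m.divisors.image (p * ·), χ d = χ p * if p ∣ m then r (m / p) else 0
  · split_ifs with hpm
    · obtain ⟨k, rfl⟩ := hpm
      have hk : k ≠ 0 := by rintro rfl; simp at hm
      rw [Nat.mul_div_cancel_left _ hp.pos, rr, ← h2]
      refine sum_congr ?_ fun _ _ => rfl
      ext d
      simp only [Nat.mem_divisors, mem_inter, mem_image, ne_eq, mul_eq_zero, hp.ne_zero, hk, or_self, not_false_eq_true, and_true]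
      constructor
      · rintro ⟨h5, e, h6, rfl⟩
        exact ⟨e, Nat.dvd_of_mul_dvd_mul_left hp.pos h5, rfl⟩
      · rintro ⟨e, h6, rfl⟩
        exact ⟨mul_dvd_mul_left p h6, e, h6.mul_left p, rfl⟩
    · rw [mul_zero]
      apply sum_eq_zero
      intro d hd
      simp only [mem_inter, mem_image, Nat.mem_divisors] at hd
      obtain ⟨h5, e, h6, rfl⟩ := hd
      exact absurd ((dvd_mul_right p e).trans h5.1) hpm
  rw [h4] at h3
  unfold rr at h3 ⊢
  rw [h1]; linarith
lemma CD.hyper (h : CD y Q c ν) (s : Ps ψ) (hl : ∀ M : ℕ, 1 ≤ M → |S M - l| ≤ 2 * Q / M) {v : V} (hv : ψ v = 1) {X : ℝ} (hX : 0 ≤ X) :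
    |∑ n ∈ ° ⌊X⌋₊, (if n.Coprime Q ∧ c n = v then r n else 0) - 2 * (ν / Q) * l * X| ≤ 12 * ν * √X := by
  have hQ := h.Q0
  have hν : ¥0 ≤ ν := nn0 _
  rcases lt_or_ge X 1 with hX1 | hX1
  · have h1 := h.l_le s hl
    have h2 := log_le_sub_one_of_pos hQ
    have h3 : ¥3 ≤ Q := by exact_mod_cast h.Q3
    have h4 : X ≤ √X := le_sqrt_of_sq_le (by nlinarith)
    rw [Nat.floor_eq_zero.2 hX1, Ioc_self, sum_empty, zero_sub, abs_neg, abs_mul, abs_mul, abs_of_nonneg hX, abs_of_nonneg §]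
    calc 2 * (ν / Q) * |l| * X ≤ 2 * (ν / Q) * (2 * Q) * √X := by
          refine mul_le_mul (mL ¢ §) h4 hX §
      _ = 4 * ν * √X := by field_simp; ring
      _ ≤ _ := mR ¢ (sqrt_nonneg _)
  set M := ⌊X⌋₊ with hM
  set U := M.sqrt with hU
  have hM1 : 1 ≤ M := Nat.le_floor (by simpa using hX1)
  have hU1 : 1 ≤ U := Nat.sqrt_pos.2 hM1
  have hUM : U * U ≤ M := Nat.sqrt_le M
  have hMU : M < (U + 1) * (U + 1) := Nat.lt_succ_sqrt M
  have hU0 : ¥0 < U := by exact_mod_cast hU1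
  have hUX : ¥U ≤ √X
  · apply le_sqrt_of_sq_le
    calc ¥U^2 = ((U * U : ℕ) : ℝ) := by push_cast; ring
      _ ≤ M := by exact_mod_cast hUM
      _ ≤ X := Nat.floor_le hX
  have hXU : √X ≤ 2 * U
  · rw [sqrt_le_left §]
    calc X ≤ M + 1 := (Nat.lt_floor_add_one X).le
      _ ≤ ((U + 1) * (U + 1) : ℕ) := by exact_mod_cast hMU
      _ ≤ (2 * U) ^ 2 := by
        have : ¥1 ≤ U := by exact_mod_cast hU1
        push_cast; nlinarith
  let P : ℕ → ℕ → Prop := fun d e => (d.Coprime Q ∧ e.Coprime Q) ∧ c d * c e = v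
  let F : ℕ → ℕ → ℝ := fun d e => if P d e then χ d else 0
  have e1 : ∑ n ∈ ° M, (if n.Coprime Q ∧ c n = v then r n else 0) = ∑ d ∈ ° M, ∑ e ∈ ° (M / d), F d e
  · rw [← conv_sum M F]
    refine sum_congr rfl fun n _ => ?_
    have : ∀ x ∈ n.divisorsAntidiagonal, F x.1 x.2 = if n.Coprime Q ∧ c n = v then χ x.1 else 0
    · intro x hx
      rw [← (mdA.1 hx).1]
      refine if_congr (Iff.trans ?_ (and_congr_left' Nat.coprime_mul_iff_left.symm)) rfl rfl
      refine ⟨fun a => ⟨a.1, ?_⟩, fun a => ⟨a.1, ?_⟩⟩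
      · rw [h.cmul _ _ a.1.1 a.1.2]; exact a.2
      · rw [← h.cmul _ _ a.1.1 a.1.2]; exact a.2
    rw [sum_congr rfl this, Nat.sum_divisorsAntidiagonal (fun i _ => if n.Coprime Q ∧ c n = v then χ i else 0), rr]
    split_ifs <;> simp
  have e2 : ∑ d ∈ ° M, ∑ e ∈ ° (M / d), F d e = ∑ d ∈ ° U, (∑ e ∈ ° (M / d), F d e + ∑ e ∈ Ioc U (M / d), F e d)
  · rw [sum_add, ← sum_Ioc_consecutive _ (Nat.zero_le U) (show U ≤ M by nlinarith)]
    congr 1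
    apply sum_comm'
    intro d e
    simp only [mem_Ioc]
    constructor
    · rintro ⟨⟨a1, a2⟩, a3, a4⟩
      rw [ldi £] at a4
      refine ⟨⟨a1, ?_⟩, a3, ?_⟩
      · rw [ldi a3, mul_comm]; exact a4
      · by_contra hc
        have := Nat.mul_le_mul (show U + 1 ≤ e by omega) (show U + 1 ≤ d by omega)
        omega
    · rintro ⟨⟨a1, a2⟩, a3, a4⟩
      rw [ldi a3] at a2
      refine ⟨⟨a1, (Nat.le_mul_of_pos_right d a3).trans a2⟩, a3, ?_⟩
      rw [ldi £, mul_comm]; exact a2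
  let n0 : V → ℕ → ℝ := fun u T => #{n ∈ ° T | n.Coprime Q ∧ c n = u}
  have hn0 : ∀ u (X : ℝ), 0 ≤ X → |n0 u ⌊X⌋₊ - ν * X / Q| ≤ ν := fun u X hX => h.count u hX
  have hsum : ∀ u a (T : ℕ), ∑ e ∈ ° T, (if e.Coprime Q ∧ c e = u then a else 0) = a * n0 u T
  · intro u a T
    rw [← sum_filter, sum_const, nsmul_eq_mul, mul_comm]
  have hP1 : ∀ d e, F d e = if e.Coprime Q ∧ c e = v * c d then χ d else 0
  · intro d e
    simp only [F, P]
    by_cases hd : d.Coprime Q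
    · refine if_congr ?_ rfl rfl
      constructor
      · rintro ⟨⟨-, a⟩, b⟩; exact ⟨a, by rw [← b, mul_comm, ← mul_assoc, h.vsq, one_mul]⟩
      · rintro ⟨a, b⟩; exact ⟨⟨hd, a⟩, by rw [b, mul_comm, mul_assoc, h.vsq, mul_one]⟩
    · rw [show χ d = 0 from if_neg hd]; simp
  have hP2 : ∀ d e, F e d = if e.Coprime Q ∧ c e = v * c d then χ d else 0
  · intro d e
    rw [← hP1]
    simp only [F, P]
    have : ((e.Coprime Q ∧ d.Coprime Q) ∧ c e * c d = v) ↔ ((d.Coprime Q ∧ e.Coprime Q) ∧ c d * c e = v)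
    · rw [mul_comm (c e)]; tauto
    rw [if_congr this rfl rfl]
    split_ifs with hh
    · rw [Xc, Xc, if_pos hh.1.1, if_pos hh.1.2]
      have := s.mul (c d) (c e)
      rw [hh.2, hv] at this
      rcases s.pm (c d) with a | a <;> rcases s.pm (c e) with b | b <;> rw [a, b] at this ⊢ <;> norm_num at this
    · rfl
  have key : ∀ d ∈ ° U, |(∑ e ∈ ° (M / d), F d e + ∑ e ∈ Ioc U (M / d), F e d) - (2 * (ν * X / Q) * (χ d / d) - ν * U / Q * χ d)| ≤ 3 * ν
  · intro d hd
    have hd := mem_Ioc.1 hd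
    have hd0 : ¥0 < d := by exact_mod_cast hd.1
    have hUd : U ≤ M / d := by rw [ldi hd.1]; exact (Nat.mul_le_mul_left U hd.2).trans hUM
    have a1 := sum_Ioc_consecutive (fun e => F e d) (Nat.zero_le _) hUd
    have a2 : ∀ T, ∑ e ∈ ° T, F e d = χ d * n0 (v * c d) T := fun T => by rw [← hsum]; exact sum_congr rfl fun e _ => hP2 d e
    have a3 : ∀ T, ∑ e ∈ ° T, F d e = χ d * n0 (v * c d) T := fun T => by rw [← hsum]; exact sum_congr rfl fun e _ => hP1 d e
    rw [a2, a2] at a1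
    rw [eq_sub_of_add_eq' a1, a3]
    have b1 := hn0 (v * c d) (X / d) §
    have b2 := hn0 (v * c d) U §
    rw [Nat.floor_div_natCast, ← hM] at b1
    rw [Nat.floor_natCast] at b2
    have e : χ d * n0 (v * c d) (M / d) + (χ d * n0 (v * c d) (M / d) - χ d * n0 (v * c d) U) - (2 * (ν * X / Q) * (χ d / d) - ν * U / Q * χ d)
      = χ d * (2 * (n0 (v * c d) (M / d) - ν * (X / d) / Q) - (n0 (v * c d) U - ν * U / Q)) := by ring
    rw [e, abs_mul]
    refine (mR (s.Xabs d) (abs_nonneg _)).trans ?_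
    rw [one_mul, abs_le]; rw [abs_le] at b1 b2
    constructor <;> linarith
  rw [e1, e2]
  have k1 : |∑ d ∈ ° U, ((∑ e ∈ ° (M / d), F d e + ∑ e ∈ Ioc U (M / d), F e d) - (2 * (ν * X / Q) * (χ d / d) - ν * U / Q * χ d))| ≤ U * (3 * ν)
  · refine (abs_sum _ _).trans ((sum_le_sum key).trans ?_)
    rw [sum_const, Nat.card_Ioc, nsmul_eq_mul, Nat.sub_zero]
  rw [sum_sub, sum_sub (fun d : ℕ => 2 * (ν * X / Q) * (χ d / d)), ← mul_sum, ← mul_sum, show ∑ d ∈ ° U, χ d / d = S U from rfl] at k1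
  have k2 : |ν * U / Q * ∑ d ∈ ° U, χ d| ≤ ν * U
  · rw [abs_mul, abs_of_nonneg §]
    refine (mL (h.Xsum s U) §).trans (le_of_eq ?_)
    field_simp
  have k3 : |2 * (ν * X / Q) * (S U - l)| ≤ 8 * ν * √X
  · rw [abs_mul, abs_of_nonneg §]
    refine (mL (hl U hU1) §).trans ?_
    have e : 2 * (ν * X / Q) * (2 * Q / U) = 4 * ν * (X / U) := by field_simp; ring
    have : X / U ≤ 2 * √X
    · rw [div_le_iff₀ hU0]
      calc X = √X * √X := (mul_self_sqrt hX).symm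
        _ ≤ √X * (2 * U) := mL hXU (sqrt_nonneg _)
        _ = _ := by ring
    rw [e]; nlinarith
  rw [abs_le] at k1 k2 k3 ⊢
  have k4 := mL hUX hν
  have e : 2 * (ν * X / Q) * (S U - l) = 2 * (ν * X / Q) * S U - 2 * (ν / Q) * l * X := by ring
  rw [e] at k3
  constructor <;> linarith
end LN
end

section
open scoped Classical
open Finset Real
namespace LN
variable {V : Type} [CommGroup V] [Fintype V] {y : ℝ} {Q : ℕ} {c : ℕ → V} {ν : ℕ} {ψ : V → ℝ} {l : ℝ}
local notation "χ" => Xc Q c ψ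
local notation "S" => SX Q c ψ
local notation "r" => rr Q c ψ
noncomputable def AD (Q : ℕ) (c : ℕ → V) (ψ : V → ℝ) (D : Finset ℕ) (X : ℝ) (v : V) : ℝ :=
  ∑ n ∈ ° ⌊X⌋₊, if (n.Coprime Q ∧ c n = v) ∧ ∀ q ∈ D, q ∣ n then rr Q c ψ n else 0
noncomputable def gg (c : ℕ → V) (ψ : V → ℝ) (p : ℕ) : ℝ := (1 + ψ (c p)) / p - ψ (c p) / p ^ 2
lemma sum_dvd_ite (N p : ℕ) (hp : 0 < p) (f : ℕ → ℝ) :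
    ∑ n ∈ ° N, (if p ∣ n then f n else 0) = ∑ m ∈ ° (N / p), f (p * m) := by
  rw [← sum_Ioc_dvd N p hp f, sum_filter]
lemma CD.AD_rec (h : CD y Q c ν) (s : Ps ψ) {D : Finset ℕ} {p : ℕ} (hp : p.Prime) (hpy : y < p)
    (hD : ∀ q ∈ D, q.Prime) (hpD : p ∉ D) (X : ℝ) (v : V) :
    AD Q c ψ (insert p D) X v = (1 + ψ (c p)) * AD Q c ψ D (X / p) (v * c p) - ψ (c p) * AD Q c ψ D (X / p / p) v := by
  have hpc := h.cop hp hpy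
  have hχ : χ p = ψ (c p) := if_pos hpc
  have hP : ∀ v m, ((p * m).Coprime Q ∧ c (p * m) = v) ∧ (∀ q ∈ D, q ∣ p * m) ↔ (m.Coprime Q ∧ c m = v * c p) ∧ ∀ q ∈ D, q ∣ m
  · intro v m
    have a : (∀ q ∈ D, q ∣ p * m) ↔ ∀ q ∈ D, q ∣ m
    · refine forall₂_congr fun q hq => ?_
      have : q ≠ p := by rintro rfl; exact hpD hq
      exact ⟨fun hd => Nat.Coprime.dvd_of_dvd_mul_left ((Nat.coprime_primes (hD q hq) hp).2 this) hd, fun hd => hd.mul_left p⟩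
    rw [a]
    refine and_congr_left' ⟨fun ⟨b, d⟩ => ?_, fun ⟨b, d⟩ => ?_⟩
    · have b := (Nat.coprime_mul_iff_left.1 b).2
      exact ⟨b, by rw [← d, h.cmul _ _ hpc b, mul_comm (c p), mul_assoc, h.vsq, mul_one]⟩
    · exact ⟨Nat.coprime_mul_iff_left.2 ⟨hpc, b⟩, by rw [h.cmul _ _ hpc b, d, mul_comm, mul_assoc, h.vsq, mul_one]⟩
  have e1 : AD Q c ψ (insert p D) X v = ∑ m ∈ ° ⌊X / p⌋₊, if (m.Coprime Q ∧ c m = v * c p) ∧ ∀ q ∈ D, q ∣ m then r (p * m) else 0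
  · unfold AD
    rw [Nat.floor_div_natCast]
    calc _ = ∑ n ∈ ° ⌊X⌋₊, (if p ∣ n then (if (n.Coprime Q ∧ c n = v) ∧ ∀ q ∈ D, q ∣ n then r n else 0) else 0) := by
          refine sum_congr rfl fun n _ => ?_
          rw [← ite_and]
          refine if_congr ?_ rfl rfl
          rw [forall_mem_insert]; tauto
      _ = _ := by
          rw [sum_dvd_ite _ _ hp.pos]
          exact sum_congr rfl fun m _ => if_congr (hP v m) rfl rfl
  have e2 : AD Q c ψ D (X / p / p) v = ∑ m ∈ ° ⌊X / p⌋₊, if p ∣ m then (if (m.Coprime Q ∧ c m = v * c p) ∧ ∀ q ∈ D, q ∣ m then r (m / p) else 0) else 0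
  · rw [sum_dvd_ite _ _ hp.pos, AD, Nat.floor_div_natCast]
    refine sum_congr rfl fun m _ => ?_
    rw [Nat.mul_div_cancel_left _ hp.pos]
    refine if_congr ((Iff.trans (hP _ m) ?_).symm) rfl rfl
    rw [mul_assoc, h.vsq, mul_one]
  rw [e1, e2, AD, mul_sum, mul_sum, ← sum_sub]
  refine sum_congr rfl fun m hm => ?_
  rw [h.hecke s hp (mem_Ioc.1 hm).1.ne', hχ]
  split_ifs <;> ring
lemma CD.AD_err (h : CD y Q c ν) (s : Ps ψ) (hl : ∀ M : ℕ, 1 ≤ M → |S M - l| ≤ 2 * Q / M) {D : Finset ℕ} (hD : ∀ p ∈ D, p.Prime ∧ y < p) :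
    ∀ v, ψ v = 1 → ∀ X, 0 ≤ X → |AD Q c ψ D X v - 2 * (ν / Q) * l * X * ∏ p ∈ D, gg c ψ p| ≤ 12 * ν * √X * 3 ^ #D := by
  induction D using Finset.induction_on with
  | empty =>
    intro v hv X hX
    have := h.hyper s hl hv hX
    simpa [AD] using this
  | insert p D hpD ih =>
    intro v hv X hX
    have ih := ih fun q hq => hD q (mem_ins hq)
    have hp := hD p (mem_insert_self _ _)
    have hp1 : ¥1 ≤ p := by exact_mod_cast hp.1.one_lt.le
    rw [h.AD_rec s hp.1 hp.2 (fun q hq => (hD q (mem_ins hq)).1) hpD, prod_insert hpD, card_insert_of_notMem hpD, gg]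
    set G := ∏ q ∈ D, gg c ψ q
    have hν : ¥0 ≤ 12 * ν := §
    have s1 : √(X / p) ≤ √X := sqrt_le_sqrt (div_le_self hX hp1)
    have s2 : √(X / p / p) ≤ √X := (sqrt_le_sqrt (div_le_self § hp1)).trans s1
    have i2 := (ih v hv (X / p / p) §).trans (mR (mL s2 hν) §)
    rw [pow_succ ¥3]
    rcases s.pm (c p) with hc | hc
    · have i1 := (ih (v * c p) (by rw [s.mul, hv, hc, one_mul]) (X / p) §).trans (mR (mL s1 hν) §)
      rw [hc]
      have e : 2 * (ν / Q) * l * X * (((1 + 1) / p - 1 / ¥p ^ 2) * G) = 2 * (2 * (ν / Q) * l * (X / p) * G) - 2 * (ν / Q) * l * (X / p / p) * G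
      · field_simp; ring
      rw [e]
      rw [abs_le] at i1 i2 ⊢
      constructor <;> linarith
    · rw [hc]
      have e : 2 * (ν / Q) * l * X * (((1 + -1) / p - -1 / ¥p ^ 2) * G) = 2 * (ν / Q) * l * (X / p / p) * G
      · field_simp; ring
      rw [e]
      rw [abs_le] at i2 ⊢
      constructor <;> linarith
noncomputable def MM (c : ℕ → V) (ψ : V → ℝ) (y l : ℝ) (Q ν : ℕ) (w : ℝ) : ℝ := 2 * (ν / Q) * l * ∏ p ∈ Pr y w, (1 - gg c ψ p)
noncomputable def RS (Q : ℕ) (c : ℕ → V) (ψ : V → ℝ) (w X : ℝ) (v : V) : ℝ :=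
  ∑ n ∈ ° ⌊X⌋₊, if Rough w n ∧ c n = v then rr Q c ψ n else 0
lemma Ps.gb (s : Ps ψ) {p : ℕ} (hp : p.Prime) : 0 ≤ gg c ψ p ∧ gg c ψ p ≤ 2 / p ∧ (1 - 1 / ¥p) ^ 2 ≤ 1 - gg c ψ p := by
  have hp1 : ¥2 ≤ p := by exact_mod_cast hp.two_le
  unfold gg
  have a1 : 0 < 1 / ¥p := §
  have a2 : 1 / ¥p ≤ 1 / 2 := odl ¤ hp1
  have e : 1 / ¥p ^ 2 = (1 / ¥p) ^ 2 := by rw [one_div_pow]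
  have e2 : 2 / ¥p = 2 * (1 / p) := by ring
  rcases s.pm (c p) with h | h <;> rw [h]
  · rw [show (1 + 1) / ¥p = 2 * (1 / p) by ring, e, e2]; refine ⟨?_, ?_, ?_⟩ <;> nlinarith
  · rw [show (1 + -1) / ¥p - -1 / p ^ 2 = 1 / p ^ 2 by ring, e, e2]; refine ⟨?_, ?_, ?_⟩ <;> nlinarith
lemma CD.RS_err (h : CD y Q c ν) (s : Ps ψ) (hl0 : 0 ≤ l) (hl : ∀ M : ℕ, 1 ≤ M → |S M - l| ≤ 2 * Q / M) {w : ℝ} (hw : y ≤ w)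
    {v : V} (hv : ψ v = 1) {X : ℝ} (hX : 0 ≤ X) :
    |RS Q c ψ w X v - MM c ψ y l Q ν w * X| ≤ 1 / 2 * (MM c ψ y l Q ν w * X) + 12 * ν * √X * w ^ 272 := by
  have hs := sieve h.hy hw 1 ((° ⌊X⌋₊).filter fun n : ℕ => n.Coprime Q ∧ c n = v) r (gg c ψ)
    (2 * (ν / Q) * l * X) (12 * ν * √X) (fun n _ => h.r0 s n)
    (fun p hp => by have := s.gb (c := c) ((mem_Pr h.ypos.le).1 hp).1; exact ⟨this.1, this.2.1⟩) § § ?_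
  · have e1 : RS Q c ψ w X v = ∑ n ∈ ((° ⌊X⌋₊).filter fun n : ℕ => n.Coprime Q ∧ c n = v) with ∀ p ∈ Pr y w, ¬ p ∣ n, r n
    · rw [RS, filter_filter, sum_filter]
      exact sum_congr rfl fun n _ => if_congr (by rw [h.rough_iff hw]; tauto) rfl rfl
    have e2 : MM c ψ y l Q ν w * X = 2 * (ν / Q) * l * X * ∏ p ∈ Pr y w, (1 - gg c ψ p) := by rw [MM]; ring
    rw [e1, e2]; simpa using hs
  · intro D hD
    have hD' : ∀ p ∈ D, p.Prime ∧ y < p := fun p hp => ⟨((mem_Pr h.ypos.le).1 (hD hp)).1, ((mem_Pr h.ypos.le).1 (hD hp)).2.1⟩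
    have := h.AD_err s hl hD' v hv X hX
    rw [filter_filter, sum_filter]
    refine this.trans (mL ?_ §)
    calc ¥3 ^ #D ≤ ∏ p ∈ D, ¥p ^ 2 := by
          rw [← prod_const]
          refine prod_le_prod (fun _ _ => by norm_num) fun p hp => ?_
          have : ¥2 ≤ p := by exact_mod_cast (hD' p hp).1.two_le
          nlinarith
      _ = _ := prod_pow _ _ _
end LN
end

section
open scoped Classical
open Finset Real
namespace LN
variable {V : Type} [CommGroup V] [Fintype V] {y : ℝ} {Q : ℕ} {c : ℕ → V} {ν : ℕ} {ψ : V → ℝ} {l : ℝ}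
local notation "χ" => Xc Q c ψ
local notation "S" => SX Q c ψ
local notation "r" => rr Q c ψ
lemma sum_inv_le (N : ℕ) : ∑ d ∈ ° N, 1 / ¥d ≤ 1 + log N := by
  have := harmonic_le_one_add_log N
  rw [harmonic_eq_sum_Icc] at this
  push_cast at this
  simp only [one_div]; exact this
lemma Ps.rsum (s : Ps ψ) (N : ℕ) : ∑ n ∈ ° N, r n ≤ N * (1 + log N) := by
  calc ∑ n ∈ ° N, r n ≤ ∑ n ∈ ° N, ∑ x ∈ n.divisorsAntidiagonal, ¥1 := sum_le_sum fun n _ => by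
        rw [rr, ← Nat.sum_divisorsAntidiagonal (fun i _ => χ i)]
        exact sum_le_sum fun d _ => (abs_le.1 (s.Xabs _)).2
    _ = ∑ d ∈ ° N, ∑ e ∈ ° (N / d), ¥1 := conv_sum N fun _ _ => 1
    _ ≤ ∑ d ∈ ° N, N * (1 / ¥d) := sum_le_sum fun d _ => by
        rw [sum_const, Nat.card_Ioc, Nat.sub_zero, nsmul_eq_mul, mul_one, mul_one_div]; exact Nat.cast_div_le
    _ ≤ _ := by rw [← mul_sum]; exact mL (sum_inv_le N) (nn0 _)
noncomputable def TP (Q : ℕ) (c : ℕ → V) (ψ : V → ℝ) (w x : ℝ) (v : V) (p : ℕ) : ℝ :=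
  ∑ m ∈ ° ⌊x / p⌋₊, if Rough w m ∧ c m = v * c p then rr Q c ψ (p * m) else 0
lemma CD.RS_le (h : CD y Q c ν) (s : Ps ψ) {w x : ℝ} (hw : y ≤ w) (hx : 1 ≤ x) (v : V) :
    RS Q c ψ w x v ≤ 1 + 2 * #{p ∈ ° ⌊x⌋₊ | p.Prime ∧ c p = v} + ∑ p ∈ Pr w √x, TP Q c ψ w x v p := by
  have hw0 : 0 ≤ w := h.ypos.le.trans hw
  have h1 : ∀ n ∈ ° ⌊x⌋₊, (if Rough w n ∧ c n = v then r n else 0) ≤ (if n = 1 then 1 else 0) + 2 * (if n.Prime ∧ c n = v then 1 else 0)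
      + ∑ p ∈ Pr w √x, if p ∣ n then (if Rough w n ∧ c n = v then r n else 0) else 0 := by
    intro n hn
    have hn := mem_Ioc.1 hn
    have hx' : ¥n ≤ x := (Nat.le_floor_iff ¢).1 hn.2
    have r0 := h.r0 s n
    have h0 : ∀ p ∈ Pr w √x, 0 ≤ if p ∣ n then (if Rough w n ∧ c n = v then r n else 0) else 0 := fun p _ => by split_ifs <;> simp [r0]
    by_cases hr : Rough w n ∧ c n = v
    · have t0 := sum_nonneg h0
      rw [if_pos hr] at t0
      by_cases h2 : n = 1
      · rw [if_pos hr, if_pos h2]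
        have : r n = 1 := by simp [h2, rr, h.X1 s]
        have : ¥0 ≤ 2 * if n.Prime ∧ c n = v then 1 else 0 := by split_ifs <;> norm_num
        linarith
      by_cases hp : n.Prime
      · rw [if_pos hr, if_neg h2, if_pos ⟨hp, hr.2⟩]
        have : r n ≤ 2
        · rw [rr, hp.sum_divisors, h.X1 s]
          linarith [(abs_le.1 (s.Xabs (Q := Q) (c := c) n)).2]
        linarith
      · have hm := Nat.minFac_prime h2
        have hmem : n.minFac ∈ Pr w √x
        · rw [mem_Pr hw0]
          refine ⟨hm, hr.1 _ hm (Nat.minFac_dvd n), le_sqrt_of_sq_le ?_⟩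
          have := Nat.minFac_sq_le_self hn.1 hp
          exact le_trans (by exact_mod_cast this) hx'
        have := single_le_sum h0 hmem
        rw [if_pos (Nat.minFac_dvd n)] at this
        have a : ¥0 ≤ 2 * if n.Prime ∧ c n = v then 1 else 0 := by split_ifs <;> norm_num
        rw [if_neg h2]
        linarith
    · rw [if_neg hr]
      have a : ¥0 ≤ 2 * if n.Prime ∧ c n = v then 1 else 0 := by split_ifs <;> norm_num
      have b : ¥0 ≤ if n = 1 then 1 else 0 := by split_ifs <;> norm_num
      have := sum_nonneg h0
      rw [if_neg hr] at this
      linarith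
  refine (sum_le_sum h1).trans ?_
  rw [sum_add, sum_add, sum_comm, ← mul_sum]
  refine add_le_add (add_le_add ?_ ?_) (sum_le_sum fun p hp => ?_)
  · rw [sum_ite_eq']; split_ifs <;> norm_num
  · rw [← sum_filter, sum_const, nsmul_eq_mul, mul_one]
  · have hp := (mem_Pr hw0).1 hp
    have hpc := h.cop hp.1 (hw.trans_lt hp.2.1)
    rw [sum_dvd_ite _ _ hp.1.pos, TP, Nat.floor_div_natCast]
    refine (sum_congr rfl fun m _ => if_congr ?_ rfl rfl).le
    rw [Rough.mul_iff]
    constructor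
    · rintro ⟨⟨-, a⟩, b⟩
      exact ⟨a, by rw [← b, h.cmul _ _ hpc (h.rcop (a.mono hw)), mul_comm (c p), mul_assoc, h.vsq, mul_one]⟩
    · rintro ⟨a, b⟩
      refine ⟨⟨fun q hq hd => ?_, a⟩, by rw [h.cmul _ _ hpc (h.rcop (a.mono hw)), b, mul_comm, mul_assoc, h.vsq, mul_one]⟩
      rw [(Nat.prime_dvd_prime_iff_eq hq hp.1).1 hd]; exact hp.2.1
lemma CD.TP_le (h : CD y Q c ν) (s : Ps ψ) (hl0 : 0 ≤ l) (hl : ∀ M : ℕ, 1 ≤ M → |S M - l| ≤ 2 * Q / M) {w x : ℝ} (hw : y ≤ w) (hx : 1 ≤ x)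
    {v : V} (hv : ψ v = 1) {p : ℕ} (hp : p.Prime) (hpw : w < p) (hM : 0 ≤ MM c ψ y l Q ν w) :
    TP Q c ψ w x v p ≤ 3 / 2 * (MM c ψ y l Q ν w * x) * ((1 + ψ (c p)) / p) + 24 * ν * w ^ 272 * √(x / p) + x * (1 + log x) * (1 / p ^ 2) := by
  have hp0 : ¥0 < p := by exact_mod_cast hp.pos
  have hp1 : ¥1 ≤ p := by exact_mod_cast hp.one_lt.le
  have hχ : χ p = ψ (c p) := if_pos (h.cop hp (hw.trans_lt hpw))
  have hlx : 0 ≤ log x := log_nonneg hx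
  have t1 : 0 ≤ 24 * ν * w ^ 272 * √(x / p) := §
  have t2 : 0 ≤ x * (1 + log x) * (1 / ¥p ^ 2) := §
  rcases s.pm (c p) with hc | hc
  · have h1 : TP Q c ψ w x v p ≤ 2 * RS Q c ψ w (x / p) (v * c p)
    · rw [TP, RS, mul_sum]
      refine sum_le_sum fun m hm => ?_
      split_ifs
      · rw [h.hecke s hp (mem_Ioc.1 hm).1.ne', hχ, hc]
        have : 0 ≤ if p ∣ m then r (m / p) else 0 := by split_ifs; exacts [h.r0 s _, le_rfl]
        linarith
      · simp
    have h2 := (abs_le.1 (h.RS_err s hl0 hl hw (v := v * c p) (by rw [s.mul, hv, hc, one_mul]) (X := x / p) §)).2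
    rw [hc]
    have e : 3 / 2 * (MM c ψ y l Q ν w * x) * ((1 + 1) / p) = 3 * (MM c ψ y l Q ν w * (x / p)) := by ring
    rw [e]; linarith
  · rw [hc, add_neg_cancel, zero_div, mul_zero, zero_add]
    have h1 : TP Q c ψ w x v p ≤ ∑ m ∈ ° ⌊x / p / p⌋₊, r m
    · rw [TP, Nat.floor_div_natCast (x / p)]
      have : ∑ m ∈ ° (⌊x / p⌋₊ / p), r m = ∑ m ∈ ° (⌊x / p⌋₊ / p), r (p * m / p) :=
        sum_congr rfl fun m _ => by rw [Nat.mul_div_cancel_left _ hp.pos]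
      rw [this, ← sum_dvd_ite _ _ hp.pos (fun m => r (m / p))]
      refine sum_le_sum fun m hm => ?_
      have : 0 ≤ if p ∣ m then r (m / p) else 0 := by split_ifs; exacts [h.r0 s _, le_rfl]
      split_ifs at this ⊢ with h1 h2 <;> first | exact this | skip
      · rw [h.hecke s hp (mem_Ioc.1 hm).1.ne', hχ, hc, if_pos ‹p ∣ m›]; linarith
      · rw [h.hecke s hp (mem_Ioc.1 hm).1.ne', hχ, hc, if_neg ‹¬ p ∣ m›]; linarith
    have h3 : (⌊x / p / p⌋₊ : ℝ) ≤ x * (1 / p ^ 2) := (Nat.floor_le §).trans (le_of_eq (by field_simp))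
    have h4 : log ⌊x / p / p⌋₊ ≤ log x
    · rcases Nat.eq_zero_or_pos ⌊x / p / p⌋₊ with h0 | h0
      · rw [h0]; simpa using hlx
      · refine log_le_log (by exact_mod_cast h0) ((Nat.floor_le §).trans ?_)
        exact (div_le_self § hp1).trans (div_le_self § hp1)
    have h5 := s.rsum (Q := Q) (c := c) ⌊x / p / p⌋₊
    have h6 : (⌊x / p / p⌋₊ : ℝ) * (1 + log ⌊x / p / p⌋₊) ≤ x * (1 / p ^ 2) * (1 + log x) :=
      mul_le_mul h3 ¢ (by have := log_natCast_nonneg ⌊x / p / p⌋₊; linarith) §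
    linarith
lemma CD.primes_ge (h : CD y Q c ν) (s : Ps ψ) (hl0 : 0 ≤ l) (hl : ∀ M : ℕ, 1 ≤ M → |S M - l| ≤ 2 * Q / M) {w x : ℝ} (hw : y ≤ w) (hx : 1 ≤ x)
    {v : V} (hv : ψ v = 1) (hM : 0 ≤ MM c ψ y l Q ν w) (hs : ∑ p ∈ Pr w √x, (1 + ψ (c p)) / p ≤ 1 / 12) :
    3 / 8 * (MM c ψ y l Q ν w * x) - (1 + 60 * ν * w ^ 272 * (√x * √√x) + x * (1 + log x) ^ 2 / w) ≤ 2 * #{p ∈ ° ⌊x⌋₊ | p.Prime ∧ c p = v} := by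
  have hw0 : 0 < w := h.ypos.trans_le hw
  have hx0 : 0 < x := ¢
  have hlx : 0 ≤ log x := log_nonneg hx
  have h1 := h.RS_le s hw hx v
  have h2 := (abs_le.1 (h.RS_err s hl0 hl hw hv hx0.le)).1
  have sx1 : 1 ≤ √x := one_le_sqrt.2 hx
  have ssx : 1 ≤ √√x := one_le_sqrt.2 sx1
  have hf1 : 1 ≤ ⌊√x⌋₊ := Nat.le_floor (by simpa using sx1)
  have hfx : (⌊√x⌋₊ : ℝ) ≤ √x := Nat.floor_le (sqrt_nonneg _)
  have hsub : Pr w √x ⊆ ° ⌊√x⌋₊ := fun p hp => by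
    have hp := (mem_Pr hw0.le).1 hp
    exact mem_Ioc.2 ⟨hp.1.pos, Nat.le_floor hp.2.2⟩
  have h3 : ∑ p ∈ Pr w √x, TP Q c ψ w x v p ≤ 3 / 2 * (MM c ψ y l Q ν w * x) * ∑ p ∈ Pr w √x, (1 + ψ (c p)) / p + 24 * ν * w ^ 272 * ∑ p ∈ Pr w √x, √(x / p)
      + x * (1 + log x) * ∑ p ∈ Pr w √x, (1 / ¥p ^ 2) := by
    rw [mul_sum, mul_sum, mul_sum, ← sum_add, ← sum_add]
    refine sum_le_sum fun p hp => ?_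
    have hp := (mem_Pr hw0.le).1 hp
    exact h.TP_le s hl0 hl hw hx hv hp.1 hp.2.1 hM
  have h4 : ∑ p ∈ Pr w √x, √(x / p) ≤ 2 * (√x * √√x)
  · calc _ ≤ ∑ p ∈ ° ⌊√x⌋₊, √(x / p) := sub_sum hsub fun _ _ _ => sqrt_nonneg _
      _ = √x * ∑ p ∈ ° ⌊√x⌋₊, ¥p ^ (-1 + 1 / 2 : ℝ) := by
        rw [mul_sum]; refine sum_congr rfl fun p _ => ?_
        rw [sqrt_div hx0.le, sqrt_eq_rpow ¥p, show (-1 + 1 / 2 : ℝ) = -(1 / 2) by norm_num, rpow_neg (nn0 _), div_eq_mul_inv]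
      _ ≤ √x * ((⌊√x⌋₊ : ℝ) ^ (1 / 2 : ℝ) / (1 / 2)) := mL (sum_rpow_le ¤ ¤ _) (sqrt_nonneg _)
      _ ≤ _ := by
        rw [← sqrt_eq_rpow]
        have := mL (sqrt_le_sqrt hfx) (sqrt_nonneg x)
        linarith
  have h5 : ∑ p ∈ Pr w √x, (1 / ¥p ^ 2) ≤ (1 + log x) / w
  · calc _ ≤ ∑ p ∈ Pr w √x, 1 / w * (1 / ¥p) := sum_le_sum fun p hp => by
          have hp := (mem_Pr hw0.le).1 hp
          rw [one_div_mul_one_div, pow_two]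
          exact odl (mul_pos hw0 (hw0.trans hp.2.1)) (mR hp.2.1.le (nn0 _))
      _ ≤ 1 / w * ∑ p ∈ ° ⌊√x⌋₊, 1 / ¥p := by
          rw [← mul_sum]
          exact mL (sub_sum hsub fun _ _ _ => by positivity) §
      _ ≤ 1 / w * (1 + log x) := by
          refine mL ((sum_inv_le _).trans ?_) §
          have e : √x ≤ x := sqrt_le_iff.2 ⟨hx0.le, by nlinarith⟩
          have := log_le_log (by exact_mod_cast hf1) (hfx.trans e)
          linarith
      _ = _ := by ring
  have k1 := mL hs (by positivity : 0 ≤ 3 / 2 * (MM c ψ y l Q ν w * x))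
  have k2 := mL h4 (by positivity : 0 ≤ 24 * ν * w ^ 272)
  have k3 := mL h5 (by positivity : 0 ≤ x * (1 + log x))
  have k4 : √x ≤ √x * √√x := le_mul_of_one_le_right § ssx
  have k5 := mL k4 (by positivity : 0 ≤ 12 * ν * w ^ 272)
  have e : x * (1 + log x) * ((1 + log x) / w) = x * (1 + log x) ^ 2 / w := by ring
  rw [e] at k3
  linarith
end LN
end

section
open scoped Classical
open Finset Real
namespace LN
local notation "Λ" => ArithmeticFunction.vonMangoldt
lemma mert2 : ∃ K : ℝ, ∀ N : ℕ, 2 ≤ N → ∑ k ∈ Ioc 1 N, Λ k / k / log k ≤ log (log N) + K := by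
  have A : ∀ N : ℕ, 1 ≤ N → ∑ k ∈ Ioc 1 N, Λ k / k ≤ log N + 6 := fun N hN => by
    have h := (abs_le.1 (mertens_nat hN)).2
    rw [← insert_Ioc_add_one_left_eq_Ioc (by omega : 0 < N), sum_insert ¶] at h
    simp at h; linarith
  have D : ∀ N : ℕ, 2 ≤ N → ∑ k ∈ Ioc 1 N, Λ k / k / log k - (∑ k ∈ Ioc 1 N, Λ k / k) / log N
      ≤ log (log N) - 6 / log N + (6 / log 2 - log (log 2)) := by
    intro N hN
    induction N, hN using Nat.le_induction with
    | base =>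
      rw [show Ioc 1 2 = {2} from rfl]; simp
    | succ n hn ih =>
      have a0 : 0 < log n := log_pos (by exact_mod_cast hn)
      have b0 : log n ≤ log (n+1) := log_le_log § ¢
      rw [← insert_Ioc_right_eq_Ioc_add_one £, sum_insert ¶, sum_insert ¶]
      have h := A n £
      push_cast
      set T := ∑ k ∈ Ioc 1 n, Λ k / k
      set a := log n
      set b := log (¥n+1)
      have hb : 0 < b := ¢
      have k1 := mR h (sub_nonneg.2 (odl a0 b0))
      have k2 := one_sub_inv_le_log_of_pos (div_pos hb a0)
      rw [log_div hb.ne' a0.ne', inv_div] at k2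
      have e : (a + 6) * (1 / a - 1 / b) = 1 - a / b + 6 / a - 6 / b := by field_simp; ring
      rw [e] at k1
      rw [add_div]
      have e2 : T * (1 / a - 1 / b) = T / a - T / b := by ring
      rw [e2] at k1
      linarith
  refine ⟨1 + (6 / log 2 - log (log 2)), fun N hN => ?_⟩
  have a0 : 0 < log N := log_pos (by exact_mod_cast hN)
  have h1 := D N hN
  have h2 := dR (A N £) a0.le
  rw [add_div, div_self a0.ne'] at h2
  linarith
lemma PP_lower : ∃ K : ℝ, 0 < K ∧ ∀ w : ℝ, 2 ≤ w → K / log w ≤ PP 1 w := by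
  obtain ⟨K, hK⟩ := mert2
  refine ⟨exp (-(K + 1)), exp_pos _, fun w hw => ?_⟩
  have hN : 2 ≤ ⌊w⌋₊ := Nat.le_floor (by exact_mod_cast hw)
  set N := ⌊w⌋₊
  have l0 : 0 < log N := log_pos (by exact_mod_cast hN)
  have hNw : log N ≤ log w := log_le_log § (Nat.floor_le ¢)
  have t : ∀ M : ℕ, 1 ≤ M → ∑ k ∈ Ioc 1 M, (1 / (¥k - 1) - 1 / k) ≤ 1 - 1 / M := fun M hM => by
    induction M, hM using Nat.le_induction with
    | base => simp
    | succ n hn ih =>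
      rw [← insert_Ioc_right_eq_Ioc_add_one £, sum_insert ¶]
      push_cast; rw [add_sub_cancel_right]; linarith
  have hsub : Pr 1 w ⊆ Ioc 1 N := fun p hp => by
    rw [mem_Pr ¤] at hp
    exact mem_Ioc.2 ⟨hp.1.one_lt, Nat.le_floor hp.2.2⟩
  have a1 : ∑ p ∈ Pr 1 w, (1 / ¥p) ≤ log (log N) + K
  · refine le_trans ?_ (hK N hN)
    refine le_trans (le_of_eq (sum_congr rfl fun p hp => ?_)) (sub_sum hsub fun k _ _ =>
      div_nonneg (div_nonneg Lnn (nn0 _)) (log_natCast_nonneg _))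
    rw [mem_Pr ¤] at hp
    rw [ArithmeticFunction.vonMangoldt_apply_prime hp.1, div_right_comm, div_self (log_pos (by exact_mod_cast hp.1.one_lt)).ne']
  have a2 : ∑ p ∈ Pr 1 w, (1 / (¥p - 1) - 1 / p) ≤ 1
  · refine (sub_sum hsub fun k hk _ => ?_).trans ((t N £).trans ?_)
    · have : ¥1 < k := by exact_mod_cast (mem_Ioc.1 hk).1
      exact sub_nonneg.2 (odl ¢ ¢)
    · have : 0 ≤ 1 / ¥N := §
      linarith
  have a3 : exp (-∑ p ∈ Pr 1 w, (1 / (¥p - 1))) ≤ PP 1 w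
  · rw [← sum_neg_distrib, exp_sum]
    refine prod_le_prod (fun _ _ => (exp_nonneg _)) fun p hp => ?_
    have hp1 : ¥1 < p := ((mem_Pr ¤).1 hp).2.1
    have := add_one_le_exp (1 / (¥p - 1))
    rw [exp_neg]
    have e : 1 - 1 / ¥p = (1 / (¥p - 1) + 1)⁻¹
    · have q1 : ¥p - 1 ≠ 0 := (sub_pos.2 hp1).ne'
      have q2 : ¥p ≠ 0 := §
      rw [div_add_one q1, inv_div, add_sub_cancel, sub_div, div_self q2]
    rw [e]
    exact inv_anti₀ (by have : 0 < ¥p - 1 := ¢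
                        positivity) this
  rw [sum_sub] at a2
  have a4 : exp (-(K+1) - log (log w)) ≤ PP 1 w
  · refine le_trans (exp_le_exp.2 ?_) a3
    have := log_le_log l0 hNw
    linarith
  rwa [exp_sub, exp_log ¢] at a4
variable {V : Type} [CommGroup V] [Fintype V] {y : ℝ} {Q : ℕ} {c : ℕ → V} {ν : ℕ} {ψ : V → ℝ} {l : ℝ}
lemma CD.MM_ge (h : CD y Q c ν) (s : Ps ψ) (hl0 : 0 ≤ l) {w : ℝ} (hw : y ≤ w) :
    2 * l * (PP 1 w ^ 2 / ϕ V) ≤ MM c ψ y l Q ν w := by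
  have hV : ¥0 < ϕ V := cardV_pos
  have hy := h.y1000
  have e : ¥ν / Q = PP 1 y / ϕ V := by rw [← h.tot, mul_div_cancel_right₀ _ hV.ne']
  have k : PP y w ^ 2 ≤ ∏ p ∈ Pr y w, (1 - gg c ψ p)
  · rw [PP, ← prod_pow]
    exact prod_le_prod (fun _ _ => sq_nonneg _) fun p hp => (s.gb ((mem_Pr h.ypos.le).1 hp).1).2.2
  rw [MM, e, ← PP_mul ¤ (by linarith : ¥1 ≤ y) hw]
  have p1 : PP 1 y ^ 2 ≤ PP 1 y := by rw [sq]; exact mul_le_of_le_one_left PP_nonneg PP_le_one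
  have p2 := mul_le_mul p1 k (sq_nonneg _) PP_nonneg
  have p3 := mL p2 (by positivity : 0 ≤ 2 * l / ϕ V)
  rw [mul_pow]; refine le_trans (le_of_eq ?_) (p3.trans (le_of_eq ?_)) <;> ring
lemma CD.nule (h : CD y Q c ν) : ¥ν ≤ exp (1.4 * y) := by
  refine le_trans ?_ h.Qle
  rw [← h.fib 1]
  exact_mod_cast (card_filter_le _ _).trans ¶
lemma exp_dec (A : ℝ) (b : ℝ) (hb : 0 < b) : ∃ L0 : ℝ, 1 ≤ L0 ∧ ∀ L : ℝ, L0 ≤ L → A * (1 + L) ^ 3 * exp (-(L / 4000)) ≤ b := by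
  have h1 := tendsto_pow_mul_exp_neg_atTop_nhds_zero 3
  have h2 : Filter.Tendsto (fun L : ℝ => (1 + L) / 4000) Filter.atTop Filter.atTop :=
    (Filter.tendsto_atTop_add_const_left _ _ Filter.tendsto_id).atTop_div_const ¤
  have h3 := ((h1.comp h2).const_mul (A * 4000 ^ 3 * exp (1 / 4000))).eventually_le_const (u := b) (by simpa using hb)
  obtain ⟨L0, h0⟩ := Filter.eventually_atTop.1 h3
  refine ⟨max 1 L0, le_max_left _ _, fun L hL => le_trans (le_of_eq ?_) (h0 L ((le_max_right _ _).trans hL))⟩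
  simp only [Function.comp]
  rw [show -(L / 4000) = 1 / 4000 + -((1 + L) / 4000) by ring, exp_add]
  ring
lemma er_aux {x L y w a : ℝ} (hxe : x = exp L) (hL00 : 0 < L) (q0 : 62 * (1 + L) ^ 3 * exp (-(L / 4000)) ≤ a / 8)
    (hyL : y ≤ L / 960000) (hw : w = exp (L / 2000)) (hν : ¥ν ≤ exp (1.4 * y)) :
    1 + 60 * ν * w ^ 272 * (√x * √√x) + x * (1 + L) ^ 2 / w ≤ a / 8 * (x / L) * exp (-(2.9 * y)) := by
  have hx0 : 0 < x := hxe ▸ exp_pos _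
  have ha0 : 0 < a / 8 := ltl § q0
  have e0 : 62 * (1 + L) ^ 2 * exp (L - 0.00035 * L) ≤ a / 8 * (x / L) * exp (-(2.9 * y))
  · have q := q0
    have q1 : exp (-(L / 10000)) ≤ exp (-(2.9 * y)) := exp_le_exp.2 ¢
    have q2 : 62 * (1 + L) ^ 2 * L * exp (-(L / 4000)) ≤ a / 8 :=
      le_trans (mR (by rw [pow_succ _ 2, ← mul_assoc]; exact mL ¢ §) (exp_nonneg _)) q
    calc _ = 62 * (1 + L) ^ 2 * L * exp (-(L / 4000)) * (x / L) * exp (-(L / 10000)) := by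
          rw [hxe, show L - 0.00035 * L = -(L / 4000) + L + -(L / 10000) by ring, exp_add, exp_add]; field_simp
      _ ≤ _ := mul_le_mul (mR q2 §) q1 (exp_nonneg _) §
  refine le_trans ?_ e0
  obtain ⟨G, hG⟩ : ∃ G, G = exp (L - 0.00035 * L) := ⟨_, rfl⟩
  rw [← hG]
  have g1 : 1 ≤ G := by rw [hG]; exact one_le_exp ¢
  have g2 : 60 * ν * w ^ 272 * (√x * √√x) ≤ 60 * G
  · rw [hxe, ← exp_half, ← exp_half, hw, ← exp_nat_mul, ← exp_add, mul_assoc, mul_assoc]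
    refine mL ((mR hν §).trans ?_) ¤
    rw [← exp_add, ← exp_add, hG]
    exact exp_le_exp.2 (by push_cast; linarith)
  have g3 : x * (1 + L) ^ 2 / w ≤ (1 + L) ^ 2 * G
  · rw [mul_comm x, mul_div_assoc, hxe, hw, ← exp_sub, hG]
    exact mL (exp_le_exp.2 ¢) (sq_nonneg _)
  have g4 : 1 * G ≤ (1 + L) ^ 2 * G := mR (by nlinarith) ¢
  linarith
theorem exc : ∃ c1 L0 : ℝ, 0 < c1 ∧ ∀ {V : Type} [CommGroup V] [Fintype V] {y : ℝ} {Q : ℕ} {c : ℕ → V} {ν : ℕ} {ψ : V → ℝ} (v : V) (x : ℝ) (N : ℕ),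
    CD y Q c ν → Ps ψ → ψ v = 1 → 1 ≤ x → L0 ≤ log x → N ≤ log x → log x ≤ N + 1 → 4 * y ≤ 1 / 240000 * N →
    ∑ p ∈ Pr (exp (1 / 240000 * N)) (exp (0.7 * N)), (1 + ψ (c p)) * (log p / p) ≤ 10 * (1 / 240000) * N →
    c1 * (x / log x) * exp (-(2.9 * y)) ≤ #{p ∈ ° ⌊x⌋₊ | p.Prime ∧ c p = v} := by
  obtain ⟨K, hK, hP⟩ := PP_lower
  set B := 50 + 8 * Cp with hB
  have hB0 : 0 < B := by have := Cp0; positivity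
  set a := K ^ 2 / (B * 40000) * 0.002 with ha
  obtain ⟨L0, hL1, hL0⟩ := exp_dec 62 (a / 8) §
  refine ⟨a / 8, L0, §, ?_⟩
  intro V _ _ y Q c ν ψ v x N h s hv hx hL hN hN1 hf hs
  set L := log x with hLd
  have hx0 : 0 < x := ¢
  have hxe : x = exp L := (exp_log hx0).symm
  have hy := h.y1000
  have hQ := h.Q0
  have hL00 : 0 < L := ¢
  obtain ⟨l, hlt, hl⟩ := h.ell s
  have hlg := h.ell_ge s hlt
  have hl0 : 0 < l := ltl § hlg
  have hle : exp (-(1.4 * y)) / 200 ≤ l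
  · refine le_trans ?_ hlg
    rw [exp_neg, ← one_div, div_div, mul_comm]
    exact odl § (by linarith [h.Qle])
  have hNl := h.Nle s hl0 hl ¤ hf hs
  set w := exp (L / 2000) with hw
  have hyw : y ≤ w := by have := add_one_le_exp (L / 2000); linarith
  have hw2 : 2 ≤ w := ¢
  have hM1 := h.MM_ge s hl0.le hyw
  have hs' : ∑ p ∈ Pr w √x, (1 + ψ (c p)) / p ≤ 1 / 12
  · have k : ∑ p ∈ Pr w √x, (1 + ψ (c p)) / p ≤ 2000 / L * ∑ p ∈ Pr (exp (1 / 240000 * N)) (exp (0.7 * N)), (1 + ψ (c p)) * (log p / p)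
    · have nn : ∀ p : ℕ, 0 ≤ (1 + ψ (c p)) := fun p => by rcases s.pm (c p) with e | e <;> rw [e] <;> norm_num
      rw [mul_sum]
      refine (sum_le_sum fun p hp => ?_).trans (sub_sum (fun p hp => ?_) fun p _ _ =>
        mul_nonneg § (mul_nonneg (nn p) (div_nonneg (log_natCast_nonneg p) (nn0 _))))
      · have hp := (mem_Pr (exp_nonneg _)).1 hp
        have k1 : L / 2000 ≤ log p := (le_log_iff_exp_le (by exact_mod_cast hp.1.pos)).2 hp.2.1.le
        have k2 : 1 ≤ 2000 / L * log p
        · rw [dmd, one_le_div hL00]; linarith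
        calc (1 + ψ (c p)) / p ≤ (1 + ψ (c p)) / p * (2000 / L * log p) := le_mul_of_one_le_right (div_nonneg (nn p) (nn0 _)) k2
          _ = _ := by ring
      · have hp := (mem_Pr (exp_nonneg _)).1 hp
        refine (mem_Pr (exp_nonneg _)).2 ⟨hp.1, lt_of_le_of_lt (exp_le_exp.2 ¢) hp.2.1, hp.2.2.trans ?_⟩
        rw [hxe, ← exp_half]
        exact exp_le_exp.2 ¢
    refine k.trans ((mL hs §).trans ?_)
    rw [dmd, div_le_iff₀ hL00]; linarith
  have hM0 : 0 ≤ MM c ψ y l Q ν w := le_trans § hM1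
  have key := h.primes_ge s hl0.le hl hyw hx hv hM0 hs'
  have mm : a * (x / L) * exp (-(2.9 * y)) ≤ MM c ψ y l Q ν w * x
  · have p1 : K / L ≤ PP 1 w
    · refine le_trans ?_ (hP w hw2)
      rw [hw, log_exp]
      exact div_le_div_of_nonneg_left hK.le ¢ ¢
    have p2 := pow_le_pow_left₀ § p1 2
    have hV : ¥0 < ϕ V := cardV_pos
    have p3 : exp (-(y / 100)) ≤ 1 / ϕ V
    · rw [exp_neg, ← one_div]; exact odl hV h.Vle
    have p4 : l / (2 * B * y ^ 2) ≤ 1 / L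
    · rw [div_le_div_iff₀ § hL00]
      rw [← mul_div_assoc, le_div_iff₀ hl0] at hNl
      have : L * l ≤ 2 * N * l := mR ¢ hl0.le
      linarith
    have p5 : 0.002 * exp (-(0.09 * y)) ≤ 1 / y ^ 2
    · have q := add_one_le_exp (0.045 * y)
      have q2 := pow_le_pow_left₀ ¢ (by linarith : 0.045 * y ≤ exp (0.045 * y)) 2
      rw [← exp_nat_mul, show ((2:ℕ):ℝ) * (0.045 * y) = 0.09 * y by push_cast; ring] at q2
      rw [exp_neg, ← div_eq_mul_inv, div_le_div_iff₀ (exp_pos _) §]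
      rw [mul_pow] at q2; linarith [sq_nonneg y]
    have p6 := pow_le_pow_left₀ § hle 2
    rw [div_pow, ← exp_nat_mul] at p6
    rw [mul_comm _ x, hLd, ← hLd]
    have e : a * (x / L) * exp (-(2.9 * y)) = x * (K ^ 2 / (B * L) * (exp ((2:ℕ) * -(1.4 * y)) / 200 ^ 2) * (0.002 * exp (-(0.09 * y))) * exp (-(y / 100)))
    · rw [show -(2.9 * y) = (2:ℕ) * -(1.4 * y) + -(0.09 * y) + -(y / 100) by push_cast; ring, exp_add, exp_add, ha]; field_simp; norm_num
    rw [e]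
    refine mL (le_trans ?_ hM1) hx0.le
    calc _ ≤ K ^ 2 / (B * L) * l ^ 2 * (1 / y ^ 2) * (1 / ϕ V) := by
          refine mul_le_mul (mul_le_mul (mL p6 §) p5 § §) p3 (exp_nonneg _) §
      _ = 2 * l * (K ^ 2 / L) * (l / (2 * B * y ^ 2)) * (1 / ϕ V) := by field_simp
      _ ≤ 2 * l * (K ^ 2 / L) * (1 / L) * (1 / ϕ V) := by
          refine mR (mL p4 §) §
      _ = 2 * l * ((K / L) ^ 2 / ϕ V) := by ring
      _ ≤ _ := mL (dR p2 hV.le) §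
  have er : 1 + 60 * ν * w ^ 272 * (√x * √√x) + x * (1 + log x) ^ 2 / w ≤ a / 8 * (x / L) * exp (-(2.9 * y))
  · exact er_aux hxe hL00 (hL0 L hL) ¢ rfl h.nule
  linarith
end LN
end

section
open scoped Classical
open Finset Real
namespace LN
local notation "Λ" => ArithmeticFunction.vonMangoldt
lemma exp_small {β : ℝ} (h0 : 0 < β) (C : ℝ) {b : ℝ} (hb : 0 < b) : ∃ m : ℕ, 1 ≤ m ∧ C * exp (-(β * m)) ≤ b := by
  obtain ⟨m, hm⟩ := exists_nat_ge (max 1 (C / (b * β)))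
  have h1 := (le_max_left _ _).trans hm
  have h2 := (le_max_right _ _).trans hm
  refine ⟨m, by exact_mod_cast h1, ?_⟩
  rw [div_le_iff₀ §] at h2
  have := mL (add_one_le_exp (β * m)) hb.le
  rw [exp_neg, ← div_eq_mul_inv, div_le_iff₀ (exp_pos _)]
  nlinarith
theorem caseA {β δ : ℝ} (h0 : 0 < β) (h1 : β ≤ 1 / 16) (hδ : 0 < δ) (R : ℕ) : ∃ c2 : ℝ, ∃ M : ℕ, 0 < c2 ∧
    ∀ {V : Type} [CommGroup V] [Fintype V] {y : ℝ} {Q : ℕ} {c : ℕ → V} {ν : ℕ} (v : V) (x : ℝ) (N i : ℕ),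
    CD y Q c ν → 100 ≤ β ^ 2 * y → 1 ≤ x → N ≤ log x → log x ≤ N + 1 → i ≤ N → N ≤ i + 4 * R → M ≤ i → δ < ft β y c i v →
    c2 * x * exp (-(y / 100)) ≤ ∑ k ∈ ° ⌊x⌋₊, if c k = v then Λ k else 0 := by
  obtain ⟨m, hm1, hm⟩ := exp_small h0 (Cf β) (by positivity : 0 < δ / 2)
  obtain ⟨q, hq1, hq⟩ := exp_small h0 (Cf β * exp β) (by positivity : 0 < δ / (4 * m))
  have hlam : 0 < lam β := h0.trans_le (lam_ge β)
  refine ⟨exp (-(4 * R + 1 + q)) * (δ / (4 * m * lam β ^ 2)), m + q, §, ?_⟩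
  intro V _ _ y Q c ν v x N i h hyb hx hN hN1 hi hiN hM hft
  have hV : ¥0 < ϕ V := cardV_pos
  set A := ϕ V * lam β ^ 2 with hA
  have hA0 : 0 < A := §
  set g := am β ¡y with hg
  have g0 : ∀ k, 0 ≤ g k := fun k => by
    rw [hg, am]; split_ifs
    exacts [mul_nonneg Lnn (rpow_nonneg (nn0 _) _), le_rfl]
  have T0 := Sv_nonneg (c := c) g g0 v
  have Tm : ∀ {a b : ℕ}, a ≤ b → Sv c g v a ≤ Sv c g v b := fun hab =>
    sub_sum (Ioc_subset_Ioc_right (Ex_mono hab)) fun k _ _ => by split_ifs; exacts [g0 k, le_rfl]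
  have P : ∀ n : ℕ, A * ∑ j ∈ range n, Sv c g v j ≤ Cf β * exp (β * n) := fun n => by
    have := h.ft_leC h0 h1 hyb n v
    rw [ft_eq, mul_right_comm, exp_neg, ← div_eq_mul_inv, div_le_iff₀ (exp_pos _)] at this
    exact this
  rw [ft_eq, mul_right_comm, exp_neg, ← div_eq_mul_inv, lt_div_iff₀ (exp_pos _)] at hft
  have s1 : ∑ j ∈ range i, Sv c g v j ≤ ∑ j ∈ range (i - m), Sv c g v j + m * Sv c g v i
  · rw [← sum_range_add_sum_Ico _ (by omega : i - m ≤ i)]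
    gcongr
    refine (sum_le_card_nsmul _ _ (Sv c g v i) fun j hj => Tm (mem_Ico.1 hj).2.le).trans ?_
    rw [Nat.card_Ico, show i - (i - m) = m by omega, nsmul_eq_mul]
  have s2 := mL s1 hA0.le
  have s3 := P (i - m)
  have s4 : Cf β * exp (β * (i - m : ℕ)) ≤ δ / 2 * exp (β * i)
  · rw [Nat.cast_sub £, show β * (¥i - m) = -(β * m) + β * i by ring, exp_add, ← mul_assoc]
    exact mR hm (exp_nonneg _)
  have s5 : A * Sv c g v (i - q) ≤ δ / (4 * m) * exp (β * i)
  · have : Sv c g v (i - q) ≤ ∑ j ∈ range (i - q + 1), Sv c g v j := single_le_sum (fun j _ => T0 j) ¶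
    refine (mL this hA0.le).trans ((P _).trans ?_)
    rw [Nat.cast_add, Nat.cast_sub £, show β * (¥i - q + (1:ℕ)) = β + (-(β * q) + β * i) by push_cast; ring, exp_add, exp_add, ← mul_assoc, ← mul_assoc]
    exact mR hq (exp_nonneg _)
  have s6 : δ / (2 * m) * exp (β * i) ≤ A * Sv c g v i
  · rw [dmd, div_le_iff₀ §]
    linarith
  have s7 : δ / (4 * m) * exp (β * i) ≤ A * (Sv c g v i - Sv c g v (i - q))
  · have : δ / (2 * m) = 2 * (δ / (4 * m)) := by field_simp; norm_num
    rw [this] at s6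
    linarith
  set Z := ∑ k ∈ ° ⌊x⌋₊, if c k = v then Λ k else 0 with hZ
  have hiq : ((i - q : ℕ) : ℝ) = i - q := Nat.cast_sub £
  have s8 : Sv c g v i - Sv c g v (i - q) ≤ exp ((-1 + β) * (¥i - q)) * Z
  · have e : Sv c g v i - Sv c g v (i - q) = ∑ k ∈ Ioc (Ex (i - q)) (Ex i), if c k = v then g k else 0
    · rw [Sv, Sv, ← sum_Ioc_consecutive _ (Nat.zero_le _) (Ex_mono (by omega : i - q ≤ i)), add_sub_cancel_left]
    rw [e, hZ, mul_sum]
    refine (sum_le_sum fun k hk => ?_).trans (sub_sum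
      (f := fun k => exp ((-1 + β) * (¥i - q)) * if c k = v then Λ k else 0) (Ioc_subset_Ioc (Nat.zero_le _) ?_) fun k _ _ => ?_)
    · split_ifs
      · rw [hg, am]
        split_ifs
        · rw [mul_comm]
          refine mR ?_ Lnn
          have hk := (Nat.lt_of_floor_lt (mem_Ioc.1 hk).1).le
          rw [hiq] at hk
          rw [mul_comm, exp_mul]
          exact rpow_le_rpow_of_nonpos (exp_pos _) hk ¢
        · exact mul_nonneg (exp_nonneg _) Lnn
      · simp
    · refine Nat.floor_le_floor ?_
      rw [← le_log_iff_exp_le ¢]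
      exact le_trans (by exact_mod_cast hi) hN
    · refine mul_nonneg (exp_nonneg _) ?_
      split_ifs; exacts [Lnn, le_rfl]
  have s9 := s7.trans (mL s8 hA0.le)
  have e1 : exp (¥i - q) * (δ / (4 * m)) ≤ A * Z
  · have t := mL s9 (exp_pos ((1 - β) * (¥i - q))).le
    have t1 : exp (¥i - q) ≤ exp ((1 - β) * (¥i - q)) * exp (β * i)
    · rw [← exp_add]; refine exp_le_exp.2 ?_
      have : 0 ≤ β * q := §
      linarith
    have t2 : exp ((1 - β) * (¥i - q)) * exp ((-1 + β) * (¥i - q)) = 1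
    · rw [← exp_add, ← exp_zero]; congr 1; ring
    have t3 := mR t1 (by positivity : 0 ≤ δ / (4 * m))
    calc _ ≤ _ := t3
      _ = exp ((1 - β) * (¥i - q)) * (δ / (4 * m) * exp (β * i)) := by ring
      _ ≤ _ := t
      _ = A * Z * (exp ((1 - β) * (¥i - q)) * exp ((-1 + β) * (¥i - q))) := by ring
      _ = _ := by rw [t2, mul_one]
  have e2 : exp (-(4 * R + 1 + q)) * x ≤ exp (¥i - q)
  · rw [← exp_log (by linarith : 0 < x), ← exp_add]
    have : ¥N ≤ i + 4 * R := by exact_mod_cast hiN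
    exact exp_le_exp.2 ¢
  have e3 : exp (-(y / 100)) ≤ 1 / ϕ V
  · rw [exp_neg, ← one_div]; exact odl hV h.Vle
  calc _ = exp (-(4 * R + 1 + q)) * x * (δ / (4 * m)) / lam β ^ 2 * exp (-(y / 100)) := by field_simp
    _ ≤ exp (¥i - q) * (δ / (4 * m)) / lam β ^ 2 * (1 / ϕ V) := by
      refine mul_le_mul (dR (mR e2 §) §) e3 (exp_nonneg _) §
    _ ≤ A * Z / lam β ^ 2 * (1 / ϕ V) :=
      mR (dR e1 §) §
    _ = Z := by rw [hA]; field_simp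
theorem main_CD : ∃ c₃ c₀ Y L0 : ℝ, 0 < c₃ ∧ 0 < c₀ ∧ ∀ {X V : Type} [Fintype X] [CommGroup V] [Fintype V] {y : ℝ} {Q : ℕ} {c : ℕ → V} {ν : ℕ} {χ : X → V → ℝ}
    (v : V) (x : ℝ), CD y Q c ν → Chars χ → 1 ≤ x → L0 ≤ log x → Y ≤ y → y ≤ c₀ * log x →
    c₃ * (x / log x) * exp (-(2.9 * y)) ≤ #{p ∈ ° ⌊x⌋₊ | p.Prime ∧ c p = v} := by
  obtain ⟨β, δ, R, L, Y, hβ, hβ1, hδ, hL, hG⟩ := GP_exists (ε := 1 / 240000) ¤ ¤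
  obtain ⟨c1, L1, hc1, h1⟩ := exc
  obtain ⟨c2, M, hc2, h2⟩ := caseA hβ hβ1 hδ R
  obtain ⟨L2, hL2, h3⟩ := exp_dec Cp (c2 / 2) §
  refine ⟨min c1 (c2 / 2), 1 / (2 * (L + 1)), max Y (100 / β ^ 2), max L1 (max L2 (M + 4 * R + 1)), lt_min hc1 §, §, ?_⟩
  intro X V _ _ _ y Q c ν χ v x h hχ hx hlx hY hyx
  have a1 := (le_max_left _ _).trans hlx
  have a2 := (le_max_right _ _).trans hlx
  have a3 := (le_max_left _ _).trans a2
  have a4 := (le_max_right _ _).trans a2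
  have b1 := (le_max_left _ _).trans hY
  have b2 := (le_max_right _ _).trans hY
  rw [div_le_iff₀' §] at b2
  have hx0 : 0 < x := ¢
  have hl0 : 0 < log x := ¢
  have hy0 := h.y1000
  have hN : (⌊log x⌋₊ : ℝ) ≤ log x := Nat.floor_le hl0.le
  have hN1 := (Nat.lt_floor_add_one (log x)).le
  set N := ⌊log x⌋₊
  have hxl : 0 < x / log x := §
  rw [dmd, one_mul, le_div_iff₀ §] at hyx
  have hN2 : 1 ≤ ¥N
  · have : 1 ≤ N := (Nat.one_le_floor_iff _).2 ¢
    exact_mod_cast this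
  have hLy : 0 < L * y := §
  obtain ⟨n1, g⟩ := hG y N b1 ¢
  rcases h.step1 hχ v g with ⟨i, i1, i2, i3⟩ | ⟨z, z1, z2⟩
  · have hiM : M ≤ i
    · have : M + 4 * R ≤ N := Nat.le_floor (by push_cast; linarith)
      omega
    have k := h2 v x N i h b2 hx hN hN1 i1 i2 hiM i3
    have k1 : (∑ k ∈ ° ⌊x⌋₊, if c k = v then Λ k else 0) ≤ log x * #{p ∈ ° ⌊x⌋₊ | p.Prime ∧ c p = v} + Cp * √x
    · have e : log x * #{p ∈ ° ⌊x⌋₊ | p.Prime ∧ c p = v} = ∑ p ∈ ° ⌊x⌋₊, if p.Prime ∧ c p = v then log x else 0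
      · rw [← sum_filter, sum_const, nsmul_eq_mul, mul_comm]
      have e2 := (Cp_sp ⌊x⌋₊).trans (mL (sqrt_le_sqrt (Nat.floor_le hx0.le)) Cp0)
      rw [e]
      refine le_trans ?_ (add_le_add_right e2 _)
      rw [← sum_add]
      refine sum_le_sum fun k hk => ?_
      have hk := mem_Ioc.1 hk
      have : log k ≤ log x := log_le_log (by exact_mod_cast hk.1) ((Nat.le_floor_iff hx0.le).1 hk.2)
      have v0 : 0 ≤ Λ k := Lnn
      by_cases q1 : c k = v <;> by_cases q2 : k.Prime <;> simp [q1, q2, v0, hl0.le, ArithmeticFunction.vonMangoldt_apply_prime, this]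
    have k2 : Cp * √x ≤ c2 / 2 * x * exp (-(y / 100))
    · have q := h3 (log x) a3
      have q1 : √x ≤ exp (-(log x / 4000)) * (x * exp (-(y / 100)))
      · have q3 : x = exp (log x) := (exp_log hx0).symm
        generalize log x = t at q3 hyx hl0 ⊢
        rw [q3, ← exp_half, ← exp_add, ← exp_add]
        exact exp_le_exp.2 ¢
      have q2 : Cp * exp (-(log x / 4000)) ≤ c2 / 2 :=
        le_trans (mR (le_mul_of_one_le_right Cp0 (one_le_pow₀ ¢)) (exp_nonneg _)) q
      calc _ ≤ _ := mL q1 Cp0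
        _ = Cp * exp (-(log x / 4000)) * (x * exp (-(y / 100))) := by ring
        _ ≤ c2 / 2 * (x * exp (-(y / 100))) := mR q2 §
        _ = _ := by ring
    have k3 : c2 / 2 * (x / log x) * exp (-(y / 100)) ≤ #{p ∈ ° ⌊x⌋₊ | p.Prime ∧ c p = v}
    · rw [← mul_div_assoc, dmd, div_le_iff₀ hl0]
      linarith
    refine le_trans (mul_le_mul (mR (min_le_right _ _) hxl.le) (exp_le_exp.2 ¢) (exp_nonneg _) §) k3
  · obtain ⟨nt, st⟩ := h.step2 hχ g z z2
    have s : Ps (χ z) := ⟨hχ.mul z, hχ.pm z, hχ.sum_zero z nt⟩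
    refine le_trans ?_ (h1 v x N h s z1 hx a1 hN hN1 g.hf st)
    exact mR (mR (min_le_left _ _) hxl.le) (exp_nonneg _)
end LN
end

section
open scoped Classical
open Finset Real
namespace LN
lemma res_ex {q : ℕ} (hq : q.Prime) (h2 : q ≠ 2) {e : ℤ} (he : e = 1 ∨ e = -1) :
    ∃ u : ℕ, ∀ n : ℕ, n ≡ u [MOD q] → jacobiSym n q = e := by
  haveI := Fact.mk hq
  have k : ∀ n u : ℕ, n ≡ u [MOD q] → ((n:ℤ) : ZMod q) = ((u:ℕ) : ZMod q) := fun n u h => by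
    rw [Int.cast_natCast]; exact (ZMod.natCast_eq_natCast_iff _ _ _).2 h
  rcases he with rfl | rfl
  · refine ⟨1, fun n hn => ?_⟩
    have := k n 1 hn
    rw [← jacobiSym.legendreSym.to_jacobiSym, legendreSym.eq_one_iff _ (by rw [this]; simp), this]
    simp
  · obtain ⟨a, ha⟩ := FiniteField.exists_nonsquare (F := ZMod q) (by rwa [ZMod.ringChar_zmod_n])
    refine ⟨a.val, fun n hn => ?_⟩
    rw [← jacobiSym.legendreSym.to_jacobiSym, legendreSym.eq_neg_one_iff, k n _ hn, ZMod.natCast_zmod_val]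
    exact ha
lemma rec_ex {q : ℕ} (hq : q.Prime) (h2 : q ≠ 2) {e : ℤ} (he : e = 1 ∨ e = -1) {t : ℕ} (ht : t = 1 ∨ t = 3) :
    ∃ u : ℕ, ∀ n : ℕ, n ≡ u [MOD q] → n % 4 = t → jacobiSym q n = e := by
  have ho : Odd q := hq.odd_of_ne_two h2
  have hqm : q % 4 = 1 ∨ q % 4 = 3 := by have := Nat.odd_iff.1 ho; omega
  by_cases h : t = 3 ∧ q % 4 = 3
  · obtain ⟨u, hu⟩ := res_ex hq h2 (e := -e) £
    refine ⟨u, fun n hn hn4 => ?_⟩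
    rw [jacobiSym.quadratic_reciprocity_three_mod_four h.2 £, hu n hn, neg_neg]
  · obtain ⟨u, hu⟩ := res_ex hq h2 he
    refine ⟨u, fun n hn hn4 => ?_⟩
    rw [← hu n hn]
    rcases ht with ht | ht
    · exact jacobiSym.quadratic_reciprocity_one_mod_four' ho £
    · exact jacobiSym.quadratic_reciprocity_one_mod_four £ (Nat.odd_iff.2 £)
def JJ (n0 : ℕ) : Finset ℤ := insert (-1) ((Nat.primesLE n0).image (fun q : ℕ => (q:ℤ)))
def QQ (n0 : ℕ) : ℕ := 4 * primorial n0
lemma mem_JJ {n0 : ℕ} {a : ℤ} : a ∈ JJ n0 ↔ a = -1 ∨ ∃ q : ℕ, (q ≤ n0 ∧ q.Prime) ∧ (q:ℤ) = a := by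
  simp [JJ, Nat.mem_primesLE]
lemma JJ_dvd {n0 : ℕ} {a : ℤ} (ha : a ∈ JJ n0) : 4 * a.natAbs ∣ QQ n0 := by
  refine mul_dvd_mul_left 4 ?_
  rcases mem_JJ.1 ha with rfl | ⟨q, hq, rfl⟩
  · simp
  · simpa using (hq.2.dvd_primorial_iff).2 hq.1
lemma QQ_odd {n0 n : ℕ} (h : n.Coprime (QQ n0)) : Odd n := by
  rw [← Nat.coprime_two_right]
  exact h.coprime_dvd_right (Dvd.dvd.mul_right ¤ _)
lemma JJ_pm {n0 n : ℕ} {a : ℤ} (ha : a ∈ JJ n0) (h : n.Coprime (QQ n0)) : jacobiSym a n = 1 ∨ jacobiSym a n = -1 := by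
  refine jacobiSym.eq_one_or_neg_one ?_
  rw [Int.gcd, Int.natAbs_natCast]
  exact (h.coprime_dvd_right ((Dvd.intro_left 4 rfl).trans (JJ_dvd ha))).symm
lemma JJ_surj {n0 : ℕ} (hn : 2 ≤ n0) (e : ℤ → ℤ) (he : ∀ a, e a = 1 ∨ e a = -1) :
    ∃ r : ℕ, r.Coprime (QQ n0) ∧ ∀ a ∈ JJ n0, jacobiSym a r = e a := by
  have h8 : ∃ s : ℕ, s < 8 ∧ (s % 4 = 1 ∨ s % 4 = 3) ∧ ∀ r : ℕ, r % 8 = s → Odd r ∧ r % 4 = s % 4 ∧ jacobiSym (-1) r = e (-1) ∧ jacobiSym 2 r = e 2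
  · have k : ∀ s r : ℕ, s % 2 = 1 → r % 8 = s → Odd r ∧ r % 4 = s % 4 ∧ jacobiSym (-1) r = (if s % 4 = 1 then 1 else -1) ∧
        jacobiSym 2 r = (if s = 1 ∨ s = 7 then 1 else -1) := fun s r h1 h2 => by
      have ho : Odd r := Nat.odd_iff.2 £
      have h4 : r % 4 = s % 4 := £
      refine ⟨ho, h4, ?_, ?_⟩
      · rw [jacobiSym.at_neg_one ho, ZMod.χ₄_nat_eq_if_mod_four, if_neg £, h4]
      · rw [jacobiSym.at_two ho, ZMod.χ₈_nat_eq_if_mod_eight, if_neg £, h2]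
    rcases he (-1) with h1 | h1 <;> rcases he 2 with h2 | h2 <;> rw [h1, h2]
    · exact ⟨1, ¤, ¤, fun r hr => by simpa using k 1 r rfl hr⟩
    · exact ⟨5, ¤, ¤, fun r hr => by simpa using k 5 r rfl hr⟩
    · exact ⟨7, ¤, ¤, fun r hr => by simpa using k 7 r rfl hr⟩
    · exact ⟨3, ¤, ¤, fun r hr => by simpa using k 3 r rfl hr⟩
  obtain ⟨s, hs7, hs, hs8⟩ := h8
  have hu : ∀ q : ℕ, ∃ u : ℕ, q.Prime → q ≠ 2 → ∀ n : ℕ, n ≡ u [MOD q] → n % 4 = s % 4 → jacobiSym q n = e q := fun q => by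
    by_cases hq : q.Prime ∧ q ≠ 2
    · obtain ⟨u, hu⟩ := rec_ex hq.1 hq.2 (he q) hs
      exact ⟨u, fun _ _ => hu⟩
    · exact ⟨0, fun a b => absurd ⟨a, b⟩ hq⟩
  choose u hu using hu
  obtain ⟨r, hr⟩ := Nat.chineseRemainderOfFinset (fun q => if q = 2 then s else u q) (fun q => if q = 2 then 8 else q) (Nat.primesLE n0)
    (fun q hq => by
      have := (Nat.mem_primesLE.1 hq).2.ne_zero
      split_ifs <;> omega)
    (fun p hp q hq hpq => by
      have hp := (Nat.mem_primesLE.1 hp).2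
      have hq := (Nat.mem_primesLE.1 hq).2
      have := (Nat.coprime_primes hp hq).2 hpq
      simp only [Function.onFun]
      split_ifs with a b b
      · omega
      · subst a; exact Nat.Coprime.pow_left 3 this
      · subst b; exact Nat.Coprime.pow_right 3 this
      · exact this)
  have r8 := hr 2 (Nat.mem_primesLE.2 ⟨hn, Nat.prime_two⟩)
  simp only [if_true] at r8
  obtain ⟨t1, t2, t3, t4⟩ := hs8 r (by rw [r8, Nat.mod_eq_of_lt hs7])
  have key : ∀ a ∈ JJ n0, jacobiSym a r = e a := fun a ha => by
    rcases mem_JJ.1 ha with rfl | ⟨q, hq, rfl⟩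
    · exact t3
    · by_cases q2 : q = 2
      · subst q2; exact t4
      · have := hr q (Nat.mem_primesLE.2 hq)
        simp only [if_neg q2] at this
        exact hu q hq.2 q2 r this t2
  refine ⟨r, Nat.Coprime.mul_right (Nat.Coprime.pow_right 2 (Nat.coprime_two_right.2 t1)) ?_, key⟩
  rw [primorial_eq_prod_primesLE]
  refine Nat.Coprime.prod_right fun q hq => ?_
  have k := key q (mem_JJ.2 (Or.inr ⟨q, Nat.mem_primesLE.1 hq, rfl⟩))
  have k0 : jacobiSym q r ≠ 0 := by rw [k]; rcases he q with h | h <;> rw [h] <;> norm_num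
  rw [Nat.Coprime, Nat.gcd_comm]
  by_contra h
  haveI : NeZero r := ⟨by rintro rfl; simp at t1⟩
  exact k0 (jacobiSym.eq_zero_iff_not_coprime.2 (by rwa [Int.gcd_natCast_natCast]))
noncomputable def sg (a : ℤ) (n : ℕ) : ℤˣ := if jacobiSym a n = 1 then 1 else -1
noncomputable def cc (n0 n : ℕ) : JJ n0 → ℤˣ := fun a => if n.Coprime (QQ n0) then sg a n else 1
lemma cc_mul {n0 m n : ℕ} (hm : m.Coprime (QQ n0)) (hn : n.Coprime (QQ n0)) : cc n0 (m * n) = cc n0 m * cc n0 n := by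
  funext a
  have m0 : m ≠ 0 := (QQ_odd hm).pos.ne'
  have n1 : n ≠ 0 := (QQ_odd hn).pos.ne'
  simp only [cc, Pi.mul_apply, if_pos hm, if_pos hn, if_pos (Nat.Coprime.mul_left hm hn), sg]
  rw [jacobiSym.mul_right' _ m0 n1]
  rcases JJ_pm a.2 hm with h | h <;> rcases JJ_pm a.2 hn with h' | h' <;> rw [h, h'] <;> norm_num
lemma cc_per {n0 m n : ℕ} (h : m ≡ n [MOD QQ n0]) : cc n0 m = cc n0 n := by
  have hc : m.Coprime (QQ n0) ↔ n.Coprime (QQ n0) := by rw [Nat.Coprime, Nat.Coprime, h.gcd_eq]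
  funext a
  by_cases hm : m.Coprime (QQ n0)
  · have hn := hc.1 hm
    simp only [cc, if_pos hm, if_pos hn, sg]
    rw [jacobiSym.mod_right _ (QQ_odd hm), jacobiSym.mod_right _ (QQ_odd hn), h.of_dvd (JJ_dvd a.2)]
  · simp only [cc, if_neg hm, if_neg (fun t => hm (hc.2 t))]
lemma cc_surj {n0 : ℕ} (hn : 2 ≤ n0) (v : JJ n0 → ℤˣ) : ∃ r : ℕ, r.Coprime (QQ n0) ∧ cc n0 r = v := by
  obtain ⟨r, hr, h⟩ := JJ_surj hn (fun a => if h : a ∈ JJ n0 then (v ⟨a, h⟩ : ℤ) else 1) fun a => by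
    split_ifs with h
    · rcases Int.units_eq_one_or (v ⟨a, h⟩) with e | e <;> rw [e] <;> simp
    · simp
  refine ⟨r, hr, funext fun a => ?_⟩
  have := h a a.2
  rw [dif_pos a.2] at this
  simp only [cc, if_pos hr, sg, this]
  rcases Int.units_eq_one_or (v a) with e | e <;> rw [e] <;> simp
lemma cc_fib {n0 : ℕ} (hn : 2 ≤ n0) (v : JJ n0 → ℤˣ) : #{r ∈ range (QQ n0) | r.Coprime (QQ n0) ∧ cc n0 r = v} =
    #{r ∈ range (QQ n0) | r.Coprime (QQ n0) ∧ cc n0 r = 1} := by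
  have hQ : 0 < QQ n0 := Nat.mul_pos ¤ (primorial_pos _)
  haveI : NeZero (QQ n0) := ⟨hQ.ne'⟩
  let f : (ZMod (QQ n0))ˣ →* (JJ n0 → ℤˣ) := MonoidHom.mk' (fun u => cc n0 (u : ZMod (QQ n0)).val) fun a b => by
    rw [← cc_mul (ZMod.val_coe_unit_coprime a) (ZMod.val_coe_unit_coprime b)]
    refine cc_per ?_
    rw [Units.val_mul, ZMod.val_mul]; exact Nat.mod_modEq _ _
  have fs : ∀ v, v ∈ Set.range f := fun v => by
    obtain ⟨r, hr, e⟩ := cc_surj hn v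
    refine ⟨ZMod.unitOfCoprime r hr, ?_⟩
    rw [← e]
    refine cc_per ?_
    rw [ZMod.coe_unitOfCoprime, ZMod.val_natCast]; exact Nat.mod_modEq _ _
  have fc : ∀ v, #{r ∈ range (QQ n0) | r.Coprime (QQ n0) ∧ cc n0 r = v} = #{u | f u = v} := fun v => by
    symm
    refine card_bij (fun (u : (ZMod (QQ n0))ˣ) _ => (u : ZMod (QQ n0)).val) (fun u hu => ?_) (fun a _ b _ h => ?_) fun r hr => ?_
    · simp only [mem_filter, mem_range, mem_univ, true_and] at hu ⊢
      exact ⟨ZMod.val_lt _, ZMod.val_coe_unit_coprime u, hu⟩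
    · exact Units.ext (ZMod.val_injective _ h)
    · simp only [mem_filter, mem_range, mem_univ, true_and] at hr
      have e : ((ZMod.unitOfCoprime r hr.2.1 : (ZMod (QQ n0))ˣ) : ZMod (QQ n0)).val = r
      · rw [ZMod.coe_unitOfCoprime, ZMod.val_natCast, Nat.mod_eq_of_lt hr.1]
      refine ⟨ZMod.unitOfCoprime r hr.2.1, ?_, e⟩
      simp only [mem_filter, mem_univ, true_and]
      change cc n0 _ = v
      rw [e]; exact hr.2.2
  rw [fc, fc]
  exact MonoidHom.card_fiber_eq_of_mem_range f (fs _) (fs _)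
noncomputable def XX (n0 : ℕ) (D : Finset (JJ n0)) (v : JJ n0 → ℤˣ) : ℝ := ∏ a ∈ D, ((v a : ℤ) : ℝ)
lemma XX_chars (n0 : ℕ) : Chars (XX n0) where
  sq v := funext fun a => Int.units_mul_self _
  mul D u v := by simp [XX, prod_mul_distrib]
  pm D v := by
    unfold XX
    induction D using Finset.induction_on with
    | empty => simp
    | insert a s ha ih =>
      rw [prod_insert ha]
      rcases Int.units_eq_one_or (v a) with e | e <;> rcases ih with h | h <;> rw [e, h] <;> norm_num
  orth v := by
    unfold XX
    rw [← powerset_univ, ← prod_one_add]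
    split_ifs with h
    · subst h
      simp only [Pi.one_apply, Units.val_one, Int.cast_one, prod_const, card_univ, Fintype.card_fun, Fintype.card_units_int]
      norm_num
    · obtain ⟨a, ha⟩ := Function.ne_iff.1 h
      refine prod_eq_zero (mem_univ a) ?_
      rw [(Int.units_eq_one_or (v a)).resolve_left ha]; norm_num
lemma CD_ex : ∃ Y : ℝ, ∀ y : ℝ, Y ≤ y → ∃ ν, CD y (QQ ⌊y⌋₊) (cc ⌊y⌋₊) ν := by
  have hpi := Chebyshev.eventually_primeCounting_le (ε := 1) ¤
  have hlog := tendsto_log_atTop.eventually_ge_atTop 1000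
  obtain ⟨Y, hY⟩ := Filter.eventually_atTop.1 (hpi.and hlog)
  refine ⟨max Y (max (exp 14) 1000000), fun y hy => ?_⟩
  obtain ⟨h1, h2⟩ := hY y ((le_max_left _ _).trans hy)
  have hy14 := (le_max_left _ _).trans ((le_max_right _ _).trans hy)
  have hy6 := (le_max_right _ _).trans ((le_max_right _ _).trans hy)
  have hn : 2 ≤ ⌊y⌋₊ := Nat.le_floor (by push_cast; linarith)
  have hfl : (⌊y⌋₊ : ℝ) ≤ y := Nat.floor_le ¢
  have l4 : log 4 ≤ 1.3864
  · rw [show ¥4 = 2 ^ 2 by norm_num, log_pow]; have := log_two_lt_d9; push_cast; linarith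
  have l0 : 0 ≤ log 4 := log_nonneg ¤
  refine ⟨#{r ∈ range (QQ ⌊y⌋₊) | r.Coprime (QQ ⌊y⌋₊) ∧ cc ⌊y⌋₊ r = 1}, ?_⟩
  have hQ : (QQ ⌊y⌋₊ : ℝ) ≤ exp (1.4 * y)
  · have : (QQ ⌊y⌋₊ : ℝ) ≤ 4 * 4 ^ ⌊y⌋₊
    · unfold QQ; exact_mod_cast Nat.mul_le_mul_left 4 (primorial_le_four_pow _)
    refine this.trans ?_
    generalize ⌊y⌋₊ = m at hfl
    rw [← pow_succ', ← exp_log (by norm_num : ¥0 < 4), ← exp_nat_mul]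
    refine exp_le_exp.2 ?_
    push_cast
    have := mul_le_mul (add_le_add_left hfl 1) l4 l0 ¢
    linarith
  have hV : (Fintype.card (JJ ⌊y⌋₊ → ℤˣ) : ℝ) ≤ exp (y / 100)
  · rw [Fintype.card_fun, Fintype.card_units_int, Fintype.card_coe]
    have hc : #(JJ ⌊y⌋₊) ≤ Nat.primeCounting ⌊y⌋₊ + 1 :=
      (card_insert_le _ _).trans (Nat.add_le_add_right (card_image_le.trans (le_of_eq (Nat.primesLE_card_eq_primeCounting _))) 1)
    have hc' : (#(JJ ⌊y⌋₊) : ℝ) ≤ Nat.primeCounting ⌊y⌋₊ + 1 := by exact_mod_cast hc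
    have : (log 4 + 1) * y / log y ≤ y / 400
    · rw [div_le_div_iff₀ ¢ ¤]
      have a1 := mL h2 (by linarith : 0 ≤ y)
      have a2 := mR l4 (by linarith : 0 ≤ y)
      linarith
    push_cast
    generalize #(JJ ⌊y⌋₊) = m at hc'
    rw [← exp_log (by norm_num : ¥0 < 2), ← exp_nat_mul]
    refine exp_le_exp.2 ?_
    have k1 := log_two_lt_d9
    have k2 := mL (by linarith : log 2 ≤ 1) (nn0 (α := ℝ) m)
    linarith
  refine ⟨Nat.mul_pos ¤ (primorial_pos _), fun v => funext fun a => Int.units_mul_self _, fun m n => cc_mul,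
    fun m n => cc_per, fun v => by convert cc_fib hn v, fun p hp => ?_, hQ, hV, hy14⟩
  rw [← Nat.le_floor_iff ¢, ← hp.dvd_primorial_iff, QQ, hp.dvd_mul]
  refine ⟨fun h => h.elim (fun h => ?_) id, Or.inr⟩
  have := (Nat.prime_dvd_prime_iff_eq hp Nat.prime_two).1 (hp.dvd_of_dvd_pow (show p ∣ 2 ^ 2 from h))
  rw [this, Nat.prime_two.dvd_primorial_iff]; exact hn
end LN
end

section
open scoped Classical
open Finset Real
namespace LN
lemma mf {P : ℕ → Prop} {d : DecidablePred P} {s : Finset ℕ} {p : ℕ} : p ∈ @Finset.filter ℕ P d s ↔ p ∈ s ∧ P p := Finset.mem_filter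
lemma cc_val {n0 p : ℕ} {v : JJ n0 → ℤˣ} (hp : p.Coprime (QQ n0)) (h : cc n0 p = v) (a : JJ n0) : jacobiSym a p = (v a : ℤ) := by
  have := congrFun h a
  simp only [cc, if_pos hp, sg] at this
  rw [← this]
  rcases JJ_pm a.2 hp with e | e <;> rw [e] <;> simp
lemma final_count {y : ℝ} (hy : 2 ≤ y) {y' : ℝ} (hyy : y ≤ y') {ν : ℕ} (h : CD y' (QQ ⌊y'⌋₊) (cc ⌊y'⌋₊) ν) (ε : ℕ → ℤ) (hε : ∀ q, ε q = 1 ∨ ε q = -1) (a : ℕ) (ha : a = 1 ∨ a = 3) :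
    ∃ v : JJ ⌊y'⌋₊ → ℤˣ, ∀ p : ℕ, p.Prime → y' < p → cc ⌊y'⌋₊ p = v → p % 4 = a ∧ ∀ q ∈ range (⌊y⌋₊ + 1), q.Prime → jacobiSym q p = ε q := by
  let w : ℤ → ℤˣ := fun t => if t = -1 then (if a = 1 then 1 else -1) else (if ε t.toNat = 1 then 1 else -1)
  refine ⟨fun t => w t, fun p hp hpy hc => ?_⟩
  have hcop := h.cop hp hpy
  have ho := QQ_odd hcop
  constructor
  · have k := cc_val hcop hc ⟨-1, mem_JJ.2 (Or.inl rfl)⟩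
    simp only [w, if_true] at k
    rw [jacobiSym.at_neg_one ho, ZMod.χ₄_nat_eq_if_mod_four, if_neg (by have := Nat.odd_iff.1 ho; omega)] at k
    have := Nat.odd_iff.1 ho
    rcases ha with rfl | rfl
    · by_contra h1
      rw [if_neg h1] at k; simp at k
    · by_contra h1
      rw [if_pos £] at k; simp at k
  · intro q hq hqp
    have hq' : q ≤ ⌊y'⌋₊ := (Nat.lt_succ_iff.1 (mem_range.1 hq)).trans (Nat.floor_le_floor hyy)
    have k := cc_val hcop hc ⟨q, mem_JJ.2 (Or.inr ⟨q, ⟨hq', hqp⟩, rfl⟩)⟩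
    simp only [w] at k
    rw [if_neg £, Int.toNat_natCast] at k
    rw [k]
    rcases hε q with e | e <;> rw [e] <;> simp
end LN
end

open scoped Classical
open Finset Real

open LN in
theorem stmt_13 :
    ∃ c₀ > 0, ∃ c₁ > 0, ∃ C > 0, ∃ x₀ : ℝ, ∀ (x y : ℝ), x₀ ≤ x → 3 ≤ y →
      y ≤ c₀ * Real.log x →
      ∀ (ε : ℕ → ℤ), (∀ q, ε q = 1 ∨ ε q = -1) →
      ∀ a : ℕ, (a = 1 ∨ a = 3) →
      c₁ * (Nat.primeCounting ⌊x⌋₊ : ℝ) * Real.exp (-3 * y - C * y / Real.log y) ≤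
        (((Finset.range (⌊x⌋₊ + 1)).filter (fun p : ℕ => p.Prime ∧ p % 4 = a ∧
            ∀ q ∈ Finset.range (⌊y⌋₊ + 1), Nat.Prime q → jacobiSym (q : ℤ) p = ε q)).card
          : ℝ) := by
  obtain ⟨c₃, c₀, Y, L0, hc3, hc0, hm⟩ := main_CD
  obtain ⟨Y', hY'⟩ := CD_ex
  obtain ⟨L1, hL1, hd⟩ := exp_dec 1 (c₃ / 2) §
  obtain ⟨x1, hx1⟩ := Filter.eventually_atTop.1 (Chebyshev.eventually_primeCounting_le (ε := 1) ¤)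
  set Z := max (max Y Y') 3 with hZ
  set d := min c₀ (1 / 10) with hd'
  have hd0 : 0 < d := lt_min hc0 ¤
  set c₁ := c₃ / 2 * exp (-(2.9 * Z)) / (log 4 + 1) with hc1
  refine ⟨d, hd0, c₁, §, 1, one_pos, max x1 (exp (max L0 (max L1 (Z / d)))), ?_⟩
  intro x y hx hy hyx ε hε a ha
  have b1 := (le_max_left _ _).trans hx
  have b2 := (le_max_right _ _).trans hx
  have hx0 : 0 < x := (exp_pos _).trans_le b2
  rw [← le_log_iff_exp_le hx0] at b2
  have b3 := (le_max_left _ _).trans b2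
  have b4 := (le_max_left _ _).trans ((le_max_right _ _).trans b2)
  have b5 := (le_max_right _ _).trans ((le_max_right _ _).trans b2)
  rw [div_le_iff₀' hd0] at b5
  set L := log x with hL
  have hxe : x = exp L := (exp_log hx0).symm
  have hL0 : 0 < L := ¢
  have hx1' : 1 ≤ x := by rw [hxe]; exact one_le_exp hL0.le
  obtain ⟨y', hy'⟩ : ∃ y', y' = max y Z := ⟨_, rfl⟩
  have hyy : y ≤ y' := hy' ▸ le_max_left _ _
  have hZy : Z ≤ y' := hy' ▸ le_max_right _ _
  have hdL : y' ≤ d * L := hy' ▸ max_le hyx b5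
  have hY1 : Y ≤ y' := ((le_max_left _ _).trans (le_max_left _ _)).trans hZy
  have hY2 : Y' ≤ y' := ((le_max_right _ _).trans (le_max_left _ _)).trans hZy
  have hZ0 : 3 ≤ Z := le_max_right _ _
  have hys : y' ≤ y + Z := hy' ▸ max_le ¢ ¢
  have hd1 : y' ≤ c₀ * L := hdL.trans (mR (min_le_left _ _) hL0.le)
  have hd2 : y' ≤ 1 / 10 * L := hdL.trans (mR (min_le_right _ _) hL0.le)
  obtain ⟨ν, h⟩ := hY' y' hY2
  obtain ⟨v, hv⟩ := final_count ¢ hyy h ε hε a ha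
  have main := hm v x h (XX_chars _) hx1' b3 hY1 hd1
  suffices key : ∀ F : Finset ℕ, (∀ p, p ∈ range (⌊x⌋₊ + 1) → (p.Prime ∧ p % 4 = a ∧
            ∀ q ∈ Finset.range (⌊y⌋₊ + 1), Nat.Prime q → jacobiSym (q : ℤ) p = ε q) → p ∈ F) →
      c₁ * (Nat.primeCounting ⌊x⌋₊ : ℝ) * exp (-3 * y - 1 * y / log y) ≤ (#F : ℝ) from
    key _ fun p h1 h2 => mf.2 ⟨h1, h2⟩
  intro F hF
  have hcard : ∀ G : Finset ℕ, (∀ p ∈ G, p ∈ ° ⌊x⌋₊ ∧ p.Prime ∧ cc ⌊y'⌋₊ p = v) → (#G : ℝ) ≤ #F + y' := fun G hG => by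
    have hsub : G ⊆ F ∪ ° ⌊y'⌋₊ := fun p hp => by
      obtain ⟨p1, p2, p3⟩ := hG p hp
      have p1 := mem_Ioc.1 p1
      rw [mem_union]
      rcases le_or_gt ¥p y' with q | q
      · exact Or.inr (mem_Ioc.2 ⟨p1.1, Nat.le_floor q⟩)
      · exact Or.inl (hF p (mem_range.2 £) ⟨p2, hv p p2 q p3⟩)
    have k := (card_le_card hsub).trans (card_union_le _ _)
    rw [Nat.card_Ioc, Nat.sub_zero] at k
    have k2 : (⌊y'⌋₊ : ℝ) ≤ y' := Nat.floor_le ¢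
    have : (#G : ℝ) ≤ #F + ⌊y'⌋₊ := by exact_mod_cast k
    linarith
  have main := main.trans (hcard _ fun p hp => mf.1 hp)
  have small : y' ≤ c₃ / 2 * (x / L) * exp (-(2.9 * y'))
  · have q := hd L b4
    have q1 : exp (L / 4000) ≤ x * exp (-(2.9 * y'))
    · rw [hxe, ← exp_add]; exact exp_le_exp.2 ¢
    have q2 : L * L ≤ (1 + L) ^ 3 := by nlinarith [mul_pos hL0 hL0, mul_pos (mul_pos hL0 hL0) hL0]
    rw [one_mul, exp_neg, ← div_eq_mul_inv, div_le_iff₀ (exp_pos _)] at q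
    rw [← mul_div_assoc, dmd, le_div_iff₀ hL0]
    have q3 := mL q1 (by positivity : 0 ≤ c₃ / 2)
    have q4 := mR (by linarith : y' ≤ L) hL0.le
    linarith
  have hpi := hx1 x b1
  have e1 : exp (-(2.9 * Z)) * exp (-3 * y - 1 * y / log y) ≤ exp (-(2.9 * y'))
  · rw [← exp_add]
    refine exp_le_exp.2 ?_
    have : 0 ≤ 1 * y / log y := div_nonneg ¢ (log_nonneg ¢)
    linarith
  calc _ ≤ c₁ * ((log 4 + 1) * x / L) * exp (-3 * y - 1 * y / log y) :=
        mR (mL hpi §) (exp_nonneg _)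
    _ = c₃ / 2 * (x / L) * (exp (-(2.9 * Z)) * exp (-3 * y - 1 * y / log y)) := by rw [hc1]; field_simp
    _ ≤ c₃ / 2 * (x / L) * exp (-(2.9 * y')) := mL e1 §
    _ ≤ _ := by rw [← hL] at main; linarith
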